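/- Let R be a local Gorenstein ring with infinite residue field, and let I be an R-ideal of height g, analytic spread ℓ, and minimal number of generators n = ℓ + 1 ≥ 2, satisfying G_ℓ and depth R/I^j ≥ dim R/I − j + 1 for 1 ≤ j ≤ ℓ − g + 1. Let φ be a matrix with n rows presenting I. Then the reduction number of I is ℓ − g + 1 if and only if core(I) = I₁(φ)·I. Moreover, if either condition holds and R and I are normal, then I₁(φ) and core(I) are integrally closed. -/

import Mathlib

open IsLocalRing

universe u v

namespace CPU

section Defs

variable {R : Type u} [CommRing R]

/-- The minimal number of generators of a submodule, as an extended natural number. -/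
noncomputable def muE {M : Type v} [AddCommGroup M] [Module R M] (N : Submodule R M) : ℕ∞ :=
  sInf {n : ℕ∞ | ∃ s : Finset M, (s.card : ℕ∞) = n ∧ Submodule.span R (s : Set M) = N}

/-- The Krull dimension of a ring, valued in `WithBot ℕ∞`. -/
noncomputable def rDim (S : Type v) [CommRing S] : WithBot ℕ∞ :=
  ringKrullDim S

/-- `J` is a reduction of `I`. -/
def IsReduction (J I : Ideal R) : Prop :=
  J ≤ I ∧ ∃ r : ℕ, I ^ (r + 1) = J * I ^ r

/-- `J` is a minimal reduction of `I`. -/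
def IsMinimalReduction (J I : Ideal R) : Prop :=
  IsReduction J I ∧ ∀ J' : Ideal R, IsReduction J' I → J' ≤ J → J' = J

/-- The core of an ideal: the intersection of all of its minimal reductions. -/
noncomputable def core (I : Ideal R) : Ideal R :=
  sInf {J : Ideal R | IsMinimalReduction J I}

/-- The reduction number of `I`. -/
noncomputable def reductionNumber (I : Ideal R) : ℕ∞ :=
  sInf {n : ℕ∞ | ∃ r : ℕ, (r : ℕ∞) = n ∧ ∃ J : Ideal R,
    IsMinimalReduction J I ∧ I ^ (r + 1) = J * I ^ r}

/-- `γ(I)`: the least number of minimal reductions whose intersection is the core. -/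
noncomputable def gamma (I : Ideal R) : ℕ∞ :=
  sInf {n : ℕ∞ | ∃ t : ℕ, (t : ℕ∞) = n ∧ ∃ Js : Fin t → Ideal R,
    (∀ i, IsMinimalReduction (Js i) I) ∧ core I = ⨅ i, Js i}

/-- The height of an ideal. -/
noncomputable def ht (I : Ideal R) : WithBot ℕ∞ :=
  ⨅ (p : PrimeSpectrum R) (_ : I ≤ p.asIdeal),
    rDim (Localization.AtPrime p.asIdeal)

/-- The Krull dimension of the special fiber ring of `I`,
i.e. the analytic spread of `I`. -/
noncomputable def fiberDim [IsLocalRing R] (I : Ideal R) : WithBot ℕ∞ :=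
  rDim (↥(reesAlgebra I) ⧸
    (Ideal.map (algebraMap R ↥(reesAlgebra I)) (maximalIdeal R)))

/-- The condition `G_s`. -/
def Gcond (I : Ideal R) (s : ℕ) : Prop :=
  ∀ p : PrimeSpectrum R, I ≤ p.asIdeal →
    rDim (Localization.AtPrime p.asIdeal) < (s : WithBot ℕ∞) →
    (muE (Ideal.map (algebraMap R (Localization.AtPrime p.asIdeal)) I) : WithBot ℕ∞) ≤
      rDim (Localization.AtPrime p.asIdeal)

/-- Depth of a module over a local ring, via lengths of regular sequences in the
maximal ideal. -/
noncomputable def mDepth (R : Type u) [CommRing R] [IsLocalRing R]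
    (M : Type v) [AddCommGroup M] [Module R M] : ℕ∞ :=
  sSup {n : ℕ∞ | ∃ rs : List R, (∀ x ∈ rs, x ∈ maximalIdeal R) ∧
    RingTheory.Sequence.IsRegular M rs ∧ (rs.length : ℕ∞) = n}

/-- Depth of the quotient `R/K` of a local ring `R`. -/
noncomputable def qDepth (R : Type u) [CommRing R] [IsLocalRing R] (K : Ideal R) : ℕ∞ :=
  mDepth R (R ⧸ K)

/-- The socle of `R/K`, for `R` local. -/
noncomputable def socle (R : Type u) [CommRing R] [IsLocalRing R] (K : Ideal R) :
    Ideal (R ⧸ K) :=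
  Submodule.colon (⊥ : Ideal (R ⧸ K)) (Ideal.map (Ideal.Quotient.mk K) (maximalIdeal R))

/-- The Cohen–Macaulay type of the quotient `R/K` of a local ring `R`. -/
noncomputable def qType (R : Type u) [CommRing R] [IsLocalRing R] (K : Ideal R) : ℕ∞ :=
  sInf {n : ℕ∞ | ∃ rs : List R, (∀ x ∈ rs, x ∈ maximalIdeal R) ∧
    RingTheory.Sequence.IsRegular (R ⧸ K) rs ∧ (rs.length : ℕ∞) = qDepth R K ∧
    muE (socle R (K ⊔ Ideal.ofList rs)) = n}

/-- Cohen–Macaulayness for a quotient `R/K` of a local ring `R`. -/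
def IsCMQuot (R : Type u) [CommRing R] [IsLocalRing R] (K : Ideal R) : Prop :=
  rDim (R ⧸ K) = (qDepth R K : WithBot ℕ∞)

/-- A Cohen–Macaulay local ring: depth equals Krull dimension. -/
def IsCMLocalRing (R : Type u) [CommRing R] [IsLocalRing R] : Prop :=
  rDim R = (qDepth R (⊥ : Ideal R) : WithBot ℕ∞)

/-- A Gorenstein local ring: Cohen–Macaulay of type one. -/
def IsGorensteinLocalRing (R : Type u) [CommRing R] [IsLocalRing R] : Prop :=
  IsCMLocalRing R ∧ qType R (⊥ : Ideal R) = 1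

/-- Gorensteinness of the quotient ring `R/K` of a local ring. -/
def IsGorQuot (R : Type u) [CommRing R] [IsLocalRing R] (K : Ideal R) : Prop :=
  IsCMQuot R K ∧ qType R K = 1

/-- A regular local ring: the maximal ideal is generated by `dim R` elements. -/
def IsRegularLocal (R : Type u) [CommRing R] [IsLocalRing R] : Prop :=
  IsNoetherianRing R ∧ (muE (maximalIdeal R) : WithBot ℕ∞) = rDim R

/-- Serre's condition `S₂` for the quotient ring `R/K`. -/
def QuotS2 (K : Ideal R) : Prop :=
  ∀ (q : Ideal R) (hq : q.IsPrime), K ≤ q →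
    letI := hq
    min 2 (rDim ((Localization.AtPrime q) ⧸
        (Ideal.map (algebraMap R (Localization.AtPrime q)) K)))
      ≤ (qDepth (Localization.AtPrime q)
          (Ideal.map (algebraMap R (Localization.AtPrime q)) K) : WithBot ℕ∞)

/-- `K` is an `s`-residual intersection of `I`. -/
def IsResidualIntersection (I K : Ideal R) (s : ℕ) : Prop :=
  K ≠ ⊤ ∧ ht I ≤ (s : WithBot ℕ∞) ∧ (s : WithBot ℕ∞) ≤ ht K ∧
    ∃ a : Ideal R, a ≤ I ∧ (∃ f : Finset R, f.card ≤ s ∧ Ideal.span (f : Set R) = a) ∧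
      K = Submodule.colon a I

/-- `K` is a geometric `s`-residual intersection of `I`. -/
def IsGeometricRI (I K : Ideal R) (s : ℕ) : Prop :=
  IsResidualIntersection I K s ∧ (s : WithBot ℕ∞) + 1 ≤ ht (I ⊔ K)

/-- `I` is weakly `s`-residually `S₂`. -/
def WeaklyResS2 (I : Ideal R) (s : ℕ) : Prop :=
  ∀ i ≤ s, ∀ K : Ideal R, IsGeometricRI I K i → QuotS2 K

/-- The condition `AN_s` for `I`. -/
def ANcond [IsLocalRing R] (I : Ideal R) (s : ℕ) : Prop :=
  ∀ i ≤ s, ∀ K : Ideal R, IsResidualIntersection I K i → IsCMQuot R K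

/-- The condition `AN_s⁻` for `I`. -/
def ANminus [IsLocalRing R] (I : Ideal R) (s : ℕ) : Prop :=
  ∀ i ≤ s, ∀ K : Ideal R, IsGeometricRI I K i → IsCMQuot R K

/-- `I` is universally weakly `s`-residually `S₂`: for every finite set of
variables, the extension of `I` to `R(x₁, …, x_n)` is weakly `s`-residually `S₂`. -/
def UnivWeaklyResS2 [IsLocalRing R] (I : Ideal R) (s : ℕ) : Prop :=
  ∀ (n : ℕ)
    (hP : (Ideal.map (MvPolynomial.C (σ := Fin n)) (maximalIdeal R)).IsPrime),
    letI := hP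
    WeaklyResS2 (Ideal.map
      ((algebraMap (MvPolynomial (Fin n) R)
        (Localization.AtPrime
          (Ideal.map (MvPolynomial.C (σ := Fin n)) (maximalIdeal R)))).comp
        (MvPolynomial.C)) I) s

/-- The `j`-th Fitting ideal of (the module) `I`. -/
noncomputable def fittingIdeal (I : Ideal R) (j : ℕ) : Ideal R :=
  ⨆ (n : ℕ) (π : (Fin n → R) →ₗ[R] R) (_ : LinearMap.range π = I),
    Ideal.span {d : R | ∃ (v : Fin (n - j) → (Fin n → R)) (r : Fin (n - j) → Fin n),
      (∀ k, π (v k) = 0) ∧ d = Matrix.det (Matrix.of fun i k => v k (r i))}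

/-- The set `Q(I)` of primes containing `Fitt_ℓ(I)` at which `R` has dimension `ℓ`
and `I` has analytic spread `ℓ`. -/
def QSet [IsLocalRing R] (I : Ideal R) (l : ℕ) : Set (PrimeSpectrum R) :=
  {p | fittingIdeal I l ≤ p.asIdeal ∧
    rDim (Localization.AtPrime p.asIdeal) = (l : WithBot ℕ∞) ∧
    fiberDim (Ideal.map (algebraMap R (Localization.AtPrime p.asIdeal)) I)
      = (l : WithBot ℕ∞)}

/-- An ideal is integrally closed if it admits no larger ideal of which it is a
reduction. -/
def IsIntClosedIdeal (I : Ideal R) : Prop :=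
  ∀ J : Ideal R, IsReduction I J → J = I

/-- A normal ideal: all powers are integrally closed. -/
def IsNormalIdeal (I : Ideal R) : Prop :=
  ∀ j : ℕ, IsIntClosedIdeal (I ^ j)

/-- `φ` is a presentation matrix of the ideal `I` (with `n = μ(I)` rows). -/
def Presents {n m : ℕ} (φ : Matrix (Fin n) (Fin m) R) (I : Ideal R) : Prop :=
  muE I = (n : ℕ∞) ∧ ∃ π : (Fin n → R) →ₗ[R] R, LinearMap.range π = I ∧
    LinearMap.range (Matrix.toLin' φ) = LinearMap.ker π

/-- The ideal of `t × t` minors of a matrix. -/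
noncomputable def minorsIdeal {n m : ℕ} (t : ℕ) (φ : Matrix (Fin n) (Fin m) R) : Ideal R :=
  Ideal.span {d : R | ∃ (r : Fin t → Fin n) (c : Fin t → Fin m),
    d = (φ.submatrix r c).det}

/-- The grade of an ideal: the supremum of lengths of regular sequences contained
in it. -/
noncomputable def grade (I : Ideal R) : ℕ∞ :=
  sSup {n : ℕ∞ | ∃ rs : List R, (∀ x ∈ rs, x ∈ I) ∧
    RingTheory.Sequence.IsRegular R rs ∧ (rs.length : ℕ∞) = n}

end Defs

/-- `M` has projective dimension at most `n` over `R`. -/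
def ProjDimLE (R : Type u) [CommRing R] :
    (n : ℕ) → (M : Type u) → [AddCommGroup M] → [Module R M] → Prop
  | 0, M, _, _ => Module.Projective R M
  | n + 1, M, _, _ => ∃ (k : ℕ) (f : (Fin k → R) →ₗ[R] M), Function.Surjective f ∧
      ProjDimLE R n ↥(LinearMap.ker f)

section Defs2

variable {R : Type u} [CommRing R]

/-- `M` has projective dimension exactly `n` over `R`. -/
def ProjDimEq (R : Type u) [CommRing R] (M : Type u) [AddCommGroup M] [Module R M]
    (n : ℕ) : Prop :=
  ProjDimLE R n M ∧ ∀ m : ℕ, ProjDimLE R m M → n ≤ m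

/-- A perfect ideal: the projective dimension of `R/I` equals the grade of `I`. -/
def IsPerfectIdeal (I : Ideal R) : Prop :=
  ∃ g : ℕ, grade I = (g : ℕ∞) ∧ ProjDimEq R (R ⧸ I) g

/-- The multiplicative set which is the complement of the union of the associated
primes of `R/H`. -/
def assComplement (H : Ideal R) : Submonoid R where
  carrier := {r : R | ∀ p ∈ associatedPrimes R (R ⧸ H), r ∉ p}
  one_mem' := fun p hp => (Ideal.ne_top_iff_one p).mp hp.1.ne_top
  mul_mem' := fun {a b} ha hb p hp hab =>
    (hp.1.mem_or_mem hab).elim (ha p hp) (hb p hp)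

/-- The `j`-th symbolic power of `H`. -/
noncomputable def symbolicPower (H : Ideal R) (j : ℕ) : Ideal R :=
  Ideal.comap (algebraMap R (Localization (assComplement H)))
    (Ideal.map (algebraMap R (Localization (assComplement H))) (H ^ j))

/-- Serre's condition `S₂` for a module. -/
def ModuleS2 (S : Type u) [CommRing S] (M : Type v) [AddCommGroup M] [Module S M] : Prop :=
  ∀ (q : Ideal S) (hq : q.IsPrime),
    letI := hq
    min 2 (rDim ((Localization.AtPrime q) ⧸
        (Module.annihilator (Localization.AtPrime q) (LocalizedModule q.primeCompl M))))
      ≤ (mDepth (Localization.AtPrime q) (LocalizedModule q.primeCompl M) : WithBot ℕ∞)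

/-- `M` is a maximal Cohen–Macaulay `S`-module. -/
def IsMCM (S : Type u) [CommRing S] (M : Type v) [AddCommGroup M] [Module S M] : Prop :=
  ∀ (q : Ideal S) (hq : q.IsMaximal),
    letI := hq.isPrime
    (mDepth (Localization.AtPrime q) (LocalizedModule q.primeCompl M) : WithBot ℕ∞) =
      rDim (Localization.AtPrime q)

end Defs2


set_option linter.unusedSectionVars false
set_option linter.unusedVariables false

section ExtTools
open CategoryTheory CategoryTheory.Abelian

variable {R : Type u} [CommRing R] [IsLocalRing R]
variable {A B C M : Type u} [AddCommGroup A] [AddCommGroup B] [AddCommGroup C] [AddCommGroup M]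
  [Module R A] [Module R B] [Module R C] [Module R M]

/-- `Ext^i(k, M)` for the residue field `k`. -/
abbrev EE (R : Type u) [CommRing R] [IsLocalRing R] (M : Type u) [AddCommGroup M] [Module R M]
    (i : ℕ) : Type u :=
  Ext.{u} (ModuleCat.of R (ResidueField R)) (ModuleCat.of R M) i

/-- depth at least `s` -/
def Dep (R : Type u) [CommRing R] [IsLocalRing R] (s : ℕ) (M : Type u) [AddCommGroup M]
    [Module R M] : Prop := ∀ i < s, Subsingleton (EE R M i)

/-- depth at least `s` and `Ext^s(k,M)` of length at most `c` -/
def Ty (R : Type u) [CommRing R] [IsLocalRing R] (s : ℕ) (M : Type u) [AddCommGroup M]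
    [Module R M] (c : ℕ) : Prop := Dep R s M ∧ Module.length R (EE R M s) ≤ (c : ℕ∞)

/-- functoriality -/
noncomputable def EEmap (f : A →ₗ[R] B) (i : ℕ) : EE R A i →ₗ[R] EE R B i :=
  (Ext.mk₀ (ModuleCat.ofHom f)).postcompOfLinear R _ (add_zero i)

lemma EEmap_comp (f : A →ₗ[R] B) (g : B →ₗ[R] C) (i : ℕ) (e : EE R A i) :
    EEmap (g ∘ₗ f) i e = EEmap g i (EEmap f i e) := by
  simp [EEmap, ModuleCat.ofHom_comp]

lemma EEmap_id (i : ℕ) (e : EE R A i) : EEmap (LinearMap.id : A →ₗ[R] A) i e = e := by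
  simp [EEmap]

lemma EEmap_smul (x : R) (i : ℕ) (e : EE R A i) :
    EEmap (x • (LinearMap.id : A →ₗ[R] A)) i e = x • e := by
  rw [Ext.smul_eq_comp_mk₀]
  rfl

lemma EE_smul_zero (x : R) (hx : x ∈ maximalIdeal R) (i : ℕ) (e : EE R A i) : x • e = 0 := by
  have h : x • e = (Ext.mk₀ (x • 𝟙 (ModuleCat.of R (ResidueField R)))).comp e (zero_add i) := by
    simp [Ext.mk₀_smul]
  have h2 : x • 𝟙 (ModuleCat.of R (ResidueField R)) = 0 := by
    ext y
    obtain ⟨y, rfl⟩ := residue_surjective y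
    show x • residue R y = 0
    rw [Algebra.smul_def]
    have : algebraMap R (ResidueField R) x = 0 := (residue_eq_zero_iff x).2 hx
    rw [this, zero_mul]
  rw [h, h2]; simp

/-- equivalence on Ext -/
noncomputable def EEequiv (f : A ≃ₗ[R] B) (i : ℕ) : EE R A i ≃ₗ[R] EE R B i :=
  LinearEquiv.ofLinearMap (EEmap f.toLinearMap i) (EEmap f.symm.toLinearMap i)
    (by ext e; simp [← EEmap_comp, EEmap_id]) (by ext e; simp [← EEmap_comp, EEmap_id])

/-- degree zero -/
noncomputable def EEzero : EE R M 0 ≃ₗ[R] (ResidueField R →ₗ[R] M) :=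
  Ext.linearEquiv₀.trans ModuleCat.homLinearEquiv


lemma EE_ses (f : A →ₗ[R] B) (g : B →ₗ[R] C) (hf : Function.Injective f)
    (hg : Function.Surjective g) (hfg : Function.Exact f g) :
    ∃ h : (ModuleCat.ofHom f ≫ ModuleCat.ofHom g = 0),
    (ShortComplex.mk _ _ h).ShortExact := by
  have h : (ModuleCat.ofHom f ≫ ModuleCat.ofHom g = 0) := by
    ext x; exact hfg.apply_apply_eq_zero x
  refine ⟨h, ?_⟩
  refine { exact := ?_, mono_f := ?_, epi_g := ?_ }
  · rw [ShortComplex.ShortExact.moduleCat_exact_iff_function_exact]; exact hfg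
  · exact (ModuleCat.mono_iff_injective _).2 hf
  · exact (ModuleCat.epi_iff_surjective _).2 hg

lemma EE_les (f : A →ₗ[R] B) (g : B →ₗ[R] C) (hf : Function.Injective f)
    (hg : Function.Surjective g) (hfg : Function.Exact f g) (i : ℕ) :
    ∃ δ : EE R C i →ₗ[R] EE R A (i + 1),
    Function.Exact (EEmap f i) (EEmap g i) ∧ Function.Exact (EEmap g i) δ ∧
    Function.Exact δ (EEmap f (i + 1)) := by
  obtain ⟨h, hS⟩ := EE_ses f g hf hg hfg
  refine ⟨hS.extClass.postcompOfLinear R _ rfl, ?_, ?_, ?_⟩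
  · exact (ShortComplex.ab_exact_iff_function_exact _).1 (Ext.covariant_sequence_exact₂' _ hS i)
  · exact (ShortComplex.ab_exact_iff_function_exact _).1
      (Ext.covariant_sequence_exact₃' _ hS i _ rfl)
  · exact (ShortComplex.ab_exact_iff_function_exact _).1
      (Ext.covariant_sequence_exact₁' _ hS i _ rfl)

lemma EE_zero_inj (f : A →ₗ[R] B) (hf : Function.Injective f) : Function.Injective (EEmap f 0) := by
  intro a b hab
  have := Ext.postcomp_mk₀_injective_of_mono (ModuleCat.of R (ResidueField R))
    (ModuleCat.ofHom f) (hf := (ModuleCat.mono_iff_injective _).2 hf)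
  exact this hab

lemma Dep.mono {s t : ℕ} (h : Dep R s M) (hts : t ≤ s) : Dep R t M :=
  fun i hi => h i (lt_of_lt_of_le hi hts)

lemma Dep.zero : Dep R 0 M := fun i hi => absurd hi (Nat.not_lt_zero i)

lemma Dep.equiv {s : ℕ} (h : Dep R s A) (e : A ≃ₗ[R] B) : Dep R s B := fun i hi => by
  have := h i hi
  exact (EEequiv e i).symm.toEquiv.subsingleton

lemma Ty.equiv {s c : ℕ} (h : Ty R s A c) (e : A ≃ₗ[R] B) : Ty R s B c :=
  ⟨h.1.equiv e, by rw [← (EEequiv e s).length_eq]; exact h.2⟩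

lemma Ty.mono {s c c' : ℕ} (h : Ty R s A c) (hc : c ≤ c') : Ty R s A c' :=
  ⟨h.1, h.2.trans (by exact_mod_cast hc)⟩

lemma Ty.of_dep {s c : ℕ} (h : Dep R (s + 1) A) : Ty R s A c :=
  ⟨h.mono (Nat.le_succ s), by
    have := h s (Nat.lt_succ_self s)
    rw [Module.length_eq_zero]; exact bot_le⟩

lemma Ty.dep_of_zero {s : ℕ} (h : Ty R s A 0) : Dep R (s + 1) A := fun i hi => by
  rcases Nat.lt_succ_iff_lt_or_eq.1 hi with h1 | rfl
  · exact h.1 i h1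
  · have := h.2
    exact Module.length_eq_zero_iff.1 (le_antisymm (by simpa using this) bot_le)

lemma Dep.of_subsingleton [Subsingleton M] {s : ℕ} : Dep R s M := fun i _ => by
  constructor
  intro a b
  have h : (LinearMap.id : M →ₗ[R] M) = (0 : R) • LinearMap.id := by
    ext x; exact Subsingleton.elim _ _
  rw [← EEmap_id (A := M) i a, ← EEmap_id (A := M) i b, h, EEmap_smul, EEmap_smul, zero_smul,
    zero_smul]

lemma subs_mid {X Y Z : Type u} [AddCommGroup X] [AddCommGroup Y] [AddCommGroup Z] [Module R X]
    [Module R Y] [Module R Z] {f : X →ₗ[R] Y} {g : Y →ₗ[R] Z} (h : Function.Exact f g)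
    (hX : Subsingleton X) (hZ : Subsingleton Z) : Subsingleton Y := by
  refine subsingleton_of_forall_eq 0 fun y => ?_
  obtain ⟨x, rfl⟩ := (h y).1 (Subsingleton.elim _ _)
  rw [Subsingleton.elim x 0, map_zero]

lemma length_mid {X Y Z : Type u} [AddCommGroup X] [AddCommGroup Y] [AddCommGroup Z] [Module R X]
    [Module R Y] [Module R Z] {f : X →ₗ[R] Y} {g : Y →ₗ[R] Z} (h : Function.Exact f g) :
    Module.length R Y ≤ Module.length R X + Module.length R Z := by
  have h1 : Module.length R Y = Module.length R (LinearMap.ker g) +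
      Module.length R (LinearMap.range g) := by
    refine Module.length_eq_add_of_exact (LinearMap.ker g).subtype g.rangeRestrict
      (Submodule.subtype_injective _) g.surjective_rangeRestrict ?_
    rw [LinearMap.exact_iff, Submodule.range_subtype, LinearMap.ker_rangeRestrict]
  rw [h1]
  gcongr
  · rw [LinearMap.exact_iff.1 h]
    exact Module.length_le_of_surjective f.rangeRestrict f.surjective_rangeRestrict
  · exact Module.length_le_of_injective (LinearMap.range g).subtype (Submodule.subtype_injective _)

lemma dep_mid (f : A →ₗ[R] B) (g : B →ₗ[R] C) (hf : Function.Injective f)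
    (hg : Function.Surjective g) (hfg : Function.Exact f g) {s : ℕ} (hA : Dep R s A)
    (hC : Dep R s C) : Dep R s B := fun i hi => by
  obtain ⟨δ, h1, -, -⟩ := EE_les f g hf hg hfg i
  exact subs_mid h1 (hA i hi) (hC i hi)

lemma dep_right (f : A →ₗ[R] B) (g : B →ₗ[R] C) (hf : Function.Injective f)
    (hg : Function.Surjective g) (hfg : Function.Exact f g) {s : ℕ} (hA : Dep R (s + 1) A)
    (hB : Dep R s B) : Dep R s C := fun i hi => by
  obtain ⟨δ, -, h1, -⟩ := EE_les f g hf hg hfg i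
  exact subs_mid h1 (hB i hi) (hA (i + 1) (by omega))

lemma dep_left (f : A →ₗ[R] B) (g : B →ₗ[R] C) (hf : Function.Injective f)
    (hg : Function.Surjective g) (hfg : Function.Exact f g) {s : ℕ} (hB : Dep R s B)
    (hC : Dep R (s - 1) C) : Dep R s A := fun i hi => by
  cases i with
  | zero =>
    have := hB 0 hi
    exact (EE_zero_inj f hf).subsingleton
  | succ i =>
    obtain ⟨δ, -, -, h1⟩ := EE_les f g hf hg hfg i
    exact subs_mid h1 (hC i (by omega)) (hB (i + 1) hi)

lemma ty_mid (f : A →ₗ[R] B) (g : B →ₗ[R] C) (hf : Function.Injective f)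
    (hg : Function.Surjective g) (hfg : Function.Exact f g) {s a c : ℕ} (hA : Ty R s A a)
    (hC : Ty R s C c) : Ty R s B (a + c) := by
  refine ⟨dep_mid f g hf hg hfg hA.1 hC.1, ?_⟩
  obtain ⟨δ, h1, -, -⟩ := EE_les f g hf hg hfg s
  refine (length_mid h1).trans ?_
  push_cast
  exact add_le_add hA.2 hC.2

lemma ty_right (f : A →ₗ[R] B) (g : B →ₗ[R] C) (hf : Function.Injective f)
    (hg : Function.Surjective g) (hfg : Function.Exact f g) {s a : ℕ} (hA : Ty R (s + 1) A a)
    (hB : Dep R (s + 1) B) : Ty R s C a := by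
  refine ⟨dep_right f g hf hg hfg hA.1 (hB.mono (Nat.le_succ s)), ?_⟩
  obtain ⟨δ, -, h1, -⟩ := EE_les f g hf hg hfg s
  refine (length_mid h1).trans ?_
  have := hB s (Nat.lt_succ_self s)
  rw [Module.length_eq_zero, zero_add]
  exact hA.2

lemma ty_left (f : A →ₗ[R] B) (g : B →ₗ[R] C) (hf : Function.Injective f)
    (hg : Function.Surjective g) (hfg : Function.Exact f g) {s a : ℕ} (hB : Ty R s B a)
    (hC : Dep R s C) : Ty R s A a := by
  refine ⟨dep_left f g hf hg hfg hB.1 (hC.mono (Nat.sub_le _ _)), ?_⟩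
  cases s with
  | zero => exact (Module.length_le_of_injective _ (EE_zero_inj f hf)).trans hB.2
  | succ s =>
    obtain ⟨δ, -, -, h1⟩ := EE_les f g hf hg hfg s
    refine (length_mid h1).trans ?_
    have := hC s (Nat.lt_succ_self s)
    rw [Module.length_eq_zero, zero_add]
    exact hB.2

open Pointwise in
lemma quot_exact (x : R) : Function.Exact (x • (LinearMap.id : M →ₗ[R] M))
    (Submodule.mkQ (x • (⊤ : Submodule R M))) := by
  intro y
  rw [Submodule.mkQ_apply, Submodule.Quotient.mk_eq_zero, Submodule.mem_smul_pointwise_iff_exists]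
  simp

lemma Dep.quot {s : ℕ} (h : Dep R (s + 1) M) {x : R} (hx : IsSMulRegular M x) :
    Dep R s (QuotSMulTop x M) :=
  dep_right (x • LinearMap.id) (Submodule.mkQ _) (fun a b hab => hx hab)
    (Submodule.mkQ_surjective _) (quot_exact x) h (h.mono (Nat.le_succ s))

lemma Ty.quot {s c : ℕ} (h : Ty R (s + 1) M c) {x : R} (hx : IsSMulRegular M x) :
    Ty R s (QuotSMulTop x M) c :=
  ty_right (x • LinearMap.id) (Submodule.mkQ _) (fun a b hab => hx hab)
    (Submodule.mkQ_surjective _) (quot_exact x) h h.1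

lemma Dep.lift {s : ℕ} {x : R} (hxm : x ∈ maximalIdeal R) (hx : IsSMulRegular M x)
    (h : Dep R s (QuotSMulTop x M)) : Dep R (s + 1) M := fun i hi => by
  cases i with
  | zero =>
    refine subsingleton_of_forall_eq 0 fun e => ?_
    apply EE_zero_inj (x • (LinearMap.id : M →ₗ[R] M)) (fun a b hab => hx hab)
    rw [EEmap_smul, EE_smul_zero x hxm, map_zero]
  | succ i =>
    obtain ⟨δ, -, -, h1⟩ := EE_les (x • LinearMap.id) (Submodule.mkQ _) (fun a b hab => hx hab)
      (Submodule.mkQ_surjective _) (quot_exact x) i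
    refine subsingleton_of_forall_eq 0 fun e => ?_
    obtain ⟨y, rfl⟩ := (h1 e).1 (by rw [EEmap_smul, EE_smul_zero x hxm])
    have := h i (by omega)
    rw [Subsingleton.elim y 0, map_zero]

lemma Ty.lift {s c : ℕ} {x : R} (hxm : x ∈ maximalIdeal R) (hx : IsSMulRegular M x)
    (h : Ty R s (QuotSMulTop x M) c) : Ty R (s + 1) M c := by
  refine ⟨h.1.lift hxm hx, ?_⟩
  obtain ⟨δ, -, -, h1⟩ := EE_les (x • LinearMap.id) (Submodule.mkQ _) (fun a b hab => hx hab)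
      (Submodule.mkQ_surjective _) (quot_exact x) s
  refine (Module.length_le_of_surjective δ ?_).trans h.2
  intro e
  exact (h1 e).1 (by rw [EEmap_smul, EE_smul_zero x hxm])

lemma Dep.exists_regular [IsNoetherianRing R] [Module.Finite R M] {s : ℕ} (h : Dep R (s + 1) M) :
    ∃ x ∈ maximalIdeal R, IsSMulRegular M x := by
  have h0 := h 0 (Nat.succ_pos s)
  have : Subsingleton (ResidueField R →ₗ[R] M) := EEzero.symm.toEquiv.subsingleton
  obtain ⟨x, hx, hreg⟩ := IsSMulRegular.subsingleton_linearMap_iff.1 this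
  refine ⟨x, ?_, hreg⟩
  rw [Module.mem_annihilator] at hx
  rw [← residue_eq_zero_iff]
  have := hx 1
  rwa [Algebra.smul_def, mul_one] at this

lemma Dep.prod {s : ℕ} (hA : Dep R s A) (hB : Dep R s B) : Dep R s (A × B) :=
  dep_mid (LinearMap.inl R A B) (LinearMap.snd R A B) LinearMap.inl_injective
    LinearMap.snd_surjective Function.Exact.inl_snd hA hB

lemma Dep.exists_regular₂ [IsNoetherianRing R] [Module.Finite R A] [Module.Finite R B] {s : ℕ}
    (hA : Dep R (s + 1) A) (hB : Dep R (s + 1) B) :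
    ∃ x ∈ maximalIdeal R, IsSMulRegular A x ∧ IsSMulRegular B x := by
  obtain ⟨x, hx, h⟩ := (hA.prod hB).exists_regular
  refine ⟨x, hx, fun a b hab => ?_, fun a b hab => ?_⟩
  · have := @h (a, 0) (b, 0) (by ext <;> simp; exact hab)
    exact congrArg Prod.fst this
  · have := @h (0, a) (0, b) (by ext <;> simp; exact hab)
    exact congrArg Prod.snd this

lemma dep_of_regular (rs : List R) (hrs : ∀ x ∈ rs, x ∈ maximalIdeal R) :
    ∀ (M : Type u) [AddCommGroup M] [Module R M],
    RingTheory.Sequence.IsWeaklyRegular M rs → Dep R rs.length M := by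
  induction rs with
  | nil => intro M _ _ _; exact Dep.zero
  | cons x rs ih =>
    intro M _ _ h
    rw [RingTheory.Sequence.isWeaklyRegular_cons_iff] at h
    exact (ih (fun y hy => hrs y (List.mem_cons_of_mem _ hy)) _ h.2).lift
      (hrs x List.mem_cons_self) h.1

end ExtTools

section Isch
variable {R : Type u} [CommRing R] [IsLocalRing R] [IsNoetherianRing R]
variable {M : Type u} [AddCommGroup M] [Module R M]

lemma height_lt_of_lt {p q : Ideal R} (hp : p.IsPrime) (hq : q.IsPrime) (h : p < q) :
    p.height + 1 ≤ q.height := Ideal.height_add_one_le_of_lt_of_isPrime h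

lemma assoc_iff {p : Ideal R} : p ∈ associatedPrimes R M ↔
    p.IsPrime ∧ ∃ m : M, ∀ r, r ∈ p ↔ r • m = 0 := by
  rw [AssociatedPrimes.mem_iff, isAssociatedPrime_iff]
  simp [SetLike.ext_iff, Submodule.mem_colon_singleton]

lemma exists_assoc (m : M) (hm : m ≠ 0) :
    ∃ q ∈ associatedPrimes R M, ∀ r : R, r • m = 0 → r ∈ q := by
  obtain ⟨q, hq, hle⟩ := exists_le_isAssociatedPrime_of_isNoetherianRing R m hm
  exact ⟨q, hq, fun r hr => hle (by simpa [Submodule.mem_colon_singleton] using hr)⟩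

/-- Ischebeck-type bound. -/
lemma isch {d : ℕ} (hd : ∀ p : Ideal R, p.IsPrime → p.height ≤ (d : ℕ∞)) (s : ℕ) :
    ∀ (M : Type u) [AddCommGroup M] [Module R M] [Module.Finite R M] (_ : Dep R s M)
      (p : Ideal R) (_ : p ∈ associatedPrimes R M), p.height + (s : ℕ∞) ≤ (d : ℕ∞) := by
  induction s with
  | zero => intro M _ _ _ _ p hp; simpa using hd p hp.1
  | succ s ih =>
    intro M _ _ _ hM p hp
    obtain ⟨x, hxm, hx⟩ := hM.exists_regular
    have hpp := hp.1
    obtain ⟨m0, hm⟩ := (assoc_iff.1 hp).2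
    have hm0ne : m0 ≠ 0 := by
      rintro rfl
      exact hpp.ne_top (Ideal.eq_top_iff_one _ |>.2 ((hm 1).2 (by simp)))
    have hxp : x ∉ p := fun h => hm0ne (hx (by simpa using (hm x).1 h))
    let U : Submodule R M :=
      { carrier := {m | ∀ r ∈ p, r • m = 0}
        add_mem' := fun {a b} ha hb r hr => by rw [smul_add, ha r hr, hb r hr, add_zero]
        zero_mem' := fun r _ => smul_zero r
        smul_mem' := fun c m hm r hr => by rw [smul_comm, hm r hr, smul_zero] }
    have hU : ∃ u ∈ U, ∀ m, u ≠ x • m := by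
      by_contra hcon
      push Not at hcon
      have : U ≤ (maximalIdeal R) • U := by
        intro u hu
        obtain ⟨m, rfl⟩ := hcon u hu
        refine Submodule.smul_mem_smul hxm ?_
        intro r hr
        apply hx
        have := hu r hr
        rw [smul_comm] at this
        simpa using this
      have hbot := Submodule.eq_bot_of_le_smul_of_le_jacobson_bot (maximalIdeal R) U
        (IsNoetherian.noetherian U) this (IsLocalRing.maximalIdeal_le_jacobson _)
      have : m0 ∈ U := fun r hr => (hm r).1 hr
      rw [hbot] at this
      exact hm0ne this
    obtain ⟨u, hu, hux⟩ := hU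
    let ub : QuotSMulTop x M := Submodule.mkQ _ u
    have hub : ub ≠ 0 := by
      intro h
      have h2 := (Submodule.Quotient.mk_eq_zero _).1 h
      rw [Submodule.mem_smul_pointwise_iff_exists] at h2
      obtain ⟨m, -, h3⟩ := h2
      exact hux m h3.symm
    obtain ⟨q, hq, hle⟩ := exists_assoc (R := R) ub hub
    have hpq : p < q := by
      have h1 : ∀ r, r • u = 0 → r ∈ q := fun r hr => hle r (by
        rw [← map_smul, hr, map_zero])
      refine lt_of_le_of_ne (fun r hr => h1 r (hu r hr)) ?_
      rintro rfl
      apply hxp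
      apply hle
      rw [← map_smul]
      exact (Submodule.Quotient.mk_eq_zero _).2
        (Submodule.smul_mem_pointwise_smul _ _ _ Submodule.mem_top)
    have h1 := height_lt_of_lt hpp hq.1 hpq
    have h2 := ih (QuotSMulTop x M) (hM.quot hx) q hq
    calc p.height + ((s + 1 : ℕ) : ℕ∞) = (p.height + 1) + s := by push_cast; ring
      _ ≤ q.height + s := by gcongr
      _ ≤ d := h2

/-- Every prime containing `K` has height at least `i`. -/
def HtGE (K : Ideal R) (i : ℕ) : Prop := ∀ p : Ideal R, p.IsPrime → K ≤ p → (i : ℕ∞) ≤ p.height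

lemma htGE_mono {K L : Ideal R} {i : ℕ} (h : HtGE K i) (hKL : K ≤ L) : HtGE L i :=
  fun p hp hL => h p hp (hKL.trans hL)

lemma htGE_succ {K L : Ideal R} {i : ℕ} (h : HtGE K i) (hKL : K ≤ L)
    (hL : ∀ q ∈ K.minimalPrimes, ¬ L ≤ q) : HtGE L (i + 1) := by
  intro p hp hLp
  obtain ⟨q, hq, hqp⟩ := Ideal.exists_minimalPrimes_le (hKL.trans hLp)
  have hne : q ≠ p := by rintro rfl; exact hL q hq hLp
  have h1 := height_lt_of_lt hq.1.1 hp (lt_of_le_of_ne hqp hne)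
  have h2 := h q hq.1.1 hq.1.2
  push_cast
  exact (add_le_add_left h2 1).trans h1

lemma regular_not_mem_assoc [Module.Finite R M] {x : R} (hx : IsSMulRegular M x) {q : Ideal R}
    (hq : q ∈ associatedPrimes R M) : x ∉ q := by
  obtain ⟨hqp, m, hm⟩ := assoc_iff.1 hq
  intro hxq
  have : m = 0 := hx (by simpa using (hm x).1 hxq)
  exact hqp.ne_top (Ideal.eq_top_iff_one _ |>.2 ((hm 1).2 (by simp [this])))

lemma isArtinian_quot {d : ℕ} (hd : ∀ p : Ideal R, p.IsPrime → p.height ≤ (d : ℕ∞)) {K : Ideal R}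
    (h : HtGE K d) : IsArtinian R (R ⧸ K) := by
  have hmax : ∀ p : Ideal R, p.IsPrime → K ≤ p → p = maximalIdeal R := by
    intro p hp hK
    by_contra hne
    have h1 := height_lt_of_lt hp (maximalIdeal.isMaximal R).isPrime
      (lt_of_le_of_ne (le_maximalIdeal hp.ne_top) hne)
    have h2 := h p hp hK
    have h3 := hd (maximalIdeal R) (maximalIdeal.isMaximal R).isPrime
    have : ((d + 1 : ℕ) : ℕ∞) ≤ (d : ℕ∞) := by
      push_cast
      exact ((add_le_add_left h2 1).trans h1).trans h3
    have : d + 1 ≤ d := by exact_mod_cast this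
    omega
  have : Ring.KrullDimLE 0 (R ⧸ K) := by
    rw [Ring.krullDimLE_zero_iff]
    intro P hP
    have h1 := hmax (P.comap (Ideal.Quotient.mk K)) inferInstance (by
      intro x hx; simp [Ideal.Quotient.eq_zero_iff_mem.2 hx])
    have : P = (maximalIdeal R).map (Ideal.Quotient.mk K) := by
      rw [← h1, Ideal.map_comap_of_surjective _ Ideal.Quotient.mk_surjective]
    have h2 : (P.comap (Ideal.Quotient.mk K)).IsMaximal := h1 ▸ maximalIdeal.isMaximal R
    rw [this, ← h1]
    rcases Ideal.map_eq_top_or_isMaximal_of_surjective (Ideal.Quotient.mk K)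
      Ideal.Quotient.mk_surjective h2 with h3 | h3
    · rw [Ideal.map_comap_of_surjective _ Ideal.Quotient.mk_surjective] at h3
      exact absurd h3 hP.ne_top
    · exact h3
  have : IsArtinianRing (R ⧸ K) := IsNoetherianRing.isArtinianRing_of_krullDimLE_zero
  exact isArtinian_of_surjective_algebraMap (R := R ⧸ K) (S := R) Ideal.Quotient.mk_surjective

lemma isArtinian_of_ann [Module.Finite R M] (h : IsArtinian R (R ⧸ Module.annihilator R M)) :
    IsArtinian R M := by
  obtain ⟨n, f, hf⟩ := Module.Finite.exists_fin' R M
  let φ : (Fin n → R ⧸ Module.annihilator R M) →ₗ[R] M :=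
    LinearMap.lsum R (fun _ => R ⧸ Module.annihilator R M) R (fun i =>
      Submodule.liftQ _ (LinearMap.toSpanSingleton R M (f (Pi.single i 1)))
        (fun r hr => by
          simpa using Module.mem_annihilator.1 hr _))
  refine isArtinian_of_surjective _ φ ?_
  intro m
  obtain ⟨v, rfl⟩ := hf m
  refine ⟨fun i => Ideal.Quotient.mk _ (v i), ?_⟩
  have hv : v = ∑ i, v i • Pi.single (M := fun _ => R) i (1 : R) := by
    ext j; simp [Finset.sum_apply, Pi.single_apply]
  conv_rhs => rw [hv, map_sum]
  simp only [φ, LinearMap.lsum_apply, LinearMap.sum_apply, LinearMap.comp_apply,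
    LinearMap.proj_apply, map_smul]
  refine Finset.sum_congr rfl fun i _ => ?_
  exact Submodule.liftQ_apply _ _ _

lemma length_hom_le {X : Type u} [AddCommGroup X] [Module R X] (hX : IsFiniteLength R X) :
    Module.length R (X →ₗ[R] M) ≤
      Module.length R X * Module.length R (ResidueField R →ₗ[R] M) := by
  induction hX with
  | of_subsingleton =>
    rw [Module.length_eq_zero_iff.2 ⟨fun f g => by ext x; rw [Subsingleton.elim x 0]; simp⟩]
    exact bot_le
  | @of_simple_quotient X _ _ N hs hN ih =>
    have h1 : Module.length R X = Module.length R N + Module.length R (X ⧸ N) :=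
      Module.length_eq_add_of_exact N.subtype N.mkQ N.subtype_injective N.mkQ_surjective
        (LinearMap.exact_subtype_mkQ N)
    rw [h1, Module.length_eq_one R (X ⧸ N), add_mul, one_mul, add_comm]
    have hex : Function.Exact (LinearMap.lcomp R M N.mkQ) (LinearMap.lcomp R M N.subtype) := by
      intro f
      constructor
      · intro hf
        refine ⟨N.liftQ f (fun x hx => ?_), ?_⟩
        · exact LinearMap.congr_fun hf ⟨x, hx⟩
        · ext x; rfl
      · rintro ⟨f, rfl⟩
        ext x
        show f (Submodule.Quotient.mk (x : X)) = 0
        rw [(Submodule.Quotient.mk_eq_zero _).2 x.2, map_zero]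
    refine (length_mid hex).trans ?_
    refine add_le_add ?_ ih
    obtain ⟨m, hm, ⟨e⟩⟩ := isSimpleModule_iff_quot_maximal.1 hs
    obtain rfl := IsLocalRing.eq_maximalIdeal hm
    exact (LinearEquiv.congrLeft M R e).length_eq.le
end Isch

section LemEZ
open scoped Pointwise
variable {R : Type u} [CommRing R] [IsLocalRing R] [IsNoetherianRing R]
variable {M : Type u} [AddCommGroup M] [Module R M]

lemma finite_hom {A B : Type u} [AddCommGroup A] [Module R A] [AddCommGroup B] [Module R B]
    [Module.Finite R A] [Module.Finite R B] : Module.Finite R (A →ₗ[R] B) := by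
  obtain ⟨n, f, hf⟩ := Module.Finite.exists_fin' R A
  exact Module.Finite.of_injective (LinearMap.lcomp R B f) (fun g h hgh => by
    ext x
    obtain ⟨y, rfl⟩ := hf x
    exact LinearMap.congr_fun hgh y)

lemma sub_eq_of_length {X : Type u} [AddCommGroup X] [Module R X] {N P : Submodule R X}
    (hNP : N ≤ P) (h : Module.length R P ≤ Module.length R N) (hfin : Module.length R N ≠ ⊤) :
    N = P := by
  have h1 : Module.length R P = Module.length R N + Module.length R (P ⧸ N.submoduleOf P) := by
    rw [Module.length_eq_add_of_exact (N.submoduleOf P).subtype (N.submoduleOf P).mkQ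
      (Submodule.subtype_injective _) (Submodule.mkQ_surjective _)
      (LinearMap.exact_subtype_mkQ _)]
    rw [(Submodule.submoduleOfEquivOfLe hNP).length_eq]
  rw [h1] at h
  have h2 : Module.length R (P ⧸ N.submoduleOf P) = 0 := by
    have : Module.length R N + Module.length R (P ⧸ N.submoduleOf P) ≤ Module.length R N + 0 := by
      simpa using h
    exact le_antisymm ((ENat.add_le_add_iff_left hfin).1 this) bot_le
  rw [Module.length_eq_zero_iff, Submodule.Quotient.subsingleton_iff] at h2
  exact le_antisymm hNP (Submodule.submoduleOf_eq_top.1 h2)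

lemma ann_minimal_regular [Module.Finite R M] {x : R} (hx : IsSMulRegular M x) {i : ℕ}
    (h : HtGE (Module.annihilator R M) i) :
    HtGE (Module.annihilator R (QuotSMulTop x M)) (i + 1) := by
  refine htGE_succ h ?_ ?_
  · exact LinearMap.annihilator_le_of_surjective (Submodule.mkQ _) (Submodule.mkQ_surjective _)
  · intro q hq hle
    refine regular_not_mem_assoc hx
      (Module.associatedPrimes.minimalPrimes_annihilator_subset_associatedPrimes R M hq) (hle ?_)
    rw [Module.mem_annihilator]
    intro m
    obtain ⟨m, rfl⟩ := Submodule.mkQ_surjective _ m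
    rw [← map_smul]
    exact (Submodule.Quotient.mk_eq_zero _).2
        (Submodule.smul_mem_pointwise_smul _ _ _ Submodule.mem_top)

lemma lemE {d : ℕ} (hd : ∀ p : Ideal R, p.IsPrime → p.height ≤ (d : ℕ∞)) (s : ℕ) :
    ∀ (i : ℕ) (_ : d ≤ i + s) (M : Type u) [AddCommGroup M] [Module R M] [Module.Finite R M]
      (_ : Ty R s M 1) (_ : HtGE (Module.annihilator R M) i) (f : M →ₗ[R] M),
      ∃ r : R, ∀ m, f m = r • m := by
  induction s with
  | zero =>
    intro i hi M _ _ _ hM hht f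
    have hht' : HtGE (Module.annihilator R M) d := fun p hp hK =>
      le_trans (by exact_mod_cast (by simpa using hi)) (hht p hp hK)
    have hA := isArtinian_quot hd hht'
    have hAM := isArtinian_of_ann hA
    have hk : Module.length R (ResidueField R →ₗ[R] M) ≤ 1 := by
      rw [← (EEzero (R := R) (M := M)).length_eq]; simpa using hM.2
    have hl : ∀ (X : Type u) [AddCommGroup X] [Module R X], IsFiniteLength R X →
        Module.length R (X →ₗ[R] M) ≤ Module.length R X := fun X _ _ hX =>
      (length_hom_le hX).trans ((mul_le_mul_right hk _).trans (mul_one _).le)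
    have h1 := hl M (isFiniteLength_iff_isNoetherian_isArtinian.2 ⟨inferInstance, hAM⟩)
    have h2 := hl (R ⧸ Module.annihilator R M)
      (isFiniteLength_iff_isNoetherian_isArtinian.2 ⟨inferInstance, hA⟩)
    have h3 : Module.length R M ≤ Module.length R ((R ⧸ Module.annihilator R M) →ₗ[R] M) := by
      let φ : M →ₗ[R] ((R ⧸ Module.annihilator R M) →ₗ[R] M) :=
        { toFun := fun m => Submodule.liftQ _ (LinearMap.toSpanSingleton R M m)
            (fun r hr => by simpa using Module.mem_annihilator.1 hr _)
          map_add' := fun a b =>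
            Submodule.linearMap_qext _ (LinearMap.ext_ring (smul_add (1 : R) _ _))
          map_smul' := fun a b =>
            Submodule.linearMap_qext _ (LinearMap.ext_ring (smul_comm (1 : R) a _)) }
      refine Module.length_le_of_injective φ ?_
      intro a b hab
      have := LinearMap.congr_fun hab (Submodule.Quotient.mk 1)
      have h' : (1 : R) • a = (1 : R) • b := this
      simpa using h'
    let ψ : (R ⧸ Module.annihilator R M) →ₗ[R] (M →ₗ[R] M) :=
      Submodule.liftQ _ (LinearMap.toSpanSingleton R (M →ₗ[R] M) LinearMap.id) (fun r hr => by
        have := Module.mem_annihilator.1 hr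
        simp only [LinearMap.mem_ker, LinearMap.toSpanSingleton_apply]
        ext m; simpa using this m)
    have hψ : Function.Injective ψ := by
      rw [← LinearMap.ker_eq_bot]
      apply Submodule.ker_liftQ_eq_bot
      intro r hr
      rw [Module.mem_annihilator]
      intro m
      exact LinearMap.congr_fun hr m
    have hlen : Module.length R (LinearMap.range ψ) =
        Module.length R (R ⧸ Module.annihilator R M) :=
      (LinearEquiv.ofInjective ψ hψ).length_eq.symm
    have htop := sub_eq_of_length (N := LinearMap.range ψ) (P := ⊤) le_top (by
      rw [hlen, Module.length_top]; exact h1.trans (h3.trans h2)) (by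
      rw [hlen]; exact Module.length_ne_top)
    obtain ⟨r, hr⟩ : f ∈ LinearMap.range ψ := by rw [htop]; trivial
    obtain ⟨r, rfl⟩ := Submodule.mkQ_surjective _ r
    refine ⟨r, fun m => ?_⟩
    rw [← hr]; rfl
  | succ s ih =>
    intro i hi M _ _ _ hM hht f
    obtain ⟨x, hxm, hx⟩ := hM.1.exists_regular
    have key : ∀ f : M →ₗ[R] M, ∃ (r : R) (h : M →ₗ[R] M), f = r • LinearMap.id + x • h := by
      intro f
      let f' : QuotSMulTop x M →ₗ[R] QuotSMulTop x M := Submodule.mapQ _ _ f (by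
        intro m hm
        rw [Submodule.mem_smul_pointwise_iff_exists] at hm
        obtain ⟨m', -, rfl⟩ := hm
        rw [Submodule.mem_comap, map_smul]
        exact Submodule.smul_mem_pointwise_smul _ _ _ Submodule.mem_top)
      obtain ⟨r, hr⟩ := ih (i + 1) (by omega) (QuotSMulTop x M) (hM.quot hx)
        (ann_minimal_regular hx hht) f'
      have h1 : ∀ m, ∃ m', f m - r • m = x • m' := by
        intro m
        have := hr (Submodule.mkQ _ m)
        have h2 : Submodule.mkQ (x • (⊤ : Submodule R M)) (f m - r • m) = 0 := by
          rw [map_sub, map_smul, ← this]; exact sub_self _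
        have h3 := (Submodule.Quotient.mk_eq_zero _).1 h2
        rw [Submodule.mem_smul_pointwise_iff_exists] at h3
        obtain ⟨m', -, h⟩ := h3
        exact ⟨m', h.symm⟩
      choose h hh using h1
      refine ⟨r, { toFun := h, map_add' := fun a b => ?_, map_smul' := fun c a => ?_ }, ?_⟩
      · apply hx
        show x • h (a + b) = x • (h a + h b)
        rw [smul_add, ← hh, ← hh, ← hh, map_add, smul_add]; abel
      · apply hx
        show x • h (c • a) = x • (c • h a)
        rw [smul_comm, ← hh, ← hh, map_smul, smul_sub, smul_comm r c]
      · ext m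
        show f m = r • m + x • h m
        rw [← hh]; abel
    have hfin : Module.Finite R (M →ₗ[R] M) := finite_hom
    have hN : (⊤ : Submodule R (M →ₗ[R] M)) ≤ Submodule.span R {LinearMap.id} := by
      apply Submodule.le_of_le_smul_of_le_jacobson_bot (I := maximalIdeal R) hfin.fg_top
        (IsLocalRing.maximalIdeal_le_jacobson _)
      intro f _
      obtain ⟨r, h, rfl⟩ := key f
      refine Submodule.add_mem_sup ?_ ?_
      · exact Submodule.smul_mem _ _ (Submodule.mem_span_singleton_self _)
      · exact Submodule.smul_mem_smul hxm trivial
    obtain ⟨r, rfl⟩ := Submodule.mem_span_singleton.1 (hN (Submodule.mem_top (x := f)))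
    exact ⟨r, fun m => rfl⟩

lemma lemZ {d : ℕ} (hd : ∀ p : Ideal R, p.IsPrime → p.height ≤ (d : ℕ∞)) (s : ℕ) {l : ℕ}
    (hl : 0 < l) :
    ∀ (i : ℕ) (_ : d ≤ i + s) (E : Type u) [AddCommGroup E] [Module R E] [Module.Finite R E]
      (f : (Fin l → R) →ₗ[R] E) (K : Ideal R) (_ : ∀ u, f u = 0 ↔ ∀ j, u j ∈ K)
      (_ : Dep R s (E ⧸ LinearMap.range f)) (_ : Ty R s E l) (_ : HtGE K i) (z : E)
      (_ : ∀ c ∈ K, c • z = 0), z ∈ LinearMap.range f := by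
  induction s with
  | zero =>
    intro i hi E _ _ _ f K hf _ hE hK z hz
    have hK' : HtGE K d := fun p hp h =>
      le_trans (by exact_mod_cast (by simpa using hi)) (hK p hp h)
    have hA := isArtinian_quot hd hK'
    have hk : Module.length R (ResidueField R →ₗ[R] E) ≤ l := by
      rw [← (EEzero (R := R) (M := E)).length_eq]; simpa using hE.2
    have h2 := (length_hom_le (M := E) (X := R ⧸ K)
      (isFiniteLength_iff_isNoetherian_isArtinian.2 ⟨inferInstance, hA⟩)).trans
      (mul_le_mul_right hk _)
    let Z : Submodule R E :=
      { carrier := {z | ∀ c ∈ K, c • z = 0}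
        add_mem' := fun {a b} ha hb r hr => by rw [smul_add, ha r hr, hb r hr, add_zero]
        zero_mem' := fun r _ => smul_zero r
        smul_mem' := fun c m hm r hr => by rw [smul_comm, hm r hr, smul_zero] }
    have h3 : Module.length R Z ≤ Module.length R ((R ⧸ K) →ₗ[R] E) := by
      let φ : Z →ₗ[R] ((R ⧸ K) →ₗ[R] E) :=
        { toFun := fun m => Submodule.liftQ _ (LinearMap.toSpanSingleton R E m)
            (fun r hr => by simpa using m.2 r hr)
          map_add' := fun a b =>
            Submodule.linearMap_qext _ (LinearMap.ext_ring (smul_add (1 : R) _ _))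
          map_smul' := fun a b =>
            Submodule.linearMap_qext _ (LinearMap.ext_ring (smul_comm (1 : R) a _)) }
      refine Module.length_le_of_injective φ ?_
      intro a b hab
      have := LinearMap.congr_fun hab (Submodule.Quotient.mk 1)
      have h' : (1 : R) • (a : E) = (1 : R) • (b : E) := this
      simpa using h'
    have hker : LinearMap.ker f = LinearMap.ker
        (LinearMap.pi (fun j => (Submodule.mkQ K) ∘ₗ (LinearMap.proj (R := R) (φ := fun _ : Fin l => R) j))) := by
      ext u
      rw [LinearMap.mem_ker, hf, LinearMap.mem_ker, funext_iff]
      exact forall_congr' fun j => (Submodule.Quotient.mk_eq_zero K).symm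
    have hsurj : Function.Surjective (LinearMap.pi (fun j => (Submodule.mkQ K) ∘ₗ
        (LinearMap.proj (R := R) (φ := fun _ : Fin l => R) j))) := by
      intro v
      choose u hu using fun j => Submodule.mkQ_surjective K (v j)
      exact ⟨u, by ext j; exact hu j⟩
    have e : LinearMap.range f ≃ₗ[R] (Fin l → R ⧸ K) :=
      (f.quotKerEquivRange.symm.trans (Submodule.quotEquivOfEq _ _ hker)).trans
        (LinearMap.quotKerEquivOfSurjective _ hsurj)
    have hlen : Module.length R (LinearMap.range f) = Module.length R (R ⧸ K) * l := by
      rw [e.length_eq, Module.length_pi_of_fintype]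
      simp [mul_comm]
    have hle : LinearMap.range f ≤ Z := by
      rintro _ ⟨u, rfl⟩ c hc
      rw [← map_smul, hf]
      intro j
      exact K.mul_mem_right _ hc
    have := sub_eq_of_length hle (by rw [hlen]; exact h3.trans h2) (by
      rw [e.length_eq]; exact Module.length_ne_top)
    rw [this]; exact hz
  | succ s ih =>
    intro i hi E _ _ _ f K hf hQ hE hK z hz
    obtain ⟨x, hxm, hxE, hxQ⟩ := hE.1.exists_regular₂ hQ
    have hxQ' : ∀ e, x • e ∈ LinearMap.range f → e ∈ LinearMap.range f := by
      intro e he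
      have : x • (Submodule.mkQ (LinearMap.range f) e) = x • 0 := by
        rw [← map_smul, smul_zero]; exact (Submodule.Quotient.mk_eq_zero _).2 he
      exact (Submodule.Quotient.mk_eq_zero _).1 (hxQ this)
    have mem_x : ∀ e : E, e ∈ x • (⊤ : Submodule R E) ↔ ∃ e', x • e' = e := by
      intro e; rw [Submodule.mem_smul_pointwise_iff_exists]; simp
    let f' : (Fin l → R) →ₗ[R] QuotSMulTop x E := (Submodule.mkQ _) ∘ₗ f
    let K' := K ⊔ Ideal.span {x}
    have hxK : ∀ r, x * r ∈ K → r ∈ K := by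
      intro r hr
      have h1 : f (fun _ => x * r) = 0 := (hf _).2 (fun _ => hr)
      have h2 : f (fun _ => r) = 0 := by
        apply hxE
        show x • f (fun _ => r) = x • (0 : E)
        rw [← map_smul, smul_zero]; exact h1
      exact (hf _).1 h2 ⟨0, hl⟩
    have hf' : ∀ u, f' u = 0 ↔ ∀ j, u j ∈ K' := by
      intro u
      show Submodule.Quotient.mk (f u) = 0 ↔ _
      rw [Submodule.Quotient.mk_eq_zero, mem_x]
      constructor
      · rintro ⟨e, he⟩ j
        obtain ⟨v, rfl⟩ := hxQ' e (he ▸ ⟨u, rfl⟩)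
        have := (hf (u - x • v)).1 (by rw [map_sub, map_smul, he, sub_self]) j
        rw [show u j = (u - x • v) j + v j * x by simp [mul_comm]]
        exact Submodule.add_mem_sup this (Ideal.mul_mem_left _ _ (Ideal.mem_span_singleton_self x))
      · intro h
        choose a ha b hb hab using fun j => Submodule.mem_sup.1 (h j)
        choose c hc using fun j => Ideal.mem_span_singleton'.1 (hb j)
        refine ⟨f c, ?_⟩
        have h1 : f a = 0 := (hf a).2 ha
        have h2 : u = a + x • c := by
          ext j
          rw [← hab j, ← hc j]
          simp [mul_comm]
        rw [h2, map_add, h1, map_smul, zero_add]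
    have e : QuotSMulTop x (E ⧸ LinearMap.range f) ≃ₗ[R] (QuotSMulTop x E ⧸ LinearMap.range f') := by
      let g : (E ⧸ LinearMap.range f) →ₗ[R] (QuotSMulTop x E ⧸ LinearMap.range f') :=
        Submodule.mapQ _ _ (Submodule.mkQ _) (by rintro _ ⟨u, rfl⟩; exact ⟨u, rfl⟩)
      have hg : Function.Surjective g := by
        intro y
        obtain ⟨y, rfl⟩ := Submodule.mkQ_surjective _ y
        obtain ⟨y, rfl⟩ := Submodule.mkQ_surjective _ y
        exact ⟨Submodule.mkQ _ y, rfl⟩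
      have hker : x • (⊤ : Submodule R (E ⧸ LinearMap.range f)) = LinearMap.ker g := by
        ext y
        obtain ⟨y, rfl⟩ := Submodule.mkQ_surjective _ y
        rw [Submodule.mem_smul_pointwise_iff_exists, LinearMap.mem_ker]
        constructor
        · rintro ⟨w, -, hw⟩
          rw [← hw, map_smul]
          obtain ⟨w, rfl⟩ := Submodule.mkQ_surjective _ w
          show Submodule.mkQ _ (Submodule.mkQ _ (x • w)) = 0
          have : Submodule.mkQ (x • (⊤ : Submodule R E)) (x • w) = 0 :=
            (Submodule.Quotient.mk_eq_zero _).2 ((mem_x _).2 ⟨w, rfl⟩)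
          rw [this, map_zero]
        · intro h
          have h1 : Submodule.mkQ (x • (⊤ : Submodule R E)) y ∈ LinearMap.range f' :=
            (Submodule.Quotient.mk_eq_zero _).1 h
          obtain ⟨u, hu⟩ := h1
          have h2 : Submodule.mkQ (x • (⊤ : Submodule R E)) (y - f u) = 0 := by
            rw [map_sub, ← hu]; exact sub_self _
          obtain ⟨w, hw⟩ := (mem_x _).1 ((Submodule.Quotient.mk_eq_zero _).1 h2)
          refine ⟨Submodule.mkQ _ w, trivial, ?_⟩
          rw [← map_smul, hw, map_sub]
          rw [(Submodule.Quotient.mk_eq_zero (LinearMap.range f)).2 ⟨u, rfl⟩ |> (fun h => (h : Submodule.mkQ (LinearMap.range f) (f u) = 0)), sub_zero]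
      exact (Submodule.quotEquivOfEq _ _ hker).trans (LinearMap.quotKerEquivOfSurjective g hg)
    have hK' : HtGE K' (i + 1) := by
      refine htGE_succ hK le_sup_left ?_
      intro q hq hle
      have hq' : q ∈ associatedPrimes R (R ⧸ K) := by
        apply Module.associatedPrimes.minimalPrimes_annihilator_subset_associatedPrimes R (R ⧸ K)
        rwa [Ideal.annihilator_quotient]
      refine regular_not_mem_assoc (M := R ⧸ K) (x := x) ?_ hq'
        (hle (Ideal.mem_sup_right (Ideal.mem_span_singleton_self x)))
      refine (isSMulRegular_iff_right_eq_zero_of_smul (M := R ⧸ K) (r := x)).2 ?_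
      intro y
      obtain ⟨y, rfl⟩ := Ideal.Quotient.mk_surjective y
      intro hy
      rw [Ideal.Quotient.eq_zero_iff_mem]
      apply hxK
      rw [← Ideal.Quotient.eq_zero_iff_mem]
      exact hy
    have main := ih (i + 1) (by omega) (QuotSMulTop x E) f' K' hf' ((hQ.quot hxQ).equiv e)
      (hE.quot hxE) hK'
    let Z : Submodule R E :=
      { carrier := {z | ∀ c ∈ K, c • z = 0}
        add_mem' := fun {a b} ha hb r hr => by rw [smul_add, ha r hr, hb r hr, add_zero]
        zero_mem' := fun r _ => smul_zero r
        smul_mem' := fun c m hm r hr => by rw [smul_comm, hm r hr, smul_zero] }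
    have hle : LinearMap.range f ≤ Z := by
      rintro _ ⟨u, rfl⟩ c hc
      rw [← map_smul, hf]
      intro j
      exact K.mul_mem_right _ hc
    have hZ : Z ≤ LinearMap.range f := by
      apply Submodule.le_of_le_smul_of_le_jacobson_bot (I := maximalIdeal R)
        (IsNoetherian.noetherian Z) (IsLocalRing.maximalIdeal_le_jacobson _)
      intro w hw
      obtain ⟨u, hu⟩ := main (Submodule.mkQ _ w) (by
        intro c hc
        obtain ⟨a, ha, b, hb, rfl⟩ := Submodule.mem_sup.1 hc
        obtain ⟨c, rfl⟩ := Ideal.mem_span_singleton'.1 hb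
        rw [← map_smul, add_smul, hw a ha, zero_add, mul_comm, mul_smul]
        exact (Submodule.Quotient.mk_eq_zero _).2 ((mem_x _).2 ⟨_, rfl⟩))
      have h2 : Submodule.mkQ (x • (⊤ : Submodule R E)) (w - f u) = 0 := by
        rw [map_sub, ← hu]; exact sub_self _
      obtain ⟨v, hv⟩ := (mem_x _).1 ((Submodule.Quotient.mk_eq_zero _).1 h2)
      have hvZ : v ∈ Z := by
        intro c hc
        apply hxE
        show x • c • v = x • (0 : E)
        rw [smul_comm, hv, smul_zero]
        exact Z.sub_mem hw (hle ⟨u, rfl⟩) c hc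
      rw [show w = f u + x • v by rw [hv]; abel]
      exact Submodule.add_mem_sup ⟨u, rfl⟩ (Submodule.smul_mem_smul hxm hvZ)
    exact hZ hz
end LemEZ

section Generic
variable {R : Type u} [CommRing R] [IsLocalRing R] [IsNoetherianRing R]

/-- ideal generated by the first `i` elements of a sequence -/
def JJ (a : ℕ → R) (i : ℕ) : Ideal R := Ideal.span (a '' Set.Iio i)

lemma JJ_zero (a : ℕ → R) : JJ a 0 = ⊥ := by simp [JJ]

lemma JJ_succ (a : ℕ → R) (i : ℕ) : JJ a (i + 1) = JJ a i ⊔ Ideal.span {a i} := by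
  rw [JJ, JJ, ← Ideal.span_union]
  congr 1
  ext x
  simp only [Set.mem_image, Set.mem_Iio, Set.mem_union, Set.mem_singleton_iff]
  constructor
  · rintro ⟨j, hj, rfl⟩
    rcases Nat.lt_succ_iff_lt_or_eq.1 hj with h | rfl
    · exact Or.inl ⟨j, h, rfl⟩
    · exact Or.inr rfl
  · rintro (⟨j, hj, rfl⟩ | rfl)
    · exact ⟨j, by omega, rfl⟩
    · exact ⟨i, by omega, rfl⟩

lemma JJ_mono (a : ℕ → R) {i j : ℕ} (h : i ≤ j) : JJ a i ≤ JJ a j :=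
  Ideal.span_mono (Set.image_mono (Set.Iio_subset_Iio h))

lemma mem_JJ (a : ℕ → R) {i j : ℕ} (h : i < j) : a i ∈ JJ a j :=
  Ideal.subset_span ⟨i, h, rfl⟩

lemma JJ_le {a : ℕ → R} {i : ℕ} {I : Ideal R} (h : ∀ j < i, a j ∈ I) : JJ a i ≤ I := by
  rw [JJ, Ideal.span_le]
  rintro _ ⟨j, hj, rfl⟩
  exact h j hj

lemma JJ_congr {a b : ℕ → R} {i : ℕ} (h : ∀ j < i, a j = b j) : JJ a i = JJ b i := by
  rw [JJ, JJ]
  congr 1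
  exact Set.image_congr (fun j hj => h j hj)

/-- saturation -/
def sat (B I : Ideal R) : Ideal R where
  carrier := {x | ∃ N : ℕ, ∀ y ∈ I ^ N, y * x ∈ B}
  add_mem' := by
    rintro a b ⟨N, hN⟩ ⟨M, hM⟩
    refine ⟨N + M, fun y hy => ?_⟩
    rw [mul_add]
    exact B.add_mem (hN y (Ideal.pow_le_pow_right (by omega) hy))
      (hM y (Ideal.pow_le_pow_right (by omega) hy))
  zero_mem' := ⟨0, fun y _ => by simp⟩
  smul_mem' := by
    rintro c x ⟨N, hN⟩
    exact ⟨N, fun y hy => by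
      rw [smul_eq_mul, mul_left_comm]; exact B.mul_mem_left _ (hN y hy)⟩

lemma mem_sat {B I : Ideal R} {x : R} : x ∈ sat B I ↔ ∃ N : ℕ, ∀ y ∈ I ^ N, y * x ∈ B := Iff.rfl

lemma le_sat (B I : Ideal R) : B ≤ sat B I := fun x hx => ⟨0, fun y _ => B.mul_mem_left _ hx⟩

lemma sat_mono {B C : Ideal R} (I : Ideal R) (h : B ≤ C) : sat B I ≤ sat C I :=
  fun x ⟨N, hN⟩ => ⟨N, fun y hy => h (hN y hy)⟩

lemma sat_uniform (B I : Ideal R) : ∃ N : ℕ, ∀ x ∈ sat B I, ∀ y ∈ I ^ N, y * x ∈ B := by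
  obtain ⟨S, hS⟩ := IsNoetherian.noetherian (sat B I)
  have h1 : ∀ x ∈ S, ∃ N : ℕ, ∀ y ∈ I ^ N, y * x ∈ B := fun x hx =>
    mem_sat.1 (hS ▸ Ideal.subset_span hx)
  choose! N hN using h1
  refine ⟨S.sup N, fun x hx y hy => ?_⟩
  rw [← hS] at hx
  refine Submodule.span_induction (p := fun x _ => y * x ∈ B) ?_ (by simp) ?_ ?_ hx
  · intro x hx
    exact hN x hx y (Ideal.pow_le_pow_right (Finset.le_sup hx) hy)
  · intro x z _ _ h1 h2
    rw [mul_add]; exact B.add_mem h1 h2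
  · intro c x _ h
    rw [smul_eq_mul, mul_left_comm]; exact B.mul_mem_left _ h

lemma sat_of_mul {B I : Ideal R} {x : R} (N : ℕ) (h : ∀ y ∈ I ^ N, y * x ∈ sat B I) :
    x ∈ sat B I := by
  obtain ⟨M, hM⟩ := sat_uniform B I
  refine ⟨M + N, fun y hy => ?_⟩
  rw [pow_add] at hy
  refine Submodule.mul_induction_on hy ?_ ?_
  · intro m hm n hn
    rw [mul_assoc]
    exact hM _ (h n hn) m hm
  · intro x y h1 h2
    rw [add_mul]; exact B.add_mem h1 h2

/-- avoidance with infinite residue field -/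
lemma avoid [Infinite (ResidueField R)] (J : Ideal R) (F : Set (Ideal R)) (hF : F.Finite)
    (h : ∀ b ∈ F, ¬ J ≤ b) : ∃ a ∈ J, ∀ b ∈ F, a ∉ b := by
  induction F, hF using Set.Finite.induction_on with
  | empty => exact ⟨0, J.zero_mem, by simp⟩
  | @insert b F hb hF ih =>
    obtain ⟨a, haJ, ha⟩ := ih (fun c hc => h c (Set.mem_insert_of_mem _ hc))
    by_cases hab : a ∈ b
    swap
    · refine ⟨a, haJ, ?_⟩
      rintro c (rfl | hc)
      · exact hab
      · exact ha c hc
    obtain ⟨e, heJ, heb⟩ := Set.not_subset.1 (h b (Set.mem_insert _ _))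
    let bad : Set (ResidueField R) := ⋃ c ∈ F, {α | ∃ x : R, residue R x = α ∧ a + x * e ∈ c}
    have hbad : bad.Finite := by
      refine hF.biUnion fun c hc => Set.Subsingleton.finite ?_
      rintro _ ⟨x, rfl, hx⟩ _ ⟨y, rfl, hy⟩
      by_contra hne
      have hu : IsUnit (x - y) := by
        rw [← IsLocalRing.residue_ne_zero_iff_isUnit, map_sub]
        exact sub_ne_zero.2 hne
      have h1 : (x - y) * e ∈ c := by
        have := c.sub_mem hx hy
        rwa [show a + x * e - (a + y * e) = (x - y) * e by ring] at this
      have h2 : e ∈ c := (Ideal.unit_mul_mem_iff_mem c hu).1 h1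
      exact ha c hc (by
        have := c.sub_mem hx (c.mul_mem_left x h2)
        rwa [add_sub_cancel_right] at this)
    obtain ⟨α, hα⟩ := (hbad.union (Set.finite_singleton 0)).infinite_compl.nonempty
    obtain ⟨x, rfl⟩ := residue_surjective α
    simp only [Set.mem_compl_iff, Set.mem_union, Set.mem_singleton_iff, not_or] at hα
    have hu : IsUnit x := (IsLocalRing.residue_ne_zero_iff_isUnit x).1 hα.2
    refine ⟨a + x * e, J.add_mem haJ (J.mul_mem_left _ heJ), ?_⟩
    rintro c (rfl | hc)
    · intro hmem
      exact heb ((Ideal.unit_mul_mem_iff_mem c hu).1 (by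
        have := c.sub_mem hmem hab
        rwa [add_sub_cancel_left] at this))
    · intro hmem
      exact hα.1 (Set.mem_biUnion hc ⟨x, rfl, hmem⟩)

/-- `I` is locally at `p` generated by `B` and `r` elements -/
def gen (I p B : Ideal R) (r : ℕ) : Prop :=
  ∃ S : Finset R, (∀ s ∈ S, s ∈ I) ∧ S.card ≤ r ∧ ∃ σ ∉ p, ∀ x ∈ I, σ * x ∈ B ⊔ Ideal.span (S : Set R)

lemma gen_mono {I p B C : Ideal R} {r s : ℕ} (h : gen I p B r) (hBC : B ≤ C) (hrs : r ≤ s) :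
    gen I p C s := by
  obtain ⟨S, h1, h2, σ, h3, h4⟩ := h
  exact ⟨S, h1, h2.trans hrs, σ, h3, fun x hx => sup_le_sup_right hBC _ (h4 x hx)⟩

lemma gen_zero {I p B : Ideal R} (h : gen I p B 0) : ∃ σ ∉ p, ∀ x ∈ I, σ * x ∈ B := by
  obtain ⟨S, h1, h2, σ, h3, h4⟩ := h
  obtain rfl : S = ∅ := Finset.card_eq_zero.1 (Nat.le_zero.1 h2)
  exact ⟨σ, h3, fun x hx => by simpa using h4 x hx⟩

/-- Nakayama without localization -/
lemma naka_p {I p B : Ideal R} [hp : p.IsPrime] {σ : R} (hσ : σ ∉ p)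
    (h : ∀ x ∈ I, σ * x ∈ B ⊔ p * I) : ∃ τ ∉ p, ∀ x ∈ I, τ * x ∈ B := by
  let q : I →ₗ[R] (R ⧸ B) := (Submodule.mkQ B) ∘ₗ (Submodule.subtype I)
  let M := LinearMap.range q
  let f : M →ₗ[R] M := σ • LinearMap.id
  have hf : LinearMap.range f ≤ p • ⊤ := by
    rintro _ ⟨⟨_, ⟨x, rfl⟩⟩, rfl⟩
    have hxx := h (x : R) x.2
    obtain ⟨b, hb, y, hy, hby⟩ := Submodule.mem_sup.1 hxx
    have hyI : y ∈ I := (Ideal.mul_le_right : p * I ≤ I) hy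
    have h1 : (⟨y, hyI⟩ : I) ∈ p • (⊤ : Submodule R I) := Submodule.mem_smul_top_iff _ _ _ |>.2 hy
    have h2 : f (q.rangeRestrict x) = q.rangeRestrict ⟨y, hyI⟩ := by
      apply Subtype.ext
      show σ • Submodule.Quotient.mk (x : R) = (Submodule.Quotient.mk y : R ⧸ B)
      rw [← Submodule.Quotient.mk_smul, Submodule.Quotient.eq, smul_eq_mul, ← hby,
        add_sub_cancel_right]
      exact hb
    have h3 : q.rangeRestrict ⟨y, hyI⟩ ∈ Submodule.map q.rangeRestrict (p • (⊤ : Submodule R I)) :=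
      Submodule.mem_map_of_mem h1
    rw [Submodule.map_smul''] at h3
    have h4 : f (q.rangeRestrict x) ∈ p • (⊤ : Submodule R M) := by
      rw [h2]; exact Submodule.smul_mono le_rfl le_top h3
    exact h4
  obtain ⟨P, hP, -, hcoef, hz⟩ :=
    LinearMap.exists_monic_and_natDegree_eq_and_coeff_mem_pow_and_aeval_eq_zero R f p hf
  refine ⟨P.eval σ, ?_, ?_⟩
  · intro hmem
    have : P.eval σ - σ ^ P.natDegree ∈ p := by
      rw [Polynomial.eval_eq_sum_range, Finset.sum_range_succ, hP.coeff_natDegree, one_mul,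
        add_sub_cancel_right]
      refine Ideal.sum_mem _ fun i hi => Ideal.mul_mem_right _ _ ?_
      have hi' := Finset.mem_range.1 hi
      exact Ideal.pow_le_self (by omega) (hcoef i)
    have h2 : σ ^ P.natDegree ∈ p := by
      have := p.sub_mem hmem this
      rwa [sub_sub_cancel] at this
    exact hσ (hp.mem_of_pow_mem _ h2)
  · intro x hx
    have h1 : Polynomial.aeval f P = P.eval σ • LinearMap.id := by
      have : f = algebraMap R (Module.End R M) σ := rfl
      rw [this, Polynomial.aeval_algebraMap_apply]
      rw [Polynomial.coe_aeval_eq_eval]; rfl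
    rw [h1] at hz
    have h2 := congrArg Subtype.val (LinearMap.congr_fun hz ⟨q ⟨x, hx⟩, ⟨_, rfl⟩⟩)
    have h3 : (Submodule.Quotient.mk (P.eval σ • x) : R ⧸ B) = 0 := h2
    exact (Submodule.Quotient.mk_eq_zero _).1 h3

/-- One step in the construction of a generic sequence -/
lemma generic_step {I J B : Ideal R} {l i : ℕ} (hJI : J ≤ I)
    (hP1 : ∀ q : Ideal R, q.IsPrime → J ≤ q → I ≤ q)
    (hP2 : ∀ p : Ideal R, p.IsPrime → I ≤ p → p.height < (l : ℕ∞) → ∃ σ ∉ p, ∀ x ∈ I, σ * x ∈ J)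
    (hinv : ∀ p : Ideal R, p.IsPrime → I ≤ p → ∀ h : ℕ, p.height = h → h < l → gen I p B (h - i)) :
    ∃ F : Set (Ideal R), F.Finite ∧ (∀ b ∈ F, ¬ J ≤ b) ∧ ∀ a ∈ J, (∀ b ∈ F, a ∉ b) →
      (∀ x, a * x ∈ sat B I → x ∈ sat B I) ∧
      (∀ p : Ideal R, p.IsPrime → I ≤ p → ∀ h : ℕ, p.height = h → h < l →
        gen I p (B ⊔ Ideal.span {a}) (h - (i + 1))) := by
  let X : Set (Ideal R) := {p | p.IsPrime ∧ I ≤ p ∧ ∃ h : ℕ, p.height = h ∧ h < l ∧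
    ¬ gen I p B (h - i - 1)}
  let c : ℕ → Ideal R := fun r => I ⊔ Ideal.span {σ | ∃ S : Finset R, (∀ s ∈ S, s ∈ I) ∧
    S.card ≤ r - 1 ∧ ∀ x ∈ I, σ * x ∈ B ⊔ Ideal.span (S : Set R)}
  have hXfin : X.Finite := by
    refine Set.Finite.subset (Set.Finite.biUnion (Set.finite_Iic l)
      (fun r _ => Ideal.finite_minimalPrimes_of_isNoetherianRing R (c r))) ?_
    rintro p ⟨hp, hIp, h, hh, hl, hbad⟩
    refine Set.mem_biUnion (show h - i ∈ Set.Iic l by simp; omega) ?_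
    have hi : i < h := by
      by_contra hcon
      apply hbad
      exact gen_mono (hinv p hp hIp h hh hl) le_rfl (by omega)
    refine ⟨⟨hp, sup_le hIp ?_⟩, ?_⟩
    · rw [Ideal.span_le]
      rintro σ ⟨S, h1, h2, h3⟩
      by_contra hσ
      exact hbad ⟨S, h1, h2, σ, hσ, h3⟩
    · rintro q ⟨hq, hcq⟩ hqp
      by_contra hne
      have hlt : q < p := lt_of_le_not_ge hqp hne
      have hht := height_lt_of_lt hq hp hlt
      rw [hh] at hht
      have hqfin : q.height ≠ ⊤ := by
        intro h; rw [h] at hht; simp at hht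
      obtain ⟨h', hh'⟩ := ENat.ne_top_iff_exists.1 hqfin
      rw [← hh'] at hht
      have hlt' : h' + 1 ≤ h := by exact_mod_cast hht
      obtain ⟨S, h1, h2, σ, h3, h4⟩ := hinv q hq (le_sup_left.trans hcq) h' hh'.symm (by omega)
      exact h3 (hcq (Ideal.mem_sup_right (Ideal.subset_span ⟨S, h1, by omega, h4⟩)))
  classical
  let bp : Ideal R → Ideal R := fun p => if hp : p.IsPrime then
    { carrier := {a | ∃ σ ∉ p, σ * a ∈ B ⊔ p * I}
      add_mem' := by
        rintro a b ⟨σ, h1, h2⟩ ⟨τ, h3, h4⟩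
        refine ⟨σ * τ, hp.mul_notMem h1 h3, ?_⟩
        rw [show σ * τ * (a + b) = τ * (σ * a) + σ * (τ * b) by ring]
        exact Ideal.add_mem _ (Ideal.mul_mem_left _ _ h2) (Ideal.mul_mem_left _ _ h4)
      zero_mem' := ⟨1, (Ideal.ne_top_iff_one _).1 hp.ne_top, by simp⟩
      smul_mem' := by
        rintro c x ⟨σ, h1, h2⟩
        refine ⟨σ, h1, ?_⟩
        rw [smul_eq_mul, mul_left_comm]
        exact Ideal.mul_mem_left _ _ h2 } else ⊥
  have hbp : ∀ p : Ideal R, p.IsPrime → ∀ a, a ∈ bp p ↔ ∃ σ ∉ p, σ * a ∈ B ⊔ p * I := by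
    intro p hp a
    simp only [bp, dif_pos hp]
    rfl
  refine ⟨(bp '' X) ∪ associatedPrimes R (R ⧸ sat B I), (hXfin.image _).union
    (associatedPrimes.finite _ _), ?_, ?_⟩
  · rintro b (⟨p, ⟨hp, hIp, h, hh, hl, hbad⟩, rfl⟩ | hb)
    · intro hJ
      obtain ⟨σ', hσ', h2⟩ := hP2 p hp hIp (by rw [hh]; exact_mod_cast hl)
      have h3 : I ≤ bp p := by
        intro x hx
        obtain ⟨τ, h4, h5⟩ := (hbp p hp _).1 (hJ (h2 x hx))
        exact (hbp p hp _).2 ⟨τ * σ', hp.mul_notMem h4 hσ', by rwa [mul_assoc]⟩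
      obtain ⟨S, hS⟩ := IsNoetherian.noetherian I
      have h4 : ∀ s ∈ S, ∃ σ ∉ p, σ * s ∈ B ⊔ p * I := fun s hs =>
        (hbp p hp _).1 (h3 (hS ▸ Ideal.subset_span hs))
      choose! τ hτ hτ' using h4
      obtain ⟨ρ, hρ, hρ'⟩ := naka_p (hp := hp) (σ := ∏ s ∈ S, τ s) (I := I) (B := B)
        (by
          intro hmem
          obtain ⟨s, hs, h⟩ := (Ideal.IsPrime.prod_mem_iff (hp := hp)).1 hmem
          exact hτ s hs h) (by
          intro x hx
          rw [← hS] at hx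
          refine Submodule.span_induction (p := fun x _ => (∏ s ∈ S, τ s) * x ∈ B ⊔ p * I)
            ?_ (by simp) ?_ ?_ hx
          · intro s hs
            obtain ⟨c, hc⟩ := Finset.dvd_prod_of_mem τ hs
            rw [hc, mul_right_comm]
            exact Ideal.mul_mem_right _ _ (hτ' s hs)
          · intro x z _ _ h1 h2
            rw [mul_add]; exact Ideal.add_mem _ h1 h2
          · intro c x _ h
            rw [smul_eq_mul, mul_left_comm]; exact Ideal.mul_mem_left _ _ h)
      exact hbad ⟨∅, by simp, by simp, ρ, hρ, fun x hx => by simpa using hρ' x hx⟩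
    · intro hJ
      have hp := hb.1
      have hI := hP1 b hp hJ
      obtain ⟨z, hz⟩ := (assoc_iff.1 hb).2
      obtain ⟨z, rfl⟩ := Ideal.Quotient.mk_surjective z
      have hz' : ∀ r, r ∈ b ↔ r * z ∈ sat B I := fun r => by
        rw [hz, ← Ideal.Quotient.eq_zero_iff_mem]; rfl
      have h1 : z ∈ sat B I := sat_of_mul 1 (fun y hy => (hz' y).1 (hI (by simpa using hy)))
      exact hp.ne_top ((Ideal.eq_top_iff_one _).2 ((hz' 1).2 (by simpa using h1)))
  · intro a haJ ha
    constructor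
    · intro x hx
      by_contra hcon
      obtain ⟨q, hq, hq2⟩ := exists_assoc (R := R) (Ideal.Quotient.mk (sat B I) x) (by
        rwa [Ne, Ideal.Quotient.eq_zero_iff_mem])
      refine ha q (Or.inr hq) (hq2 a ?_)
      exact (Ideal.Quotient.eq_zero_iff_mem (I := sat B I)).2 hx
    · intro p hp hIp h hh hl
      by_cases hg : gen I p B (h - i - 1)
      · exact gen_mono hg le_sup_left (by omega)
      have hab : a ∉ bp p := ha _ (Or.inl ⟨p, ⟨hp, hIp, h, hh, hl, hg⟩, rfl⟩)
      rw [hbp p hp] at hab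
      push Not at hab
      obtain ⟨S, h1, h2, σ, h3, h4⟩ := hinv p hp hIp h hh hl
      obtain ⟨b, hb, y, hy, hby⟩ := Submodule.mem_sup.1 (h4 a (hJI haJ))
      obtain ⟨f, hf, hf2⟩ := Submodule.mem_span_finset.1 hy
      have hex : ∃ s ∈ S, f s ∉ p := by
        by_contra hcon
        push Not at hcon
        refine hab σ h3 ?_
        rw [← hby, ← hf2]
        refine Submodule.add_mem_sup hb (Ideal.sum_mem _ fun s hs => ?_)
        exact Ideal.mul_mem_mul (hcon s hs) (h1 s hs)
      obtain ⟨s, hs, hfs⟩ := hex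
      classical
      have hcard := Finset.card_erase_of_mem hs
      have hle : Ideal.span ((S.erase s : Finset R) : Set R) ≤
          B ⊔ Ideal.span {a} ⊔ Ideal.span ((S.erase s : Finset R) : Set R) := le_sup_right
      have hsm : f s * s ∈ B ⊔ Ideal.span {a} ⊔ Ideal.span ((S.erase s : Finset R) : Set R) := by
        have h5 : f s * s = σ * a - b - ∑ s' ∈ S.erase s, f s' * s' := by
          rw [← hby, ← hf2, ← Finset.add_sum_erase _ _ hs]
          simp only [smul_eq_mul]; ring
        rw [h5]
        refine Ideal.sub_mem _ (Ideal.sub_mem _ ?_ ?_) ?_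
        · exact Ideal.mem_sup_left (Ideal.mem_sup_right (Ideal.mul_mem_left _ _ (Ideal.mem_span_singleton_self a)))
        · exact Ideal.mem_sup_left (Ideal.mem_sup_left hb)
        · exact Ideal.sum_mem _ fun s' hs' => Ideal.mul_mem_left _ _ (hle (Ideal.subset_span hs'))
      refine ⟨S.erase s, fun s' hs' => h1 s' (Finset.mem_of_mem_erase hs'), by omega, f s * σ,
        hp.mul_notMem hfs h3, fun x hx => ?_⟩
      have h6 : B ⊔ Ideal.span (S : Set R) ≤ Submodule.colon (B ⊔ Ideal.span {a} ⊔ Ideal.span ((S.erase s : Finset R) : Set R)) {f s} := by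
        refine sup_le ?_ (Ideal.span_le.2 ?_)
        · intro z hz
          rw [Submodule.mem_colon_singleton]
          exact Ideal.mul_mem_right _ _ (Ideal.mem_sup_left (Ideal.mem_sup_left hz))
        · intro z hz
          rw [SetLike.mem_coe, Submodule.mem_colon_singleton]
          by_cases hzs : z = s
          · rw [hzs, smul_eq_mul, mul_comm]; exact hsm
          · exact Ideal.mul_mem_right _ _ (hle (Ideal.subset_span (Finset.mem_erase.2 ⟨hzs, hz⟩)))
      have := h6 (h4 x hx)
      rw [Submodule.mem_colon_singleton] at this
      rw [mul_assoc, mul_comm]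
      exact this

/-- good sequences -/
structure GoodSeq (I : Ideal R) (a : ℕ → R) (m : ℕ) : Prop where
  mem : ∀ i < m, a i ∈ I
  reg : ∀ i < m, ∀ x, a i * x ∈ sat (JJ a i) I → x ∈ sat (JJ a i) I
  g2 : ∀ i ≤ m, ∀ p : Ideal R, p.IsPrime → I ≤ p → p.height ≤ (i : ℕ∞) →
    ∃ σ ∉ p, ∀ x ∈ I, σ * x ∈ JJ a i

lemma exists_good [Infinite (ResidueField R)] {I J : Ideal R} {l : ℕ} (hJI : J ≤ I)
    (hP1 : ∀ q : Ideal R, q.IsPrime → J ≤ q → I ≤ q)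
    (hP2 : ∀ p : Ideal R, p.IsPrime → I ≤ p → p.height < (l : ℕ∞) → ∃ σ ∉ p, ∀ x ∈ I, σ * x ∈ J)
    (hP3 : ∀ p : Ideal R, p.IsPrime → I ≤ p → ∀ h : ℕ, p.height = h → h < l → gen I p ⊥ h)
    (Q : ℕ → Ideal R → Prop) (hQ0 : Q 0 ⊥)
    (hQ : ∀ i B, i + 1 < l → B ≤ J → Q i B → ∃ F : Set (Ideal R), F.Finite ∧ (∀ b ∈ F, ¬ J ≤ b) ∧
      ∀ a ∈ J, (∀ b ∈ F, a ∉ b) → Q (i + 1) (B ⊔ Ideal.span {a})) (m : ℕ) (hm : m < l) :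
    ∃ a : ℕ → R, GoodSeq I a m ∧ (∀ i < m, a i ∈ J) ∧ Q m (JJ a m) := by
  suffices h : ∃ a : ℕ → R, GoodSeq I a m ∧ (∀ i < m, a i ∈ J) ∧ Q m (JJ a m) ∧
      ∀ p : Ideal R, p.IsPrime → I ≤ p → ∀ h : ℕ, p.height = h → h < l → gen I p (JJ a m) (h - m) by
    obtain ⟨a, h1, h2, h3, -⟩ := h
    exact ⟨a, h1, h2, h3⟩
  induction m with
  | zero =>
    have h3 : ∀ p : Ideal R, p.IsPrime → I ≤ p → ∀ h : ℕ, p.height = h → h < l →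
        gen I p (JJ (fun _ : ℕ => (0 : R)) 0) (h - 0) := by
      intro p hp hIp h hh hl
      rw [JJ_zero]
      exact hP3 p hp hIp h hh hl
    refine ⟨fun _ => 0, ⟨by simp, by simp, ?_⟩, by simp, by rwa [JJ_zero], h3⟩
    intro i hi p hp hIp hht
    obtain rfl : i = 0 := by omega
    exact gen_zero (h3 p hp hIp 0 (le_antisymm (by simpa using hht) bot_le) hm)
  | succ m ih =>
    obtain ⟨a, hg, haJ, hQm, hinv⟩ := ih (by omega)
    obtain ⟨F, hF, hF2, hF3⟩ := generic_step hJI hP1 hP2 hinv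
    obtain ⟨F', hF', hF2', hF3'⟩ := hQ m _ hm (JJ_le haJ) hQm
    obtain ⟨e, heJ, he⟩ := avoid J (F ∪ F') (hF.union hF') (by
      rintro b (hb | hb)
      · exact hF2 b hb
      · exact hF2' b hb)
    obtain ⟨h1, h2⟩ := hF3 e heJ (fun b hb => he b (Or.inl hb))
    have h3 := hF3' e heJ (fun b hb => he b (Or.inr hb))
    let a' := Function.update a m e
    have ha' : ∀ j < m, a' j = a j := fun j hj => Function.update_of_ne (by omega) _ _
    have hm' : a' m = e := Function.update_self _ _ _
    have hJJ : ∀ i ≤ m, JJ a' i = JJ a i := fun i hi => JJ_congr (fun j hj => ha' j (by omega))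
    have hJm : JJ a' (m + 1) = JJ a m ⊔ Ideal.span {e} := by
      rw [JJ_succ, hJJ m le_rfl, hm']
    have hmemJ : ∀ i < m + 1, a' i ∈ J := by
      intro i hi
      rcases Nat.lt_succ_iff_lt_or_eq.1 hi with h | rfl
      · rw [ha' i h]; exact haJ i h
      · rw [hm']; exact heJ
    refine ⟨a', ⟨fun i hi => hJI (hmemJ i hi), ?_, ?_⟩, hmemJ, by rwa [hJm], by rwa [hJm]⟩
    · intro i hi x hx
      rcases Nat.lt_succ_iff_lt_or_eq.1 hi with h | rfl
      · rw [hJJ i (by omega)] at hx ⊢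
        rw [ha' i h] at hx
        exact hg.reg i h x hx
      · rw [hJJ i (by omega)] at hx ⊢
        rw [hm'] at hx
        exact h1 x hx
    · intro i hi p hp hIp hht
      rcases Nat.le_succ_iff.1 hi with h | rfl
      · rw [hJJ i h]; exact hg.g2 i h p hp hIp hht
      · rw [Nat.succ_eq_add_one, hJm]
        have hfin : p.height ≠ ⊤ := by
          intro h; rw [h] at hht; simp at hht
        obtain ⟨h', hh'⟩ := ENat.ne_top_iff_exists.1 hfin
        rw [← hh'] at hht
        have hle : h' ≤ m + 1 := by exact_mod_cast hht
        exact gen_zero (gen_mono (h2 p hp hIp h' hh'.symm (by omega)) le_rfl (by omega))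
end Generic

section Ladder
variable {R : Type u} [CommRing R] [IsLocalRing R] [IsNoetherianRing R]

/-- the subquotient `B / (A ∩ B)` -/
abbrev QQ (B A : Ideal R) : Type u := ↥B ⧸ Submodule.comap B.subtype A

lemma QQ_mk_eq_zero {A B : Ideal R} (x : B) :
    (Submodule.Quotient.mk x : QQ B A) = 0 ↔ (x : R) ∈ A := Submodule.Quotient.mk_eq_zero _

lemma ses_mul {A B A' C D : Ideal R} (c : R) (hAC : A' ≤ C) (hBC : ∀ x ∈ B, c * x ∈ C)
    (hD : ∀ x ∈ C, x ∈ D ↔ ∃ y ∈ B, x - c * y ∈ A')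
    (hA : ∀ x ∈ B, c * x ∈ A' ↔ x ∈ A) :
    ∃ (f : QQ B A →ₗ[R] QQ C A') (g : QQ C A' →ₗ[R] QQ C D),
      Function.Injective f ∧ Function.Surjective g ∧ Function.Exact f g := by
  let f0 : B →ₗ[R] C := LinearMap.codRestrict C (c • B.subtype) (fun x => hBC x x.2)
  let f : QQ B A →ₗ[R] QQ C A' := Submodule.mapQ _ _ f0 (fun x hx => (hA x x.2).2 hx)
  have hle : Submodule.comap C.subtype A' ≤ Submodule.comap C.subtype D := fun x hx =>
    (hD x x.2).2 ⟨0, B.zero_mem, by simpa using hx⟩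
  let g : QQ C A' →ₗ[R] QQ C D := Submodule.factor hle
  refine ⟨f, g, ?_, Submodule.factor_surjective hle, ?_⟩
  · rw [injective_iff_map_eq_zero]
    intro x
    obtain ⟨x, rfl⟩ := Submodule.Quotient.mk_surjective _ x
    intro h
    have h' : (Submodule.Quotient.mk (f0 x) : QQ C A') = 0 := h
    rw [QQ_mk_eq_zero] at h' ⊢
    exact (hA x x.2).1 h'
  · intro x
    obtain ⟨x, rfl⟩ := Submodule.Quotient.mk_surjective _ x
    have h1 : g (Submodule.Quotient.mk x) = 0 ↔ (x : R) ∈ D := QQ_mk_eq_zero x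
    rw [h1, hD x x.2]
    constructor
    · rintro ⟨y, hy, h⟩
      refine ⟨Submodule.Quotient.mk ⟨y, hy⟩, ?_⟩
      have : (Submodule.Quotient.mk (f0 ⟨y, hy⟩) : QQ C A') = Submodule.Quotient.mk x := by
        rw [eq_comm, Submodule.Quotient.eq]; exact h
      exact this
    · rintro ⟨y, hy⟩
      obtain ⟨y, rfl⟩ := Submodule.Quotient.mk_surjective _ y
      have h2 : (Submodule.Quotient.mk (f0 y) : QQ C A') = Submodule.Quotient.mk x := hy
      rw [eq_comm, Submodule.Quotient.eq] at h2
      exact ⟨y, y.2, h2⟩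

/-- `QQ B ⊥ ≃ B` and so on -/
lemma QQ_bot (B A : Ideal R) (h : A = ⊥) : Nonempty (B ≃ₗ[R] QQ B A) := by
  subst h
  refine ⟨(Submodule.quotEquivOfEqBot _ ?_).symm⟩
  rw [eq_bot_iff]
  rintro x hx
  exact Subtype.ext hx

lemma QQ_top (B A : Ideal R) (h : B = ⊤) : Nonempty ((R ⧸ A) ≃ₗ[R] QQ B A) := by
  subst h
  exact ⟨(Submodule.Quotient.equiv _ _ Submodule.topEquiv (by
    ext x
    simp only [Submodule.mem_map, Submodule.mem_comap]
    constructor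
    · rintro ⟨y, hy, rfl⟩; exact hy
    · intro hx; exact ⟨⟨x, trivial⟩, hx, rfl⟩)).symm⟩

lemma endo_of_rel {A B C : Ideal R} (hE : ∀ f : QQ B A →ₗ[R] QQ B A, ∃ r : R, ∀ m, f m = r • m)
    (x b : R) (h1 : ∀ m ∈ B, ∃ m' ∈ B, x * m - b * m' ∈ C) (h2 : ∀ m ∈ B, b * m ∈ C → m ∈ A)
    (h3 : ∀ m ∈ A, x * m ∈ C) :
    ∃ r : R, ∀ m ∈ B, ∀ m' ∈ B, x * m - b * m' ∈ C → m' - r * m ∈ A := by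
  choose! φ hφ hφ2 using h1
  let f0 : B →ₗ[R] QQ B A :=
    { toFun := fun m => Submodule.Quotient.mk ⟨φ m, hφ m m.2⟩
      map_add' := fun m n => by
        rw [← Submodule.Quotient.mk_add, Submodule.Quotient.eq]
        refine h2 _ (Submodule.sub_mem _ (hφ _ (B.add_mem m.2 n.2)) (B.add_mem (hφ m m.2) (hφ n n.2))) ?_
        have := C.sub_mem (C.add_mem (hφ2 m m.2) (hφ2 n n.2)) (hφ2 (m + n) (B.add_mem m.2 n.2))
        show b * (φ (m + n) - (φ m + φ n)) ∈ C
        convert this using 1; ring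
      map_smul' := fun c m => by
        rw [RingHom.id_apply, ← Submodule.Quotient.mk_smul, Submodule.Quotient.eq]
        refine h2 _ (Submodule.sub_mem _ (hφ _ (B.mul_mem_left c m.2)) (B.mul_mem_left c (hφ m m.2))) ?_
        have := C.sub_mem (C.mul_mem_left c (hφ2 m m.2)) (hφ2 (c * m) (B.mul_mem_left c m.2))
        show b * (φ (c * m) - c * φ m) ∈ C
        convert this using 1; ring }
  let f : QQ B A →ₗ[R] QQ B A := Submodule.liftQ _ f0 (fun m hm => by
    have : (Submodule.Quotient.mk ⟨φ m, hφ m m.2⟩ : QQ B A) = 0 := by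
      rw [QQ_mk_eq_zero]
      refine h2 _ (hφ m m.2) ?_
      have := C.sub_mem (h3 m hm) (hφ2 m m.2)
      rwa [sub_sub_cancel] at this
    exact this)
  obtain ⟨r, hr⟩ := hE f
  refine ⟨r, fun m hm m' hm' hmm => ?_⟩
  have h4 : (Submodule.Quotient.mk ⟨φ m, hφ m hm⟩ : QQ B A) = r • Submodule.Quotient.mk ⟨m, hm⟩ :=
    hr (Submodule.Quotient.mk ⟨m, hm⟩)
  rw [← Submodule.Quotient.mk_smul, Submodule.Quotient.eq] at h4
  have h5 : φ m - r * m ∈ A := h4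
  have h6 : m' - φ m ∈ A := by
    refine h2 _ (B.sub_mem hm' (hφ m hm)) ?_
    have := C.sub_mem (hφ2 m hm) hmm
    convert this using 1; ring
  have := A.add_mem h5 h6
  convert this using 1; ring

/-- standing hypotheses -/
structure Ctx (I : Ideal R) (g l d : ℕ) : Prop where
  hd : ∀ p : Ideal R, p.IsPrime → p.height ≤ (d : ℕ∞)
  hIg : HtGE I g
  hR : Ty R d R 1
  hDep : ∀ j s : ℕ, 1 ≤ j → j ≤ l - g + 1 → s + j ≤ d - g + 1 → Dep R s (R ⧸ I ^ j)
  hgl : g ≤ l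
  hld : l ≤ d
  hl1 : 1 ≤ l
  hIm : I ≤ maximalIdeal R
  hG : ∀ p : Ideal R, p.IsPrime → I ≤ p → ∀ h : ℕ, p.height = h → h < l → gen I p ⊥ h

/-- subquotients in the ladder -/
abbrev NN (I : Ideal R) (a : ℕ → R) (i f : ℕ) : Type u := QQ (I ^ f) (JJ a i * I ^ (f - 1))

/-- intersection property -/
def VV (I : Ideal R) (a : ℕ → R) (i f : ℕ) : Prop :=
  ∀ x ∈ sat (JJ a i) I, x ∈ I ^ f → x ∈ JJ a i * I ^ (f - 1)

variable {I : Ideal R} {g l d : ℕ} {a : ℕ → R}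

lemma ladder_ses {m : ℕ} (ha : GoodSeq I a m) {i f : ℕ} (hi : i < m) (hV : VV I a i f) :
    ∃ (φ : NN I a i f →ₗ[R] NN I a i (f + 1)) (ψ : NN I a i (f + 1) →ₗ[R] NN I a (i + 1) (f + 1)),
      Function.Injective φ ∧ Function.Surjective ψ ∧ Function.Exact φ ψ := by
  have haI := ha.mem i hi
  refine ses_mul (a i) ?_ ?_ ?_ ?_
  · rw [Nat.add_sub_cancel, pow_succ']
    exact Ideal.mul_mono_left (JJ_le (fun j hj => ha.mem j (by omega)))
  · intro x hx
    rw [pow_succ']; exact Ideal.mul_mem_mul haI hx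
  · intro x hx
    rw [Nat.add_sub_cancel, JJ_succ, Ideal.sup_mul, Submodule.mem_sup]
    constructor
    · rintro ⟨y, hy, z, hz, rfl⟩
      obtain ⟨w, hw, rfl⟩ := Ideal.mem_span_singleton_mul.1 hz
      exact ⟨w, hw, by rwa [add_sub_cancel_right]⟩
    · rintro ⟨w, hw, h⟩
      exact ⟨_, h, a i * w, Ideal.mem_span_singleton_mul.2 ⟨w, hw, rfl⟩, by ring⟩
  · intro x hx
    rw [Nat.add_sub_cancel]
    constructor
    · intro h
      exact hV x (ha.reg i hi x (le_sat _ _ (Ideal.mul_le_left h))) hx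
    · intro h
      rcases f with _ | f
      · simp only [pow_zero, mul_one, Ideal.one_eq_top, Ideal.mul_top, Nat.zero_sub] at h ⊢
        exact Ideal.mul_mem_left _ _ h
      · rw [Nat.add_sub_cancel] at h
        rw [pow_succ', mul_left_comm]
        exact Ideal.mul_mem_mul haI h
end Ladder

section Ladder2
variable {R : Type u} [CommRing R] [IsLocalRing R] [IsNoetherianRing R]
variable {I : Ideal R} {g l d : ℕ} {a : ℕ → R}

lemma V_of_dep (C : Ctx I g l d) {m : ℕ} (ha : GoodSeq I a m) {i f : ℕ} (hi : i ≤ m) (hid : i ≤ d)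
    (hf : 1 ≤ f) (hD : Dep R (d - i) (NN I a i f)) : VV I a i f := by
  intro x hx hxf
  by_contra hcon
  obtain ⟨q, hq, hq2⟩ := exists_assoc (R := R)
    (Submodule.Quotient.mk ⟨x, hxf⟩ : NN I a i f) (by rwa [Ne, QQ_mk_eq_zero])
  have hq3 : ∀ r, r * x ∈ JJ a i * I ^ (f - 1) → r ∈ q := by
    intro r hr
    apply hq2
    rw [← Submodule.Quotient.mk_smul, QQ_mk_eq_zero]
    exact hr
  have hqp := hq.1
  have hht := isch C.hd _ _ hD q hq
  have hfin : q.height ≠ ⊤ := by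
    intro h; rw [h] at hht; simp at hht
  obtain ⟨h', hh'⟩ := ENat.ne_top_iff_exists.1 hfin
  rw [← hh'] at hht
  have hle : h' + (d - i) ≤ d := by exact_mod_cast hht
  obtain ⟨N, hN⟩ := hx
  have hIq : I ≤ q := by
    have : I ^ (N + (f - 1)) ≤ q := by
      intro y hy
      apply hq3
      rw [pow_add] at hy
      refine Submodule.mul_induction_on hy ?_ ?_
      · intro y hy z hz
        rw [mul_right_comm]
        exact Ideal.mul_mem_mul (hN y hy) hz
      · intro y z h1 h2
        rw [add_mul]; exact Ideal.add_mem _ h1 h2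
    exact hqp.le_of_pow_le this
  obtain ⟨σ, hσ, hσ2⟩ := ha.g2 i hi q hqp hIq (by rw [← hh']; exact_mod_cast (by omega : h' ≤ i))
  apply hσ
  apply hq3
  obtain ⟨f, rfl⟩ : ∃ f', f = f' + 1 := ⟨f - 1, by omega⟩
  rw [Nat.add_sub_cancel]
  rw [pow_succ'] at hxf
  refine Submodule.mul_induction_on hxf ?_ ?_
  · intro y hy z hz
    rw [← mul_assoc]
    exact Ideal.mul_mem_mul (hσ2 y hy) hz
  · intro y z h1 h2
    rw [mul_add]; exact Ideal.add_mem _ h1 h2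

lemma V_descend {m : ℕ} (ha : GoodSeq I a m) {i f : ℕ} (hi : i < m) (h1 : VV I a (i + 1) (f + 1))
    (h2 : VV I a i f) : VV I a i (f + 1) := by
  intro x hx hxf
  have h3 := h1 x (sat_mono I (JJ_mono a (Nat.le_succ i)) hx) hxf
  rw [Nat.add_sub_cancel] at h3 ⊢
  rw [JJ_succ, Ideal.sup_mul, Submodule.mem_sup] at h3
  obtain ⟨z, hz, y, hy, rfl⟩ := h3
  obtain ⟨w, hw, rfl⟩ := Ideal.mem_span_singleton_mul.1 hy
  refine Ideal.add_mem _ hz ?_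
  have h4 : w ∈ sat (JJ a i) I := ha.reg i hi w (by
    have := Ideal.sub_mem _ hx (le_sat _ _ (Ideal.mul_le_left hz) : z ∈ sat (JJ a i) I)
    rwa [add_sub_cancel_left] at this)
  have h5 := h2 w h4 hw
  rcases f with _ | f
  · simp only [pow_zero, Ideal.one_eq_top, Ideal.mul_top, Nat.zero_sub] at h5 ⊢
    exact Ideal.mul_mem_left _ _ h5
  · rw [Nat.add_sub_cancel] at h5
    rw [pow_succ', mul_left_comm]
    exact Ideal.mul_mem_mul (ha.mem i hi) h5

lemma stage_zero (C : Ctx I g l d) (ha : GoodSeq I a (l - 1)) :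
    ∀ i, i + 1 ≤ g → Ty R (d - i) (NN I a i 0) 1 ∧ VV I a i 0 := by
  have key : ∀ i, i + 1 ≤ g → Ty R (d - i) (NN I a i 0) 1 → VV I a i 0 := by
    intro i hi hT x hx _
    by_contra hcon
    obtain ⟨q, hq, hq2⟩ := exists_assoc (R := R)
      (Submodule.Quotient.mk ⟨x, by simp⟩ : NN I a i 0) (by rwa [Ne, QQ_mk_eq_zero])
    have hq3 : ∀ r, r * x ∈ JJ a i * I ^ (0 - 1) → r ∈ q := by
      intro r hr
      apply hq2
      rw [← Submodule.Quotient.mk_smul, QQ_mk_eq_zero]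
      exact hr
    have hht := isch C.hd _ _ hT.1 q hq
    obtain ⟨N, hN⟩ := hx
    have hIq : I ≤ q := by
      have : I ^ N ≤ q := by
        intro y hy
        apply hq3
        simpa using hN y hy
      exact hq.1.le_of_pow_le this
    have hgq := C.hIg q hq.1 hIq
    have h1 : ((g + (d - i) : ℕ) : ℕ∞) ≤ d := by
      push_cast
      exact (add_le_add_left hgq _).trans hht
    have h2 : g + (d - i) ≤ d := by exact_mod_cast h1
    have := C.hgl
    have := C.hld
    omega
  have hgl := C.hgl
  have hld := C.hld
  intro i hi
  induction i with
  | zero =>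
    have hT : Ty R (d - 0) (NN I a 0 0) 1 := by
      obtain ⟨e⟩ := QQ_bot (I ^ 0) (JJ a 0 * I ^ (0 - 1)) (by rw [JJ_zero]; simp)
      refine Ty.equiv (A := ↥(I ^ 0)) ?_ e
      refine Ty.equiv (A := R) C.hR ?_
      exact ((LinearEquiv.ofEq _ _ (by simp)).trans Submodule.topEquiv).symm
    exact ⟨hT, key 0 hi hT⟩
  | succ i ih =>
    obtain ⟨hT, hV⟩ := ih (by omega)
    have hT' : Ty R (d - (i + 1)) (NN I a (i + 1) 0) 1 := by
      obtain ⟨φ, ψ, h1, h2, h3⟩ := ses_mul (R := R) (A := JJ a i * I ^ (0 - 1)) (B := I ^ 0)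
        (A' := JJ a i * I ^ (0 - 1)) (C := I ^ 0) (D := JJ a (i + 1) * I ^ (0 - 1)) (a i)
        (by simp) (by simp) (by
          intro x hx
          simp only [Nat.zero_sub, pow_zero, Ideal.one_eq_top, Ideal.mul_top, Submodule.mem_top,
            true_and]
          rw [JJ_succ, Submodule.mem_sup]
          constructor
          · rintro ⟨y, hy, z, hz, rfl⟩
            obtain ⟨w, rfl⟩ := Ideal.mem_span_singleton'.1 hz
            exact ⟨w, by rwa [mul_comm, add_sub_cancel_right]⟩
          · rintro ⟨w, h⟩
            exact ⟨_, h, a i * w, Ideal.mem_span_singleton'.2 ⟨w, mul_comm _ _⟩, by ring⟩) (by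
          intro x hx
          constructor
          · intro h
            exact hV x (ha.reg i (by omega) x (le_sat _ _ (Ideal.mul_le_left h))) hx
          · intro h
            exact Ideal.mul_mem_left _ _ h)
      have e : d - i = d - (i + 1) + 1 := by omega
      rw [e] at hT
      exact ty_right φ ψ h1 h2 h3 hT hT.1
    exact ⟨hT', key _ hi hT'⟩

lemma dep_pow (C : Ctx I g l d) (f : ℕ) (hf : f ≤ l - g + 1) (s : ℕ) (hs : s ≤ d)
    (hs2 : s + g + f ≤ d + 2) (hfg : 1 ≤ f + g) : Dep R s ↥(I ^ f) := by
  rcases f with _ | f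
  · refine Dep.equiv (A := R) (C.hR.1.mono hs) ?_
    exact ((LinearEquiv.ofEq _ _ (by simp)).trans Submodule.topEquiv).symm
  rcases s with _ | s
  · exact Dep.zero
  exact dep_left (I ^ (f + 1)).subtype (I ^ (f + 1)).mkQ (Submodule.subtype_injective _)
    (Submodule.mkQ_surjective _) (LinearMap.exact_subtype_mkQ _) (C.hR.1.mono hs)
    (C.hDep _ _ (by omega) hf (by omega))

lemma ladder (C : Ctx I g l d) (ha : GoodSeq I a (l - 1)) (f : ℕ) (hf : f ≤ l - g + 1) :
    (∀ i, i + 1 ≤ l → i + 1 ≤ f + g → (∀ s, s ≤ d - i → s + g + f ≤ d + 2 → Dep R s (NN I a i f)) ∧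
      VV I a i f) ∧ (∀ i, i + 1 ≤ l → i + 1 = f + g → Ty R (d - i) (NN I a i f) 1) := by
  have hgl := C.hgl
  have hld := C.hld
  have hl1 := C.hl1
  induction f with
  | zero =>
    have h0 := stage_zero C ha
    refine ⟨fun i _ hi => ⟨fun s hs _ => (h0 i (by omega)).1.1.mono hs, (h0 i (by omega)).2⟩, ?_⟩
    intro i _ hi
    exact (h0 i (by omega)).1
  | succ f ih =>
    obtain ⟨ih1, ih2⟩ := ih (by omega)
    have hD : ∀ i, i + 1 ≤ l → i + 1 ≤ f + 1 + g →
        ∀ s, s ≤ d - i → s + g + (f + 1) ≤ d + 2 → Dep R s (NN I a i (f + 1)) := by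
      intro i
      induction i with
      | zero =>
        intro _ h2 s hs hs2
        obtain ⟨e⟩ := QQ_bot (I ^ (f + 1)) (JJ a 0 * I ^ (f + 1 - 1)) (by rw [JJ_zero]; simp)
        exact (dep_pow C (f + 1) hf s (by omega) hs2 (by omega)).equiv e
      | succ i ih =>
        intro h1 h2 s hs hs2
        obtain ⟨h3, h4⟩ := ih1 i (by omega) (by omega)
        obtain ⟨φ, ψ, k1, k2, k3⟩ := ladder_ses ha (by omega) h4
        exact dep_right φ ψ k1 k2 k3 (h3 (s + 1) (by omega) (by omega))
          (ih (by omega) (by omega) s (by omega) hs2)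
    have hV : ∀ j i, i + j = l → i + 1 ≤ l → i + 1 ≤ f + 1 + g → VV I a i (f + 1) := by
      intro j
      induction j with
      | zero => intro i h1 h2; omega
      | succ j ihj =>
        intro i h1 h2 h3
        by_cases hc : f + g ≤ i + 1
        · exact V_of_dep C ha (by omega) (by omega) (by omega) (hD i h2 h3 _ le_rfl (by omega))
        · exact V_descend ha (by omega) (ihj (i + 1) (by omega) (by omega) (by omega))
            (ih1 i h2 (by omega)).2
    refine ⟨fun i h1 h2 => ⟨hD i h1 h2, hV (l - i) i (by omega) h1 h2⟩, ?_⟩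
    intro i h1 h2
    rcases i with _ | i
    · obtain ⟨rfl, rfl⟩ : f = 0 ∧ g = 0 := by omega
      obtain ⟨e⟩ := QQ_bot (I ^ (0 + 1)) (JJ a 0 * I ^ (0 + 1 - 1)) (by rw [JJ_zero]; simp)
      refine Ty.equiv ?_ e
      exact ty_left (I ^ (0 + 1)).subtype (I ^ (0 + 1)).mkQ (Submodule.subtype_injective _)
        (Submodule.mkQ_surjective _) (LinearMap.exact_subtype_mkQ _) C.hR
        (C.hDep _ _ (by omega) hf (by omega))
    · obtain ⟨h3, h4⟩ := ih1 i (by omega) (by omega)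
      obtain ⟨φ, ψ, k1, k2, k3⟩ := ladder_ses ha (by omega) h4
      have hT := ih2 i (by omega) (by omega)
      have e : d - i = d - (i + 1) + 1 := by omega
      rw [e] at hT
      exact ty_right φ ψ k1 k2 k3 hT (hD i (by omega) (by omega) _ (by omega) (by omega))

lemma ht_of_not_le {B : Ideal R} {b : R} {j : ℕ} (hreg : ∀ x, b * x ∈ sat B I → x ∈ sat B I)
    (h : ∀ q : Ideal R, q.IsPrime → ¬ I ≤ q → B ≤ q → (j : ℕ∞) ≤ q.height) (p : Ideal R)
    (hp : p.IsPrime) (hIp : ¬ I ≤ p) (hB : B ≤ p) (hb : b ∈ p) : ((j + 1 : ℕ) : ℕ∞) ≤ p.height := by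
  have hsat : ∀ p : Ideal R, p.IsPrime → ¬ I ≤ p → B ≤ p → sat B I ≤ p := by
    rintro p hp hIp hB x ⟨N, hN⟩
    by_contra hx
    refine hIp (hp.le_of_pow_le (n := N) fun y hy => ?_)
    exact (hp.mem_or_mem (hB (hN y hy))).resolve_right hx
  obtain ⟨q, hq, hqp⟩ := Ideal.exists_minimalPrimes_le (hsat p hp hIp hB)
  have hqass : q ∈ associatedPrimes R (R ⧸ sat B I) := by
    apply Module.associatedPrimes.minimalPrimes_annihilator_subset_associatedPrimes R (R ⧸ sat B I)
    rwa [Ideal.annihilator_quotient]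
  have hreg' : IsSMulRegular (R ⧸ sat B I) b := by
    refine (isSMulRegular_iff_right_eq_zero_of_smul (M := R ⧸ sat B I) (r := b)).2 ?_
    intro y
    obtain ⟨y, rfl⟩ := Ideal.Quotient.mk_surjective y
    intro hy
    rw [Ideal.Quotient.eq_zero_iff_mem]
    apply hreg
    rw [← Ideal.Quotient.eq_zero_iff_mem]
    exact hy
  have hbq := regular_not_mem_assoc hreg' hqass
  have hlt : q < p := lt_of_le_not_ge hqp (fun h => hbq (h hb))
  have h1 := height_lt_of_lt hq.1.1 hp hlt
  have h2 := h q hq.1.1 (fun hI => hIp (hI.trans hqp)) ((le_sat _ _).trans hq.1.2)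
  push_cast
  exact (add_le_add_left h2 1).trans h1

lemma ht_J {m : ℕ} (ha : GoodSeq I a m) (i : ℕ) (hi : i ≤ m) (p : Ideal R)
    (hp : p.IsPrime) (hIp : ¬ I ≤ p) (hB : JJ a i ≤ p) : ((i : ℕ) : ℕ∞) ≤ p.height := by
  induction i generalizing p with
  | zero => exact bot_le
  | succ i ih =>
    exact ht_of_not_le (ha.reg i (by omega)) (fun q hq h1 h2 => ih (by omega) q hq h1 h2) p hp hIp
      ((JJ_mono a (Nat.le_succ i)).trans hB) (hB (mem_JJ a (Nat.lt_succ_self i)))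

lemma htGE_sat {m : ℕ} (ha : GoodSeq I a m) (i : ℕ) (hi : i ≤ m) {K : Ideal R}
    (hK : ∀ x : R, (∀ y ∈ I, x * y ∈ JJ a i) → x ∈ K) : HtGE K i := by
  intro p hp hKp
  by_cases hIp : I ≤ p
  · by_contra hcon
    obtain ⟨σ, hσ, h⟩ := ha.g2 i hi p hp hIp (le_of_lt (not_le.1 hcon))
    exact hσ (hKp (hK σ h))
  · exact ht_J ha i hi p hp hIp (fun x hx => hKp (hK x (fun y hy => Ideal.mul_mem_right _ _ hx)))

lemma exists_regular_mem [Infinite (ResidueField R)] {M : Type u} [AddCommGroup M] [Module R M]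
    [Module.Finite R M] (K : Ideal R) (h : ∀ p ∈ associatedPrimes R M, ¬ K ≤ p) :
    ∃ u ∈ K, IsSMulRegular M u := by
  obtain ⟨u, hu, hu2⟩ := avoid K _ (associatedPrimes.finite R M) h
  refine ⟨u, hu, (isSMulRegular_iff_right_eq_zero_of_smul).2 fun m hm => ?_⟩
  by_contra hne
  obtain ⟨q, hq, hq2⟩ := exists_assoc (R := R) m hne
  exact hu2 q hq (hq2 u hm)

/-- endomorphisms of the critical modules are multiplications -/
lemma ladder_endo (C : Ctx I g l d) (ha : GoodSeq I a (l - 1)) (i f : ℕ) (hi : i + 1 ≤ l)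
    (hif : i + 1 = f + g) (φ : NN I a i f →ₗ[R] NN I a i f) : ∃ r : R, ∀ m, φ m = r • m := by
  have hgl := C.hgl
  have hld := C.hld
  refine lemE C.hd (d - i) i (by omega) (NN I a i f)
    ((ladder C ha f (by omega)).2 i hi hif) ?_ φ
  refine htGE_sat ha i (by omega) ?_
  intro x hx
  rw [Module.mem_annihilator]
  intro m
  obtain ⟨m, rfl⟩ := Submodule.Quotient.mk_surjective _ m
  rw [← Submodule.Quotient.mk_smul, QQ_mk_eq_zero]
  obtain ⟨m, hm⟩ := m
  show x * m ∈ _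
  rcases f with _ | f
  · have hV := ((ladder C ha 0 (by omega)).1 i hi (by omega)).2
    refine hV _ ⟨1, fun y hy => ?_⟩ (by simp)
    rw [pow_one] at hy
    rw [mul_left_comm, ← mul_assoc, mul_comm, ]
    exact Ideal.mul_mem_left _ _ (by first | exact hx y hy | (rw [mul_comm]; exact hx y hy))
  · rw [Nat.add_sub_cancel]
    rw [pow_succ'] at hm
    refine Submodule.mul_induction_on hm ?_ ?_
    · intro y hy z hz
      rw [← mul_assoc]
      exact Ideal.mul_mem_mul (hx y hy) hz
    · intro y z h1 h2
      rw [mul_add]; exact Ideal.add_mem _ h1 h2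
end Ladder2

section VOne
variable {R : Type u} [CommRing R] [IsLocalRing R] [IsNoetherianRing R]
variable {I : Ideal R} {g l d : ℕ} {a : ℕ → R}

/-- elements carrying I into J -/
def colI (J I : Ideal R) : Ideal R where
  carrier := {x | ∀ y ∈ I, x * y ∈ J}
  add_mem' := fun {x z} hx hz y hy => by rw [add_mul]; exact J.add_mem (hx y hy) (hz y hy)
  zero_mem' := fun y _ => by simp
  smul_mem' := fun c x hx y hy => by
    rw [smul_eq_mul, mul_assoc]; exact J.mul_mem_left _ (hx y hy)

lemma mem_colI {J I : Ideal R} {x : R} : x ∈ colI J I ↔ ∀ y ∈ I, x * y ∈ J := Iff.rfl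

lemma V_one [Infinite (ResidueField R)] (C : Ctx I g l d) (ha : GoodSeq I a (l - 1)) (i : ℕ) :
    i + 1 ≤ l → VV I a i 1 := by
  have hgl := C.hgl
  have hld := C.hld
  induction i with
  | zero => intro hi; exact ((ladder C ha 1 (by omega)).1 0 hi (by omega)).2
  | succ i ih =>
    intro hi
    by_cases hig : i + 1 ≤ g
    · exact ((ladder C ha 1 (by omega)).1 (i + 1) hi (by omega)).2
    push Not at hig
    have hV := ih (by omega)
    obtain ⟨f, hf⟩ : ∃ f, i + 1 = f + g := ⟨i + 1 - g, by omega⟩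
    have hf1 : 1 ≤ f := by omega
    have hL := ladder C ha f (by omega)
    have hVf := (hL.1 i (by omega) (by omega)).2
    have hTy := hL.2 i (by omega) hf
    set A := JJ a i * I ^ (f - 1) with hA
    set H := sat (JJ a i) I with hH
    intro y hyH hyI
    have hyI' : y ∈ I := by simpa using hyI
    show y ∈ JJ a (i + 1) * I ^ (1 - 1)
    simp only [Nat.sub_self, pow_zero, mul_one]
    obtain ⟨N, hN⟩ := hyH
    let 𝔞 : Ideal R := I ^ N ⊔ colI (JJ a (i + 1)) I
    have hk : ∀ c ∈ 𝔞, c * y ∈ JJ a (i + 1) := by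
      intro c hc
      obtain ⟨c1, h1, c2, h2, rfl⟩ := Submodule.mem_sup.1 hc
      rw [add_mul]; exact Ideal.add_mem _ (hN _ h1) (h2 y hyI')
    have hht : ∀ p : Ideal R, p.IsPrime → 𝔞 ≤ p → ¬ p.height ≤ ((i + 1 : ℕ) : ℕ∞) := by
      intro p hp hap hle
      have hIp : I ≤ p := hp.le_of_pow_le (le_sup_left.trans hap)
      obtain ⟨σ, hσ, hσ2⟩ := ha.g2 (i + 1) (by omega) p hp hIp hle
      exact hσ (hap (Submodule.mem_sup_right hσ2))
    have hkill : ∀ h ∈ H, ∀ m ∈ I ^ f, h * m ∈ A := fun h hh m hm =>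
      hVf _ (Ideal.mul_mem_right _ _ hh) (Ideal.mul_mem_left _ _ hm)
    obtain ⟨u, hu, hureg⟩ := exists_regular_mem (M := NN I a i f) 𝔞 (by
      intro p hp hap
      refine hht p hp.1 hap ?_
      have := isch C.hd (d - i) _ hTy.1 p hp
      have h2 : p.height ≠ ⊤ := fun h => by rw [h] at this; simp at this
      obtain ⟨q, hq⟩ := ENat.ne_top_iff_exists.1 h2
      rw [← hq] at this ⊢
      norm_cast at this ⊢
      omega)
    have hD2 : Dep R (d - i - 1) (QuotSMulTop u (NN I a i f)) :=
      Dep.quot (hTy.1.mono (by omega)) hureg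
    obtain ⟨v, hv, hvreg⟩ := exists_regular_mem (M := QuotSMulTop u (NN I a i f)) 𝔞 (by
      intro p hp hap
      refine hht p hp.1 hap ?_
      have := isch C.hd (d - i - 1) _ hD2 p hp
      have h2 : p.height ≠ ⊤ := fun h => by rw [h] at this; simp at this
      obtain ⟨q, hq⟩ := ENat.ne_top_iff_exists.1 h2
      rw [← hq] at this ⊢
      norm_cast at this ⊢
      omega)
    have hdec : ∀ c ∈ 𝔞, ∃ s, c * y - a i * s ∈ JJ a i := by
      intro c hc
      have := hk c hc
      rw [JJ_succ] at this
      obtain ⟨z, hz, w, hw, h⟩ := Submodule.mem_sup.1 this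
      obtain ⟨s, rfl⟩ := Ideal.mem_span_singleton.1 hw
      exact ⟨s, by rw [← h, add_sub_cancel_right]; exact hz⟩
    obtain ⟨s, hs⟩ := hdec u hu
    obtain ⟨s', hs'⟩ := hdec v hv
    have hreg := ha.reg i (by omega)
    have h1 : v * s - u * s' ∈ H := by
      refine hreg _ (le_sat _ _ ?_)
      have := Ideal.sub_mem _ (Ideal.mul_mem_left _ u hs') (Ideal.mul_mem_left _ v hs)
      convert this using 1; ring
    have hur : ∀ m ∈ I ^ f, u * m ∈ A → m ∈ A := by
      intro m hm hum
      have : (Submodule.Quotient.mk ⟨m, hm⟩ : NN I a i f) = 0 := by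
        refine (isSMulRegular_iff_right_eq_zero_of_smul).1 hureg _ ?_
        rw [← Submodule.Quotient.mk_smul, QQ_mk_eq_zero]
        exact hum
      rwa [QQ_mk_eq_zero] at this
    obtain ⟨r, hr⟩ := endo_of_rel (ladder_endo C ha i f (by omega) hf) s u (C := A) (by
      intro m hm
      have h2 : (Submodule.Quotient.mk (s • (Submodule.Quotient.mk ⟨m, hm⟩ : NN I a i f)) :
          QuotSMulTop u (NN I a i f)) = 0 := by
        refine (isSMulRegular_iff_right_eq_zero_of_smul).1 hvreg _ ?_
        rw [← Submodule.Quotient.mk_smul, Submodule.Quotient.mk_eq_zero,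
          Submodule.mem_smul_pointwise_iff_exists]
        refine ⟨s' • Submodule.Quotient.mk ⟨m, hm⟩, trivial, ?_⟩
        rw [← sub_eq_zero, ← neg_eq_zero, neg_sub, smul_smul, smul_smul, ← sub_smul,
          ← Submodule.Quotient.mk_smul, QQ_mk_eq_zero]
        exact hkill _ h1 _ hm
      rw [Submodule.Quotient.mk_eq_zero, Submodule.mem_smul_pointwise_iff_exists] at h2
      obtain ⟨m', -, h3⟩ := h2
      obtain ⟨⟨m', hm'⟩, rfl⟩ := Submodule.Quotient.mk_surjective _ m'
      refine ⟨m', hm', ?_⟩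
      rw [eq_comm, ← sub_eq_zero, ← Submodule.Quotient.mk_smul, ← Submodule.Quotient.mk_smul,
        ← Submodule.Quotient.mk_sub, QQ_mk_eq_zero] at h3
      exact h3) hur (fun m hm => Ideal.mul_mem_left _ _ hm)
    have hsr : ∀ m ∈ I ^ f, (s - u * r) * m ∈ A := by
      intro m hm
      -- find companion
      have h2 : ∃ m' ∈ I ^ f, s * m - u * m' ∈ A := by
        have h2 : (Submodule.Quotient.mk (s • (Submodule.Quotient.mk ⟨m, hm⟩ : NN I a i f)) :
            QuotSMulTop u (NN I a i f)) = 0 := by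
          refine (isSMulRegular_iff_right_eq_zero_of_smul).1 hvreg _ ?_
          rw [← Submodule.Quotient.mk_smul, Submodule.Quotient.mk_eq_zero,
            Submodule.mem_smul_pointwise_iff_exists]
          refine ⟨s' • Submodule.Quotient.mk ⟨m, hm⟩, trivial, ?_⟩
          rw [← sub_eq_zero, ← neg_eq_zero, neg_sub, smul_smul, smul_smul, ← sub_smul,
            ← Submodule.Quotient.mk_smul, QQ_mk_eq_zero]
          exact hkill _ h1 _ hm
        rw [Submodule.Quotient.mk_eq_zero, Submodule.mem_smul_pointwise_iff_exists] at h2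
        obtain ⟨m', -, h3⟩ := h2
        obtain ⟨⟨m', hm'⟩, rfl⟩ := Submodule.Quotient.mk_surjective _ m'
        refine ⟨m', hm', ?_⟩
        rw [eq_comm, ← sub_eq_zero, ← Submodule.Quotient.mk_smul, ← Submodule.Quotient.mk_smul,
          ← Submodule.Quotient.mk_sub, QQ_mk_eq_zero] at h3
        exact h3
      obtain ⟨m', hm', h3⟩ := h2
      have := Ideal.add_mem _ h3 (Ideal.mul_mem_left _ u (hr m hm m' hm' h3))
      convert this using 1; ring
    have hsr2 : s - u * r ∈ H := ⟨f, fun m hm => by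
      rw [mul_comm]; exact Ideal.mul_le_left (hsr m hm)⟩
    have h5 : u * (y - a i * r) ∈ H := by
      have := Ideal.add_mem _ (le_sat _ I hs) (Ideal.mul_mem_left _ (a i) hsr2)
      convert this using 1; ring
    have h6 : y - a i * r ∈ H := by
      refine ⟨f, fun m hm => ?_⟩
      refine Ideal.mul_le_left (hur _ (Ideal.mul_mem_right _ _ hm) ?_)
      have := hkill _ h5 m hm
      convert this using 1; ring
    have h7 := hV _ h6 (by
      rw [pow_one]
      exact Ideal.sub_mem _ hyI' (Ideal.mul_mem_right _ _ (ha.mem i (by omega))))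
    simp only [Nat.sub_self, pow_zero, mul_one] at h7
    rw [JJ_succ]
    exact Submodule.mem_sup.2 ⟨_, h7, a i * r, Ideal.mul_mem_right _ _ (Ideal.mem_span_singleton_self _),
      by ring⟩

/-- K1 -/
lemma K_one [Infinite (ResidueField R)] (C : Ctx I g l d) (ha : GoodSeq I a (l - 1)) {b : R}
    (hb : b ∈ I) (hreg : ∀ x, b * x ∈ sat (JJ a (l - 1)) I → x ∈ sat (JJ a (l - 1)) I) (x : R)
    (hx : ∀ y ∈ I ^ (l - g + 1), x * y ∈ (JJ a (l - 1) ⊔ Ideal.span {b}) * I ^ (l - g)) :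
    ∀ y ∈ I, x * y ∈ JJ a (l - 1) ⊔ Ideal.span {b} := by
  intro c hc
  have hgl := C.hgl
  have hl1 := C.hl1
  set W := JJ a (l - 1) with hW
  have hWI : W ≤ I := JJ_le ha.mem
  obtain ⟨f, hf⟩ : ∃ f, f = l - g := ⟨_, rfl⟩
  rw [← hf] at hx
  have hL := ladder C ha f (by omega)
  have hVf := (hL.1 (l - 1) (by omega) (by omega)).2
  have h1 : ∀ m ∈ I ^ f, ∃ m' ∈ I ^ f, x * c * m - b * m' ∈ sat W I := by
    intro m hm
    have := hx (c * m) (by rw [pow_succ']; exact Ideal.mul_mem_mul hc hm)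
    rw [Ideal.sup_mul, Submodule.mem_sup] at this
    obtain ⟨w, hw, z, hz, h⟩ := this
    obtain ⟨m', hm', rfl⟩ := Ideal.mem_span_singleton_mul.1 hz
    refine ⟨m', hm', le_sat _ _ (Ideal.mul_le_left (J := I ^ f) ?_)⟩
    rw [mul_assoc, ← h, add_sub_cancel_right]; exact hw
  obtain ⟨r, hr⟩ := endo_of_rel (ladder_endo C ha (l - 1) f (by omega) (by omega)) (x * c) b
    (C := sat W I) h1 (fun m hm hbm => hVf m (hreg m hbm) hm)
    (fun m hm => Ideal.mul_mem_left _ _ (le_sat _ _ (Ideal.mul_le_left hm)))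
  have h2 : x * c - b * r ∈ sat W I := by
    refine sat_of_mul f (fun m hm => ?_)
    obtain ⟨m', hm', h⟩ := h1 m hm
    have h3 := hr m hm m' hm' h
    have := Ideal.add_mem _ h (Ideal.mul_mem_left _ b (le_sat W I (Ideal.mul_le_left h3)))
    convert this using 1; ring
  have h3 := V_one C ha (l - 1) (by omega) _ h2 (by
    rw [pow_one]; exact Ideal.sub_mem _ (Ideal.mul_mem_left _ _ hc) (Ideal.mul_mem_right _ _ hb))
  simp only [Nat.sub_self, pow_zero, mul_one] at h3
  exact Submodule.mem_sup.2 ⟨_, h3, b * r, Ideal.mul_mem_right _ _ (Ideal.mem_span_singleton_self _),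
      by ring⟩
end VOne

section Lin
variable {R : Type u} [CommRing R] [IsLocalRing R] [IsNoetherianRing R]
variable {I : Ideal R} {g l d : ℕ} {a : ℕ → R}

/-- contraction of `B + pI` from the localization at `p` -/
def bpid (I p B : Ideal R) (hp : p.IsPrime) : Ideal R where
  carrier := {a | ∃ σ ∉ p, σ * a ∈ B ⊔ p * I}
  add_mem' := by
    rintro a b ⟨σ, h1, h2⟩ ⟨τ, h3, h4⟩
    refine ⟨σ * τ, hp.mul_notMem h1 h3, ?_⟩
    rw [show σ * τ * (a + b) = τ * (σ * a) + σ * (τ * b) by ring]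
    exact Ideal.add_mem _ (Ideal.mul_mem_left _ _ h2) (Ideal.mul_mem_left _ _ h4)
  zero_mem' := ⟨1, (Ideal.ne_top_iff_one _).1 hp.ne_top, by simp⟩
  smul_mem' := by
    rintro c x ⟨σ, h1, h2⟩
    refine ⟨σ, h1, ?_⟩
    rw [smul_eq_mul, mul_left_comm]
    exact Ideal.mul_mem_left _ _ h2

lemma bpid_uniform {I p B N : Ideal R} {hp : p.IsPrime} (h : N ≤ bpid I p B hp) :
    ∃ σ ∉ p, ∀ x ∈ N, σ * x ∈ B ⊔ p * I := by
  obtain ⟨S, hS⟩ := IsNoetherian.noetherian N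
  have h4 : ∀ s ∈ S, ∃ σ ∉ p, σ * s ∈ B ⊔ p * I := fun s hs => h (hS ▸ Ideal.subset_span hs)
  choose! τ hτ hτ' using h4
  refine ⟨∏ s ∈ S, τ s, ?_, ?_⟩
  · intro hmem
    obtain ⟨s, hs, h⟩ := (Ideal.IsPrime.prod_mem_iff (hp := hp)).1 hmem
    exact hτ s hs h
  · intro x hx
    rw [← hS] at hx
    refine Submodule.span_induction (p := fun x _ => (∏ s ∈ S, τ s) * x ∈ B ⊔ p * I)
      ?_ (by simp) ?_ ?_ hx
    · intro s hs
      obtain ⟨c, hc⟩ := Finset.dvd_prod_of_mem τ hs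
      rw [hc, mul_right_comm]
      exact Ideal.mul_mem_right _ _ (hτ' s hs)
    · intro x z _ _ h1 h2
      rw [mul_add]; exact Ideal.add_mem _ h1 h2
    · intro c x _ h
      rw [smul_eq_mul, mul_left_comm]; exact Ideal.mul_mem_left _ _ h

lemma exch {I p B : Ideal R} (hp : p.IsPrime) {r : ℕ} {a : R} (haI : a ∈ I)
    (hgen : gen I p B r) (hab : a ∉ bpid I p B hp) : gen I p (B ⊔ Ideal.span {a}) (r - 1) := by
  replace hab : ¬ ∃ σ ∉ p, σ * a ∈ B ⊔ p * I := hab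
  push Not at hab
  obtain ⟨S, h1, h2, σ, h3, h4⟩ := hgen
  obtain ⟨b, hb, y, hy, hby⟩ := Submodule.mem_sup.1 (h4 a haI)
  obtain ⟨f, hf, hf2⟩ := Submodule.mem_span_finset.1 hy
  have hex : ∃ s ∈ S, f s ∉ p := by
    by_contra hcon
    push Not at hcon
    refine hab σ h3 ?_
    rw [← hby, ← hf2]
    refine Submodule.add_mem_sup hb (Ideal.sum_mem _ fun s hs => ?_)
    exact Ideal.mul_mem_mul (hcon s hs) (h1 s hs)
  obtain ⟨s, hs, hfs⟩ := hex
  classical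
  have hcard := Finset.card_erase_of_mem hs
  have hle : Ideal.span ((S.erase s : Finset R) : Set R) ≤
      B ⊔ Ideal.span {a} ⊔ Ideal.span ((S.erase s : Finset R) : Set R) := le_sup_right
  have hsm : f s * s ∈ B ⊔ Ideal.span {a} ⊔ Ideal.span ((S.erase s : Finset R) : Set R) := by
    have h5 : f s * s = σ * a - b - ∑ s' ∈ S.erase s, f s' * s' := by
      rw [← hby, ← hf2, ← Finset.add_sum_erase _ _ hs]
      simp only [smul_eq_mul]; ring
    rw [h5]
    refine Ideal.sub_mem _ (Ideal.sub_mem _ ?_ ?_) ?_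
    · exact Ideal.mem_sup_left (Ideal.mem_sup_right (Ideal.mul_mem_left _ _ (Ideal.mem_span_singleton_self a)))
    · exact Ideal.mem_sup_left (Ideal.mem_sup_left hb)
    · exact Ideal.sum_mem _ fun s' hs' => Ideal.mul_mem_left _ _ (hle (Ideal.subset_span hs'))
  refine ⟨S.erase s, fun s' hs' => h1 s' (Finset.mem_of_mem_erase hs'), by omega, f s * σ,
    hp.mul_notMem hfs h3, fun x hx => ?_⟩
  have h6 : B ⊔ Ideal.span (S : Set R) ≤ Submodule.colon (B ⊔ Ideal.span {a} ⊔ Ideal.span ((S.erase s : Finset R) : Set R)) {f s} := by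
    refine sup_le ?_ (Ideal.span_le.2 ?_)
    · intro z hz
      rw [Submodule.mem_colon_singleton]
      exact Ideal.mul_mem_right _ _ (Ideal.mem_sup_left (Ideal.mem_sup_left hz))
    · intro z hz
      rw [SetLike.mem_coe, Submodule.mem_colon_singleton]
      by_cases hzs : z = s
      · rw [hzs, smul_eq_mul, mul_comm]; exact hsm
      · exact Ideal.mul_mem_right _ _ (hle (Ideal.subset_span (Finset.mem_erase.2 ⟨hzs, hz⟩)))
  have := h6 (h4 x hx)
  rw [Submodule.mem_colon_singleton] at this
  rw [mul_assoc, mul_comm]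
  exact this

lemma gen_one {I p B : Ideal R} (hp : p.IsPrime) (h : gen I p B 1) :
    ∃ x ∈ I, ∃ σ ∉ p, ∀ y ∈ I, σ * y ∈ B ⊔ Ideal.span {x} := by
  obtain ⟨S, h1, h2, σ, h3, h4⟩ := h
  rcases Finset.card_le_one_iff_subset_singleton.1 h2 with ⟨x, hx⟩
  by_cases hxI : x ∈ I
  · have h5 : B ⊔ Ideal.span (S : Set R) ≤ B ⊔ Ideal.span {x} := sup_le_sup_left (Ideal.span_mono (by exact_mod_cast hx)) _
    exact ⟨x, hxI, σ, h3, fun y hy => h5 (h4 y hy)⟩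
  · have : S = ∅ := by
      rcases Finset.subset_singleton_iff.1 hx with h | h
      · exact h
      · exact absurd (h1 x (by simp [h])) hxI
    subst this
    exact ⟨0, I.zero_mem, σ, h3, fun y hy => by simpa using h4 y hy⟩

lemma Ctx.lower (C : Ctx I g l d) {h : ℕ} (hg : g ≤ h) (hl : h ≤ l) (h1 : 1 ≤ h) : Ctx I g h d where
  hd := C.hd
  hIg := C.hIg
  hR := C.hR
  hDep := fun j s h1 h2 h3 => C.hDep j s h1 (by omega) h3
  hgl := hg
  hld := hl.trans C.hld
  hl1 := h1
  hIm := C.hIm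
  hG := fun p hp hI h hh hl' => C.hG p hp hI h hh (by omega)

lemma lin [Infinite (ResidueField R)] (C : Ctx I g l d) {J : Ideal R} (hJ : IsReduction J I)
    (p : Ideal R) (hp : p.IsPrime) (hIp : I ≤ p) (hht : p.height < (l : ℕ∞)) :
    ∃ σ ∉ p, ∀ x ∈ I, σ * x ∈ J := by
  by_contra hcon
  obtain ⟨hJI, r, hr⟩ := hJ
  obtain ⟨h, hh⟩ := ENat.ne_top_iff_exists.1 (ne_top_of_lt hht)
  have hhl : h < l := by rw [← hh] at hht; exact_mod_cast hht
  have hgh : g ≤ h := by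
    have := C.hIg p hp hIp
    rw [← hh] at this; exact_mod_cast this
  rcases Nat.eq_zero_or_pos h with h0 | hpos
  · subst h0
    obtain ⟨σ, hσ, hσ2⟩ := gen_zero (C.hG p hp hIp 0 hh.symm hhl)
    exact hcon ⟨σ, hσ, fun x hx => by
      have := hσ2 x hx
      rw [Ideal.mem_bot] at this
      rw [this]; exact J.zero_mem⟩
  -- maximal bad ideal
  obtain ⟨N, ⟨hN1, hN2, hN3⟩, hNmax⟩ := set_has_maximal_iff_noetherian.2
    (inferInstanceAs (IsNoetherian R R))
    {N : Ideal R | J ⊔ p * I ≤ N ∧ N ≤ I ∧ ¬ ∃ σ ∉ p, ∀ x ∈ I, σ * x ∈ N}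
    ⟨J ⊔ p * I, le_rfl, sup_le hJI Ideal.mul_le_right, by
      rintro ⟨σ, hσ, hσ2⟩
      exact hcon (naka_p (hp := hp) hσ hσ2)⟩
  have hmax : ∀ x ∈ I, x ∉ N → ∃ σ ∉ p, ∀ y ∈ I, σ * y ∈ N ⊔ Ideal.span {x} := by
    intro x hx hxN
    by_contra h1
    refine hNmax (N ⊔ Ideal.span {x}) ⟨hN1.trans le_sup_left,
      sup_le hN2 ((Ideal.span_singleton_le_iff_mem _).2 hx), h1⟩ ?_
    refine lt_of_le_of_ne le_sup_left ?_
    intro h2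
    apply hxN
    rw [h2]
    exact Ideal.mem_sup_right (Ideal.mem_span_singleton_self x)
  have hsatN : ∀ x ∈ I, ∀ τ ∉ p, τ * x ∈ N → x ∈ N := by
    intro x hx τ hτ hτx
    by_contra hxN
    obtain ⟨σ, hσ, hσ2⟩ := hmax x hx hxN
    refine hN3 ⟨τ * σ, hp.mul_notMem hτ hσ, fun y hy => ?_⟩
    obtain ⟨n, hn, w, hw, hnw⟩ := Submodule.mem_sup.1 (hσ2 y hy)
    obtain ⟨c, rfl⟩ := Ideal.mem_span_singleton'.1 hw
    rw [mul_assoc, ← hnw, mul_add, mul_left_comm]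
    exact N.add_mem (Ideal.mul_mem_left N _ hn) (Ideal.mul_mem_left N _ hτx)
  obtain ⟨x0, hx0, hx0N⟩ : ∃ x ∈ I, x ∉ N := by
    by_contra h1
    push Not at h1
    exact hN3 ⟨1, (Ideal.ne_top_iff_one _).1 hp.ne_top, fun x hx => by simpa using h1 x hx⟩
  have C' := C.lower hgh hhl.le hpos
  obtain ⟨b, hb1, hb2, hb3⟩ := exists_good (I := I) (J := N) (l := h) hN2
    (fun q hq hNq => by
      have hJq : J ≤ q := le_sup_left.trans (hN1.trans hNq)
      refine hq.le_of_pow_le (n := r + 1) ?_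
      rw [hr]
      exact Ideal.mul_le_left.trans hJq)
    (fun q hq hIq hqh => by
      have hpq : ¬ p ≤ q := by
        intro hpq
        have := Ideal.height_mono hpq
        rw [← hh] at this
        exact absurd hqh (not_lt.2 this)
      obtain ⟨σ, hσ, hσq⟩ := Set.not_subset.1 hpq
      exact ⟨σ, hσq, fun x hx => hN1 (Ideal.mem_sup_right (Ideal.mul_mem_mul hσ hx))⟩)
    (fun q hq hIq h' hh' hl' => C.hG q hq hIq h' hh' (by omega))
    (fun i B => gen I p B (max (h - i) 1))
    (gen_mono (C.hG p hp hIp h hh.symm hhl) le_rfl (by omega))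
    (by
      intro i B hi hBN hQ
      by_cases hg1 : gen I p B 1
      · exact ⟨∅, Set.finite_empty, by simp, fun a _ _ => gen_mono hg1 le_sup_left (by omega)⟩
      · refine ⟨{bpid I p B hp}, Set.finite_singleton _, ?_, ?_⟩
        · rintro b rfl hNb
          obtain ⟨τ, hτ, hτ2⟩ := bpid_uniform hNb
          obtain ⟨σ, hσ, hσ2⟩ := hmax x0 hx0 hx0N
          obtain ⟨ρ, hρ, hρ2⟩ := naka_p (hp := hp) (I := I) (B := B ⊔ Ideal.span {x0}) (σ := τ * σ)
            (hp.mul_notMem hτ hσ) (by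
              intro y hy
              obtain ⟨n, hn, w, hw, hnw⟩ := Submodule.mem_sup.1 (hσ2 y hy)
              rw [mul_assoc, ← hnw, mul_add]
              refine Ideal.add_mem _ ?_ (Ideal.mem_sup_left (Ideal.mem_sup_right (Ideal.mul_mem_left _ _ hw)))
              exact (sup_le_sup_right le_sup_left _ : B ⊔ p * I ≤ B ⊔ Ideal.span {x0} ⊔ p * I) (hτ2 n hn))
          exact hg1 ⟨{x0}, by simpa using hx0, by simp, ρ, hρ, by simpa using hρ2⟩
        · intro a haN hab
          refine gen_mono (exch hp (hN2 haN) hQ (hab _ rfl)) le_rfl (by omega))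
    (h - 1) (by omega)
  obtain ⟨x, hxI, σ, hσ, hσ2⟩ := gen_one hp (gen_mono hb3 le_rfl (show max (h - (h - 1)) 1 ≤ 1 by omega))
  have hWN : JJ b (h - 1) ≤ N := JJ_le hb2
  have hxN : x ∉ N := by
    intro hxN
    exact hN3 ⟨σ, hσ, fun y hy => sup_le hWN ((Ideal.span_singleton_le_iff_mem _).2 hxN) (hσ2 y hy)⟩
  have hJW : ∀ z ∈ J, σ * z ∈ JJ b (h - 1) ⊔ p * I := by
    intro z hz
    have hzN : z ∈ N := hN1 (Ideal.mem_sup_left hz)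
    obtain ⟨n, hn, w, hw, hnw⟩ := Submodule.mem_sup.1 (hσ2 z (hN2 hzN))
    obtain ⟨c, rfl⟩ := Ideal.mem_span_singleton'.1 hw
    have hc : c ∈ p := by
      by_contra hc
      refine hxN (hsatN x hxI c hc ?_)
      rw [show c * x = σ * z - n by rw [← hnw]; ring]
      exact N.sub_mem (Ideal.mul_mem_left N _ hzN) (hWN hn)
    rw [← hnw]
    exact Submodule.add_mem_sup hn (Ideal.mul_mem_mul hc hxI)
  obtain ⟨τ, hτ, hτ2⟩ := naka_p (hp := hp) (I := I ^ (r + 1)) (B := JJ b (h - 1) * I ^ r) hσ (by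
    intro y hy
    rw [hr] at hy
    refine Submodule.mul_induction_on hy ?_ ?_
    · intro z hz w hw
      have := Ideal.mul_mem_mul (hJW z hz) hw
      rw [Ideal.sup_mul, mul_assoc p, ← pow_succ'] at this
      rwa [← mul_assoc]
    · intro y z h1 h2
      rw [mul_add]; exact Ideal.add_mem _ h1 h2)
  refine hN3 ⟨τ, hτ, fun y hy => hWN ?_⟩
  have := V_one C' hb1 (h - 1) (by omega) (τ * y) ⟨r, fun z hz => by
    rw [mul_left_comm]
    exact Ideal.mul_le_left (hτ2 _ (by rw [pow_succ]; exact Ideal.mul_mem_mul hz hy))⟩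
    (by rw [pow_one]; exact Ideal.mul_mem_left _ _ hy)
  simpa using this
end Lin

section Red
variable {R : Type u} [CommRing R] [IsLocalRing R] [IsNoetherianRing R]
variable {I : Ideal R} {g l d : ℕ} {a : ℕ → R}

lemma naka_m {B N : Ideal R} (h : N ≤ B ⊔ maximalIdeal R * N) : N ≤ B :=
  Submodule.le_of_le_smul_of_le_jacobson_bot (IsNoetherian.noetherian N)
    (IsLocalRing.maximalIdeal_le_jacobson _) h

lemma mem_of_unit_mul {B : Ideal R} {c x : R} (hc : c ∉ maximalIdeal R) (h : c * x ∈ B) : x ∈ B := by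
  rw [mem_maximalIdeal, mem_nonunits_iff, not_not] at hc
  exact (Ideal.unit_mul_mem_iff_mem B hc).1 h

lemma mem_bpid_m {B : Ideal R} {x : R} :
    x ∈ bpid I (maximalIdeal R) B (maximalIdeal.isMaximal R).isPrime ↔ x ∈ B ⊔ maximalIdeal R * I :=
  ⟨fun ⟨σ, hσ, h⟩ => mem_of_unit_mul hσ h,
    fun h => ⟨1, (Ideal.ne_top_iff_one _).1 (maximalIdeal.isMaximal R).ne_top, by rwa [one_mul]⟩⟩

lemma gen_m {B : Ideal R} {r : ℕ} (h : gen I (maximalIdeal R) B r) :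
    ∃ S : Finset R, (∀ s ∈ S, s ∈ I) ∧ S.card ≤ r ∧ I ≤ B ⊔ Ideal.span (S : Set R) := by
  obtain ⟨S, h1, h2, σ, h3, h4⟩ := h
  exact ⟨S, h1, h2, fun x hx => mem_of_unit_mul h3 (h4 x hx)⟩

lemma gen_of_m {B : Ideal R} {S : Finset R} (h1 : ∀ s ∈ S, s ∈ I) (h2 : I ≤ B ⊔ Ideal.span (S : Set R)) :
    gen I (maximalIdeal R) B S.card :=
  ⟨S, h1, le_rfl, 1, (Ideal.ne_top_iff_one _).1 (maximalIdeal.isMaximal R).ne_top,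
    fun x hx => by rw [one_mul]; exact h2 hx⟩

lemma exch_m {B : Ideal R} {r : ℕ} {x : R} (hx : x ∈ I) (h : gen I (maximalIdeal R) B r)
    (hxB : x ∉ B ⊔ maximalIdeal R * I) : gen I (maximalIdeal R) (B ⊔ Ideal.span {x}) (r - 1) :=
  exch (maximalIdeal.isMaximal R).isPrime hx h (fun h => hxB (mem_bpid_m.1 h))

lemma gen_zero_m {B : Ideal R} (h : gen I (maximalIdeal R) B 0) : I ≤ B := by
  obtain ⟨σ, hσ, h2⟩ := gen_zero h
  exact fun x hx => mem_of_unit_mul hσ (h2 x hx)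

/-- Nakayama for reductions -/
lemma red_naka {J J' : Ideal R} {r : ℕ} (h : J ≤ J' ⊔ maximalIdeal R * I)
    (hr : I ^ (r + 1) ≤ J * I ^ r) : I ^ (r + 1) ≤ J' * I ^ r := by
  refine naka_m (hr.trans ((Ideal.mul_mono_left h).trans ?_))
  rw [Ideal.sup_mul, mul_assoc, ← pow_succ']

lemma red_mono {J : Ideal R} {r r' : ℕ} (hrr : r ≤ r') (hr : I ^ (r + 1) ≤ J * I ^ r) :
    I ^ (r' + 1) ≤ J * I ^ r' := by
  obtain ⟨c, rfl⟩ := Nat.exists_eq_add_of_le hrr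
  rw [show r + c + 1 = (r + 1) + c by ring, pow_add I (r + 1) c, pow_add I r c, ← mul_assoc]
  exact Ideal.mul_mono_left hr

lemma red_of {J : Ideal R} {r : ℕ} (hJ : J ≤ I) (hr : I ^ (r + 1) ≤ J * I ^ r) : IsReduction J I :=
  ⟨hJ, r, le_antisymm hr (by rw [pow_succ']; exact Ideal.mul_mono_left hJ)⟩

lemma red_eq {J : Ideal R} {r : ℕ} (hJ : J ≤ I) (hr : I ^ (r + 1) ≤ J * I ^ r) :
    I ^ (r + 1) = J * I ^ r :=
  le_antisymm hr (by rw [pow_succ']; exact Ideal.mul_mono_left hJ)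

/-- numerical hypotheses about reductions -/
structure RCtx (I : Ideal R) (l : ℕ) : Prop where
  f1 : ∀ S : Finset R, IsReduction (Ideal.span (S : Set R)) I → l ≤ S.card
  f2 : ∃ L : Ideal R, IsReduction L I ∧ L ≠ I
  mu1 : gen I (maximalIdeal R) ⊥ (l + 1)
  mu2 : ∀ S : Finset R, Ideal.span (S : Set R) = I → l + 1 ≤ S.card

lemma JJ_finset (b : ℕ → R) (q : ℕ) : ∃ S : Finset R, S.card ≤ q ∧ Ideal.span (S : Set R) = JJ b q := by
  classical
  refine ⟨(Finset.range q).image b, Finset.card_image_le.trans (by simp), ?_⟩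
  rw [JJ]; congr 1; ext x; simp

lemma RCtx.f1' (D : RCtx I l) {q : ℕ} {B : Ideal R} {S : Finset R} (hB : B = Ideal.span (S : Set R))
    (hS : S.card ≤ q) (hBI : B ≤ I) {r : ℕ}
    (h : I ^ (r + 1) ≤ (B ⊔ maximalIdeal R * I) * I ^ r) : l ≤ q := by
  have := D.f1 S (by rw [← hB]; exact red_of hBI (red_naka le_rfl h))
  omega

lemma greedy {J : Ideal R} (i : ℕ) : (∃ (b : ℕ → R) (q : ℕ), q < i ∧ (∀ j < q, b j ∈ J) ∧
    J ≤ JJ b q ⊔ maximalIdeal R * I) ∨ (∃ b : ℕ → R, ∀ j < i, b j ∈ J ∧ b j ∉ JJ b j ⊔ maximalIdeal R * I) := by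
  induction i with
  | zero => right; exact ⟨fun _ => 0, by simp⟩
  | succ i ih =>
    rcases ih with ⟨b, q, h1, h2⟩ | ⟨b, hb⟩
    · exact Or.inl ⟨b, q, by omega, h2⟩
    by_cases h : J ≤ JJ b i ⊔ maximalIdeal R * I
    · exact Or.inl ⟨b, i, by omega, fun j hj => (hb j hj).1, h⟩
    · obtain ⟨x, hx, hx2⟩ := Set.not_subset.1 h
      right
      refine ⟨Function.update b i x, fun j hj => ?_⟩
      rcases Nat.lt_succ_iff_lt_or_eq.1 hj with hj | rfl
      · rw [JJ_congr (b := b) (fun k hk => by rw [Function.update_of_ne (by omega)]),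
          Function.update_of_ne (by omega)]
        exact hb j hj
      · rw [JJ_congr (b := b) (fun k hk => by rw [Function.update_of_ne (by omega)]),
          Function.update_self]
        exact ⟨hx, hx2⟩

lemma exch_JJ {N : Ideal R} {r : ℕ} (hN : gen N (maximalIdeal R) ⊥ r) (hNI : N ≤ I) {b : ℕ → R} (q : ℕ)
    (hb : ∀ j < q, b j ∈ N ∧ b j ∉ JJ b j ⊔ maximalIdeal R * I) :
    gen N (maximalIdeal R) (JJ b q) (r - q) := by
  induction q with
  | zero => rw [JJ_zero]; exact hN
  | succ q ih =>
    rw [JJ_succ, ← Nat.sub_sub]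
    refine exch_m (hb q (by omega)).1 (ih fun j hj => hb j (by omega)) (fun h => (hb q (by omega)).2 ?_)
    exact (sup_le_sup_left (Ideal.mul_mono_right hNI) _ : JJ b q ⊔ maximalIdeal R * N ≤ _) h

lemma RCtx.struct (D : RCtx I l) {J : Ideal R} (hJ : IsReduction J I) :
    ∃ b : ℕ → R, (∀ j < l, b j ∈ J ∧ b j ∉ JJ b j ⊔ maximalIdeal R * I) ∧
      gen I (maximalIdeal R) (JJ b l) 1 := by
  obtain ⟨hJI, r, hr⟩ := hJ
  rcases greedy (I := I) (J := J) l with ⟨b, q, hq, hb, h⟩ | ⟨b, hb⟩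
  · exfalso
    obtain ⟨S, hS, hS2⟩ := JJ_finset b q
    have := D.f1' hS2.symm hS (JJ_le fun j hj => hJI (hb j hj)) (hr.le.trans (Ideal.mul_mono_left h))
    omega
  · refine ⟨b, hb, ?_⟩
    have := exch_JJ D.mu1 le_rfl l (fun j hj => ⟨hJI (hb j hj).1, (hb j hj).2⟩)
    rwa [Nat.add_sub_cancel_left] at this

lemma RCtx.min_struct (D : RCtx I l) {J : Ideal R} (hJ : IsMinimalReduction J I) :
    ∃ b : ℕ → R, J = JJ b l ∧ (∀ j < l, b j ∉ JJ b j ⊔ maximalIdeal R * I) ∧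
      (∃ x ∈ I, x ∉ J ⊔ maximalIdeal R * I ∧ I = J ⊔ Ideal.span {x}) := by
  obtain ⟨b, hb, hg⟩ := D.struct hJ.1
  obtain ⟨hJI, r, hr⟩ := hJ.1
  have hJne : J ≠ I := by
    rintro rfl
    obtain ⟨L, hL, hL2⟩ := D.f2
    exact hL2 (hJ.2 L hL hL.1)
  have hle : JJ b l ≤ J := JJ_le fun j hj => (hb j hj).1
  have h1 : J ≤ JJ b l ⊔ maximalIdeal R * I := by
    by_contra hcon
    obtain ⟨x, hx, hx2⟩ := Set.not_subset.1 hcon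
    have := gen_zero_m (exch_m (hJI hx) hg hx2)
    exact hJne (le_antisymm hJI (this.trans (sup_le hle ((Ideal.span_singleton_le_iff_mem _).2 hx))))
  have h2 : JJ b l = J := hJ.2 _ (red_of (hle.trans hJI) (red_naka h1 hr.le)) hle
  refine ⟨b, h2.symm, fun j hj => (hb j hj).2, ?_⟩
  rw [h2] at hg
  obtain ⟨x, hx, hx2⟩ : ∃ x ∈ I, x ∉ J ⊔ maximalIdeal R * I := by
    by_contra hcon
    push Not at hcon
    exact hJne (le_antisymm hJI (naka_m hcon))
  refine ⟨x, hx, hx2, le_antisymm (gen_zero_m (exch_m hx hg hx2))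
    (sup_le hJI ((Ideal.span_singleton_le_iff_mem _).2 hx))⟩

lemma RCtx.min_of (D : RCtx I l) {J : Ideal R} (hJ : IsReduction J I) (hg : gen J (maximalIdeal R) ⊥ l) :
    IsMinimalReduction J I := by
  refine ⟨hJ, fun J' hJ' hle => le_antisymm hle ?_⟩
  obtain ⟨b, hb, -⟩ := D.struct hJ'
  have := exch_JJ hg hJ.1 l (fun j hj => ⟨hle (hb j hj).1, (hb j hj).2⟩)
  rw [Nat.sub_self] at this
  exact (gen_zero_m this).trans (JJ_le fun j hj => (hb j hj).1)

/-- openness of goodness -/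
lemma fin_good {B : Ideal R} {x y : R} {r : ℕ}
    (hy : y ∈ I) (h : I ^ (r + 1) ≤ (B ⊔ Ideal.span {x}) * I ^ r) :
    ∃ E : Finset (ResidueField R), 0 ∉ E ∧ ∀ s : R, residue R s ∉ E →
      I ^ (r + 1) ≤ (B ⊔ Ideal.span {x + s * y}) * I ^ r := by
  classical
  obtain ⟨q, z, hz⟩ := Submodule.fg_iff_exists_fin_generating_family.1 (IsNoetherian.noetherian (I ^ r))
  have hzm : ∀ i, z i ∈ I ^ r := fun i => hz ▸ Submodule.subset_span ⟨i, rfl⟩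
  have hM : ∀ i, ∃ c : Fin q → R, y * z i - ∑ j, c j * (x * z j) ∈ B * I ^ r := by
    intro i
    have h1 : y * z i ∈ I ^ (r + 1) := by rw [pow_succ']; exact Ideal.mul_mem_mul hy (hzm i)
    have h2 := h h1
    rw [Ideal.sup_mul, Submodule.mem_sup] at h2
    obtain ⟨w, hw, v, hv, hwv⟩ := h2
    obtain ⟨v, hv3, rfl⟩ := Ideal.mem_span_singleton_mul.1 hv
    rw [← hz] at hv3
    obtain ⟨c, rfl⟩ := (Submodule.mem_span_range_iff_exists_fun R).1 hv3
    refine ⟨c, ?_⟩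
    have : ∑ j, c j * (x * z j) = x * ∑ j, c j • z j := by
      rw [Finset.mul_sum]
      exact Finset.sum_congr rfl fun j _ => by rw [smul_eq_mul]; ring
    rw [this, ← hwv, add_sub_cancel_right]; exact hw
  choose M hM using hM
  let MM : Matrix (Fin q) (Fin q) R := Matrix.of M
  let P : Polynomial R := Matrix.det (1 + (Polynomial.X : Polynomial R) • MM.map Polynomial.C)
  have hP : ∀ s : R, P.eval s = Matrix.det (1 + s • MM) := by
    intro s
    rw [← Polynomial.coe_evalRingHom, RingHom.map_det]
    congr 1
    ext i j
    simp [Matrix.one_apply]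
    split_ifs <;> simp [mul_comm]
  let Pk := P.map (residue R)
  have hPk : ∀ s : R, Pk.eval (residue R s) = residue R (P.eval s) := fun s => by
    rw [Polynomial.eval_map, Polynomial.eval₂_at_apply]
  have h0 : Pk.eval 0 = 1 := by
    have := hPk 0
    rw [hP, map_zero] at this
    simpa using this
  have hPk0 : Pk ≠ 0 := by intro h; rw [h] at h0; simp at h0
  refine ⟨Pk.roots.toFinset, ?_, ?_⟩
  · rw [Multiset.mem_toFinset, Polynomial.mem_roots hPk0, Polynomial.IsRoot, h0]
    exact one_ne_zero
  intro s hs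
  rw [Multiset.mem_toFinset, Polynomial.mem_roots hPk0, Polynomial.IsRoot, hPk, hP] at hs
  have hu : IsUnit (Matrix.det (1 + s • MM)) := by
    by_contra hcon
    exact hs (Ideal.Quotient.eq_zero_iff_mem.2 ((mem_maximalIdeal _).2 hcon))
  set T := (B ⊔ Ideal.span {x + s * y}) * I ^ r with hT
  have hBT : B * I ^ r ≤ T := Ideal.mul_mono_left le_sup_left
  have hA : ∀ i, ∑ j, (1 + s • MM) i j * (x * z j) ∈ T := by
    intro i
    have h1 : (x + s * y) * z i ∈ T := Ideal.mul_mem_mul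
      (Ideal.mem_sup_right (Ideal.mem_span_singleton_self _)) (hzm i)
    have h2 := T.sub_mem h1 (Ideal.mul_mem_left _ s (hBT (hM i)))
    convert h2 using 1
    simp only [Matrix.add_apply, Matrix.one_apply, Matrix.smul_apply, add_mul, Finset.sum_add_distrib,
      smul_eq_mul, ite_mul, one_mul, zero_mul, Finset.sum_ite_eq, Finset.mem_univ, if_true, MM, Matrix.of_apply,
      mul_sub, Finset.mul_sum, mul_assoc]
    ring
  have hz2 : ∀ k, x * z k ∈ T := by
    intro k
    have h1 : ∑ i, (1 + s • MM)⁻¹ k i * ∑ j, (1 + s • MM) i j * (x * z j) ∈ T :=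
      Ideal.sum_mem _ fun i _ => Ideal.mul_mem_left _ _ (hA i)
    have h2 : ∑ i, (1 + s • MM)⁻¹ k i * ∑ j, (1 + s • MM) i j * (x * z j) = x * z k := by
      simp only [Finset.mul_sum]
      rw [Finset.sum_comm]
      have : ∀ j, ∑ i, (1 + s • MM)⁻¹ k i * ((1 + s • MM) i j * (x * z j)) =
          (1 : Matrix (Fin q) (Fin q) R) k j * (x * z j) := by
        intro j
        have h5 := congrFun (congrFun (Matrix.nonsing_inv_mul _ hu) k) j
        rw [← h5, Matrix.mul_apply, Finset.sum_mul]
        exact Finset.sum_congr rfl fun i _ => by rw [mul_assoc]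
      simp only [this, Matrix.one_apply, ite_mul, one_mul, zero_mul, Finset.sum_ite_eq, Finset.mem_univ, if_true]
    rwa [h2] at h1
  refine h.trans ?_
  rw [Ideal.sup_mul]
  refine sup_le hBT ?_
  intro w hw
  obtain ⟨v, hv, rfl⟩ := Ideal.mem_span_singleton_mul.1 hw
  rw [← hz] at hv
  obtain ⟨c, rfl⟩ := (Submodule.mem_span_range_iff_exists_fun R).1 hv
  rw [Finset.mul_sum]
  refine Ideal.sum_mem _ fun j _ => ?_
  rw [smul_eq_mul, mul_left_comm]
  exact Ideal.mul_mem_left _ _ (hz2 j)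

end Red

section Step
variable {R : Type u} [CommRing R] [IsLocalRing R] [IsNoetherianRing R]
variable {I : Ideal R} {g l d : ℕ} {a : ℕ → R}

lemma good_in [Infinite (ResidueField R)] (C : Ctx I g l d) {J : Ideal R} (hJ : IsReduction J I) {v : R}
    (hv : v ∈ J) (hgv : gen J (maximalIdeal R) (Ideal.span {v}) (l - 1)) (Q : ℕ → Ideal R → Prop)
    (hQ0 : Q 0 ⊥)
    (hQ : ∀ i B, i + 1 < l → B ≤ J → Q i B → ∃ F : Set (Ideal R), F.Finite ∧ (∀ b ∈ F, ¬ J ≤ b) ∧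
      ∀ a ∈ J, (∀ b ∈ F, a ∉ b) → Q (i + 1) (B ⊔ Ideal.span {a})) :
    ∃ a : ℕ → R, GoodSeq I a (l - 1) ∧ J = JJ a (l - 1) ⊔ Ideal.span {v} ∧ Q (l - 1) (JJ a (l - 1)) := by
  have hl1 := C.hl1
  obtain ⟨hJI, r, hr⟩ := hJ
  obtain ⟨a, h1, h2, h3, h4⟩ := exists_good (I := I) (J := J) (l := l) hJI
    (fun q hq hJq => by
      refine hq.le_of_pow_le (n := r + 1) ?_
      rw [hr]
      exact Ideal.mul_le_left.trans hJq)
    (fun p hp hIp hht => lin C ⟨hJI, r, hr⟩ p hp hIp hht) C.hG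
    (fun i B => gen J (maximalIdeal R) (B ⊔ Ideal.span {v}) (l - 1 - i) ∧ Q i B)
    ⟨by simpa using hgv, hQ0⟩ (by
      rintro i B hi hB ⟨h1, h2⟩
      obtain ⟨F, hF, hF2, hF3⟩ := hQ i B hi hB h2
      by_cases hg : gen J (maximalIdeal R) (B ⊔ Ideal.span {v}) (l - 1 - (i + 1))
      · refine ⟨F, hF, hF2, fun a ha haF => ⟨gen_mono hg ?_ le_rfl, hF3 a ha haF⟩⟩
        exact sup_le_sup_right le_sup_left _
      · refine ⟨F ∪ {B ⊔ Ideal.span {v} ⊔ maximalIdeal R * J}, hF.union (Set.finite_singleton _), ?_, ?_⟩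
        · rintro b (hb | rfl) hJb
          · exact hF2 b hb hJb
          · apply hg
            refine gen_mono (gen_of_m (S := ∅) (by simp) (by simpa using naka_m hJb)) le_rfl (by simp)
        · intro a ha hab
          refine ⟨?_, hF3 a ha fun b hb => hab b (Or.inl hb)⟩
          have := exch_m ha h1 (hab _ (Or.inr rfl))
          rw [sup_assoc, sup_comm (Ideal.span {v}), ← sup_assoc] at this
          exact gen_mono this le_rfl (by omega))
    (l - 1) (by omega)
  rw [Nat.sub_self] at h3
  exact ⟨a, h1, le_antisymm (gen_zero_m h3) (sup_le (JJ_le h2) ((Ideal.span_singleton_le_iff_mem _).2 hv)), h4⟩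

lemma reg_of_red {W : Ideal R} {b : R} {r : ℕ} (hr : I ^ (r + 1) ≤ (W ⊔ Ideal.span {b}) * I ^ r) (x : R)
    (hx : b * x ∈ sat W I) : x ∈ sat W I := by
  refine sat_of_mul (r + 1) fun y hy => ?_
  have h1 := hr hy
  rw [Ideal.sup_mul, Submodule.mem_sup] at h1
  obtain ⟨w, hw, v, hv, rfl⟩ := h1
  obtain ⟨v, hv, rfl⟩ := Ideal.mem_span_singleton_mul.1 hv
  rw [add_mul]
  refine Ideal.add_mem _ (Ideal.mul_mem_right _ _ (le_sat _ _ (Ideal.mul_le_left hw))) ?_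
  rw [mul_right_comm]
  exact Ideal.mul_mem_right _ _ hx

lemma V_top [Infinite (ResidueField R)] (C : Ctx I g l d) (ha : GoodSeq I a (l - 1)) {b : R} (hb : b ∈ I)
    (ht : I ^ (l - g + 1 + 1) ≤ (JJ a (l - 1) ⊔ Ideal.span {b}) * I ^ (l - g + 1)) (c : ℕ) :
    VV I a (l - 1) (l - g + 1 + c) := by
  have hgl := C.hgl
  have hl1 := C.hl1
  induction c with
  | zero => exact ((ladder C ha (l - g + 1) (by omega)).1 (l - 1) (by omega) (by omega)).2
  | succ c ih =>
    intro x hx hx2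
    have h1 := red_mono (r' := l - g + 1 + c) (by omega) ht hx2
    show x ∈ JJ a (l - 1) * I ^ (l - g + 1 + c)
    rw [Ideal.sup_mul, Submodule.mem_sup] at h1
    obtain ⟨w, hw, v, hv, rfl⟩ := h1
    obtain ⟨v, hv3, rfl⟩ := Ideal.mem_span_singleton_mul.1 hv
    have h2 : b * v ∈ sat (JJ a (l - 1)) I := by
      have := Ideal.sub_mem _ hx (le_sat _ I (Ideal.mul_le_left hw))
      rwa [add_sub_cancel_left] at this
    have h3 := ih v (reg_of_red ht v h2) hv3
    refine Ideal.add_mem _ hw ?_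
    rw [show l - g + 1 + c = (l - g + 1 + c - 1) + 1 by omega, pow_succ', mul_left_comm]
    exact Ideal.mul_mem_mul hb h3

lemma step_red [Infinite (ResidueField R)] (C : Ctx I g l d) (ha : GoodSeq I a (l - 1)) {b b' : R} (hb : b ∈ I)
    (hb' : b' ∈ I) (ht : I ^ (l - g + 1 + 1) ≤ (JJ a (l - 1) ⊔ Ideal.span {b}) * I ^ (l - g + 1)) {r : ℕ}
    (hr : I ^ (r + 1) ≤ (JJ a (l - 1) ⊔ Ideal.span {b'}) * I ^ r) :
    I ^ (l - g + 1 + 1) ≤ (JJ a (l - 1) ⊔ Ideal.span {b'}) * I ^ (l - g + 1) := by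
  have key : ∀ c, I ^ (l - g + 1 + c + 1) ≤ (JJ a (l - 1) ⊔ Ideal.span {b'}) * I ^ (l - g + 1 + c) →
      I ^ (l - g + 1 + 1) ≤ (JJ a (l - 1) ⊔ Ideal.span {b'}) * I ^ (l - g + 1) := by
    intro c
    induction c with
    | zero => exact id
    | succ c ih =>
      intro h
      apply ih
      intro y hy
      have h1 : b * y ∈ I ^ (l - g + 1 + (c + 1) + 1) := by
        rw [pow_succ']; exact Ideal.mul_mem_mul hb hy
      have h2 := h h1
      rw [Ideal.sup_mul, Submodule.mem_sup] at h2
      obtain ⟨w, hw, v, hv, hwv⟩ := h2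
      obtain ⟨z, hz, rfl⟩ := Ideal.mem_span_singleton_mul.1 hv
      have h3 := red_mono (r' := l - g + 1 + c) (by omega) ht hz
      rw [Ideal.sup_mul, Submodule.mem_sup] at h3
      obtain ⟨w1, hw1, v1, hv1, hwv1⟩ := h3
      obtain ⟨z1, hz1, rfl⟩ := Ideal.mem_span_singleton_mul.1 hv1
      have h4 : y - b' * z1 ∈ sat (JJ a (l - 1)) I := by
        refine reg_of_red ht _ (le_sat _ _ ?_)
        have : b * (y - b' * z1) = w + b' * w1 := by
          rw [mul_sub, ← hwv, ← hwv1]; ring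
        rw [this]
        exact Ideal.add_mem _ (Ideal.mul_le_left hw) (Ideal.mul_mem_left _ _ (Ideal.mul_le_left hw1))
      have h5 := V_top C ha hb ht (c + 1) _ h4 (Ideal.sub_mem _ hy (by
        rw [← add_assoc, pow_succ']; exact Ideal.mul_mem_mul hb' hz1))
      rw [Ideal.sup_mul, Submodule.mem_sup]
      exact ⟨_, h5, b' * z1, Ideal.mem_span_singleton_mul.2 ⟨z1, hz1, rfl⟩, by ring⟩
  exact key r (red_mono (by omega) hr)

lemma step_K [Infinite (ResidueField R)] (C : Ctx I g l d) (ha : GoodSeq I a (l - 1)) {b b' : R} (hb : b ∈ I)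
    (hb' : b' ∈ I) (ht : I ^ (l - g + 1 + 1) ≤ (JJ a (l - 1) ⊔ Ideal.span {b}) * I ^ (l - g + 1))
    (ht' : I ^ (l - g + 1 + 1) ≤ (JJ a (l - 1) ⊔ Ideal.span {b'}) * I ^ (l - g + 1)) :
    colI (JJ a (l - 1) ⊔ Ideal.span {b}) I ≤ colI (JJ a (l - 1) ⊔ Ideal.span {b'}) I := by
  intro x hx
  refine K_one C ha hb' (reg_of_red ht') x ?_
  intro y hy
  have h1 : b * y ∈ I ^ (l - g + 1 + 1) := by
    rw [pow_succ']; exact Ideal.mul_mem_mul hb hy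
  have h2 := ht' h1
  rw [Ideal.sup_mul, Submodule.mem_sup] at h2
  obtain ⟨w, hw, v, hv, hwv⟩ := h2
  obtain ⟨z, hz, rfl⟩ := Ideal.mem_span_singleton_mul.1 hv
  have h3 : ∀ z ∈ I ^ (l - g + 1), x * z ∈ (JJ a (l - 1) ⊔ Ideal.span {b}) * I ^ (l - g) := by
    intro z hz
    rw [pow_succ'] at hz
    refine Submodule.mul_induction_on hz ?_ ?_
    · intro p hp q hq
      rw [← mul_assoc]; exact Ideal.mul_mem_mul (hx p hp) hq
    · intro p q h1 h2; rw [mul_add]; exact Ideal.add_mem _ h1 h2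
  have h4 := h3 z hz
  rw [Ideal.sup_mul, Submodule.mem_sup] at h4
  obtain ⟨w1, hw1, v1, hv1, hwv1⟩ := h4
  obtain ⟨z1, hz1, rfl⟩ := Ideal.mem_span_singleton_mul.1 hv1
  have h4 : x * y - b' * z1 ∈ sat (JJ a (l - 1)) I := by
    refine reg_of_red ht _ (le_sat _ _ ?_)
    have : b * (x * y - b' * z1) = x * w + b' * w1 := by
      rw [mul_sub, mul_left_comm, ← hwv, mul_add, mul_left_comm x b', ← hwv1]; ring
    rw [this]
    exact Ideal.add_mem _ (Ideal.mul_mem_left _ _ (Ideal.mul_le_left hw))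
      (Ideal.mul_mem_left _ _ (Ideal.mul_le_left hw1))
  have h5 := V_top C ha hb ht 0 _ h4 (Ideal.sub_mem _ (Ideal.mul_mem_left _ _ hy) (by
        rw [add_zero, pow_succ']; exact Ideal.mul_mem_mul hb' hz1))
  rw [add_zero, Nat.add_sub_cancel] at h5
  rw [Ideal.sup_mul, Submodule.mem_sup]
  exact ⟨_, h5, b' * z1, Ideal.mem_span_singleton_mul.2 ⟨z1, hz1, rfl⟩, by ring⟩

/-- lower bound for reduction numbers -/
lemma r_ge [Infinite (ResidueField R)] (C : Ctx I g l d) (ha : GoodSeq I a (l - 1)) {b : R} (hb : b ∈ I)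
    {r : ℕ} (hr : I ^ (r + 1) ≤ (JJ a (l - 1) ⊔ Ideal.span {b}) * I ^ r) (hrl : r ≤ l - g) :
    I ≤ JJ a (l - 1) ⊔ Ideal.span {b} := by
  intro x hx
  have := K_one C ha hb (reg_of_red hr) 1 (fun y hy => by
    rw [one_mul]; exact red_mono hrl hr hy) x hx
  rwa [one_mul] at this
end Step

section Fwd
variable {R : Type u} [CommRing R] [IsLocalRing R] [IsNoetherianRing R]
variable {I : Ideal R} {g l d : ℕ} {a : ℕ → R}

lemma span_insert_fin [DecidableEq R] (T : Finset R) (a : R) :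
    Ideal.span ((insert a T : Finset R) : Set R) = Ideal.span (T : Set R) ⊔ Ideal.span {a} := by
  rw [Finset.coe_insert, Ideal.span_insert, sup_comm]

lemma span_union_fin [DecidableEq R] (T S : Finset R) :
    Ideal.span ((T ∪ S : Finset R) : Set R) = Ideal.span (T : Set R) ⊔ Ideal.span (S : Set R) := by
  rw [Finset.coe_union, Ideal.span_union]

lemma span_erase_fin [DecidableEq R] (S : Finset R) {j : R} (hj : j ∈ S) :
    Ideal.span (S : Set R) = Ideal.span ((S.erase j : Finset R) : Set R) ⊔ Ideal.span {j} := by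
  rw [← span_insert_fin, Finset.insert_erase hj]

lemma mem_sup_span {B : Ideal R} {x z : R} : z ∈ B ⊔ Ideal.span {x} ↔ ∃ w ∈ B, ∃ c : R, z = w + c * x := by
  rw [Submodule.mem_sup]
  constructor
  · rintro ⟨w, hw, v, hv, rfl⟩
    obtain ⟨c, rfl⟩ := Ideal.mem_span_singleton'.1 hv
    exact ⟨w, hw, c, rfl⟩
  · rintro ⟨w, hw, c, rfl⟩
    exact ⟨w, hw, c * x, Ideal.mul_mem_left _ _ (Ideal.mem_span_singleton_self x), rfl⟩

lemma fwd_step [Infinite (ResidueField R)] (D : RCtx I l) {J : Ideal R} (hJ : IsReduction J I)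
    (hJ1 : gen I (maximalIdeal R) J 1) {t : ℕ} (hnt : ¬ I ^ (t + 1) ≤ J * I ^ t)
    {i : ℕ} (hi : i + 1 < l) {B : Ideal R} {T S : Finset R} (hT : T.card ≤ i)
    (hB : B = Ideal.span (T : Set R)) (hBJ : B ≤ J) (hS : ∀ s ∈ S, s ∈ I) (hSc : S.card ≤ l - i)
    (hLt : I ^ (t + 1) ≤ (B ⊔ Ideal.span (S : Set R)) * I ^ t) :
    ∃ F : Set (Ideal R), F.Finite ∧ (∀ b ∈ F, ¬ J ≤ b) ∧ ∀ a ∈ J, (∀ b ∈ F, a ∉ b) →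
      ∃ S' : Finset R, (∀ s ∈ S', s ∈ I) ∧ S'.card ≤ l - (i + 1) ∧
        I ^ (t + 1) ≤ (B ⊔ Ideal.span {a} ⊔ Ideal.span (S' : Set R)) * I ^ t := by
  classical
  have hJI := hJ.1
  have hBI : B ≤ I := hBJ.trans hJI
  have hSI : Ideal.span (S : Set R) ≤ I := Ideal.span_le.2 hS
  set L := B ⊔ Ideal.span (S : Set R) with hL
  have hLI : L ≤ I := sup_le hBI hSI
  have hLT : L = Ideal.span ((T ∪ S : Finset R) : Set R) := by rw [span_union_fin, ← hB]
  have hcard : (T ∪ S).card ≤ T.card + S.card := Finset.card_union_le _ _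
  have hLred : IsReduction L I := red_of hLI hLt
  have hcl : l ≤ (T ∪ S).card := D.f1 _ (hLT ▸ hLred)
  have h1 : ¬ L ≤ J ⊔ maximalIdeal R * I := fun h => hnt (red_naka h hLt)
  obtain ⟨x, hxL, hxJ⟩ := Set.not_subset.1 h1
  have hIJx : I ≤ J ⊔ Ideal.span {x} := gen_zero_m (exch_m (hLI hxL) hJ1 hxJ)
  have mu : ∀ U : Finset R, U.card ≤ l → Ideal.span (U : Set R) ≤ I → ¬ I ≤ Ideal.span (U : Set R) ⊔ maximalIdeal R * I := by
    intro U hU hUI h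
    have := D.mu2 U (le_antisymm hUI (naka_m h))
    omega
  have h2 : ¬ J ≤ L ⊔ maximalIdeal R * I := by
    intro h
    refine mu (T ∪ S) (by omega) (hLT ▸ hLI) ?_
    rw [← hLT]
    refine hIJx.trans (sup_le h ?_)
    rw [Ideal.span_le, Set.singleton_subset_iff]
    exact Ideal.mem_sup_left hxL
  obtain ⟨y, hyJ, hyL⟩ := Set.not_subset.1 h2
  have hL1 : gen I (maximalIdeal R) L 1 := by
    obtain ⟨b, hb, hb2⟩ := D.struct hLred
    exact gen_mono hb2 (JJ_le fun j hj => (hb j hj).1) le_rfl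
  have hIL : I ≤ L ⊔ Ideal.span {y} := gen_zero_m (exch_m (hJI hyJ) hL1 hyL)
  have hyI := hJI hyJ
  have hBjI : ∀ j, B ⊔ Ideal.span ((S.erase j : Finset R) : Set R) ≤ I := fun j =>
    sup_le hBI (Ideal.span_le.2 fun s hs => hS s (Finset.mem_of_mem_erase hs))
  have hBjT : ∀ j, B ⊔ Ideal.span ((S.erase j : Finset R) : Set R) = Ideal.span ((T ∪ S.erase j : Finset R) : Set R) :=
    fun j => by rw [span_union_fin, ← hB]
  have hLj : ∀ j ∈ S, L = B ⊔ Ideal.span ((S.erase j : Finset R) : Set R) ⊔ Ideal.span {j} := by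
    intro j hj
    rw [sup_assoc, ← span_erase_fin S hj]
  have hcj : ∀ j ∈ S, (T ∪ S.erase j).card ≤ l - 1 := by
    intro j hj
    have := Finset.card_union_le T (S.erase j)
    rw [Finset.card_erase_of_mem hj] at this
    omega
  -- choose j
  obtain ⟨j, hjS, hj⟩ : ∃ j ∈ S, ¬ J ≤ B ⊔ Ideal.span ((S.erase j : Finset R) : Set R) ⊔ Ideal.span {y} ⊔ maximalIdeal R * I := by
    by_contra hcon
    push Not at hcon
    obtain ⟨j, hj, j', hj', hne⟩ := Finset.one_lt_card.1 (show 1 < S.card by omega)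
    have hj'e : j' ∈ S.erase j := Finset.mem_erase.2 ⟨hne.symm, hj'⟩
    have hJle : J ≤ (B ⊔ Ideal.span (((S.erase j).erase j' : Finset R) : Set R) ⊔ Ideal.span {y}) ⊔ maximalIdeal R * I := by
      intro z hz
      have hz1 := hcon j hj hz
      have hz2 := hcon j' hj' hz
      rw [span_erase_fin _ hj'e, ← sup_assoc, sup_assoc, sup_assoc, sup_comm (Ideal.span {j'}), ← sup_assoc, mem_sup_span] at hz1
      obtain ⟨w, hw, c, rfl⟩ := hz1
      rw [← sup_assoc] at hw
      refine Ideal.add_mem _ hw (Ideal.mem_sup_right (Ideal.mul_mem_mul ?_ (hS _ hj')))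
      by_contra hc
      have h3 : c * j' ∈ B ⊔ Ideal.span ((S.erase j' : Finset R) : Set R) ⊔ Ideal.span {y} ⊔ maximalIdeal R * I := by
        have := Ideal.sub_mem _ hz2 ((sup_le_sup_right (sup_le_sup_right (sup_le_sup_left (Ideal.span_mono (by
          rw [Finset.coe_subset]
          exact Finset.erase_subset_erase j' (Finset.erase_subset j S))) B) (Ideal.span {y})) (maximalIdeal R * I) :
            B ⊔ Ideal.span (((S.erase j).erase j' : Finset R) : Set R) ⊔ Ideal.span {y} ⊔ maximalIdeal R * I ≤ _) hw)
        rwa [add_sub_cancel_left] at this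
      have h4 := mem_of_unit_mul hc h3
      refine mu (insert y (T ∪ S.erase j')) ?_ ?_ ?_
      · have := Finset.card_insert_le y (T ∪ S.erase j')
        have := hcj j' hj'
        omega
      · rw [span_insert_fin, ← hBjT]
        exact sup_le (hBjI j') (by rwa [Ideal.span_le, Set.singleton_subset_iff])
      · rw [span_insert_fin, ← hBjT]
        refine hIL.trans (sup_le ?_ (le_sup_of_le_left le_sup_right))
        rw [hLj j' hj']
        refine sup_le (le_sup_of_le_left le_sup_left) ?_
        rwa [Ideal.span_le, Set.singleton_subset_iff]
    obtain ⟨r, hr⟩ := hJ.2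
    have := D.f1' (q := l - 1) (S := insert y (T ∪ (S.erase j).erase j')) (by rw [span_insert_fin, span_union_fin, ← hB]) (by
      have h5 := Finset.card_insert_le y (T ∪ (S.erase j).erase j')
      have h6 := Finset.card_union_le T ((S.erase j).erase j')
      rw [Finset.card_erase_of_mem hj'e, Finset.card_erase_of_mem hj] at h6
      omega) (sup_le (sup_le hBI (Ideal.span_le.2 fun s hs => hS s (Finset.mem_of_mem_erase (Finset.mem_of_mem_erase hs)))) (by rwa [Ideal.span_le, Set.singleton_subset_iff])) (r := r) (hr.le.trans (Ideal.mul_mono_left hJle))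
    omega
  set Bj := B ⊔ Ideal.span ((S.erase j : Finset R) : Set R) with hBj
  have hBL : Bj ⊔ maximalIdeal R * I ≤ L ⊔ maximalIdeal R * I := by
    rw [hLj j hjS]
    exact sup_le_sup_right le_sup_left _
  have hjB : j ∉ Bj ⊔ maximalIdeal R * I := by
    intro h
    have := D.f1' (q := l - 1) (hBjT j) (hcj j hjS) (hBjI j) (r := t) (hLt.trans (Ideal.mul_mono_left (by
      rw [hLj j hjS]
      refine sup_le le_sup_left ?_
      rwa [Ideal.span_le, Set.singleton_subset_iff])))
    omega
  obtain ⟨E, hE0, hE⟩ := fin_good (B := Bj) (x := j) (y := y) hyI (by rw [← hLj j hjS]; exact hLt)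
  obtain ⟨lift, hlift⟩ : ∃ f : ResidueField R → R, ∀ e, residue R (f e) = e :=
    ⟨Function.surjInv residue_surjective, Function.surjInv_eq _⟩
  refine ⟨insert (Bj ⊔ Ideal.span {y} ⊔ maximalIdeal R * I) ((fun e => Bj ⊔ maximalIdeal R * I ⊔ Ideal.span {j + lift e * y}) '' (E : Set _)),
    (E.finite_toSet.image _).insert _, ?_, ?_⟩
  · rintro b (rfl | ⟨e, he, rfl⟩) h
    · exact hj h
    · have h3 := h hyJ
      rw [mem_sup_span] at h3
      obtain ⟨w, hw, c, hc⟩ := h3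
      have hcu : c ∉ maximalIdeal R := by
        intro hcm
        apply hyL
        rw [hc]
        refine Ideal.add_mem _ (hBL hw) (Ideal.mem_sup_right (Ideal.mul_mem_mul hcm ?_))
        exact Ideal.add_mem _ (hS _ hjS) (Ideal.mul_mem_left _ _ hyI)
      have h4 : (1 - c * lift e) ∈ maximalIdeal R := by
        by_contra h5
        apply hyL
        refine mem_of_unit_mul h5 ?_
        have : (1 - c * lift e) * y = w + c * j := by linear_combination hc
        rw [this]
        refine Ideal.add_mem _ (hBL hw) (Ideal.mem_sup_left (Ideal.mul_mem_left _ _ ?_))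
        rw [hLj j hjS]
        exact Ideal.mem_sup_right (Ideal.mem_span_singleton_self j)
      apply hjB
      refine mem_of_unit_mul hcu ?_
      have : c * j = (1 - c * lift e) * y - w := by linear_combination -hc
      rw [this]
      exact Ideal.sub_mem _ (Ideal.mem_sup_right (Ideal.mul_mem_mul h4 hyI)) hw
  · intro a ha hF
    have hF1 := hF _ (Set.mem_insert _ _)
    have haI := hIL (hJI ha)
    rw [hLj j hjS, mem_sup_span] at haI
    obtain ⟨w1, hw1, c, hc⟩ := haI
    obtain ⟨w, hw, e, rfl⟩ := mem_sup_span.1 hw1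
    have heu : e ∉ maximalIdeal R := by
      intro hem
      apply hF1
      rw [hc]
      refine Ideal.add_mem _ (Ideal.add_mem _ (Ideal.mem_sup_left (Ideal.mem_sup_left hw)) (Ideal.mem_sup_right (Ideal.mul_mem_mul hem (hS _ hjS)))) ?_
      exact Ideal.mem_sup_left (Ideal.mem_sup_right (Ideal.mul_mem_left _ _ (Ideal.mem_span_singleton_self y)))
    have heU : IsUnit e := by simpa using heu
    obtain ⟨e', he'⟩ := heU.exists_right_inv
    have hnE : residue R (c * e') ∉ E := by
      intro hmem
      apply hF _ (Set.mem_insert_of_mem _ ⟨_, hmem, rfl⟩)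
      set q := lift (residue R (c * e')) with hq
      have hq2 : c * e' - q ∈ maximalIdeal R := by
        rw [← residue_eq_zero_iff, map_sub, hq, hlift, sub_self]
      have : a = w + (c * e' - q) * (e * y) + e * (j + q * y) := by
        rw [hc]; linear_combination (- c * y) * he'
      rw [this]
      refine Ideal.add_mem _ (Ideal.mem_sup_left (Ideal.add_mem _ (Ideal.mem_sup_left hw) (Ideal.mem_sup_right (Ideal.mul_mem_mul hq2 (Ideal.mul_mem_left _ _ hyI))))) ?_
      exact Ideal.mem_sup_right (Ideal.mul_mem_left _ _ (Ideal.mem_span_singleton_self _))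
    refine ⟨S.erase j, fun s hs => hS s (Finset.mem_of_mem_erase hs), ?_, (hE _ hnE).trans (Ideal.mul_mono_left ?_)⟩
    · rw [Finset.card_erase_of_mem hjS]; omega
    · have hle : Bj ≤ B ⊔ Ideal.span {a} ⊔ Ideal.span ((S.erase j : Finset R) : Set R) :=
        sup_le_sup_right le_sup_left _
      refine sup_le hle ?_
      rw [Ideal.span_le, Set.singleton_subset_iff]
      refine mem_of_unit_mul heu ?_
      have : e * (j + c * e' * y) = a - w := by
        rw [hc]; linear_combination (c * y) * he'
      rw [this]
      exact Ideal.sub_mem _ (Ideal.mem_sup_left (Ideal.mem_sup_right (Ideal.mem_span_singleton_self a))) (hle hw)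

lemma RCtx.gen_min (D : RCtx I l) {J : Ideal R} (hJ : IsMinimalReduction J I) :
    gen J (maximalIdeal R) ⊥ l := by
  obtain ⟨b, hb, -⟩ := D.min_struct hJ
  obtain ⟨S, hS, hS2⟩ := JJ_finset b l
  refine gen_mono (gen_of_m (I := J) (B := ⊥) (S := S) ?_ ?_) le_rfl hS
  · intro s hs
    rw [hb, ← hS2]; exact Ideal.subset_span hs
  · rw [hS2, ← hb]; exact le_sup_right

lemma RCtx.gen_one (D : RCtx I l) {J : Ideal R} (hJ : IsReduction J I) :
    gen I (maximalIdeal R) J 1 := by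
  obtain ⟨b, hb, hb2⟩ := D.struct hJ
  exact gen_mono hb2 (JJ_le fun j hj => (hb j hj).1) le_rfl

lemma gen_v {J : Ideal R} (hJ : gen J (maximalIdeal R) ⊥ l) {v : R} (hv : v ∈ J)
    (hv2 : v ∉ maximalIdeal R * J) : gen J (maximalIdeal R) (Ideal.span {v}) (l - 1) := by
  have := exch_m hv hJ (by rwa [bot_sup_eq])
  rwa [bot_sup_eq] at this

/-- all minimal reductions are `t`-good as soon as one is -/
lemma all_good [Infinite (ResidueField R)] (C : Ctx I g l d) (D : RCtx I l) {J0 J : Ideal R}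
    (hJ0 : IsMinimalReduction J0 I) (h0 : I ^ (l - g + 1 + 1) ≤ J0 * I ^ (l - g + 1))
    (hJ : IsMinimalReduction J I) : I ^ (l - g + 1 + 1) ≤ J * I ^ (l - g + 1) := by
  classical
  by_contra hnt
  have hl1 := C.hl1
  obtain ⟨b, hb, hb2, -⟩ := D.min_struct hJ
  have hv : b 0 ∈ J := by rw [hb]; exact mem_JJ b hl1
  have hv2 : b 0 ∉ maximalIdeal R * J := by
    intro h
    apply hb2 0 hl1
    exact Ideal.mem_sup_right (Ideal.mul_mono_right hJ.1.1 h)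
  obtain ⟨b0, hb0, -⟩ := D.min_struct hJ0
  obtain ⟨S0, hS0, hS02⟩ := JJ_finset b0 l
  obtain ⟨a, ha, hJa, -, S, hSI, hSc, hSt⟩ := good_in C hJ.1 hv (gen_v (D.gen_min hJ) hv hv2)
    (fun i B => (∃ T : Finset R, T.card ≤ i ∧ B = Ideal.span (T : Set R)) ∧
      ∃ S : Finset R, (∀ s ∈ S, s ∈ I) ∧ S.card ≤ l - i ∧
        I ^ (l - g + 1 + 1) ≤ (B ⊔ Ideal.span (S : Set R)) * I ^ (l - g + 1))
    ⟨⟨∅, by simp, by simp⟩, S0, fun s hs => hJ0.1.1 (by rw [hb0, ← hS02]; exact Ideal.subset_span hs), by simpa using hS0, by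
      rw [bot_sup_eq, hS02, ← hb0]; exact h0⟩
    (by
      rintro i B hi hBJ ⟨⟨T, hT, hBT⟩, S, hSI, hSc, hSt⟩
      obtain ⟨F, hF1, hF2, hF3⟩ := fwd_step D hJ.1 (D.gen_one hJ.1) hnt hi hT hBT hBJ hSI hSc hSt
      refine ⟨F, hF1, hF2, fun a ha haF => ⟨⟨insert a T, ?_, ?_⟩, hF3 a ha haF⟩⟩
      · have := Finset.card_insert_le a T
        omega
      · rw [span_insert_fin, hBT])
  have hSne : ∃ x ∈ I, Ideal.span (S : Set R) ≤ Ideal.span {x} := by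
    rcases S.eq_empty_or_nonempty with rfl | ⟨x, hx⟩
    · exact ⟨0, I.zero_mem, by simp⟩
    · refine ⟨x, hSI x hx, Ideal.span_mono fun y hy => ?_⟩
      exact Finset.card_le_one.1 (show S.card ≤ 1 by omega) y hy x hx
  obtain ⟨x, hx, hSx⟩ := hSne
  have h1 := hSt.trans (Ideal.mul_mono_left (sup_le_sup_left hSx _))
  obtain ⟨r, hr⟩ := hJ.1.2
  rw [hJa] at hr
  have := step_red C ha hx (hJ.1.1 hv) h1 hr.le
  rw [← hJa] at this
  exact hnt this

end Fwd

section Rel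
variable {R : Type u} [CommRing R] [IsLocalRing R] [IsNoetherianRing R]
variable {I : Ideal R} {g l d : ℕ} {a : ℕ → R}

lemma mem_JJ_iff (a : ℕ → R) (i : ℕ) (z : R) :
    z ∈ JJ a i ↔ ∃ c : ℕ → R, z = ∑ j ∈ Finset.range i, c j * a j := by
  constructor
  · induction i generalizing z with
    | zero => 
      intro h
      rw [JJ_zero, Ideal.mem_bot] at h
      exact ⟨0, by simp [h]⟩
    | succ i ih =>
      intro h
      rw [JJ_succ, mem_sup_span] at h
      obtain ⟨w, hw, c, rfl⟩ := h
      obtain ⟨q, rfl⟩ := ih w hw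
      refine ⟨Function.update q i c, ?_⟩
      rw [Finset.sum_range_succ]
      congr 1
      · refine Finset.sum_congr rfl fun j hj => ?_
        rw [Function.update_of_ne (Finset.mem_range.1 hj).ne]
      · simp
  · rintro ⟨c, rfl⟩
    exact Ideal.sum_mem _ fun j hj => Ideal.mul_mem_left _ _ (mem_JJ a (Finset.mem_range.1 hj))

/-- minimal generators are independent modulo the maximal ideal -/
lemma RCtx.indep (D : RCtx I l) {e : ℕ → R} (hI : I = JJ e (l + 1)) (c : ℕ → R)
    (hc : ∑ j ∈ Finset.range (l + 1), c j * e j ∈ maximalIdeal R * I) :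
    ∀ j < l + 1, c j ∈ maximalIdeal R := by
  classical
  intro j hj
  by_contra h
  set S := ((Finset.range (l + 1)).erase j).image e with hS
  have heI : ∀ i < l + 1, e i ∈ I := fun i hi => by rw [hI]; exact mem_JJ e hi
  have hSc : S.card ≤ l := by
    refine Finset.card_image_le.trans ?_
    rw [Finset.card_erase_of_mem (Finset.mem_range.2 hj), Finset.card_range]; omega
  have hej : e j ∈ Ideal.span (S : Set R) ⊔ maximalIdeal R * I := by
    refine mem_of_unit_mul h ?_
    rw [← Finset.add_sum_erase _ _ (Finset.mem_range.2 hj)] at hc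
    have h2 : ∑ i ∈ (Finset.range (l + 1)).erase j, c i * e i ∈ Ideal.span (S : Set R) ⊔ maximalIdeal R * I :=
      Ideal.sum_mem _ fun i hi => Ideal.mul_mem_left _ _ (Ideal.mem_sup_left (Ideal.subset_span
        (by rw [hS, Finset.coe_image]; exact ⟨i, hi, rfl⟩)))
    have := Ideal.sub_mem _ (Ideal.mem_sup_right (S := Ideal.span (S : Set R)) hc) h2
    rwa [add_sub_cancel_right] at this
  have hIS : I ≤ Ideal.span (S : Set R) := by
    refine naka_m ?_
    conv_lhs => rw [hI]
    refine JJ_le fun i hi => ?_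
    by_cases hij : i = j
    · rw [hij]; exact hej
    · refine Ideal.mem_sup_left (Ideal.subset_span ?_)
      rw [hS, Finset.coe_image]
      exact ⟨i, by simp [hij, hi], rfl⟩
  have := D.mu2 S (le_antisymm (Ideal.span_le.2 (by
    intro x hx
    rw [hS, Finset.coe_image] at hx
    obtain ⟨i, hi, rfl⟩ := hx
    exact heI i (Finset.mem_range.1 (Finset.mem_of_mem_erase hi)))) hIS)
  omega

/-- ideal of coefficients of relations -/
def Rel (e : ℕ → R) (n : ℕ) : Ideal R :=
  Ideal.span {x | ∃ c : ℕ → R, ∃ j < n, ∑ i ∈ Finset.range n, c i * e i = 0 ∧ x = c j}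

lemma mem_Rel {e : ℕ → R} {n : ℕ} (c : ℕ → R) (h : ∑ i ∈ Finset.range n, c i * e i = 0) {j : ℕ} (hj : j < n) :
    c j ∈ Rel e n := Ideal.subset_span ⟨c, j, hj, h, rfl⟩

lemma RCtx.rel_le (D : RCtx I l) {e e' : ℕ → R} (hI : I = JJ e (l + 1)) (hI' : I = JJ e' (l + 1)) :
    Rel e (l + 1) ≤ Rel e' (l + 1) := by
  classical
  refine naka_m (Ideal.span_le.2 ?_)
  rintro x ⟨c, k, hk, hc, rfl⟩
  have h1 : ∀ i, ∃ θ : ℕ → R, i < l + 1 → e i = ∑ j ∈ Finset.range (l + 1), θ j * e' j := by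
    intro i
    by_cases hi : i < l + 1
    · have : e i ∈ JJ e' (l + 1) := by rw [← hI', hI]; exact mem_JJ e hi
      obtain ⟨θ, h⟩ := (mem_JJ_iff _ _ _).1 this
      exact ⟨θ, fun _ => h⟩
    · exact ⟨0, fun h => absurd h hi⟩
  have h2 : ∀ i, ∃ θ : ℕ → R, i < l + 1 → e' i = ∑ j ∈ Finset.range (l + 1), θ j * e j := by
    intro i
    by_cases hi : i < l + 1
    · have : e' i ∈ JJ e (l + 1) := by rw [← hI, hI']; exact mem_JJ e' hi
      obtain ⟨θ, h⟩ := (mem_JJ_iff _ _ _).1 this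
      exact ⟨θ, fun _ => h⟩
    · exact ⟨0, fun h => absurd h hi⟩
  choose θ hθ using h1
  choose η hη using h2
  have h3 : ∑ j ∈ Finset.range (l + 1), (∑ i ∈ Finset.range (l + 1), c i * θ i j) * e' j = 0 := by
    rw [← hc]
    simp_rw [Finset.sum_mul]
    rw [Finset.sum_comm]
    refine Finset.sum_congr rfl fun i hi => ?_
    rw [hθ i (Finset.mem_range.1 hi), Finset.mul_sum]
    simp_rw [mul_assoc]
  have h4 : ∑ j ∈ Finset.range (l + 1), (∑ i ∈ Finset.range (l + 1), c i * θ i j) * η j k ∈ Rel e' (l + 1) :=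
    Ideal.sum_mem _ fun j hj => Ideal.mul_mem_right _ _ (mem_Rel (fun j => ∑ i ∈ Finset.range (l + 1), c i * θ i j) h3 (Finset.mem_range.1 hj))
  have h5 : ∀ i < l + 1, ((if i = k then 1 else 0) - ∑ j ∈ Finset.range (l + 1), θ i j * η j k) ∈ maximalIdeal R := by
    intro i hi
    refine D.indep hI (fun k => (if i = k then 1 else 0) - ∑ j ∈ Finset.range (l + 1), θ i j * η j k) ?_ k hk
    have : ∑ k ∈ Finset.range (l + 1), ((if i = k then 1 else 0) - ∑ j ∈ Finset.range (l + 1), θ i j * η j k) * e k = 0 := by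
      simp_rw [sub_mul]
      rw [Finset.sum_sub_distrib]
      simp only [ite_mul, one_mul, zero_mul, Finset.sum_ite_eq, Finset.mem_range, hi, if_true]
      rw [sub_eq_zero, hθ i hi]
      simp_rw [Finset.sum_mul]
      rw [Finset.sum_comm]
      refine Finset.sum_congr rfl fun j hj => ?_
      rw [hη j (Finset.mem_range.1 hj), Finset.mul_sum]
      simp_rw [mul_assoc]
    rw [this]
    exact Ideal.zero_mem _
  have h6 : c k = ∑ j ∈ Finset.range (l + 1), (∑ i ∈ Finset.range (l + 1), c i * θ i j) * η j k +
      ∑ i ∈ Finset.range (l + 1), ((if i = k then 1 else 0) - ∑ j ∈ Finset.range (l + 1), θ i j * η j k) * c i := by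
    simp_rw [sub_mul]
    rw [Finset.sum_sub_distrib]
    simp only [ite_mul, one_mul, zero_mul, Finset.sum_ite_eq', Finset.mem_range, hk, if_true]
    simp_rw [Finset.sum_mul]
    rw [Finset.sum_comm (s := Finset.range (l+1)) (t := Finset.range (l+1)) (f := fun j i => c i * θ i j * η j k)]
    rw [add_sub, eq_sub_iff_add_eq, add_comm]
    congr 1
    refine Finset.sum_congr rfl fun i hi => Finset.sum_congr rfl fun j hj => by ring
  rw [h6]
  refine Ideal.add_mem _ (Ideal.mem_sup_left h4) (Ideal.mem_sup_right (Ideal.sum_mem _ fun i hi => ?_))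
  exact Ideal.mul_mem_mul (h5 i (Finset.mem_range.1 hi)) (mem_Rel c hc (Finset.mem_range.1 hi))

lemma K_le_rel {e : ℕ → R} (hI : I = JJ e (l + 1)) : colI (JJ e l) I ≤ Rel e (l + 1) := by
  intro x hx
  have h1 := hx (e l) (by rw [hI]; exact mem_JJ e (Nat.lt_succ_self l))
  obtain ⟨c, hc⟩ := (mem_JJ_iff _ _ _).1 h1
  have := mem_Rel (e := e) (n := l + 1) (Function.update (-c) l x) (by
    rw [Finset.sum_range_succ, Function.update_self, hc, ← Finset.sum_add_distrib]
    refine Finset.sum_eq_zero fun j hj => ?_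
    rw [Function.update_of_ne (Finset.mem_range.1 hj).ne]
    simp) (Nat.lt_succ_self l)
  rwa [Function.update_self] at this

lemma exists_unit_avoid [Infinite (ResidueField R)] (E : Finset (ResidueField R)) :
    ∃ s : R, s ∉ maximalIdeal R ∧ residue R s ∉ E := by
  classical
  obtain ⟨x, hx⟩ := Infinite.exists_notMem_finset (insert 0 E)
  obtain ⟨s, rfl⟩ := residue_surjective x
  rw [Finset.mem_insert, not_or] at hx
  exact ⟨s, fun h => hx.1 ((residue_eq_zero_iff _).2 h), hx.2⟩

lemma rel_le_K [Infinite (ResidueField R)] (C : Ctx I g l d) (D : RCtx I l) {e : ℕ → R}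
    (hI : I = JJ e (l + 1)) (hJ : IsMinimalReduction (JJ e l) I)
    (hJt : I ^ (l - g + 1 + 1) ≤ JJ e l * I ^ (l - g + 1)) : Rel e (l + 1) ≤ colI (JJ e l) I := by
  classical
  set J := JJ e l with hJdef
  set K := colI J I with hK
  have heI : ∀ i < l + 1, e i ∈ I := fun i hi => by rw [hI]; exact mem_JJ e hi
  have hIJ : I = J ⊔ Ideal.span {e l} := by rw [hI, JJ_succ]
  refine Ideal.span_le.2 ?_
  rintro x ⟨c, k, hk, hc, rfl⟩
  rw [Finset.sum_range_succ] at hc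
  have hcl : c l ∈ K := by
    rw [hK, mem_colI]
    intro y hy
    rw [hIJ, mem_sup_span] at hy
    obtain ⟨w, hw, q, rfl⟩ := hy
    have : c l * e l ∈ J := by
      rw [eq_neg_of_add_eq_zero_right hc]
      exact neg_mem ((mem_JJ_iff _ _ _).2 ⟨c, rfl⟩)
    rw [mul_add]
    exact Ideal.add_mem _ (Ideal.mul_mem_left _ _ hw) (by rw [mul_left_comm]; exact Ideal.mul_mem_left _ _ this)
  rcases Nat.lt_succ_iff_lt_or_eq.1 hk with hk | rfl
  swap
  · exact hcl
  by_contra hck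
  set dd := K ⊔ JJ c l with hdd
  obtain ⟨K', ⟨hKK', hK'd⟩, hmax⟩ := set_has_maximal_iff_noetherian.2 ‹IsNoetherianRing R› {K' : Ideal R | K ≤ K' ∧ K' < dd}
    ⟨K, le_rfl, lt_of_le_of_ne le_sup_left (fun h => hck (by
      show c k ∈ K
      rw [h]; exact Ideal.mem_sup_right (mem_JJ c hk)))⟩
  obtain ⟨i0, hi0, hi0K⟩ : ∃ i0 < l, c i0 ∉ K' := by
    by_contra hcon
    push Not at hcon
    exact hK'd.not_ge (sup_le hKK' (JJ_le hcon))
  have hd : dd ≤ K' ⊔ Ideal.span {c i0} := by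
    have h1 : K' ⊔ Ideal.span {c i0} ≤ dd := sup_le hK'd.le (by
      rw [Ideal.span_le, Set.singleton_subset_iff]; exact Ideal.mem_sup_right (mem_JJ c hi0))
    by_contra h2
    refine hmax (K' ⊔ Ideal.span {c i0}) ⟨hKK'.trans le_sup_left, lt_of_le_not_ge h1 h2⟩ ?_
    refine lt_of_le_not_ge le_sup_left fun h => hi0K (h (Ideal.mem_sup_right (Ideal.mem_span_singleton_self _)))
  have h1 : ∀ i, ∃ k δ : R, i < l → k ∈ K' ∧ c i = k + δ * c i0 ∧ (i = i0 → δ = 1) := by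
    intro i
    by_cases hi : i < l
    · by_cases hii : i = i0
      · exact ⟨0, 1, fun _ => ⟨K'.zero_mem, by rw [hii]; ring, fun _ => rfl⟩⟩
      · obtain ⟨w, hw, q, h⟩ := mem_sup_span.1 (hd (Ideal.mem_sup_right (mem_JJ c hi)))
        exact ⟨w, q, fun _ => ⟨hw, h, fun h => absurd h hii⟩⟩
    · exact ⟨0, 0, fun h => absurd h hi⟩
  choose k' δ hkδ using h1
  set v := ∑ j ∈ Finset.range l, δ j * e j with hv
  have hvJ : v ∈ J := (mem_JJ_iff _ _ _).2 ⟨δ, rfl⟩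
  have hvm : v ∉ maximalIdeal R * J := by
    intro h
    have h2 := D.indep hI (Function.update δ l 0) (by
      rw [Finset.sum_range_succ, Function.update_self, zero_mul, add_zero]
      rw [Finset.sum_congr rfl (g := fun j => δ j * e j) fun j hj => by rw [Function.update_of_ne (Finset.mem_range.1 hj).ne]]
      exact Ideal.mul_mono_right hJ.1.1 h) i0 (by omega)
    rw [Function.update_of_ne hi0.ne, (hkδ i0 hi0).2.2 rfl] at h2
    exact (Ideal.ne_top_iff_one _).1 (maximalIdeal.isMaximal R).ne_top h2
  obtain ⟨a, ha, hJa, -⟩ := good_in C hJ.1 hvJ (gen_v (D.gen_min hJ) hvJ hvm) (fun _ _ => True) trivial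
    (fun i B _ _ _ => ⟨∅, Set.finite_empty, by simp, fun _ _ _ => trivial⟩)
  set W := JJ a (l - 1) with hW
  have h2 : ∀ i, ∃ w ε : R, i < l → w ∈ W ∧ e i = w + ε * v := by
    intro i
    by_cases hi : i < l
    · have : e i ∈ W ⊔ Ideal.span {v} := by rw [← hJa]; exact mem_JJ e hi
      obtain ⟨w, hw, q, h⟩ := mem_sup_span.1 this
      exact ⟨w, q, fun _ => ⟨hw, h⟩⟩
    · exact ⟨0, 0, fun h => absurd h hi⟩
  choose w ε hwε using h2
  set uu := c i0 + ∑ i ∈ Finset.range l, k' i * ε i with huu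
  have h3 : uu * v + c l * e l ∈ W := by
    have : uu * v + c l * e l = - ∑ i ∈ Finset.range l, k' i * w i := by
      have h4 : ∑ j ∈ Finset.range l, c j * e j = c i0 * v + ∑ i ∈ Finset.range l, k' i * w i + (∑ i ∈ Finset.range l, k' i * ε i) * v := by
        rw [hv, Finset.mul_sum, ← hv, Finset.sum_mul, ← Finset.sum_add_distrib, ← Finset.sum_add_distrib]
        refine Finset.sum_congr rfl fun j hj => ?_
        have hj := Finset.mem_range.1 hj
        have h5 := (hkδ j hj).2.1
        have h6 := (hwε j hj).2
        linear_combination e j * h5 + k' j * h6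
      rw [huu]
      linear_combination hc - h4
    rw [this]
    exact neg_mem (Ideal.sum_mem _ fun i hi => Ideal.mul_mem_left _ _ (hwε i (Finset.mem_range.1 hi)).1)
  have helI := heI l (by omega)
  rw [hJa] at hJt
  obtain ⟨E, -, hE⟩ := fin_good (B := W) (x := v) (y := e l) helI hJt
  obtain ⟨s, hs, hsE⟩ := exists_unit_avoid E
  have hst := hE s hsE
  have hvI : v ∈ I := hJ.1.1 hvJ
  have hstep := step_K C ha (Ideal.add_mem _ hvI (Ideal.mul_mem_left _ s helI)) hvI hst hJt
  rw [← hW, ← hJa, ← hK] at hstep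
  have h4 : c l - s * uu ∈ colI (W ⊔ Ideal.span {v + s * e l}) I := by
    rw [mem_colI]
    have h5 : (c l - s * uu) * e l ∈ W ⊔ Ideal.span {v + s * e l} := by
      have : (c l - s * uu) * e l = (uu * v + c l * e l) + (-uu) * (v + s * e l) := by ring
      rw [this]
      exact mem_sup_span.2 ⟨_, h3, _, rfl⟩
    intro y hy
    rw [hIJ, hJa, mem_sup_span] at hy
    obtain ⟨w1, hw1, q, rfl⟩ := hy
    obtain ⟨w2, hw2, p, rfl⟩ := mem_sup_span.1 hw1
    have : (c l - s * uu) * (w2 + p * v + q * e l) = (c l - s * uu) * w2 + (q - p * s) * ((c l - s * uu) * e l)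
      + ((c l - s * uu) * p) * (v + s * e l) := by ring
    rw [this]
    refine Ideal.add_mem _ (Ideal.add_mem _ (Ideal.mem_sup_left (Ideal.mul_mem_left _ _ hw2)) (Ideal.mul_mem_left _ _ h5)) (Ideal.mem_sup_right (Ideal.mul_mem_left _ _ (Ideal.mem_span_singleton_self _)))
  have h5 := Ideal.sub_mem _ hcl (hstep h4)
  rw [sub_sub_cancel] at h5
  have h6 : uu ∈ K' := hKK' (mem_of_unit_mul hs h5)
  apply hi0K
  have h7 : ∑ i ∈ Finset.range l, k' i * ε i ∈ K' := Ideal.sum_mem _ fun i hi => Ideal.mul_mem_right _ _ (hkδ i (Finset.mem_range.1 hi)).1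
  have := Ideal.sub_mem _ h6 h7
  rwa [huu, add_sub_cancel_right] at this

end Rel

section Fwd2
variable {R : Type u} [CommRing R] [IsLocalRing R] [IsNoetherianRing R]
variable {I : Ideal R} {g l d : ℕ} {a : ℕ → R}

lemma RCtx.min_e (D : RCtx I l) {J : Ideal R} (hJ : IsMinimalReduction J I) :
    ∃ e : ℕ → R, J = JJ e l ∧ I = JJ e (l + 1) := by
  obtain ⟨b, hb, -, x, hx, -, hI⟩ := D.min_struct hJ
  have h1 : JJ (Function.update b l x) l = JJ b l :=
    JJ_congr fun j hj => Function.update_of_ne hj.ne _ _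
  refine ⟨Function.update b l x, by rw [h1, hb], ?_⟩
  rw [JJ_succ, h1, Function.update_self, ← hb, hI]

lemma RCtx.exists_min (D : RCtx I l) : ∃ J, IsMinimalReduction J I := by
  obtain ⟨L, hL, hLI⟩ := D.f2
  obtain ⟨b, hb, hb2⟩ := D.struct hL
  have hbL : JJ b l ≤ L := JJ_le fun j hj => (hb j hj).1
  have h1 : L ≤ JJ b l ⊔ maximalIdeal R * I := by
    by_contra h
    obtain ⟨x, hx, hx2⟩ := Set.not_subset.1 h
    have := gen_zero_m (exch_m (hL.1 hx) hb2 hx2)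
    refine hLI (le_antisymm hL.1 (this.trans (sup_le hbL ?_)))
    rwa [Ideal.span_le, Set.singleton_subset_iff]
  obtain ⟨r, hr⟩ := hL.2
  have h2 := red_of (hbL.trans hL.1) (red_naka h1 hr.le)
  refine ⟨JJ b l, D.min_of h2 ?_⟩
  obtain ⟨S, hS, hS2⟩ := JJ_finset b l
  refine gen_mono (gen_of_m (I := JJ b l) (B := ⊥) (S := S) ?_ ?_) le_rfl hS
  · intro s hs
    rw [← hS2]; exact Ideal.subset_span hs
  · rw [hS2]; exact le_sup_right

lemma core_le_rel [Infinite (ResidueField R)] (D : RCtx I l) {e : ℕ → R} 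
    (hI : I = JJ e (l + 1)) (hJ : IsMinimalReduction (JJ e l) I) {t : ℕ}
    (hJt : I ^ (t + 1) ≤ JJ e l * I ^ t) : core I ≤ Rel e (l + 1) * I := by
  classical
  intro x hx
  have hcore : ∀ J, IsMinimalReduction J I → x ∈ J := fun J hJ => (Ideal.mem_sInf.1 hx) hJ
  have heI : ∀ i < l + 1, e i ∈ I := fun i hi => by rw [hI]; exact mem_JJ e hi
  obtain ⟨c, hc⟩ := (mem_JJ_iff _ _ _).1 (hcore _ hJ)
  rw [hc]
  refine Ideal.sum_mem _ fun i hi => ?_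
  have hi := Finset.mem_range.1 hi
  refine Ideal.mul_mem_mul ?_ (heI i (by omega))
  set B := Ideal.span (((Finset.range l).erase i).image e : Set R) with hB
  have hJB : JJ e l ≤ B ⊔ Ideal.span {e i} := by
    refine JJ_le fun j hj => ?_
    by_cases hji : j = i
    · rw [hji]; exact Ideal.mem_sup_right (Ideal.mem_span_singleton_self _)
    · refine Ideal.mem_sup_left (Ideal.subset_span ?_)
      rw [Finset.coe_image]
      exact ⟨j, by simp [hji, hj], rfl⟩
  have hBJ : ∀ z, B ⊔ Ideal.span {z} ≤ JJ (Function.update e i z) l := by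
    intro z
    refine sup_le (Ideal.span_le.2 ?_) ?_
    · intro y hy
      rw [Finset.coe_image] at hy
      obtain ⟨j, hj, rfl⟩ := hy
      have hj := Finset.mem_erase.1 (Finset.mem_coe.1 hj)
      have := mem_JJ (Function.update e i z) (Finset.mem_range.1 hj.2)
      rwa [Function.update_of_ne hj.1] at this
    · rw [Ideal.span_le, Set.singleton_subset_iff]
      have := mem_JJ (Function.update e i z) hi
      rwa [Function.update_self] at this
  obtain ⟨E, -, hE⟩ := fin_good (B := B) (x := e i) (y := e l) (heI l (by omega)) (hJt.trans (Ideal.mul_mono_left hJB))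
  obtain ⟨s, hs, hsE⟩ := exists_unit_avoid E
  set e' := Function.update e i (e i + s * e l) with he'
  have hJ'I : JJ e' l ≤ I := by
    refine JJ_le fun j hj => ?_
    by_cases hji : j = i
    · rw [he', hji, Function.update_self]
      exact Ideal.add_mem _ (heI i (by omega)) (Ideal.mul_mem_left _ _ (heI l (by omega)))
    · rw [he', Function.update_of_ne hji]; exact heI j (by omega)
  have hJ' : IsMinimalReduction (JJ e' l) I := by
    refine D.min_of (red_of hJ'I ((hE s hsE).trans (Ideal.mul_mono_left (hBJ _)))) ?_
    obtain ⟨S, hS, hS2⟩ := JJ_finset e' l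
    refine gen_mono (gen_of_m (I := JJ e' l) (B := ⊥) (S := S) ?_ ?_) le_rfl hS
    · intro s hs
      rw [← hS2]; exact Ideal.subset_span hs
    · rw [hS2]; exact le_sup_right
  obtain ⟨y, hy⟩ := (mem_JJ_iff _ _ _).1 (hcore _ hJ')
  have hrel : ∑ j ∈ Finset.range (l + 1), (Function.update (c - y) l (- (y i * s))) j * e j = 0 := by
    rw [Finset.sum_range_succ, Function.update_self]
    rw [Finset.sum_congr rfl (g := fun j => c j * e j - y j * e j) fun j hj => by
      rw [Function.update_of_ne (Finset.mem_range.1 hj).ne, Pi.sub_apply, sub_mul]]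
    rw [Finset.sum_sub_distrib, ← hc, hy]
    have : ∑ j ∈ Finset.range l, y j * e' j = ∑ j ∈ Finset.range l, y j * e j + y i * (s * e l) := by
      rw [← Finset.add_sum_erase _ _ (Finset.mem_range.2 hi), ← Finset.add_sum_erase (Finset.range l) (fun j => y j * e j) (Finset.mem_range.2 hi)]
      rw [Finset.sum_congr rfl (g := fun j => y j * e j) fun j hj => by
        rw [he', Function.update_of_ne (Finset.ne_of_mem_erase hj)]]
      rw [he', Function.update_self]; ring
    rw [this]; ring
  have h1 := mem_Rel _ hrel (show i < l + 1 by omega)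
  have h2 := mem_Rel _ hrel (show l < l + 1 by omega)
  rw [Function.update_of_ne hi.ne, Pi.sub_apply] at h1
  rw [Function.update_self] at h2
  have h3 : y i ∈ Rel e (l + 1) := mem_of_unit_mul hs (by rw [mul_comm]; exact neg_mem_iff.1 h2)
  have := Ideal.add_mem _ h1 h3
  rwa [sub_add_cancel] at this

/-- forward direction -/
lemma forward [Infinite (ResidueField R)] (C : Ctx I g l d) (D : RCtx I l) {J0 : Ideal R}
    (hJ0 : IsMinimalReduction J0 I) (h0 : I ^ (l - g + 1 + 1) ≤ J0 * I ^ (l - g + 1))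
    {e : ℕ → R} (hI : I = JJ e (l + 1)) : core I = Rel e (l + 1) * I := by
  apply le_antisymm
  · obtain ⟨b, rfl, hb⟩ := D.min_e hJ0
    exact (core_le_rel D hb hJ0 h0).trans (Ideal.mul_mono_left (D.rel_le hb hI))
  · refine le_sInf fun J hJ => ?_
    obtain ⟨b, rfl, hb⟩ := D.min_e hJ
    refine (Ideal.mul_mono_left ((D.rel_le hI hb).trans (rel_le_K C D hb hJ (all_good C D hJ0 h0 hJ)))).trans ?_
    exact Ideal.mul_le.2 fun x hx y hy => hx y hy

lemma red_ge [Infinite (ResidueField R)] (C : Ctx I g l d) (D : RCtx I l) {J : Ideal R}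
    (hJ : IsMinimalReduction J I) {r : ℕ} (hr : I ^ (r + 1) ≤ J * I ^ r) : l - g + 1 ≤ r := by
  by_contra hlt
  have hl1 := C.hl1
  obtain ⟨b, hb, hb2, x, hx, hxJ, -⟩ := D.min_struct hJ
  have hv : b 0 ∈ J := by rw [hb]; exact mem_JJ b hl1
  have hv2 : b 0 ∉ maximalIdeal R * J := by
    intro h
    apply hb2 0 hl1
    exact Ideal.mem_sup_right (Ideal.mul_mono_right hJ.1.1 h)
  obtain ⟨a, ha, hJa, -⟩ := good_in C hJ.1 hv (gen_v (D.gen_min hJ) hv hv2) (fun _ _ => True) trivial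
    (fun i B _ _ _ => ⟨∅, Set.finite_empty, by simp, fun _ _ _ => trivial⟩)
  rw [hJa] at hr
  have := r_ge C ha (hJ.1.1 hv) hr (by omega)
  rw [← hJa] at this
  exact hxJ (Ideal.mem_sup_left (this hx))

end Fwd2

section Conv
variable {R : Type u} [CommRing R] [IsLocalRing R] [IsNoetherianRing R]
variable {I : Ideal R} {g l d : ℕ} {a : ℕ → R}

lemma iso_mul {A B A' C : Ideal R} (c : R) (hAC : A' ≤ C) (hBC : ∀ x ∈ B, c * x ∈ C)
    (hC : ∀ x ∈ C, ∃ y ∈ B, x - c * y ∈ A')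
    (hA : ∀ x ∈ B, c * x ∈ A' ↔ x ∈ A) : Nonempty (QQ B A ≃ₗ[R] QQ C A') := by
  obtain ⟨f, g, hf, hg, hfg⟩ := ses_mul (D := C) c hAC hBC (fun x hx => ⟨fun _ => hC x hx, fun _ => hx⟩) hA
  refine ⟨LinearEquiv.ofBijective f ⟨hf, fun z => ?_⟩⟩
  refine (hfg z).1 ?_
  obtain ⟨w, hw⟩ := Submodule.Quotient.mk_surjective _ (g z)
  rw [← hw, QQ_mk_eq_zero]
  exact w.2

lemma ses_third {A B C : Ideal R} (hAB : A ≤ B) (hBC : B ≤ C) :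
    ∃ (f : QQ B A →ₗ[R] QQ C A) (g : QQ C A →ₗ[R] QQ C B),
      Function.Injective f ∧ Function.Surjective g ∧ Function.Exact f g :=
  ses_mul 1 (hAB.trans hBC) (fun x hx => by rw [one_mul]; exact hBC hx)
    (fun x hx => ⟨fun h => ⟨x, h, by simp⟩, fun ⟨y, hy, h⟩ => by
      have := B.add_mem (hAB h) hy
      rwa [one_mul, sub_add_cancel] at this⟩) (fun x hx => by rw [one_mul])

lemma QQ_self_sub {A B : Ideal R} (h : B ≤ A) : Subsingleton (QQ B A) := by
  refine subsingleton_of_forall_eq 0 fun z => ?_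
  obtain ⟨w, rfl⟩ := Submodule.Quotient.mk_surjective _ z
  exact (QQ_mk_eq_zero w).2 (h w.2)

lemma mem_JJ_mul (a : ℕ → R) (M : Ideal R) (i : ℕ) (z : R) :
    z ∈ JJ a i * M ↔ ∃ y : ℕ → R, (∀ j, y j ∈ M) ∧ z = ∑ j ∈ Finset.range i, y j * a j := by
  constructor
  · induction i generalizing z with
    | zero => 
      intro h
      rw [JJ_zero, Ideal.bot_mul, Ideal.mem_bot] at h
      exact ⟨0, fun _ => M.zero_mem, by simp [h]⟩
    | succ i ih =>
      intro h
      rw [JJ_succ, Ideal.sup_mul, Submodule.mem_sup] at h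
      obtain ⟨w, hw, v, hv, rfl⟩ := h
      obtain ⟨c, hc, rfl⟩ := Ideal.mem_span_singleton_mul.1 hv
      obtain ⟨q, hq, rfl⟩ := ih w hw
      refine ⟨Function.update q i c, ?_, ?_⟩
      · intro j
        by_cases h : j = i
        · rw [h, Function.update_self]; exact hc
        · rw [Function.update_of_ne h]; exact hq j
      rw [Finset.sum_range_succ]
      congr 1
      · refine Finset.sum_congr rfl fun j hj => ?_
        rw [Function.update_of_ne (Finset.mem_range.1 hj).ne]
      · rw [Function.update_self, mul_comm]
  · rintro ⟨c, hc, rfl⟩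
    exact Ideal.sum_mem _ fun j hj => by
      rw [mul_comm (c j)]; exact Ideal.mul_mem_mul (mem_JJ a (Finset.mem_range.1 hj)) (hc j)

/-- the layer `J_{i+1}M/J_iM` -/
lemma layer (a : ℕ → R) (M A : Ideal R) (i : ℕ) (hA : ∀ x ∈ M, a i * x ∈ JJ a i * M ↔ x ∈ A) :
    Nonempty (QQ M A ≃ₗ[R] QQ (JJ a (i + 1) * M) (JJ a i * M)) := by
  refine iso_mul (a i) (Ideal.mul_mono_left (JJ_mono a (Nat.le_succ i)))
    (fun x hx => Ideal.mul_mem_mul (mem_JJ a (Nat.lt_succ_self i)) hx) (fun x hx => ?_) hA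
  rw [JJ_succ, Ideal.sup_mul, Submodule.mem_sup] at hx
  obtain ⟨w, hw, v, hv, rfl⟩ := hx
  obtain ⟨c, hc, rfl⟩ := Ideal.mem_span_singleton_mul.1 hv
  exact ⟨c, hc, by rwa [add_sub_cancel_right]⟩

lemma pow_sup_span {J : Ideal R} {x : R} (hx : x ∈ I) (hI : I ≤ J ⊔ Ideal.span {x}) (n : ℕ) :
    I ^ (n + 1) ≤ J * I ^ n ⊔ Ideal.span {x ^ (n + 1)} := by
  induction n with
  | zero => simpa using hI
  | succ n ih =>
    rw [pow_succ' I (n + 1)]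
    refine (Ideal.mul_mono_left hI).trans ?_
    rw [Ideal.sup_mul]
    refine sup_le le_sup_left ((Ideal.mul_mono_right ih).trans ?_)
    rw [Ideal.mul_sup, Ideal.span_singleton_mul_span_singleton, ← pow_succ']
    refine sup_le_sup_right ?_ _
    rw [mul_left_comm]
    refine Ideal.mul_mono_right ?_
    rw [pow_succ']
    refine Ideal.mul_mono_left ?_
    rw [Ideal.span_le, Set.singleton_subset_iff]
    exact hx

lemma indep_top (C : Ctx I g l d) (ha : GoodSeq I a (l - 1)) (hb : a (l - 1) ∈ I)
    (hreg : ∀ x, a (l - 1) * x ∈ sat (JJ a (l - 1)) I → x ∈ sat (JJ a (l - 1)) I)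
    (i : ℕ) (hi : i ≤ l) : ∀ z : ℕ → R, (∀ j, z j ∈ I ^ (l - g + 1)) → ∑ j ∈ Finset.range i, z j * a j = 0 →
      ∀ j < i, z j ∈ JJ a l * I ^ (l - g) := by
  have hl1 := C.hl1
  have hgl := C.hgl
  have hmem : ∀ i < l, a i ∈ I := fun i hi => by
    rcases Nat.lt_or_ge i (l - 1) with h | h
    · exact ha.mem i h
    · rw [show i = l - 1 by omega]; exact hb
  have hregs : ∀ i < l, ∀ x, a i * x ∈ sat (JJ a i) I → x ∈ sat (JJ a i) I := fun i hi => by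
    rcases Nat.lt_or_ge i (l - 1) with h | h
    · exact ha.reg i h
    · rw [show i = l - 1 by omega]; exact hreg
  induction i with
  | zero => intro z _ _ j hj; omega
  | succ i ih =>
    intro z hz hsum j hj
    rw [Finset.sum_range_succ] at hsum
    have h1 : z i ∈ JJ a i * I ^ (l - g) := by
      refine ((ladder C ha (l - g + 1) le_rfl).1 i (by omega) (by omega)).2 _ (hregs i (by omega) _ ?_) (hz i)
      apply le_sat
      rw [mul_comm, eq_neg_of_add_eq_zero_right hsum]
      exact neg_mem ((mem_JJ_iff _ _ _).2 ⟨z, rfl⟩)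
    obtain ⟨q, hq, hzi⟩ := (mem_JJ_mul _ _ _ _).1 h1
    rcases Nat.lt_succ_iff_lt_or_eq.1 hj with hj | rfl
    · have h2 : ∀ j, a i * q j ∈ JJ a l * I ^ (l - g) := fun j => Ideal.mul_mem_mul (mem_JJ a (by omega)) (hq j)
      have h3 := ih (by omega) (fun j => z j + a i * q j) (fun j => by
        refine Ideal.add_mem _ (hz j) ?_
        rw [pow_succ']
        exact Ideal.mul_mem_mul (hmem i (by omega)) (hq j)) (by
          rw [← hsum, hzi, Finset.sum_mul, ← Finset.sum_add_distrib]
          exact Finset.sum_congr rfl fun j _ => by ring) j hj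
      have := Ideal.sub_mem _ h3 (h2 j)
      rwa [add_sub_cancel_right] at this
    · exact Ideal.mul_mono_left (JJ_mono a (by omega)) h1

lemma htGE_K [Infinite (ResidueField R)] (C : Ctx I g l d) (ha : GoodSeq I a (l - 1))
    (hreg : ∀ x, a (l - 1) * x ∈ sat (JJ a (l - 1)) I → x ∈ sat (JJ a (l - 1)) I)
    (hJ : IsReduction (JJ a l) I) : HtGE (colI (JJ a l) I) l := by
  have hl1 := C.hl1
  intro p hp hKp
  by_cases hIp : I ≤ p
  · by_contra h
    obtain ⟨σ, hσ, hσ2⟩ := lin C hJ p hp hIp (not_le.1 h)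
    exact hσ (hKp hσ2)
  · have hJp : JJ a l ≤ p := fun x hx => hKp fun y hy => Ideal.mul_mem_right _ _ hx
    have := ht_of_not_le (j := l - 1) hreg (fun q hq hIq hBq => ht_J ha (l - 1) le_rfl q hq hIq hBq) p hp hIp
      ((JJ_mono a (by omega)).trans hJp) (hJp (mem_JJ a (by omega)))
    rwa [show l - 1 + 1 = l by omega] at this

lemma conv_dep (C : Ctx I g l d) (ha : GoodSeq I a (l - 1)) (hb : a (l - 1) ∈ I)
    (hreg : ∀ x, a (l - 1) * x ∈ sat (JJ a (l - 1)) I → x ∈ sat (JJ a (l - 1)) I) :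
    Dep R (d - l) (QQ (JJ a l * I ^ (l - g)) (JJ a l * I ^ (l - g + 1))) ∧
    Ty R (d - l) (QQ (JJ a l * I ^ (l - g)) (JJ a l * (JJ a l * I ^ (l - g)))) l := by
  have hl1 := C.hl1
  have hgl := C.hgl
  have hld := C.hld
  have hmem : ∀ i < l, a i ∈ I := fun i hi => by
    rcases Nat.lt_or_ge i (l - 1) with h | h
    · exact ha.mem i h
    · rw [show i = l - 1 by omega]; exact hb
  have hregs : ∀ i < l, ∀ x, a i * x ∈ sat (JJ a i) I → x ∈ sat (JJ a i) I := fun i hi => by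
    rcases Nat.lt_or_ge i (l - 1) with h | h
    · exact ha.reg i h
    · rw [show i = l - 1 by omega]; exact hreg
  have hJI : ∀ i ≤ l, JJ a i ≤ I := fun i hi => JJ_le fun j hj => hmem j (by omega)
  set f := l - g with hf
  have L0 := ladder C ha f (by omega)
  have L1 := ladder C ha (f + 1) (by omega)
  -- layers of J I^f
  have e0 : ∀ i < l, Nonempty (NN I a i f ≃ₗ[R] QQ (JJ a (i + 1) * I ^ f) (JJ a i * I ^ f)) := by
    intro i hi
    refine layer a _ _ i fun x hx => ⟨fun h => ?_, fun h => ?_⟩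
    · exact (L0.1 i (by omega) (by omega)).2 x (hregs i hi x (le_sat _ _ (Ideal.mul_le_left h))) hx
    · rcases Nat.eq_zero_or_pos f with h0 | h0
      · rw [h0] at h ⊢; exact Ideal.mul_mem_left _ _ h
      · rw [show I ^ f = I * I ^ (f - 1) by rw [← pow_succ']; congr 1; omega, mul_left_comm]
        exact Ideal.mul_mem_mul (hmem i hi) h
  have e1 : ∀ i < l, Nonempty (NN I a i (f + 1) ≃ₗ[R] QQ (JJ a (i + 1) * I ^ (f + 1)) (JJ a i * I ^ (f + 1))) := by
    intro i hi
    refine layer a _ _ i fun x hx => ⟨fun h => ?_, fun h => ?_⟩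
    · exact (L1.1 i (by omega) (by omega)).2 x (hregs i hi x (le_sat _ _ (Ideal.mul_le_left h))) hx
    · rw [pow_succ', mul_left_comm]
      exact Ideal.mul_mem_mul (hmem i hi) h
  have e2 : ∀ i < l, Nonempty (QQ (JJ a l * I ^ f) (JJ a i * I ^ f) ≃ₗ[R]
      QQ (JJ a (i + 1) * (JJ a l * I ^ f)) (JJ a i * (JJ a l * I ^ f))) := by
    intro i hi
    refine layer a _ _ i fun x hx => ⟨fun h => ?_, fun h => ?_⟩
    · refine (L1.1 i (by omega) (by omega)).2 x (hregs i hi x (le_sat _ _ (Ideal.mul_le_left h))) ?_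
      rw [pow_succ']
      exact Ideal.mul_mono_left (hJI l le_rfl) hx
    · rw [mul_left_comm]
      exact Ideal.mul_mem_mul (mem_JJ a hi) h
  -- depth statements
  have d1 : ∀ i ≤ l, Dep R (d - l + 1) (QQ (JJ a i * I ^ (f + 1)) ⊥) := by
    intro i
    induction i with
    | zero =>
      intro _
      have := QQ_self_sub (A := ⊥) (B := JJ a 0 * I ^ (f + 1)) (by rw [JJ_zero, Ideal.bot_mul])
      exact Dep.of_subsingleton
    | succ i ih =>
      intro hi
      obtain ⟨φ, ψ, h1, h2, h3⟩ := ses_third (A := ⊥) bot_le (Ideal.mul_mono_left (JJ_mono a (Nat.le_succ i)) : JJ a i * I ^ (f + 1) ≤ JJ a (i + 1) * I ^ (f + 1))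
      refine dep_mid φ ψ h1 h2 h3 (ih (by omega)) ?_
      exact Dep.equiv ((L1.1 i (by omega) (by omega)).1 _ (by omega) (by omega)) (e1 i (by omega)).some
  have t0 : ∀ i k, i ≤ k → k + 1 ≤ l → Dep R (d - l + 2) (QQ (JJ a k * I ^ f) (JJ a i * I ^ f)) := by
    intro i k hik
    induction k, hik using Nat.le_induction with
    | base =>
      intro _
      have := QQ_self_sub (A := JJ a i * I ^ f) (B := JJ a i * I ^ f) le_rfl
      exact Dep.of_subsingleton
    | succ k hik ih =>
      intro hk
      obtain ⟨φ, ψ, h1, h2, h3⟩ := ses_third (Ideal.mul_mono_left (JJ_mono a hik) : JJ a i * I ^ f ≤ JJ a k * I ^ f) (Ideal.mul_mono_left (JJ_mono a (Nat.le_succ k)) : JJ a k * I ^ f ≤ JJ a (k + 1) * I ^ f)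
      refine dep_mid φ ψ h1 h2 h3 (ih (by omega)) ?_
      exact Dep.equiv ((L0.1 k (by omega) (by omega)).1 _ (by omega) (by omega)) (e0 k (by omega)).some
  have t1 : ∀ i < l, Ty R (d - l + 1) (QQ (JJ a l * I ^ f) (JJ a i * I ^ f)) 1 := by
    intro i hi
    have hs : l - 1 + 1 = l := by omega
    obtain ⟨φ, ψ, h1, h2, h3⟩ := ses_third (Ideal.mul_mono_left (JJ_mono a (show i ≤ l - 1 by omega)) : JJ a i * I ^ f ≤ JJ a (l - 1) * I ^ f) (Ideal.mul_mono_left (JJ_mono a (Nat.le_succ (l - 1))) : JJ a (l - 1) * I ^ f ≤ JJ a (l - 1 + 1) * I ^ f)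
    have h4 : Ty R (d - l + 1) (QQ (JJ a (l - 1 + 1) * I ^ f) (JJ a (l - 1) * I ^ f)) 1 := by
      have := Ty.equiv (L0.2 (l - 1) (by omega) (by omega)) (e0 (l - 1) (by omega)).some
      rwa [show d - (l - 1) = d - l + 1 by omega] at this
    have h5 := ty_mid φ ψ h1 h2 h3 (Ty.of_dep (c := 0) (t0 i (l - 1) (by omega) (by omega))) h4
    rw [hs, zero_add] at h5
    exact h5
  have t2 : ∀ i ≤ l, Ty R (d - l + 1) (QQ (JJ a i * (JJ a l * I ^ f)) ⊥) i := by
    intro i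
    induction i with
    | zero =>
      intro _
      have := QQ_self_sub (A := ⊥) (B := JJ a 0 * (JJ a l * I ^ f)) (by rw [JJ_zero, Ideal.bot_mul])
      exact Ty.of_dep Dep.of_subsingleton
    | succ i ih =>
      intro hi
      obtain ⟨φ, ψ, h1, h2, h3⟩ := ses_third (A := ⊥) bot_le (Ideal.mul_mono_left (JJ_mono a (Nat.le_succ i)) : JJ a i * (JJ a l * I ^ f) ≤ JJ a (i + 1) * (JJ a l * I ^ f))
      exact ty_mid φ ψ h1 h2 h3 (ih (by omega)) (Ty.equiv (t1 i (by omega)) (e2 i (by omega)).some)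
  have t3 : Dep R (d - l + 1) (QQ (JJ a l * I ^ f) ⊥) := by
    have := (t1 0 (by omega)).1
    rwa [JJ_zero, Ideal.bot_mul] at this
  constructor
  · obtain ⟨φ, ψ, h1, h2, h3⟩ := ses_third (A := ⊥) bot_le (Ideal.mul_mono_right (Ideal.pow_le_pow_right (Nat.le_succ f)) : JJ a l * I ^ (f + 1) ≤ JJ a l * I ^ f)
    exact dep_right φ ψ h1 h2 h3 (d1 l le_rfl) (t3.mono (by omega))
  · obtain ⟨φ, ψ, h1, h2, h3⟩ := ses_third (A := ⊥) bot_le (Ideal.mul_le_right : JJ a l * (JJ a l * I ^ f) ≤ JJ a l * I ^ f)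
    exact ty_right φ ψ h1 h2 h3 (t2 l le_rfl) t3

end Conv

section Conv2
variable {R : Type u} [CommRing R] [IsLocalRing R] [IsNoetherianRing R]
variable {I : Ideal R} {g l d : ℕ} {a : ℕ → R}

lemma conv_main [Infinite (ResidueField R)] (C : Ctx I g l d) (ha : GoodSeq I a (l - 1)) (hb : a (l - 1) ∈ I)
    (hreg : ∀ x, a (l - 1) * x ∈ sat (JJ a (l - 1)) I → x ∈ sat (JJ a (l - 1)) I)
    (hJ : IsReduction (JJ a l) I) {x : R} (hx : x ∈ I) (hI : I ≤ JJ a l ⊔ Ideal.span {x})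
    (hKx : ∀ k ∈ colI (JJ a l) I, k * x ∈ JJ a l * colI (JJ a l) I) (hIK : I ≤ colI (JJ a l) I) :
    I ^ (l - g + 1 + 1) ≤ JJ a l * I ^ (l - g + 1) := by
  have hl1 := C.hl1
  have hgl := C.hgl
  set J := JJ a l with hJd
  set K := colI J I with hK
  set f := l - g with hf
  have haJ : ∀ i < l, a i ∈ J := fun i hi => mem_JJ a hi
  have hJl : J = JJ a (l - 1) ⊔ Ideal.span {a (l - 1)} := by
    rw [← JJ_succ, hJd]; congr 1; omega
  have hxp : ∀ n, x ^ n ∈ I ^ n := fun n => Ideal.pow_mem_pow hx n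
  have hkx : ∀ k ∈ K, k * x ^ (f + 1) ∈ J * I ^ f := by
    intro k hk
    rw [pow_succ', ← mul_assoc]
    exact Ideal.mul_mem_mul (hk x hx) (hxp f)
  have hkx2 : ∀ k ∈ K, k * x ^ (f + 1 + 1) ∈ J * (J * I ^ f) := by
    intro k hk
    rw [pow_succ', ← mul_assoc k]
    have h1 : ∀ y ∈ J * K, y * x ^ (f + 1) ∈ J * (J * I ^ f) := by
      intro y hy
      refine Submodule.mul_induction_on hy (fun m hm n hn => ?_) (fun y z hy hz => ?_)
      · rw [mul_assoc]; exact Ideal.mul_mem_mul hm (hkx n hn)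
      · rw [add_mul]; exact Ideal.add_mem _ hy hz
    exact h1 _ (hKx k hk)
  have hxE : x ^ (f + 1 + 1) ∈ J * I ^ f := by
    rw [pow_succ', pow_succ', ← mul_assoc]
    exact Ideal.mul_mem_mul (hIK hx x hx) (hxp f)
  set v : Fin l → ↥(J * I ^ f) := fun i => ⟨a i * x ^ (f + 1), Ideal.mul_mem_mul (haJ i i.2)
    (Ideal.pow_le_pow_right (Nat.le_succ f) (hxp (f + 1)))⟩ with hv
  set A := Submodule.comap (Submodule.subtype (J * I ^ f)) (J * (J * I ^ f)) with hA
  set F : (Fin l → R) →ₗ[R] QQ (J * I ^ f) (J * (J * I ^ f)) := A.mkQ ∘ₗ Fintype.linearCombination R v with hF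
  have hFz : ∀ u : Fin l → R, ((Fintype.linearCombination R v u : ↥(J * I ^ f)) : R) = ∑ i, u i * (a i * x ^ (f + 1)) := by
    intro u
    rw [Fintype.linearCombination_apply]
    simp [hv]
  have hF0 : ∀ u : Fin l → R, F u = 0 ↔ ∑ i, u i * (a i * x ^ (f + 1)) ∈ J * (J * I ^ f) := by
    intro u
    rw [← hFz]
    exact QQ_mk_eq_zero _
  have hFK : ∀ u : Fin l → R, F u = 0 ↔ ∀ j, u j ∈ K := by
    intro u
    rw [hF0]
    constructor
    · intro h
      set u' : ℕ → R := fun j => if h : j < l then u ⟨j, h⟩ else 0 with hu'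
      obtain ⟨y, hy, hsum⟩ := (mem_JJ_mul a (J * I ^ f) l _).1 h
      have h1 := indep_top C ha hb hreg l le_rfl (fun j => u' j * x ^ (f + 1) - y j) (fun j => Ideal.sub_mem _ (Ideal.mul_mem_left _ _ (hxp _)) (by
        rw [pow_succ']; exact Ideal.mul_mono_left hJ.1 (hy j))) (by
        simp_rw [sub_mul]
        rw [Finset.sum_sub_distrib, ← hsum, sub_eq_zero, Finset.sum_range]
        refine Finset.sum_congr rfl fun i _ => ?_
        simp only [hu', i.2, dif_pos]
        ring)
      intro j
      have h2 := Ideal.add_mem _ (h1 j j.2) (hy j)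
      rw [sub_add_cancel] at h2
      simp only [hu', j.2, dif_pos] at h2
      rw [hK, mem_colI, hJl]
      refine K_one C ha hb hreg (u j) ?_
      rw [← hJl, ← hf]
      intro y hy
      have h3 := pow_sup_span hx hI f hy
      obtain ⟨w, hw, c, rfl⟩ := mem_sup_span.1 h3
      rw [mul_add]
      refine Ideal.add_mem _ (Ideal.mul_mem_left _ _ hw) ?_
      rw [mul_left_comm]
      exact Ideal.mul_mem_left _ _ h2
    · intro h
      refine Ideal.sum_mem _ fun i _ => ?_
      rw [mul_left_comm (u i)]
      exact Ideal.mul_mem_mul (haJ i i.2) (hkx _ (h i))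
  obtain ⟨hd1, ht1⟩ := conv_dep C ha hb hreg
  have hrange : ∀ w : ↥(J * I ^ f), A.mkQ w ∈ LinearMap.range F ↔ (w : R) ∈ J * I ^ (f + 1) := by
    intro w
    have hsub : J * (J * I ^ f) ≤ J * I ^ (f + 1) := Ideal.mul_mono_right (by
      rw [pow_succ']; exact Ideal.mul_mono_left hJ.1)
    constructor
    · rintro ⟨u, hu⟩
      have h1 : A.mkQ (Fintype.linearCombination R v u - w) = 0 := by
        rw [map_sub, sub_eq_zero]; exact hu
      have h2 := (QQ_mk_eq_zero _).1 h1
      rw [Submodule.coe_sub, hFz] at h2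
      have h3 : ∑ i, u i * (a i * x ^ (f + 1)) ∈ J * I ^ (f + 1) := Ideal.sum_mem _ fun i _ =>
        Ideal.mul_mem_left _ _ (Ideal.mul_mem_mul (haJ i i.2) (hxp _))
      have := Ideal.sub_mem _ h3 (hsub h2)
      rwa [sub_sub_cancel] at this
    · intro h
      obtain ⟨y, hy, hw⟩ := (mem_JJ_mul a _ l _).1 h
      have h1 : ∀ j, ∃ c : R, y j - c * x ^ (f + 1) ∈ J * I ^ f := fun j => by
        obtain ⟨w, hw, c, h⟩ := mem_sup_span.1 (pow_sup_span hx hI f (hy j))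
        exact ⟨c, by rwa [h, add_sub_cancel_right]⟩
      choose c hc using h1
      refine ⟨fun i => c i, ?_⟩
      have h2 : A.mkQ (Fintype.linearCombination R v (fun i => c i) - w) = 0 := by
        refine (QQ_mk_eq_zero _).2 ?_
        rw [Submodule.coe_sub, hFz, hw, ← neg_mem_iff, neg_sub, Finset.sum_range, ← Finset.sum_sub_distrib]
        refine Ideal.sum_mem _ fun i _ => ?_
        have : y i * a i - c i * (a i * x ^ (f + 1)) = a i * (y i - c i * x ^ (f + 1)) := by ring
        rw [this]
        exact Ideal.mul_mem_mul (haJ i i.2) (hc i)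
      rw [map_sub, sub_eq_zero] at h2
      exact h2
  have hdep : Dep R (d - l) (QQ (J * I ^ f) (J * (J * I ^ f)) ⧸ LinearMap.range F) := by
    have hcomap : Submodule.comap A.mkQ (LinearMap.range F) = Submodule.comap (Submodule.subtype (J * I ^ f)) (J * I ^ (f + 1)) := by
      ext w
      rw [Submodule.mem_comap, hrange]; rfl
    have hker : LinearMap.ker ((LinearMap.range F).mkQ ∘ₗ A.mkQ) = Submodule.comap (Submodule.subtype (J * I ^ f)) (J * I ^ (f + 1)) := by
      rw [LinearMap.ker_comp, Submodule.ker_mkQ, hcomap]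
    refine Dep.equiv hd1 ?_
    exact (Submodule.quotEquivOfEq _ _ hker.symm).trans (LinearMap.quotKerEquivOfSurjective _
      ((Submodule.mkQ_surjective _).comp (Submodule.mkQ_surjective _)))
  have hz := lemZ C.hd (d - l) hl1 l (by omega) _ F K hFK hdep ht1 (htGE_K C ha hreg hJ) (A.mkQ ⟨x ^ (f + 1 + 1), hxE⟩)
    (fun c hc => by
      rw [← map_smul]
      exact (QQ_mk_eq_zero _).2 (hkx2 c hc))
  have hfin : x ^ (f + 1 + 1) ∈ J * I ^ (f + 1) := (hrange _).1 hz
  refine (pow_sup_span hx hI (f + 1)).trans (sup_le le_rfl ?_)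
  rwa [Ideal.span_le, Set.singleton_subset_iff]

/-- converse direction, with the data it produces -/
lemma backward [Infinite (ResidueField R)] (C : Ctx I g l d) (D : RCtx I l) {e : ℕ → R} (hI : I = JJ e (l + 1))
    (hcore : core I = Rel e (l + 1) * I) {J : Ideal R} (hJ : IsMinimalReduction J I) :
    ∃ (a : ℕ → R) (x : R), GoodSeq I a (l - 1) ∧ J = JJ a l ∧ a (l - 1) ∈ I ∧ x ∈ I ∧
      (∀ x, a (l - 1) * x ∈ sat (JJ a (l - 1)) I → x ∈ sat (JJ a (l - 1)) I) ∧
      I = J ⊔ Ideal.span {x} ∧ colI J I = Rel e (l + 1) ∧ I ≤ Rel e (l + 1) ∧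
      (∀ k ∈ Rel e (l + 1), k * x ∈ J * Rel e (l + 1)) ∧ I ^ (l - g + 1 + 1) ≤ J * I ^ (l - g + 1) := by
  have hl1 := C.hl1
  obtain ⟨b, hb, hb2, x, hx, hxJ, hIx⟩ := D.min_struct hJ
  have hv : b 0 ∈ J := by rw [hb]; exact mem_JJ b hl1
  have hv2 : b 0 ∉ maximalIdeal R * J := by
    intro h
    apply hb2 0 hl1
    exact Ideal.mem_sup_right (Ideal.mul_mono_right hJ.1.1 h)
  obtain ⟨a0, ha0, hJa, -⟩ := good_in C hJ.1 hv (gen_v (D.gen_min hJ) hv hv2) (fun _ _ => True) trivial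
    (fun i B _ _ _ => ⟨∅, Set.finite_empty, by simp, fun _ _ _ => trivial⟩)
  obtain ⟨r, hr⟩ := hJ.1.2
  set a := Function.update a0 (l - 1) (b 0) with ha
  have haa : ∀ i < l - 1, a i = a0 i := fun i hi => Function.update_of_ne hi.ne _ _
  have hal : a (l - 1) = b 0 := Function.update_self _ _ _
  have hJJ : ∀ i ≤ l - 1, JJ a i = JJ a0 i := fun i hi => JJ_congr fun j hj => haa j (by omega)
  have hag : GoodSeq I a (l - 1) := by
    refine ⟨fun i hi => by rw [haa i hi]; exact ha0.mem i hi, fun i hi => ?_, fun i hi => ?_⟩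
    · rw [haa i hi, hJJ i (by omega)]; exact ha0.reg i hi
    · rw [hJJ i hi]; exact ha0.g2 i hi
  have hJl : J = JJ a l := by
    rw [show l = l - 1 + 1 by omega, JJ_succ, hJJ _ le_rfl, hal]; exact hJa
  have hreg : ∀ x, a (l - 1) * x ∈ sat (JJ a (l - 1)) I → x ∈ sat (JJ a (l - 1)) I := by
    rw [hal, hJJ _ le_rfl]
    refine reg_of_red (r := r) ?_
    rw [← hJa]; exact hr.le
  have haI : a (l - 1) ∈ I := by rw [hal]; exact hJ.1.1 hv
  -- sequence with x
  set c := Function.update a l x with hc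
  have hcJ : JJ c l = J := by
    rw [hJl]; exact JJ_congr fun j hj => Function.update_of_ne hj.ne _ _
  have hcl : c l = x := Function.update_self _ _ _
  have hcI : I = JJ c (l + 1) := by rw [JJ_succ, hcJ, hcl]; exact hIx
  have hrel : Rel e (l + 1) = Rel c (l + 1) := le_antisymm (D.rel_le hI hcI) (D.rel_le hcI hI)
  have hK : colI J I = Rel e (l + 1) := by
    apply le_antisymm
    · rw [hrel, ← hcJ]; exact K_le_rel hcI
    · intro k hk
      rw [mem_colI]
      intro y hy
      have h1 : k * y ∈ core I := by rw [hcore]; exact Ideal.mul_mem_mul hk hy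
      exact (Ideal.mem_sInf.1 h1) hJ
  have hKx : ∀ k ∈ Rel e (l + 1), k * x ∈ J * Rel e (l + 1) := by
    intro k hk
    have h1 : k * x ∈ JJ c l := by
      rw [hcJ]; rw [← hK] at hk; exact hk x hx
    obtain ⟨q, hq⟩ := (mem_JJ_iff _ _ _).1 h1
    have hsum : ∑ i ∈ Finset.range (l + 1), (Function.update (fun j => - q j) l k) i * c i = 0 := by
      rw [Finset.sum_range_succ, Function.update_self, hcl, hq, ← Finset.sum_add_distrib]
      refine Finset.sum_eq_zero fun j hj => ?_
      rw [Function.update_of_ne (Finset.mem_range.1 hj).ne]; ring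
    rw [hq, ← hcJ, hrel]
    refine Ideal.sum_mem _ fun j hj => ?_
    have hj := Finset.mem_range.1 hj
    have h2 := mem_Rel _ hsum (show j < l + 1 by omega)
    rw [Function.update_of_ne hj.ne, neg_mem_iff] at h2
    rw [mul_comm (q j)]
    exact Ideal.mul_mem_mul (mem_JJ c hj) h2
  have hIK : I ≤ Rel e (l + 1) := by
    rw [hrel]
    conv_lhs => rw [hcI]
    have key : ∀ i j, i < l + 1 → j < l + 1 → i ≠ j → c i ∈ Rel c (l + 1) := by
      intro i j hi hj hij
      classical
      have hsum : ∑ k ∈ Finset.range (l + 1), (Function.update (Function.update (0 : ℕ → R) i (- c j)) j (c i)) k * c k = 0 := by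
        rw [← Finset.add_sum_erase _ _ (Finset.mem_range.2 hj), ← Finset.add_sum_erase _ _ (Finset.mem_erase.2 ⟨hij, Finset.mem_range.2 hi⟩)]
        rw [Finset.sum_eq_zero, Function.update_self, Function.update_of_ne hij, Function.update_self]
        · ring
        · intro k hk
          rw [Finset.mem_erase, Finset.mem_erase] at hk
          rw [Function.update_of_ne hk.2.1, Function.update_of_ne hk.1]
          simp
      have := mem_Rel _ hsum hj
      rwa [Function.update_self] at this
    refine JJ_le fun i hi => ?_
    by_cases h : i = 0
    · exact key i l hi (by omega) (by omega)
    · exact key i 0 hi (by omega) h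
  refine ⟨a, x, hag, hJl, haI, hx, hreg, hIx, hK, hIK, hKx, ?_⟩
  rw [hJl]
  refine conv_main C hag haI hreg (hJl ▸ hJ.1) hx (hJl ▸ hIx.le) ?_ ?_
  · rw [← hJl, hK]; exact hKx
  · rw [← hJl, hK]; exact hIK

end Conv2

section Forms
variable {R : Type u} [CommRing R] [IsLocalRing R] [IsNoetherianRing R]
variable {I : Ideal R} {g l d : ℕ} {a : ℕ → R}

lemma ht_assoc [Infinite (ResidueField R)] (C : Ctx I g l d) (ha : GoodSeq I a (l - 1)) (hb : a (l - 1) ∈ I)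
    (hreg : ∀ x, a (l - 1) * x ∈ sat (JJ a (l - 1)) I → x ∈ sat (JJ a (l - 1)) I)
    (hJ : JJ a l ≤ I) {x : R} (hx : x ∈ I) (hI : I ≤ JJ a l ⊔ Ideal.span {x})
    {c : R} {p : Ideal R} (hp : p.IsPrime) (hpc : ∀ r, r ∈ p ↔ r * c ∈ colI (JJ a l) I) :
    p.height ≤ (l : ℕ∞) := by
  have hl1 := C.hl1
  have hgl := C.hgl
  have hld := C.hld
  set J := JJ a l with hJd
  set K := colI J I with hK
  set f := l - g with hf
  have haJ : ∀ i < l, a i ∈ J := fun i hi => mem_JJ a hi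
  have hJl : J = JJ a (l - 1) ⊔ Ideal.span {a (l - 1)} := by
    rw [← JJ_succ, hJd]; congr 1; omega
  have hxp : ∀ n, x ^ n ∈ I ^ n := fun n => Ideal.pow_mem_pow hx n
  have hkx : ∀ k ∈ K, k * x ^ (f + 1) ∈ J * I ^ f := by
    intro k hk
    rw [pow_succ', ← mul_assoc]
    exact Ideal.mul_mem_mul (hk x hx) (hxp f)
  have key : ∀ u : R, u * (a 0 * x ^ (f + 1)) ∈ J * (J * I ^ f) ↔ u ∈ K := by
    intro u
    constructor
    · intro h
      obtain ⟨y, hy, hsum⟩ := (mem_JJ_mul a (J * I ^ f) l _).1 h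
      set u' : ℕ → R := fun j => if j = 0 then u else 0 with hu'
      have h1 := indep_top C ha hb hreg l le_rfl (fun j => u' j * x ^ (f + 1) - y j) (fun j => Ideal.sub_mem _ (Ideal.mul_mem_left _ _ (hxp _)) (by
        rw [pow_succ']; exact Ideal.mul_mono_left hJ (hy j))) (by
        simp_rw [sub_mul]
        rw [Finset.sum_sub_distrib, ← hsum, sub_eq_zero, Finset.sum_eq_single 0]
        · simp [hu']; ring
        · intro j _ hj; simp [hu', hj]
        · intro h; simp at h; omega)
      have h2 := Ideal.add_mem _ (h1 0 (by omega)) (hy 0)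
      rw [sub_add_cancel] at h2
      simp only [hu', if_true] at h2
      rw [hK, mem_colI, hJl]
      refine K_one C ha hb hreg u ?_
      rw [← hJl, ← hf]
      intro y hy
      have h3 := pow_sup_span hx hI f hy
      obtain ⟨w, hw, c, rfl⟩ := mem_sup_span.1 h3
      rw [mul_add]
      refine Ideal.add_mem _ (Ideal.mul_mem_left _ _ hw) ?_
      rw [mul_left_comm]
      exact Ideal.mul_mem_left _ _ h2
    · intro h
      rw [mul_left_comm u]
      exact Ideal.mul_mem_mul (haJ 0 (by omega)) (hkx _ h)
  obtain ⟨-, ht1⟩ := conv_dep C ha hb hreg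
  have hin : c * (a 0 * x ^ (f + 1)) ∈ J * I ^ f := Ideal.mul_mem_left _ _ (Ideal.mul_mem_mul (haJ 0 (by omega))
    (Ideal.pow_le_pow_right (Nat.le_succ f) (hxp (f + 1))))
  have h4 := isch C.hd (d - l) _ ht1.1 p (assoc_iff.2 ⟨hp, Submodule.Quotient.mk ⟨_, hin⟩, fun r => by
    rw [← Submodule.Quotient.mk_smul, QQ_mk_eq_zero, hpc, ← key]
    simp [mul_assoc, ← hJd, ← hf]⟩)
  have h5 : (d : ℕ∞) = (l : ℕ∞) + ((d - l : ℕ) : ℕ∞) := by norm_cast; omega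
  rw [h5] at h4
  exact (ENat.add_le_add_iff_right (ENat.natCast_ne_top _)).1 h4

/-- forms of degree `h` in the first `l` variables with constant data in `M` -/
def FM (M : Ideal R) (l : ℕ) : ℕ → Set (MvPolynomial ℕ R)
  | 0 => {Y | ∃ r ∈ M, Y = MvPolynomial.C r}
  | h + 1 => {Y | ∃ W : ℕ → MvPolynomial ℕ R, (∀ j, W j ∈ FM M l h) ∧
      Y = ∑ j ∈ Finset.range l, MvPolynomial.X j * W j}

lemma FM_zero (M : Ideal R) (l h : ℕ) : (0 : MvPolynomial ℕ R) ∈ FM M l h := by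
  induction h with
  | zero => exact ⟨0, M.zero_mem, by simp⟩
  | succ h ih => exact ⟨fun _ => 0, fun _ => ih, by simp⟩

lemma FM_add {M : Ideal R} {l h : ℕ} {Y Z : MvPolynomial ℕ R} (hY : Y ∈ FM M l h) (hZ : Z ∈ FM M l h) :
    Y + Z ∈ FM M l h := by
  induction h generalizing Y Z with
  | zero =>
    obtain ⟨r, hr, rfl⟩ := hY
    obtain ⟨s, hs, rfl⟩ := hZ
    exact ⟨r + s, M.add_mem hr hs, by simp⟩
  | succ h ih =>
    obtain ⟨W, hW, rfl⟩ := hY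
    obtain ⟨W', hW', rfl⟩ := hZ
    exact ⟨fun j => W j + W' j, fun j => ih (hW j) (hW' j), by simp [mul_add, Finset.sum_add_distrib]⟩

lemma FM_C {M N : Ideal R} {l h : ℕ} {Y : MvPolynomial ℕ R} (r : R) (hr : ∀ m ∈ M, r * m ∈ N) (hY : Y ∈ FM M l h) :
    MvPolynomial.C r * Y ∈ FM N l h := by
  induction h generalizing Y with
  | zero =>
    obtain ⟨s, hs, rfl⟩ := hY
    exact ⟨r * s, hr _ hs, by simp⟩
  | succ h ih =>
    obtain ⟨W, hW, rfl⟩ := hY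
    exact ⟨fun j => MvPolynomial.C r * W j, fun j => ih (hW j), by
      rw [Finset.mul_sum]; exact Finset.sum_congr rfl fun _ _ => by ring⟩

lemma FM_neg {M : Ideal R} {l h : ℕ} {Y : MvPolynomial ℕ R} (hY : Y ∈ FM M l h) : -Y ∈ FM M l h := by
  have := FM_C (-1) (fun m hm => by simpa using hm) hY (N := M)
  simpa using this

lemma FM_X {M : Ideal R} {l h i : ℕ} (hi : i < l) {Y : MvPolynomial ℕ R} (hY : Y ∈ FM M l h) :
    MvPolynomial.X i * Y ∈ FM M l (h + 1) := by
  refine ⟨fun j => if j = i then Y else 0, fun j => ?_, ?_⟩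
  · dsimp only; split_ifs
    · exact hY
    · exact FM_zero _ _ _
  · rw [Finset.sum_eq_single i]
    · simp
    · intro j _ hj; simp [hj]
    · intro h; simp at h; omega

lemma FM_sum {M : Ideal R} {l h : ℕ} (s : Finset ℕ) {Y : ℕ → MvPolynomial ℕ R} (hY : ∀ j ∈ s, Y j ∈ FM M l h) :
    ∑ j ∈ s, Y j ∈ FM M l h :=
  Finset.sum_induction _ (· ∈ FM M l h) (fun _ _ => FM_add) (FM_zero _ _ _) hY

lemma FM_mono {M N : Ideal R} (hMN : M ≤ N) {l h : ℕ} {Y : MvPolynomial ℕ R} (hY : Y ∈ FM M l h) :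
    Y ∈ FM N l h := by
  have := FM_C 1 (fun m hm => by simpa using hMN hm) hY (N := N)
  simpa using this

lemma FM_eval {M : Ideal R} {l h : ℕ} {Y : MvPolynomial ℕ R} (hY : Y ∈ FM M l h) :
    MvPolynomial.eval a Y ∈ (JJ a l) ^ h * M := by
  induction h generalizing Y with
  | zero =>
    obtain ⟨s, hs, rfl⟩ := hY
    simpa using hs
  | succ h ih =>
    obtain ⟨W, hW, rfl⟩ := hY
    rw [pow_succ', mul_assoc, map_sum]
    refine Ideal.sum_mem _ fun j hj => ?_
    rw [map_mul, MvPolynomial.eval_X]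
    exact Ideal.mul_mem_mul (mem_JJ a (Finset.mem_range.1 hj)) (ih (hW j))

lemma FM_surj {M : Ideal R} {l h : ℕ} {z : R} (hz : z ∈ (JJ a l) ^ h * M) :
    ∃ Y ∈ FM M l h, MvPolynomial.eval a Y = z := by
  induction h generalizing z with
  | zero => exact ⟨MvPolynomial.C z, ⟨z, by simpa using hz, rfl⟩, by simp⟩
  | succ h ih =>
    rw [pow_succ', mul_assoc] at hz
    obtain ⟨y, hy, rfl⟩ := (mem_JJ_mul _ _ _ _).1 hz
    choose W hW hW2 using fun j => ih (hy j)
    refine ⟨_, ⟨W, hW, rfl⟩, ?_⟩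
    rw [map_sum]
    exact Finset.sum_congr rfl fun j _ => by rw [map_mul, MvPolynomial.eval_X, hW2, mul_comm]

/-- strong filtration property of `d`-sequences -/
lemma huneke (hreg : ∀ i < l, ∀ x, a i * x ∈ sat (JJ a i) I → x ∈ sat (JJ a i) I)
    (hV : ∀ i < l, ∀ x ∈ sat (JJ a i) I, x ∈ I → x ∈ JJ a i) (hJ : JJ a l ≤ I) (h : ℕ) :
    ∀ k i, i + k = l → ∀ x ∈ sat (JJ a i) I, x ∈ JJ a l ^ (h + 1) * I → x ∈ JJ a i * (JJ a l ^ h * I) := by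
  induction h with
  | zero =>
    intro k
    induction k with
    | zero => intro i hi x _ hx; rw [show i = l by omega]; simpa using hx
    | succ k ih =>
      intro i hi x hx hx2
      have h1 := ih (i + 1) (by omega) x (sat_mono _ (JJ_mono a (Nat.le_succ i)) hx) hx2
      rw [JJ_succ, Ideal.sup_mul] at h1
      obtain ⟨w, hw, z, hz, rfl⟩ := Submodule.mem_sup.1 h1
      obtain ⟨v, hv, rfl⟩ := Ideal.mem_span_singleton_mul.1 hz
      refine Ideal.add_mem _ hw ?_
      have hv2 : v ∈ sat (JJ a i) I := hreg i (by omega) v (by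
        have := Ideal.sub_mem _ hx (le_sat _ I (Ideal.mul_le_left hw))
        rwa [add_sub_cancel_left] at this)
      rw [pow_zero, one_mul] at hv ⊢
      have := hV i (by omega) v hv2 hv
      rw [mul_comm (a i)]
      exact Ideal.mul_mem_mul this (hJ (mem_JJ a (by omega)))
  | succ h ihh =>
    intro k
    induction k with
    | zero => intro i hi x _ hx; rw [show i = l by omega, ← mul_assoc, ← pow_succ']; exact hx
    | succ k ih =>
      intro i hi x hx hx2
      have h1 := ih (i + 1) (by omega) x (sat_mono _ (JJ_mono a (Nat.le_succ i)) hx) hx2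
      rw [JJ_succ, Ideal.sup_mul] at h1
      obtain ⟨w, hw, z, hz, rfl⟩ := Submodule.mem_sup.1 h1
      obtain ⟨v, hv, rfl⟩ := Ideal.mem_span_singleton_mul.1 hz
      refine Ideal.add_mem _ hw ?_
      have hv2 : v ∈ sat (JJ a i) I := hreg i (by omega) v (by
        have := Ideal.sub_mem _ hx (le_sat _ I (Ideal.mul_le_left hw))
        rwa [add_sub_cancel_left] at this)
      have h3 := ihh (k + 1) i hi v hv2 hv
      have h4 : a i * v ∈ JJ a l * (JJ a i * (JJ a l ^ h * I)) := Ideal.mul_mem_mul (mem_JJ a (by omega)) h3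
      rwa [mul_left_comm, ← mul_assoc (JJ a l), ← pow_succ'] at h4

lemma form_indep (hreg : ∀ i < l, ∀ x, a i * x ∈ sat (JJ a i) I → x ∈ sat (JJ a i) I)
    (hV : ∀ i < l, ∀ x ∈ sat (JJ a i) I, x ∈ I → x ∈ JJ a i) (hJ : JJ a l ≤ I) (h : ℕ) :
    ∀ i ≤ l, ∀ Y : ℕ → MvPolynomial ℕ R, (∀ j, Y j ∈ FM I l h) →
      ∑ j ∈ Finset.range i, a j * MvPolynomial.eval a (Y j) = 0 →
      ∑ j ∈ Finset.range i, MvPolynomial.X j * Y j ∈ (JJ a l).map MvPolynomial.C := by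
  have hmemC : ∀ r ∈ JJ a l, (MvPolynomial.C r : MvPolynomial ℕ R) ∈ (JJ a l).map MvPolynomial.C :=
    fun r hr => Ideal.mem_map_of_mem _ hr
  have hsatY : ∀ i < l, ∀ Y : ℕ → MvPolynomial ℕ R, 
      ∑ j ∈ Finset.range (i + 1), a j * MvPolynomial.eval a (Y j) = 0 → 
      MvPolynomial.eval a (Y i) ∈ sat (JJ a i) I := by
    intro i hi Y hY
    refine hreg i hi _ (le_sat _ _ ?_)
    rw [Finset.sum_range_succ] at hY
    rw [eq_neg_of_add_eq_zero_right hY]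
    refine neg_mem (Ideal.sum_mem _ fun j hj => Ideal.mul_mem_right _ _ (mem_JJ a (Finset.mem_range.1 hj)))
  induction h with
  | zero =>
    intro i
    induction i with
    | zero => intro _ Y _ _; simp
    | succ i ih =>
      intro hi Y hY hsum
      have hs := hsatY i hi Y hsum
      obtain ⟨r, hr, hrY⟩ := hY i
      rw [hrY, MvPolynomial.eval_C] at hs
      have hr2 := hV i hi r hs hr
      obtain ⟨c, hc⟩ := (mem_JJ_iff _ _ _).1 hr2
      have h1 := ih (by omega) (fun j => Y j + MvPolynomial.C (c j * a i)) (fun j => FM_add (hY j)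
        ⟨_, I.mul_mem_left _ (hJ (mem_JJ a hi)), rfl⟩) (by
          rw [Finset.sum_range_succ, hrY, MvPolynomial.eval_C] at hsum
          rw [← hsum, hc, Finset.mul_sum, ← Finset.sum_add_distrib]
          exact Finset.sum_congr rfl fun j _ => by simp; ring)
      rw [Finset.sum_range_succ, hrY]
      refine Ideal.add_mem _ ?_ (Ideal.mul_mem_left _ _ (hmemC r (JJ_mono a (by omega) hr2)))
      have h2 : ∑ j ∈ Finset.range i, MvPolynomial.X j * MvPolynomial.C (c j * a i) ∈ (JJ a l).map MvPolynomial.C :=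
        Ideal.sum_mem _ fun j _ => Ideal.mul_mem_left _ _ (hmemC _ (Ideal.mul_mem_left _ _ (mem_JJ a hi)))
      have := Ideal.sub_mem _ h1 h2
      simpa [mul_add, Finset.sum_add_distrib] using this
  | succ h ihh =>
    intro i
    induction i with
    | zero => intro _ Y _ _; simp
    | succ i ih =>
      intro hi Y hY hsum
      have hs := hsatY i hi Y hsum
      have h1 := huneke hreg hV hJ h (l - i) i (by omega) _ hs (FM_eval (hY i))
      obtain ⟨z, hz, hzs⟩ := (mem_JJ_mul _ _ _ _).1 h1
      choose Z hZ hZ2 using fun j => FM_surj (hz j)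
      have h2 : Y i - ∑ j ∈ Finset.range i, MvPolynomial.X j * Z j ∈ (JJ a l).map MvPolynomial.C := by
        have h3 : Y i - ∑ j ∈ Finset.range i, MvPolynomial.X j * Z j ∈ FM I l (h + 1) := by
          rw [sub_eq_add_neg]
          exact FM_add (hY i) (FM_neg (FM_sum _ fun j hj => FM_X (by have := Finset.mem_range.1 hj; omega) (hZ j)))
        have h4 : MvPolynomial.eval a (Y i - ∑ j ∈ Finset.range i, MvPolynomial.X j * Z j) = 0 := by
          rw [map_sub, hzs, map_sum, sub_eq_zero]
          exact Finset.sum_congr rfl fun j _ => by rw [map_mul, MvPolynomial.eval_X, hZ2, mul_comm]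
        obtain ⟨W, hW, hW2⟩ := h3
        rw [hW2] at h4 ⊢
        exact ihh l le_rfl W hW (by simpa using h4)
      have h5 := ih (by omega) (fun j => Y j + MvPolynomial.X i * Z j) (fun j => FM_add (hY j) (FM_X hi (hZ j))) (by
          rw [Finset.sum_range_succ, hzs] at hsum
          rw [← hsum, Finset.mul_sum, ← Finset.sum_add_distrib]
          exact Finset.sum_congr rfl fun j _ => by simp [hZ2]; ring)
      rw [Finset.sum_range_succ]
      have := Ideal.add_mem _ h5 (Ideal.mul_mem_left _ (MvPolynomial.X i) h2)
      convert this using 1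
      simp only [mul_add, Finset.sum_add_distrib, mul_sub, Finset.mul_sum]
      rw [add_assoc]
      congr 1
      rw [show ∑ j ∈ Finset.range i, MvPolynomial.X j * (MvPolynomial.X i * Z j) = ∑ j ∈ Finset.range i, MvPolynomial.X i * (MvPolynomial.X j * Z j) from
        Finset.sum_congr rfl fun j _ => by ring]
      ring

/-- if `x c G(a) ∈ J^(h+1)` then `c G` has coefficients in `J : I` -/
lemma form_main (hreg : ∀ i < l, ∀ x, a i * x ∈ sat (JJ a i) I → x ∈ sat (JJ a i) I)
    (hV : ∀ i < l, ∀ x ∈ sat (JJ a i) I, x ∈ I → x ∈ JJ a i) (hJ : JJ a l ≤ I) {x : R} (hx : x ∈ I)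
    (hI : I ≤ JJ a l ⊔ Ideal.span {x}) (c : R) (h : ℕ) (G : MvPolynomial ℕ R) (hG : G ∈ FM ⊤ l h)
    (hz : x * c * MvPolynomial.eval a G ∈ JJ a l ^ (h + 1)) :
    MvPolynomial.C c * G ∈ (colI (JJ a l) I).map MvPolynomial.C := by
  obtain ⟨Z, hZ, hZ2⟩ := FM_surj (M := JJ a l) (a := a) (h := h) (by rw [← pow_succ]; exact hz)
  have h1 : MvPolynomial.C (x * c) * G - Z ∈ FM I l h := by
    rw [sub_eq_add_neg]
    exact FM_add (FM_C (x * c) (fun m _ => I.mul_mem_right _ (I.mul_mem_right _ hx)) hG) (FM_neg (FM_mono hJ hZ))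
  have h2 : MvPolynomial.eval a (MvPolynomial.C (x * c) * G - Z) = 0 := by
    rw [map_sub, map_mul, MvPolynomial.eval_C, hZ2, sub_self]
  have h3 : MvPolynomial.C (x * c) * G - Z ∈ (JJ a l).map MvPolynomial.C := by
    cases h with
    | zero =>
      obtain ⟨r, hr, hr2⟩ := h1
      rw [hr2, MvPolynomial.eval_C] at h2
      rw [hr2, h2]; simp
    | succ h =>
      obtain ⟨W, hW, hW2⟩ := h1
      rw [hW2] at h2 ⊢
      exact form_indep hreg hV hJ h l le_rfl W hW (by simpa using h2)
  have h4 : Z ∈ (JJ a l).map MvPolynomial.C := by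
    clear hz h3 h2 h1 hZ2 hG
    induction h generalizing Z with
    | zero => obtain ⟨r, hr, rfl⟩ := hZ; exact Ideal.mem_map_of_mem _ hr
    | succ h ih =>
      obtain ⟨W, hW, rfl⟩ := hZ
      exact Ideal.sum_mem _ fun j _ => Ideal.mul_mem_left _ _ (ih _ (hW j))
  have h5 := Ideal.add_mem _ h3 h4
  rw [sub_add_cancel] at h5
  rw [MvPolynomial.mem_map_C_iff] at h5 ⊢
  intro m
  have h6 := h5 m
  rw [MvPolynomial.coeff_C_mul] at h6 ⊢
  intro y hy
  obtain ⟨w, hw, k, rfl⟩ := mem_sup_span.1 (hI hy)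
  rw [mul_add]
  refine Ideal.add_mem _ (Ideal.mul_mem_left _ _ hw) ?_
  have := Ideal.mul_mem_left _ k h6
  convert this using 1
  ring
end Forms

section Gen

lemma loc_principal {B : Type*} [CommRing B] [IsDomain B] [IsNoetherianRing B] [IsIntegrallyClosed B]
    (P : Ideal B) [hPp : P.IsPrime] (hP : ∀ Q : Ideal B, Q.IsPrime → Q ≤ P → Q = ⊥ ∨ Q = P) (K : Ideal B) :
    ∃ k0 ∈ K, ∃ s ∉ P, ∀ k ∈ K, ∃ b, s * k = b * k0 := by
  have hle := P.primeCompl_le_nonZeroDivisors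
  have : IsDomain (Localization.AtPrime P) := IsLocalization.isDomain_localization hle
  have : IsNoetherianRing (Localization.AtPrime P) := IsLocalization.isNoetherianRing P.primeCompl _ inferInstance
  have : IsIntegrallyClosed (Localization.AtPrime P) := isIntegrallyClosed_of_isLocalization _ P.primeCompl hle
  have : IsPrincipalIdealRing (Localization.AtPrime P) := by
    have hT : IsPrincipalIdealRing (Localization.AtPrime P) ↔ IsIntegrallyClosed (Localization.AtPrime P) ∧
        ∀ Q : Ideal (Localization.AtPrime P), Q ≠ ⊥ → Q.IsPrime → Q = maximalIdeal (Localization.AtPrime P) :=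
      (tfae_of_isNoetherianRing_of_isLocalRing_of_isDomain (Localization.AtPrime P)).out 0 3
    refine hT.2 ⟨inferInstance, fun Q hQ0 hQ => ?_⟩
    have h1 := IsLocalization.AtPrime.under_maximalIdeal (Localization.AtPrime P) P
    have h2 := hP (Q.comap (algebraMap B _)) (hQ.comap _) 
      (le_trans (Ideal.comap_mono (IsLocalRing.le_maximalIdeal hQ.ne_top)) h1.le)
    have hinj : ∀ A A' : Ideal (Localization.AtPrime P), A.comap (algebraMap B _) = A'.comap (algebraMap B _) → A = A' := by
      intro A A' h
      have e1 := IsLocalization.map_under P.primeCompl (Localization.AtPrime P) A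
      have e2 := IsLocalization.map_under P.primeCompl (Localization.AtPrime P) A'
      rw [Ideal.under, h] at e1
      exact e1.symm.trans e2
    rcases h2 with h2 | h2
    · exact absurd (hinj Q ⊥ (by
        rw [h2, Ideal.comap_bot_of_injective _ (IsLocalization.injective _ hle)])) hQ0
    · exact hinj _ _ (h2.trans h1.symm)
  obtain ⟨γ, hγ⟩ := IsPrincipalIdealRing.principal (K.map (algebraMap B (Localization.AtPrime P)))
  have hγm : γ ∈ K.map (algebraMap B (Localization.AtPrime P)) := by
    rw [hγ]; exact Submodule.mem_span_singleton_self _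
  obtain ⟨⟨k0, t0⟩, h0⟩ := (IsLocalization.mem_map_algebraMap_iff P.primeCompl _).1 hγm
  have hk : ∀ k ∈ K, ∃ s ∉ P, ∃ b, s * k = b * k0 := by
    intro k hk
    have h1 : algebraMap B (Localization.AtPrime P) k ∈ K.map (algebraMap B _) := Ideal.mem_map_of_mem _ hk
    rw [hγ] at h1
    obtain ⟨c, hc⟩ := Submodule.mem_span_singleton.1 h1
    obtain ⟨⟨b, t⟩, hb⟩ := IsLocalization.surj P.primeCompl c
    refine ⟨t * t0, fun h => (hPp.mem_or_mem h).elim t.2 t0.2, b, ?_⟩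
    apply IsLocalization.injective (Localization.AtPrime P) hle
    simp only [map_mul]
    rw [← hc, smul_eq_mul]
    dsimp only at h0 hb
    rw [← h0, ← hb]; ring
  obtain ⟨S, hS⟩ := IsNoetherian.noetherian K
  refine ⟨k0, k0.2, ?_⟩
  choose! s hs b hb using hk
  refine ⟨∏ k ∈ S, s k, ?_, ?_⟩
  · intro h
    obtain ⟨k, hk, hk2⟩ := (hPp.prod_mem_iff).1 h
    exact hs k (hS ▸ Ideal.subset_span hk) hk2
  · intro k hk
    have hk' := hk
    rw [← hS] at hk
    refine Submodule.span_induction (p := fun k _ => ∃ b, (∏ k ∈ S, s k) * k = b * k0) ?_ ?_ ?_ ?_ hk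
    · intro z hz
      obtain ⟨w, hw⟩ := Finset.dvd_prod_of_mem s hz
      refine ⟨w * b z, ?_⟩
      rw [hw, mul_right_comm, mul_comm _ w, hb z (hS ▸ Ideal.subset_span hz)]; ring
    · exact ⟨0, by simp⟩
    · rintro x y _ _ ⟨b, hb⟩ ⟨b', hb'⟩
      exact ⟨b + b', by rw [mul_add, hb, hb']; ring⟩
    · rintro c x _ ⟨b, hb⟩
      exact ⟨c * b, by rw [smul_eq_mul, mul_left_comm, hb]; ring⟩

lemma height_mv {R : Type*} [CommRing R] [IsNoetherianRing R] (q l : ℕ) (p : Ideal R) [hp : p.IsPrime]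
    (hl : p.height ≤ (l : ℕ∞)) (hpr : (p.map (MvPolynomial.C (σ := Fin q))).IsPrime) :
    (p.map (MvPolynomial.C (σ := Fin q))).height ≤ (l : ℕ∞) := by
  obtain ⟨S, hS, hSl⟩ := p.exists_finset_card_eq_height_of_isNoetherianRing
  classical
  have := Ideal.height_le_card_of_mem_minimalPrimes_span_finset (p := p.map (MvPolynomial.C (σ := Fin q)))
    (s := S.image MvPolynomial.C) ?_
  · refine this.trans ?_
    refine le_trans ?_ (hSl.le.trans hl)
    exact_mod_cast Finset.card_image_le
  · rw [Finset.coe_image, ← Ideal.map_span]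
    refine ⟨⟨hpr, Ideal.map_mono hS.1.2⟩, ?_⟩
    rintro Q ⟨hQ, hSQ⟩ hQp
    rw [Ideal.map_le_iff_le_comap] at hSQ ⊢
    refine hS.2 ⟨hQ.comap _, hSQ⟩ ?_
    intro r hr
    have := hQp hr
    rw [MvPolynomial.mem_map_C_iff] at this
    simpa using this 0

lemma prime_mv {R : Type*} [CommRing R] (q : ℕ) (p : Ideal R) [hp : p.IsPrime] :
    (p.map (MvPolynomial.C (σ := Fin q))).IsPrime := by
  rw [← Ideal.Quotient.isDomain_iff_prime]
  exact (MvPolynomial.quotientEquivQuotientMvPolynomial (σ := Fin q) p).symm.toMulEquiv.isDomain _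

/-- the kernel of an evaluation in a field has height at least the number of variables -/
lemma height_ker {R F : Type*} [CommRing R] [IsDomain R] [Field F] [Algebra R F]
    [IsFractionRing R F] (q : ℕ) (b : Fin q → F) :
    (q : ℕ∞) ≤ (RingHom.ker (MvPolynomial.aeval b : MvPolynomial (Fin q) R →ₐ[R] F)).height := by
  have main : ∀ i ≤ q, (i : ℕ∞) ≤ (RingHom.ker (MvPolynomial.aeval (fun j : Fin q => if (j : ℕ) < i then
      MvPolynomial.C (b j) else MvPolynomial.X j) : MvPolynomial (Fin q) R →ₐ[R] MvPolynomial (Fin q) F)).height := by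
    intro i
    induction i with
    | zero => intro _; simp
    | succ i ih =>
      intro hi
      set θ := fun i : ℕ => (MvPolynomial.aeval (fun j : Fin q => if (j : ℕ) < i then
        MvPolynomial.C (b j) else MvPolynomial.X j) : MvPolynomial (Fin q) R →ₐ[R] MvPolynomial (Fin q) F) with hθ
      have := fun i => RingHom.ker_isPrime (θ i)
      have hlt : RingHom.ker (θ i) < RingHom.ker (θ (i + 1)) := by
        set k : Fin q := ⟨i, hi⟩ with hk
        refine lt_of_le_of_ne ?_ ?_
        · have hcomp : ∀ G, θ (i + 1) G = MvPolynomial.aeval (fun j : Fin q => if (j : ℕ) = i then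
            MvPolynomial.C (b j) else (MvPolynomial.X j : MvPolynomial (Fin q) F)) (θ i G) := by
            intro G
            induction G using MvPolynomial.induction_on with
            | C r => simp [hθ, IsScalarTower.algebraMap_apply R F (MvPolynomial (Fin q) F), MvPolynomial.algebraMap_eq]
            | add G H hG hH => simp only [map_add, hG, hH]
            | mul_X G j hG =>
              rw [map_mul, hG, map_mul, map_mul]
              congr 1
              simp only [hθ, MvPolynomial.aeval_X]
              rcases lt_trichotomy (j : ℕ) i with h | h | h
              · simp [h, Nat.lt_succ_of_lt h, MvPolynomial.algebraMap_eq]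
              · simp [h]
              · simp [not_lt_of_gt h, h.ne', show ¬ (j : ℕ) < i + 1 by omega]
          intro G hG
          rw [RingHom.mem_ker] at hG ⊢
          rw [hcomp, hG, map_zero]
        · intro heq
          obtain ⟨r, s, hs, hrs⟩ := IsFractionRing.div_surjective (A := R) (b k)
          have hs0 : algebraMap R F s ≠ 0 := by
            simpa using nonZeroDivisors.ne_zero hs
          have h1 : MvPolynomial.C s * MvPolynomial.X k - MvPolynomial.C r ∈ RingHom.ker (θ (i + 1)) := by
            rw [RingHom.mem_ker]
            simp only [hθ, map_sub, map_mul, MvPolynomial.aeval_X, MvPolynomial.aeval_C, hk, Nat.lt_succ_self, if_true]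
            rw [← hk, ← hrs, IsScalarTower.algebraMap_apply R F (MvPolynomial (Fin q) F), MvPolynomial.algebraMap_eq,
              IsScalarTower.algebraMap_apply R F (MvPolynomial (Fin q) F), MvPolynomial.algebraMap_eq,
              ← map_mul, mul_div_cancel₀ _ hs0, sub_self]
          rw [← heq, RingHom.mem_ker] at h1
          simp only [hθ, map_sub, map_mul, MvPolynomial.aeval_X, MvPolynomial.aeval_C, hk, lt_irrefl, if_false] at h1
          rw [IsScalarTower.algebraMap_apply R F (MvPolynomial (Fin q) F), MvPolynomial.algebraMap_eq,
              IsScalarTower.algebraMap_apply R F (MvPolynomial (Fin q) F), MvPolynomial.algebraMap_eq] at h1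
          have h2 := congrArg (MvPolynomial.coeff (Finsupp.single k 1)) h1
          rw [MvPolynomial.coeff_sub, MvPolynomial.coeff_C_mul, MvPolynomial.coeff_C, ← hk] at h2
          rw [if_neg (fun h => (Finsupp.single_ne_zero.2 one_ne_zero) h.symm)] at h2
          exact hs0 (by simpa using h2)
      have := Ideal.height_add_one_le_of_lt_of_isPrime hlt
      refine le_trans ?_ this
      push_cast
      gcongr
      exact ih (by omega)
  refine (main q le_rfl).trans (Ideal.height_mono ?_)
  intro G hG
  rw [RingHom.mem_ker] at hG ⊢
  have h1 : ∀ G, MvPolynomial.aeval (fun _ => (0 : F)) ((MvPolynomial.aeval (fun j : Fin q => if (j : ℕ) < q then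
      MvPolynomial.C (b j) else MvPolynomial.X j) : MvPolynomial (Fin q) R →ₐ[R] MvPolynomial (Fin q) F) G) = MvPolynomial.aeval b G := by
    intro G
    induction G using MvPolynomial.induction_on with
    | C r => simp [IsScalarTower.algebraMap_apply R F (MvPolynomial (Fin q) F), MvPolynomial.algebraMap_eq]
    | add G H hG hH => simp only [map_add, hG, hH]
    | mul_X G j hG =>
      rw [map_mul, map_mul, map_mul, hG]
      congr 1
      simp
  rw [← h1, hG, map_zero]
end Gen

section Abs

lemma abs_step {A B : Type*} [CommRing A] [CommRing B] [Algebra A B] [Algebra.IsIntegral A B]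
    [IsDomain B] [IsNoetherianRing B] [IsIntegrallyClosed B] (𝔞 K : Ideal B) (p : Ideal A) [hp : p.IsPrime]
    (h1 : 𝔞.comap (algebraMap A B) ≤ p)
    (h2 : ∀ Q : Ideal A, Q.IsPrime → RingHom.ker (algebraMap A B) < Q → Q < p → False) :
    ∃ k0 ∈ K, ∃ s ∉ 𝔞, ∀ k ∈ K, ∃ b, s * k = b * k0 := by
  obtain ⟨P, hPa, hP, hPp⟩ := Ideal.exists_ideal_over_prime_of_isIntegral p 𝔞 h1
  obtain ⟨k0, hk0, s, hs, h⟩ := loc_principal P (fun Q hQ hQP => by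
    by_contra! hc
    have hlt : ∀ A1 A2 : Ideal B, A1.IsPrime → A1 ≤ A2 → A1 ≠ A2 →
        A1.comap (algebraMap A B) < A2.comap (algebraMap A B) := by
      intro A1 A2 hA1 hle hne
      obtain ⟨z, hz2, hz1⟩ := SetLike.exists_of_lt (lt_of_le_of_ne hle hne)
      exact Ideal.comap_lt_comap_of_integral_mem_sdiff hle ⟨hz2, hz1⟩ (Algebra.IsIntegral.isIntegral z)
    refine h2 (Q.comap (algebraMap A B)) (hQ.comap _) ?_ (hPp ▸ hlt Q P hQ hQP hc.2)
    have := hlt ⊥ Q Ideal.isPrime_bot bot_le hc.1.symm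
    rwa [← RingHom.ker_eq_comap_bot] at this) K
  exact ⟨k0, hk0, s, fun h => hs (hPa h), h⟩

variable {R : Type u} [CommRing R] [IsLocalRing R] [IsNoetherianRing R] {I : Ideal R}

lemma sup_pow_le (A B : Ideal R) (n : ℕ) : (A ⊔ B) ^ (n + 1) ≤ A * (A ⊔ B) ^ n ⊔ B ^ (n + 1) := by
  induction n with
  | zero => simp
  | succ n ih =>
    calc (A ⊔ B) ^ (n + 1 + 1) = (A ⊔ B) * (A ⊔ B) ^ (n + 1) := pow_succ' _ _
      _ = A * (A ⊔ B) ^ (n + 1) ⊔ B * (A ⊔ B) ^ (n + 1) := Ideal.sup_mul _ _ _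
      _ ≤ _ := by
        refine sup_le le_sup_left ?_
        refine (Ideal.mul_mono_right ih).trans ?_
        rw [Ideal.mul_sup]
        refine sup_le_sup ?_ (by rw [← pow_succ'])
        calc B * (A * (A ⊔ B) ^ n) = A * (B * (A ⊔ B) ^ n) := mul_left_comm _ _ _
          _ ≤ A * (A ⊔ B) ^ (n + 1) := by
            rw [pow_succ']
            exact Ideal.mul_mono_right (Ideal.mul_mono_left le_sup_right)

lemma int_mem {A : Ideal R} (hA : IsIntClosedIdeal A) (n : ℕ) (ζ : R) (c : ℕ → R)
    (hc : ∀ i < n, c i ∈ A ^ (n - i)) (h : ζ ^ n = ∑ i ∈ Finset.range n, c i * ζ ^ i) : ζ ∈ A := by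
  rcases n with _ | n
  · simp at h
  have hred : IsReduction A (A ⊔ Ideal.span {ζ}) := by
    refine red_of (r := n) le_sup_left ?_
    refine (sup_pow_le _ _ _).trans (sup_le le_rfl ?_)
    rw [Ideal.span_singleton_pow, Ideal.span_singleton_le_iff_mem, h]
    refine sum_mem fun i hi => ?_
    have hi' := Finset.mem_range.1 hi
    have h1 : c i ∈ A * (A ⊔ Ideal.span {ζ}) ^ (n - i) := by
      have := hc i hi'
      rw [show n + 1 - i = n - i + 1 by omega, pow_succ'] at this
      exact Ideal.mul_mono_right (Ideal.pow_right_mono le_sup_left _) this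
    have h2 : ζ ^ i ∈ (A ⊔ Ideal.span {ζ}) ^ i :=
      Ideal.pow_mem_pow (Ideal.mem_sup_right (Ideal.mem_span_singleton_self _)) _
    have h3 := Ideal.mul_mem_mul h1 h2
    rwa [mul_assoc A, ← pow_add, show n - i + i = n by omega] at h3
  rw [← hA _ hred]
  exact Ideal.mem_sup_right (Ideal.mem_span_singleton_self _)

variable {F : Type v} [Field F] [Algebra R F]

/-- The fractions `z / a0 ^ N` with `z ∈ K * I ^ N`. -/
def InM (F : Type v) [Field F] [Algebra R F] (I : Ideal R) (a0 : R) (K : Ideal R) (w : F) : Prop :=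
  ∃ N : ℕ, ∃ z ∈ K * I ^ N, w * algebraMap R F a0 ^ N = algebraMap R F z

lemma InM_up {a0 : R} (h0 : a0 ∈ I) {K : Ideal R} {w : F} {N M : ℕ} (hNM : N ≤ M) {z : R} (hz : z ∈ K * I ^ N)
    (h : w * algebraMap R F a0 ^ N = algebraMap R F z) :
    ∃ z ∈ K * I ^ M, w * algebraMap R F a0 ^ M = algebraMap R F z := by
  refine ⟨z * a0 ^ (M - N), ?_, ?_⟩
  · have := Ideal.mul_mem_mul hz (Ideal.pow_mem_pow h0 (M - N))
    rwa [mul_assoc K, ← pow_add, show N + (M - N) = M by omega] at this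
  · rw [map_mul, ← h, map_pow, mul_assoc, ← pow_add, show N + (M - N) = M by omega]

lemma InM_add {a0 : R} (h0 : a0 ∈ I) {K : Ideal R} {w w' : F} (h : InM F I a0 K w) (h' : InM F I a0 K w') :
    InM F I a0 K (w + w') := by
  obtain ⟨N, z, hz, h⟩ := h
  obtain ⟨N', z', hz', h'⟩ := h'
  obtain ⟨y, hy, e⟩ := InM_up h0 (le_max_left N N') hz h
  obtain ⟨y', hy', e'⟩ := InM_up h0 (le_max_right N N') hz' h'
  exact ⟨_, y + y', add_mem hy hy', by rw [add_mul, e, e', map_add]⟩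

lemma InM_mul {a0 : R} {K K' : Ideal R} {w w' : F} (h : InM F I a0 K w) (h' : InM F I a0 K' w') :
    InM F I a0 (K * K') (w * w') := by
  obtain ⟨N, z, hz, h⟩ := h
  obtain ⟨N', z', hz', h'⟩ := h'
  refine ⟨N + N', z * z', ?_, ?_⟩
  · have := Ideal.mul_mem_mul hz hz'
    rwa [mul_mul_mul_comm, ← pow_add] at this
  · rw [map_mul, ← h, ← h', pow_add]; ring

lemma InM_of {a0 : R} {K : Ideal R} {k : R} (hk : k ∈ K) : InM F I a0 K (algebraMap R F k) :=
  ⟨0, k, by simpa using hk, by simp⟩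

/-- The affine chart `R[I/a0]` of the blow-up of `I`. -/
def BB (F : Type v) [Field F] [Algebra R F] (I : Ideal R) (a0 : R) (h0 : a0 ∈ I) : Subalgebra R F where
  carrier := {w | InM F I a0 ⊤ w}
  mul_mem' := fun {w w'} h h' => by simpa using InM_mul h h'
  add_mem' := fun {w w'} h h' => InM_add h0 h h'
  algebraMap_mem' := fun r => InM_of (K := ⊤) trivial

lemma mem_BB {a0 : R} (h0 : a0 ∈ I) {w : F} : w ∈ BB F I a0 h0 ↔ InM F I a0 ⊤ w := Iff.rfl

variable [IsDomain R] [IsFractionRing R F]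

lemma div_mem {a0 : R} (h0 : a0 ∈ I) (hne : a0 ≠ 0) {N : ℕ} {z : R} (hz : z ∈ I ^ N) :
    algebraMap R F z / algebraMap R F a0 ^ N ∈ BB F I a0 h0 := by
  have : algebraMap R F a0 ≠ 0 := by simpa using hne
  exact ⟨N, z, by simpa using hz, by field_simp⟩

lemma BB_noeth {a0 : R} (h0 : a0 ∈ I) (hne : a0 ≠ 0) : IsNoetherianRing (BB F I a0 h0) := by
  have hne' : algebraMap R F a0 ≠ 0 := by simpa using hne
  obtain ⟨S, hS⟩ := IsNoetherian.noetherian I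
  classical
  have hfg : (BB F I a0 h0).FG := by
    refine ⟨S.image (fun s => algebraMap R F s / algebraMap R F a0), le_antisymm ?_ ?_⟩
    · rw [Algebra.adjoin_le_iff]
      intro w hw
      obtain ⟨s, hs, rfl⟩ := Finset.mem_image.1 hw
      have := div_mem (F := F) h0 hne (N := 1) (z := s) (by rw [pow_one, ← hS]; exact Ideal.subset_span hs)
      simpa using this
    · set T := Algebra.adjoin R ((S.image (fun s => algebraMap R F s / algebraMap R F a0) : Finset F) : Set F)
      have h1 : ∀ z ∈ I, algebraMap R F z / algebraMap R F a0 ∈ T := by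
        intro z hz
        rw [← hS] at hz
        refine Submodule.span_induction (p := fun z _ => algebraMap R F z / algebraMap R F a0 ∈ T) ?_ ?_ ?_ ?_ hz
        · intro z hz
          exact Algebra.subset_adjoin (Finset.mem_image_of_mem _ hz)
        · simp
        · intro x y _ _ hx hy
          rw [map_add, add_div]; exact add_mem hx hy
        · intro r x _ hx
          rw [smul_eq_mul, map_mul, mul_div_assoc]
          exact mul_mem (T.algebraMap_mem r) hx
      have h2 : ∀ N, ∀ z ∈ I ^ N, algebraMap R F z / algebraMap R F a0 ^ N ∈ T := by
        intro N
        induction N with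
        | zero => intro z _; simp
        | succ N ih =>
          intro z hz
          rw [pow_succ] at hz
          refine Submodule.mul_induction_on hz ?_ ?_
          · intro m hm n hn
            rw [map_mul, pow_succ, mul_div_mul_comm]
            exact mul_mem (ih m hm) (h1 n hn)
          · intro x y hx hy
            rw [map_add, add_div]; exact add_mem hx hy
      rintro w ⟨N, z, hz, h⟩
      have := h2 N z (by simpa using hz)
      rwa [← h, mul_div_cancel_right₀ _ (pow_ne_zero _ hne')] at this
  have : Algebra.FiniteType R (BB F I a0 h0) := (Subalgebra.fg_iff_finiteType _).1 hfg
  exact Algebra.FiniteType.isNoetherianRing R _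

lemma BB_frac {a0 : R} (h0 : a0 ∈ I) : IsFractionRing (BB F I a0 h0) F := by
  refine IsFractionRing.of_field _ _ fun z => ?_
  obtain ⟨x, y, _, h⟩ := IsFractionRing.div_surjective (A := R) z
  exact ⟨algebraMap R _ x, algebraMap R _ y, h.symm⟩

lemma BB_ic {a0 : R} (h0 : a0 ∈ I) (hne : a0 ≠ 0) (hR : IsIntegrallyClosed R) (hN : IsNormalIdeal I) :
    ∀ w : F, IsIntegral (BB F I a0 h0) w → w ∈ BB F I a0 h0 := by
  have hne' : algebraMap R F a0 ≠ 0 := by simpa using hne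
  rintro w ⟨P, hP, hw⟩
  -- common denominator
  have hden : ∀ n, ∃ N, ∀ i < n, ∃ z ∈ I ^ N, (P.coeff i : F) * algebraMap R F a0 ^ N = algebraMap R F z := by
    intro n
    induction n with
    | zero => exact ⟨0, by simp⟩
    | succ n ih =>
      obtain ⟨N, ih⟩ := ih
      obtain ⟨M, z, hz, h⟩ := (P.coeff n).2
      refine ⟨max N M, fun i hi => ?_⟩
      rcases Nat.lt_succ_iff_lt_or_eq.1 hi with hi | rfl
      · obtain ⟨z, hz, h⟩ := ih i hi
        simpa using InM_up h0 (K := ⊤) (le_max_left N M) (by simpa using hz) h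
      · simpa using InM_up h0 (K := ⊤) (le_max_right N M) (by simpa using hz) h
  set n := P.natDegree with hn
  obtain ⟨N, hden⟩ := hden n
  choose! z hz hzz using hden
  set A0 := algebraMap R F a0 with hA0
  have hw2 : w ^ n = - ∑ i ∈ Finset.range n, (P.coeff i : F) * w ^ i := by
    rw [← Polynomial.aeval_def, Polynomial.aeval_eq_sum_range, Finset.sum_range_succ, hP.coeff_natDegree,
      one_smul] at hw
    rw [eq_neg_iff_add_eq_zero, add_comm]
    exact hw
  set c : ℕ → R := fun i => - (z i * a0 ^ (N * (n - i - 1))) with hc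
  have hcI : ∀ i < n, c i ∈ (I ^ N) ^ (n - i) := by
    intro i hi
    refine neg_mem ?_
    have := Ideal.mul_mem_mul (hz i hi) (Ideal.pow_mem_pow h0 (N * (n - i - 1)))
    rwa [← pow_add, show N + N * (n - i - 1) = N * (n - i) by
      obtain ⟨k, hk⟩ := Nat.exists_eq_add_of_lt hi
      rw [show n - i - 1 = k by omega, show n - i = k + 1 by omega]; ring, pow_mul] at this
  have heq : (w * A0 ^ N) ^ n = ∑ i ∈ Finset.range n, algebraMap R F (c i) * (w * A0 ^ N) ^ i := by
    rw [mul_pow, hw2, neg_mul, Finset.sum_mul, ← Finset.sum_neg_distrib]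
    refine Finset.sum_congr rfl fun i hi => ?_
    have hi' := Finset.mem_range.1 hi
    simp only [hc, map_neg, map_mul, map_pow, ← hzz i hi', ← hA0]
    obtain ⟨k, hk⟩ := Nat.exists_eq_add_of_lt hi'
    rw [show n - i - 1 = k by omega, hk]
    ring
  have hintg : IsIntegral R (w * A0 ^ N) := by
    refine ⟨Polynomial.X ^ n - ∑ i ∈ Finset.range n, Polynomial.C (c i) * Polynomial.X ^ i, ?_, ?_⟩
    · refine Polynomial.monic_X_pow_sub ?_
      rw [← Polynomial.mem_degreeLT]
      refine sum_mem fun i hi => ?_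
      rw [Polynomial.mem_degreeLT]
      exact (Polynomial.degree_C_mul_X_pow_le _ _).trans_lt (by exact_mod_cast Finset.mem_range.1 hi)
    · simp only [Polynomial.eval₂_sub, Polynomial.eval₂_pow, Polynomial.eval₂_X, Polynomial.eval₂_finsetSum,
        Polynomial.eval₂_mul, Polynomial.eval₂_C]
      rw [heq, sub_self]
  obtain ⟨ζ, hζ⟩ := (isIntegrallyClosed_iff F).1 hR hintg
  refine ⟨N, ζ, ?_, hζ.symm⟩
  rw [Ideal.top_mul]
  refine int_mem (hN N) n ζ c hcI ?_
  apply IsFractionRing.injective R F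
  rw [map_pow, hζ, heq, map_sum]
  simp [hζ]

lemma BB_ic' {a0 : R} (h0 : a0 ∈ I) (hne : a0 ≠ 0) (hR : IsIntegrallyClosed R) (hN : IsNormalIdeal I) :
    IsIntegrallyClosed (BB F I a0 h0) := by
  have := BB_frac (F := F) h0
  rw [isIntegrallyClosed_iff F]
  intro w hw
  exact ⟨⟨w, BB_ic h0 hne hR hN w hw⟩, rfl⟩

lemma BB_int {a : ℕ → R} {l r : ℕ} (h0 : a 0 ∈ I) (hne : a 0 ≠ 0)
    (hred : I ^ (r + 1) ≤ JJ a l * I ^ r) {A : Type*} [CommRing A] [Algebra A F] [Algebra A (BB F I (a 0) h0)]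
    [IsScalarTower A (BB F I (a 0) h0) F]
    (hA : ∀ j < l, ∃ t : A, algebraMap A F t * algebraMap R F (a 0) = algebraMap R F (a j))
    (hAR : ∀ c : R, ∃ t : A, algebraMap A F t = algebraMap R F c) :
    Algebra.IsIntegral A (BB F I (a 0) h0) := by
  set A0 := algebraMap R F (a 0) with hA0
  have hne' : A0 ≠ 0 := by simpa [hA0] using hne
  obtain ⟨S, hS⟩ := IsNoetherian.noetherian (I ^ r)
  classical
  set N : Submodule A F := Submodule.span A ((S.image fun s => algebraMap R F s / A0 ^ r : Finset F) : Set F)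
  have hrN : ∀ (c : R) (n : F), n ∈ N → algebraMap R F c * n ∈ N := by
    intro c n hn
    obtain ⟨t, ht⟩ := hAR c
    rw [← ht, ← Algebra.smul_def]
    exact N.smul_mem _ hn
  have h1 : ∀ z ∈ I ^ r, algebraMap R F z / A0 ^ r ∈ N := by
    intro z hz
    rw [← hS] at hz
    refine Submodule.span_induction (p := fun z _ => algebraMap R F z / A0 ^ r ∈ N) ?_ ?_ ?_ ?_ hz
    · intro z hz
      exact Submodule.subset_span (Finset.mem_image_of_mem _ hz)
    · simp
    · intro x y _ _ hx hy
      rw [map_add, add_div]; exact add_mem hx hy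
    · intro c x _ hx
      rw [smul_eq_mul, map_mul, mul_div_assoc]
      exact hrN _ _ hx
  have h2 : ∀ M, ∀ z ∈ I ^ (r + M), algebraMap R F z / A0 ^ (r + M) ∈ N := by
    intro M
    induction M with
    | zero => exact h1
    | succ M ih =>
      intro z hz
      obtain ⟨y, hy, rfl⟩ := (mem_JJ_mul _ _ _ _).1 (red_mono (show r ≤ r + M by omega) hred hz)
      rw [map_sum, Finset.sum_div]
      refine sum_mem fun j hj => ?_
      obtain ⟨t, ht⟩ := hA j (Finset.mem_range.1 hj)
      have := N.smul_mem t (ih (y j) (hy j))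
      rw [Algebra.smul_def] at this
      convert this using 1
      rw [map_mul, ← ht]
      rw [← add_assoc, pow_succ]
      field_simp
  refine ⟨fun b => ?_⟩
  refine isIntegral_of_smul_mem_submodule N ?_ ⟨_, rfl⟩ b ?_
  · intro hbot
    have := h1 (a 0 ^ r) (Ideal.pow_mem_pow h0 r)
    rw [hbot, Submodule.mem_bot, map_pow, ← hA0, div_self (pow_ne_zero _ hne')] at this
    exact one_ne_zero this
  · intro n hn
    obtain ⟨M, z, hz, hb⟩ := b.2
    rw [Ideal.top_mul] at hz
    have hb' : (b : F) = algebraMap R F z / A0 ^ M := by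
      rw [← hb, mul_div_cancel_right₀ _ (pow_ne_zero _ hne')]
    rw [Algebra.smul_def]
    change (b : F) * n ∈ N
    refine Submodule.span_induction (p := fun n _ => (b : F) * n ∈ N) ?_ ?_ ?_ ?_ hn
    · intro x hx
      obtain ⟨s, hs, rfl⟩ := Finset.mem_image.1 hx
      have hs' : s ∈ I ^ r := hS ▸ Ideal.subset_span hs
      have := h2 M (s * z) (by rw [pow_add]; exact Ideal.mul_mem_mul hs' hz)
      convert this using 1
      rw [hb', map_mul, pow_add]; field_simp
    · simp
    · intro x y _ _ hx hy
      rw [mul_add]; exact add_mem hx hy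
    · intro c x _ hx
      rw [mul_smul_comm]
      exact N.smul_mem _ hx
end Abs

section Nrm
variable {R : Type u} [CommRing R] [IsLocalRing R] [IsNoetherianRing R] {I : Ideal R}

lemma prime_ex {K : Ideal R} {c : R} (hc : c ∉ K) :
    ∃ (s : R) (p : Ideal R), p.IsPrime ∧ ∀ r, r ∈ p ↔ r * (s * c) ∈ K := by
  have hmc : Ideal.Quotient.mk K c ∈ Submodule.span R {Ideal.Quotient.mk K c} :=
    Submodule.mem_span_singleton_self _
  obtain ⟨p, hp, -⟩ := exists_assoc (R := R) (M := Submodule.span R {Ideal.Quotient.mk K c}) ⟨_, hmc⟩ (by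
    intro h
    rw [Subtype.ext_iff] at h
    exact hc (Ideal.Quotient.eq_zero_iff_mem.1 h))
  obtain ⟨hp, ⟨m, hm⟩, h⟩ := assoc_iff.1 hp
  obtain ⟨s, rfl⟩ := Submodule.mem_span_singleton.1 hm
  refine ⟨s, p, hp, fun r => ?_⟩
  rw [h r, Subtype.ext_iff, ← Ideal.Quotient.eq_zero_iff_mem]
  rfl

/-- dehomogenization -/
noncomputable def dh (R : Type u) [CommRing R] (q : ℕ) : MvPolynomial ℕ R →ₐ[R] MvPolynomial (Fin q) R :=
  MvPolynomial.aeval (fun j => if j = 0 then 1 else if h : j - 1 < q then MvPolynomial.X ⟨j - 1, h⟩ else 0)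

lemma FM_bump {q h : ℕ} {G : MvPolynomial ℕ R} (hG : G ∈ FM ⊤ (q + 1) h) (N : ℕ) :
    MvPolynomial.X 0 ^ N * G ∈ FM ⊤ (q + 1) (h + N) ∧ dh R q (MvPolynomial.X 0 ^ N * G) = dh R q G := by
  induction N with
  | zero => simpa using hG
  | succ N ih =>
    rw [pow_succ', mul_assoc]
    refine ⟨FM_X (by omega) ih.1, ?_⟩
    rw [map_mul, ih.2]
    simp [dh]

variable {F : Type v} [Field F] [Algebra R F]

lemma dehom (q : ℕ) (a : ℕ → R) (h0 : algebraMap R F (a 0) ≠ 0) (G : MvPolynomial (Fin q) R) :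
    ∃ h, ∃ G' ∈ FM ⊤ (q + 1) h, dh R q G' = G ∧ algebraMap R F (MvPolynomial.eval a G') =
      algebraMap R F (a 0) ^ h * MvPolynomial.aeval (fun j : Fin q => algebraMap R F (a (j + 1)) / algebraMap R F (a 0)) G := by
  induction G using MvPolynomial.induction_on with
  | C r => exact ⟨0, MvPolynomial.C r, ⟨r, trivial, rfl⟩, by simp [dh], by simp⟩
  | add G H hG hH =>
    obtain ⟨h, G', hG', e1, e2⟩ := hG
    obtain ⟨k, H', hH', f1, f2⟩ := hH
    refine ⟨h + k, MvPolynomial.X 0 ^ k * G' + MvPolynomial.X 0 ^ h * H',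
      FM_add (FM_bump hG' k).1 (by rw [add_comm h]; exact (FM_bump hH' h).1), ?_, ?_⟩
    · rw [map_add, (FM_bump hG' k).2, (FM_bump hH' h).2, e1, f1]
    · simp only [map_add, map_mul, map_pow, MvPolynomial.eval_X, e2, f2]
      ring
  | mul_X G j hG =>
    obtain ⟨h, G', hG', e1, e2⟩ := hG
    refine ⟨h + 1, MvPolynomial.X ((j : ℕ) + 1) * G', FM_X (by omega) hG', ?_, ?_⟩
    · rw [map_mul, e1, mul_comm]
      simp [dh]
    · simp only [map_mul, MvPolynomial.eval_X, e2, MvPolynomial.aeval_X]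
      field_simp
      ring

lemma le_of_red {K L : Ideal R} {s : ℕ} (hN : IsNormalIdeal I) (hL : L ^ (s + 1) = K * I * L ^ s) : L ≤ I := by
  have h1 : IsIntClosedIdeal I := by simpa using hN 1
  have : IsReduction I (I ⊔ L) := by
    refine red_of (r := s) le_sup_left ((sup_pow_le _ _ _).trans (sup_le le_rfl ?_))
    rw [hL]
    exact Ideal.mul_mono Ideal.mul_le_right (Ideal.pow_right_mono le_sup_right _)
  exact le_sup_right.trans (h1 _ this).le

lemma K_pow {J K : Ideal R} (h : K * I ≤ J * K) (N : ℕ) : K * I ^ N ≤ J ^ N * K := by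
  induction N with
  | zero => simp
  | succ N ih =>
    calc K * I ^ (N + 1) = K * I ^ N * I := by rw [pow_succ, mul_assoc]
      _ ≤ J ^ N * K * I := Ideal.mul_mono_left ih
      _ = J ^ N * (K * I) := mul_assoc _ _ _
      _ ≤ J ^ N * (J * K) := Ideal.mul_mono_right h
      _ = _ := by rw [pow_succ, mul_assoc]

lemma InM_K {a0 : R} (h0 : a0 ∈ I) {K : Ideal R} (k : BB F I a0 h0)
    (hk : k ∈ K.map (algebraMap R (BB F I a0 h0))) : InM F I a0 K (k : F) := by
  refine Submodule.span_induction (p := fun (k : BB F I a0 h0) _ => InM F I a0 K (k : F)) ?_ ?_ ?_ ?_ hk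
  · rintro _ ⟨r, hr, rfl⟩
    exact InM_of hr
  · exact ⟨0, 0, zero_mem _, by simp⟩
  · intro x y _ _ hx hy
    exact InM_add h0 hx hy
  · intro b x _ hx
    have := InM_mul b.2 hx
    rwa [Ideal.top_mul] at this

variable [IsDomain R] [IsFractionRing R F]

lemma int_w {a0 : R} (h0 : a0 ∈ I) (hne : a0 ≠ 0) {K L : Ideal R} {s' : ℕ}
    (hL : L ^ (s' + 1) = K * I * L ^ s') {y : R} (hy : y ∈ L) (hy0 : y ≠ 0) {k0 s : BB F I a0 h0} (hk0 : (k0 : F) ≠ 0)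
    (hs : ∀ k ∈ K.map (algebraMap R (BB F I a0 h0)), ∃ b, s * k = b * k0) :
    IsIntegral (BB F I a0 h0) ((s : F) * algebraMap R F y / (algebraMap R F a0 * k0)) := by
  have hne' : algebraMap R F a0 ≠ 0 := by simpa using hne
  obtain ⟨S, hS⟩ := IsNoetherian.noetherian (L ^ s')
  classical
  set N : Submodule (BB F I a0 h0) F :=
    Submodule.span _ ((S.image (algebraMap R F) : Finset F) : Set F) with hN
  have hmem : ∀ v ∈ L ^ s', algebraMap R F v ∈ N := by
    intro v hv
    rw [← hS] at hv
    refine Submodule.span_induction (p := fun v _ => algebraMap R F v ∈ N) ?_ ?_ ?_ ?_ hv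
    · intro z hz
      exact Submodule.subset_span (Finset.mem_image_of_mem _ hz)
    · simp
    · intro x y _ _ hx hy
      rw [map_add]; exact add_mem hx hy
    · intro r x _ hx
      rw [smul_eq_mul, map_mul]
      exact N.smul_mem (algebraMap R _ r) hx
  refine isIntegral_of_smul_mem_submodule N ?_ ⟨_, rfl⟩ _ ?_
  · intro hbot
    have := hmem _ (Ideal.pow_mem_pow hy s')
    rw [hbot, Submodule.mem_bot] at this
    exact pow_ne_zero s' hy0 (by simpa using this)
  · have h2 : ∀ u ∈ K * I * L ^ s', (s : F) / (algebraMap R F a0 * k0) * algebraMap R F u ∈ N := by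
      intro u hu
      rw [mul_assoc] at hu
      refine Submodule.mul_induction_on hu ?_ ?_
      · intro k hk u hu
        refine Submodule.mul_induction_on hu ?_ ?_
        · intro i hi v hv
          obtain ⟨b, hb⟩ := hs _ (Ideal.mem_map_of_mem _ hk)
          have hb' : (s : F) * algebraMap R F k = b * k0 := congrArg Subtype.val hb
          have hi' := div_mem (F := F) h0 hne (N := 1) (z := i) (by simpa using hi)
          have := N.smul_mem (b * ⟨_, hi'⟩) (hmem v hv)
          rw [Algebra.smul_def] at this
          convert this using 1
          change _ = (b : F) * (algebraMap R F i / algebraMap R F a0 ^ 1) * algebraMap R F v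
          have : (b : F) = (s : F) * algebraMap R F k / k0 := by rw [hb']; field_simp
          rw [this, map_mul, map_mul]
          field_simp
        · intro x y hx hy
          rw [mul_add, map_add, mul_add]; exact add_mem hx hy
      · intro x y hx hy
        rw [map_add, mul_add]; exact add_mem hx hy
    intro n hn
    refine Submodule.span_induction (p := fun n _ => (((s : F) * algebraMap R F y / (algebraMap R F a0 * k0)) • n : F) ∈ N) ?_ ?_ ?_ ?_ hn
    · intro x hx
      obtain ⟨v, hv, rfl⟩ := Finset.mem_image.1 hx
      have hv' : v ∈ L ^ s' := hS ▸ Ideal.subset_span hv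
      have := h2 (y * v) (by rw [← hL, pow_succ']; exact Ideal.mul_mem_mul hy hv')
      convert this using 1
      rw [smul_eq_mul, map_mul]; ring
    · simp
    · intro x y _ _ hx hy
      rw [smul_add]; exact add_mem hx hy
    · intro c x _ hx
      rw [smul_comm]
      exact N.smul_mem _ hx

lemma normal_main (F : Type v) [Field F] [Algebra R F] [IsFractionRing R F] {a : ℕ → R} {q r s' : ℕ} (hR : IsIntegrallyClosed R) (hN : IsNormalIdeal I)
    (hreg : ∀ i < q + 1, ∀ x, a i * x ∈ sat (JJ a i) I → x ∈ sat (JJ a i) I)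
    (hV : ∀ i < q + 1, ∀ x ∈ sat (JJ a i) I, x ∈ I → x ∈ JJ a i)
    (hJ : JJ a (q + 1) ≤ I) {x : R} (hx : x ∈ I) (hI : I ≤ JJ a (q + 1) ⊔ Ideal.span {x})
    (hred : I ^ (r + 1) ≤ JJ a (q + 1) * I ^ r) {K : Ideal R} (hK : K = colI (JJ a (q + 1)) I)
    (hKI : K * I ≤ JJ a (q + 1) * K) (hne : a 0 ≠ 0) (h0K : a 0 ∈ K)
    (hht : ∀ c p, Ideal.IsPrime p → (∀ r, r ∈ p ↔ r * c ∈ K) → p.height ≤ ((q + 1 : ℕ) : ℕ∞))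
    {L : Ideal R} (hL : L ^ (s' + 1) = K * I * L ^ s') {y : R} (hy : y ∈ L) : y ∈ JJ a (q + 1) := by
  classical
  have hLI := le_of_red hN hL
  have h0J : a 0 ∈ JJ a (q + 1) := mem_JJ a (by omega)
  have h0 : a 0 ∈ I := hJ h0J
  obtain ⟨w, hw, c, rfl⟩ := mem_sup_span.1 (hI (hLI hy))
  by_cases hc : c ∈ K
  · rw [hK, mem_colI] at hc
    exact add_mem hw (hc x hx)
  exfalso
  obtain ⟨σ, p, hp, hpc⟩ := prime_ex hc
  have hy' : σ * (w + c * x) ∈ L := L.mul_mem_left _ hy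
  have hw' : σ * w ∈ JJ a (q + 1) := Ideal.mul_mem_left _ _ hw
  rw [mul_add, ← mul_assoc] at hy'
  clear hy hc hw
  generalize σ * c = c at *
  generalize σ * w = w at *
  set y := w + c * x with hydef
  have hpht := hht c p hp hpc
  have hcK : c ∉ K := fun h => hp.ne_top ((Ideal.eq_top_iff_one _).2 ((hpc 1).2 (by simpa using h)))
  have hy0 : y ≠ 0 := by
    intro h
    apply hcK
    have hcx : c * x ∈ JJ a (q + 1) := by
      rw [show c * x = - w by rw [eq_neg_iff_add_eq_zero, add_comm]; exact h]
      exact neg_mem hw'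
    rw [hK, mem_colI]
    intro i hi
    obtain ⟨w1, hw1, d, rfl⟩ := mem_sup_span.1 (hI hi)
    rw [mul_add]
    refine add_mem (Ideal.mul_mem_left _ _ hw1) ?_
    rw [mul_left_comm c d x]
    exact Ideal.mul_mem_left _ _ hcx
  set A0 := algebraMap R F (a 0) with hA0
  have hne' : A0 ≠ 0 := by simpa [hA0] using hne
  set B := BB F I (a 0) h0 with hB
  have hbj : ∀ j : Fin q, algebraMap R F (a (j + 1)) / A0 ∈ B := by
    intro j
    have := div_mem (F := F) h0 hne (N := 1) (z := a (j + 1)) (by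
      rw [pow_one]; exact hJ (mem_JJ a (by omega)))
    simpa using this
  let θ' : (MvPolynomial (Fin q) R) →ₐ[R] B := MvPolynomial.aeval (fun j : Fin q => (⟨_, hbj j⟩ : B))
  let θ : (MvPolynomial (Fin q) R) →ₐ[R] F := B.val.comp θ'
  have hθ : θ = MvPolynomial.aeval (fun j : Fin q => algebraMap R F (a (j + 1)) / A0) := by
    apply MvPolynomial.algHom_ext
    intro j
    simp [θ, θ']
  let i1 : Algebra (MvPolynomial (Fin q) R) B := θ'.toRingHom.toAlgebra
  let i2 : Algebra (MvPolynomial (Fin q) R) F := θ.toRingHom.toAlgebra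
  have i3 : IsScalarTower (MvPolynomial (Fin q) R) B F := IsScalarTower.of_algebraMap_eq fun _ => rfl
  have e1 : ∀ G : MvPolynomial (Fin q) R, algebraMap (MvPolynomial (Fin q) R) B G = θ' G := fun _ => rfl
  have e2 : ∀ G : MvPolynomial (Fin q) R, algebraMap (MvPolynomial (Fin q) R) F G = θ G := fun _ => rfl
  have e3 : ∀ G : MvPolynomial (Fin q) R, ((θ' G : B) : F) = θ G := fun _ => rfl
  have i4 : Algebra.IsIntegral (MvPolynomial (Fin q) R) B := by
    refine BB_int h0 hne hred ?_ ?_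
    · intro j hj
      rcases j with _ | j
      · exact ⟨1, by simp⟩
      · refine ⟨MvPolynomial.X ⟨j, by omega⟩, ?_⟩
        rw [e2, hθ]
        simp only [MvPolynomial.aeval_X]
        rw [← hA0, div_mul_cancel₀ _ hne']
    · intro d
      refine ⟨MvPolynomial.C d, ?_⟩
      rw [e2, hθ]; simp
  have i5 : IsNoetherianRing B := BB_noeth h0 hne
  have i6 : IsIntegrallyClosed B := BB_ic' h0 hne hR hN
  let 𝔞 : Ideal B :=
    { carrier := {b | InM F I (a 0) K ((b : F) * (algebraMap R F y / A0))}
      add_mem' := fun {b b'} h h' => by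
        have := InM_add h0 h h'
        rw [← add_mul] at this
        exact this
      zero_mem' := ⟨0, 0, zero_mem _, by simp⟩
      smul_mem' := fun b b' h => by
        have := InM_mul b.2 h
        rw [Ideal.top_mul, ← mul_assoc] at this
        exact this }
  have hpm : (p.map (MvPolynomial.C (σ := Fin q))).IsPrime := prime_mv q p
  have hst1 : 𝔞.comap (algebraMap (MvPolynomial (Fin q) R) B) ≤ p.map (MvPolynomial.C (σ := Fin q)) := by
    intro G hG
    obtain ⟨N, z, hz, hzz⟩ : InM F I (a 0) K (θ G * (algebraMap R F y / A0)) := hG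
    obtain ⟨h, G', hG', f1, f2⟩ := dehom (F := F) q a hne' G
    rw [← hA0, ← hθ] at f2
    obtain ⟨hb1, hb2⟩ := FM_bump hG' N
    set G2 := MvPolynomial.X 0 ^ N * G' with hG2
    have hev : MvPolynomial.eval a G2 * y = a 0 ^ (h + 1) * z := by
      apply IsFractionRing.injective R F
      simp only [hG2, map_mul, map_pow, MvPolynomial.eval_X, f2, ← hzz]
      rw [← hA0]
      field_simp
      ring
    have hzJ : z ∈ JJ a (q + 1) ^ N := Ideal.mul_le_left (K_pow hKI N hz)
    have h1 : MvPolynomial.eval a G2 * y ∈ JJ a (q + 1) ^ (h + N + 1) := by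
      rw [hev, show h + N + 1 = (h + 1) + N by omega, pow_add]
      exact Ideal.mul_mem_mul (Ideal.pow_mem_pow h0J _) hzJ
    have h2 : MvPolynomial.eval a G2 ∈ JJ a (q + 1) ^ (h + N) := by
      have := FM_eval (a := a) hb1
      rwa [Ideal.mul_top] at this
    have h3 : x * c * MvPolynomial.eval a G2 ∈ JJ a (q + 1) ^ (h + N + 1) := by
      have h4 := Ideal.mul_mem_mul h2 hw'
      rw [← pow_succ] at h4
      have := sub_mem h1 h4
      rwa [hydef, ← mul_sub, add_sub_cancel_left, mul_comm (MvPolynomial.eval a G2), mul_comm c x] at this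
    have h5 := form_main hreg hV hJ hx hI c (h + N) G2 hb1 h3
    rw [← hK] at h5
    have h6 := Ideal.mem_map_of_mem (dh R q : MvPolynomial ℕ R →+* MvPolynomial (Fin q) R) h5
    rw [Ideal.map_map] at h6
    have hcomp : (dh R q : MvPolynomial ℕ R →+* MvPolynomial (Fin q) R).comp MvPolynomial.C = MvPolynomial.C := by
      ext r : 1
      simp [dh]
    change dh R q (MvPolynomial.C c * G2) ∈ K.map ((dh R q : MvPolynomial ℕ R →+* MvPolynomial (Fin q) R).comp MvPolynomial.C) at h6
    rw [hcomp, map_mul, hb2, f1, show dh R q (MvPolynomial.C c) = MvPolynomial.C c by simp [dh],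
      MvPolynomial.mem_map_C_iff] at h6
    rw [MvPolynomial.mem_map_C_iff]
    intro m
    have := h6 m
    rw [MvPolynomial.coeff_C_mul] at this
    rw [hpc, mul_comm]
    exact this
  have hker : RingHom.ker (algebraMap (MvPolynomial (Fin q) R) B) = RingHom.ker
      (MvPolynomial.aeval (fun j : Fin q => algebraMap R F (a (j + 1)) / A0) : MvPolynomial (Fin q) R →ₐ[R] F) := by
    rw [← hθ]
    ext G
    rw [RingHom.mem_ker, RingHom.mem_ker, e1, ← e3]
    exact ⟨fun h => by rw [h]; rfl, fun h => Subtype.ext h⟩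
  obtain ⟨k0, hk0, s, hs, hsk⟩ := abs_step (A := MvPolynomial (Fin q) R) (B := B) 𝔞 (K.map (algebraMap R B))
    (p.map (MvPolynomial.C (σ := Fin q))) hst1 (by
      intro Q hQ hlt1 hlt2
      have hkp : (RingHom.ker (algebraMap (MvPolynomial (Fin q) R) B)).IsPrime := RingHom.ker_isPrime _
      have h1 := height_ker (R := R) (F := F) q (fun j : Fin q => algebraMap R F (a (j + 1)) / A0)
      rw [← hker] at h1
      have h2 := Ideal.height_add_one_le_of_lt_of_isPrime hlt1
      have h3 := Ideal.height_add_one_le_of_lt_of_isPrime hlt2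
      have h4 := height_mv q (q + 1) p hpht hpm
      have h5 : ((q : ℕ∞) + 1) + 1 ≤ ((q + 1 : ℕ) : ℕ∞) :=
        le_trans (add_le_add_left (le_trans (add_le_add_left h1 1) h2) 1) (h3.trans h4)
      have h6 : q + 1 + 1 ≤ q + 1 := by exact_mod_cast h5
      omega)
  have hk00 : (k0 : F) ≠ 0 := by
    intro h
    obtain ⟨b, hb⟩ := hsk _ (Ideal.mem_map_of_mem _ h0K)
    have hb' : (s : F) * A0 = b * k0 := congrArg Subtype.val hb
    rw [h, mul_zero] at hb'
    have hs0 : (s : F) = 0 := (mul_eq_zero.1 hb').resolve_right hne'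
    exact hs (by rw [show s = 0 from Subtype.ext hs0]; exact zero_mem _)
  have hwB := BB_ic h0 hne hR hN _ (int_w h0 hne hL hy' hy0 hk00 hsk)
  apply hs
  change InM F I (a 0) K ((s : F) * (algebraMap R F y / A0))
  have := InM_mul hwB (InM_K h0 k0 hk0)
  rw [Ideal.top_mul] at this
  convert this using 1
  rw [← hA0]
  field_simp
end Nrm

section Fin
variable {R : Type u} [CommRing R] [IsLocalRing R] [IsNoetherianRing R]
variable {I : Ideal R} {g l d : ℕ} [Infinite (ResidueField R)]

lemma normal_J [IsDomain R] (C : Ctx I g l d) (D : RCtx I l) {e : ℕ → R} (hI : I = JJ e (l + 1))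
    (hcore : core I = Rel e (l + 1) * I) (hR : IsIntegrallyClosed R) (hN : IsNormalIdeal I)
    {J : Ideal R} (hJ : IsMinimalReduction J I) {L : Ideal R} {s : ℕ}
    (hL : L ^ (s + 1) = Rel e (l + 1) * I * L ^ s) : L ≤ J ∧ colI J I = Rel e (l + 1) := by
  obtain ⟨a, x, ha, hJa, hb, hx, hreg, hIx, hK, hIK, hkx, hred⟩ := backward C D hI hcore hJ
  refine ⟨fun y hy => ?_, hK⟩
  have hJI := hJ.1.1
  clear hJ hcore
  subst hJa
  have hreg' : ∀ i < l, ∀ x, a i * x ∈ sat (JJ a i) I → x ∈ sat (JJ a i) I := by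
    intro i hi
    by_cases h : i < l - 1
    · exact ha.reg i h
    · rw [show i = l - 1 by omega]; exact hreg
  have hV : ∀ i < l, ∀ x ∈ sat (JJ a i) I, x ∈ I → x ∈ JJ a i := by
    intro i hi x hx hxI
    have := V_one C ha i hi x hx (by simpa using hxI)
    simpa using this
  have hKI : Rel e (l + 1) * I ≤ JJ a l * Rel e (l + 1) := by
    rw [Ideal.mul_le]
    intro k hk i hi
    rw [hIx] at hi
    obtain ⟨w, hw, c, rfl⟩ := mem_sup_span.1 hi
    rw [mul_add, mul_comm k w, mul_left_comm k c x]
    exact add_mem (Ideal.mul_mem_mul hw hk) (Ideal.mul_mem_left _ _ (hkx k hk))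
  have hl1 := C.hl1
  have hne : a 0 ≠ 0 := by
    intro h0
    have h1 := hreg' 0 (by omega) 1 (by rw [h0, zero_mul]; exact zero_mem _)
    obtain ⟨N, hN⟩ := mem_sat.1 h1
    have hI0 : I = ⊥ := by
      rw [eq_bot_iff]
      intro z hz
      have := hN _ (Ideal.pow_mem_pow hz N)
      rw [JJ_zero, Ideal.mem_bot, mul_one] at this
      exact (Submodule.mem_bot R).2 (eq_zero_of_pow_eq_zero this)
    have := D.mu2 ∅ (by simp [hI0])
    simp at this
  have h0I : a 0 ∈ I := hJI (mem_JJ a (by omega))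
  have hht : ∀ c p, Ideal.IsPrime p → (∀ r, r ∈ p ↔ r * c ∈ Rel e (l + 1)) → p.height ≤ (l : ℕ∞) := by
    intro c p hp h
    rw [← hK] at h
    exact ht_assoc C ha hb hreg hJI hx hIx.le hp h
  clear hreg ha hb hI D C hkx
  obtain ⟨q, rfl⟩ : ∃ q, l = q + 1 := ⟨l - 1, by omega⟩
  exact normal_main (FractionRing R) hR hN hreg' hV hJI hx hIx.le hred hK.symm hKI hne (hIK h0I) hht hL hy

lemma normal_final [IsDomain R] (C : Ctx I g l d) (D : RCtx I l) {e : ℕ → R} (hI : I = JJ e (l + 1))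
    (hcore : core I = Rel e (l + 1) * I) (hR : IsIntegrallyClosed R) (hN : IsNormalIdeal I) :
    IsIntClosedIdeal (Rel e (l + 1)) ∧ IsIntClosedIdeal (core I) := by
  constructor
  · rintro L ⟨hle, s, hs⟩
    refine le_antisymm ?_ hle
    obtain ⟨J, hJ⟩ := D.exists_min
    have h1 : (L * I) ^ (s + 1) = Rel e (l + 1) * I * (L * I) ^ s := by
      rw [mul_pow, mul_pow, hs, pow_succ' I]; ring
    obtain ⟨h2, h3⟩ := normal_J C D hI hcore hR hN hJ h1
    rw [← h3]
    intro y hy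
    exact mem_colI.2 fun z hz => h2 (Ideal.mul_mem_mul hy hz)
  · rintro L ⟨hle, s, hs⟩
    refine le_antisymm ?_ hle
    refine le_sInf fun J hJ => ?_
    rw [hcore] at hs
    exact (normal_J C D hI hcore hR hN hJ hs).1

lemma redNumber_iff (C : Ctx I g l d) (D : RCtx I l) {e : ℕ → R} (hI : I = JJ e (l + 1)) :
    reductionNumber I = ((l - g + 1 : ℕ) : ℕ∞) ↔ core I = Rel e (l + 1) * I := by
  constructor
  · intro h
    have hne : {n : ℕ∞ | ∃ r : ℕ, (r : ℕ∞) = n ∧ ∃ J : Ideal R,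
      IsMinimalReduction J I ∧ I ^ (r + 1) = J * I ^ r}.Nonempty := by
      obtain ⟨J, hJ⟩ := D.exists_min
      obtain ⟨r, hr⟩ := hJ.1.2
      exact ⟨r, r, rfl, J, hJ, hr⟩
    obtain ⟨r, hr, J, hJ, hJr⟩ := csInf_mem hne
    change (r : ℕ∞) = reductionNumber I at hr
    rw [h] at hr
    have hr' : r = l - g + 1 := by exact_mod_cast hr
    subst hr'
    exact forward C D hJ hJr.le hI
  · intro h
    refine le_antisymm ?_ ?_
    · obtain ⟨J, hJ⟩ := D.exists_min
      obtain ⟨a, x, -, -, -, -, -, -, -, -, -, hred⟩ := backward C D hI h hJ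
      exact sInf_le ⟨_, rfl, J, hJ, red_eq hJ.1.1 hred⟩
    · refine le_sInf ?_
      rintro _ ⟨r, rfl, J, hJ, hr⟩
      exact_mod_cast red_ge C D hJ hr.le
end Fin

section Conv
variable {R : Type u} [CommRing R] [IsLocalRing R] [IsNoetherianRing R]

lemma exists_assoc_gt {s : ℕ} (M : Type u) [AddCommGroup M] [Module R M] [Module.Finite R M]
    (hM : Dep R (s + 1) M) (p : Ideal R) (hp : p ∈ associatedPrimes R M) :
    ∃ x : R, IsSMulRegular M x ∧ ∃ q ∈ associatedPrimes R (QuotSMulTop x M), p < q := by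
  obtain ⟨x, hxm, hx⟩ := hM.exists_regular
  have hpp := hp.1
  obtain ⟨m0, hm⟩ := (assoc_iff.1 hp).2
  have hm0ne : m0 ≠ 0 := by
    rintro rfl
    exact hpp.ne_top (Ideal.eq_top_iff_one _ |>.2 ((hm 1).2 (by simp)))
  have hxp : x ∉ p := fun h => hm0ne (hx (by simpa using (hm x).1 h))
  let U : Submodule R M :=
    { carrier := {m | ∀ r ∈ p, r • m = 0}
      add_mem' := fun {a b} ha hb r hr => by rw [smul_add, ha r hr, hb r hr, add_zero]
      zero_mem' := fun r _ => smul_zero r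
      smul_mem' := fun c m hm r hr => by rw [smul_comm, hm r hr, smul_zero] }
  have hU : ∃ u ∈ U, ∀ m, u ≠ x • m := by
    by_contra hcon
    push Not at hcon
    have : U ≤ (maximalIdeal R) • U := by
      intro u hu
      obtain ⟨m, rfl⟩ := hcon u hu
      refine Submodule.smul_mem_smul hxm ?_
      intro r hr
      apply hx
      have := hu r hr
      rw [smul_comm] at this
      simpa using this
    have hbot := Submodule.eq_bot_of_le_smul_of_le_jacobson_bot (maximalIdeal R) U
      (IsNoetherian.noetherian U) this (IsLocalRing.maximalIdeal_le_jacobson _)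
    have : m0 ∈ U := fun r hr => (hm r).1 hr
    rw [hbot] at this
    exact hm0ne this
  obtain ⟨u, hu, hux⟩ := hU
  let ub : QuotSMulTop x M := Submodule.mkQ _ u
  have hub : ub ≠ 0 := by
    intro h
    have h2 := (Submodule.Quotient.mk_eq_zero _).1 h
    rw [Submodule.mem_smul_pointwise_iff_exists] at h2
    obtain ⟨m, -, h3⟩ := h2
    exact hux m h3.symm
  obtain ⟨q, hq, hle⟩ := exists_assoc (R := R) ub hub
  refine ⟨x, hx, q, hq, ?_⟩
  have h1 : ∀ r, r • u = 0 → r ∈ q := fun r hr => hle r (by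
    rw [← map_smul, hr, map_zero])
  refine lt_of_le_of_ne (fun r hr => h1 r (hu r hr)) ?_
  rintro rfl
  apply hxp
  apply hle
  rw [← map_smul]
  exact (Submodule.Quotient.mk_eq_zero _).2
    (Submodule.smul_mem_pointwise_smul _ _ _ Submodule.mem_top)

lemma dim_quot_succ {p q : Ideal R} (hp : p.IsPrime) (hq : q.IsPrime) (h : p < q) :
    ringKrullDim (R ⧸ q) + 1 ≤ ringKrullDim (R ⧸ p) := by
  obtain ⟨x, hxq, hxp⟩ := SetLike.exists_of_lt h
  refine ringKrullDim_succ_le_of_surjective (Ideal.Quotient.factor h.le)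
    (Ideal.Quotient.factor_surjective h.le) (r := Ideal.Quotient.mk p x) ?_ ?_
  · rw [mem_nonZeroDivisors_iff_ne_zero]
    rwa [ne_eq, Ideal.Quotient.eq_zero_iff_mem]
  · simpa [Ideal.Quotient.eq_zero_iff_mem] using hxq

lemma isch2 (s : ℕ) :
    ∀ (M : Type u) [AddCommGroup M] [Module R M] [Module.Finite R M] (_ : Dep R s M)
      (p : Ideal R) (_ : p ∈ associatedPrimes R M), (s : WithBot ℕ∞) ≤ ringKrullDim (R ⧸ p) := by
  induction s with
  | zero =>
    intro M _ _ _ _ p hp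
    have := hp.1
    simpa using ringKrullDim_nonneg_of_nontrivial (R := R ⧸ p)
  | succ s ih =>
    intro M _ _ _ hM p hp
    obtain ⟨x, hx, q, hq, hpq⟩ := exists_assoc_gt M hM p hp
    have h2 := ih (QuotSMulTop x M) (hM.quot hx) q hq
    have h3 := dim_quot_succ hp.1 hq.1 hpq
    push_cast
    exact le_trans (by gcongr) h3

lemma min_assoc {K p : Ideal R} (h : p ∈ K.minimalPrimes) : p ∈ associatedPrimes R (R ⧸ K) := by
  apply Module.associatedPrimes.minimalPrimes_annihilator_subset_associatedPrimes
  rwa [Ideal.annihilator_quotient]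

noncomputable def quotQuotEquiv (K : Ideal R) (x : R) :
    QuotSMulTop x (R ⧸ K) ≃ₗ[R] R ⧸ (K ⊔ Ideal.span {x}) := by
  refine (Submodule.quotEquivOfEq _ (Submodule.map (Submodule.mkQ K) (K ⊔ Ideal.span {x})) ?_).trans
    (Submodule.quotientQuotientEquivQuotient K (K ⊔ Ideal.span {x}) le_sup_left)
  ext y
  obtain ⟨y, rfl⟩ := Submodule.mkQ_surjective _ y
  rw [Submodule.map_sup, Submodule.mkQ_map_self, bot_sup_eq, ]
  rw [Submodule.mem_smul_pointwise_iff_exists]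
  rw [Submodule.mem_map]
  constructor
  · rintro ⟨z, -, hz⟩
    obtain ⟨z, rfl⟩ := Submodule.mkQ_surjective _ z
    exact ⟨x * z, Ideal.mul_mem_right _ _ (Ideal.mem_span_singleton_self x), by
      rw [← hz, ← map_smul]; rfl⟩
  · rintro ⟨z, hz, hzy⟩
    obtain ⟨w, rfl⟩ := Ideal.mem_span_singleton.1 hz
    exact ⟨K.mkQ w, trivial, by rw [← map_smul, ← hzy]; rfl⟩

lemma dim_ge (n : ℕ) : ∀ (K p : Ideal R) (s i : ℕ), p.IsPrime → K ≤ p → Dep R s (R ⧸ K) →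
    (∀ q : Ideal R, q.IsPrime → K ≤ q → q ≤ p → (i : ℕ∞) ≤ q.height) →
    p.height ≤ ((i + n : ℕ) : ℕ∞) → (s : WithBot ℕ∞) ≤ n + ringKrullDim (R ⧸ p) := by
  induction n with
  | zero =>
    intro K p s i hp hK hD hq hph
    simp only [Nat.cast_zero, zero_add]
    refine isch2 s (R ⧸ K) hD p (min_assoc ⟨⟨hp, hK⟩, ?_⟩)
    intro q ⟨hq1, hq2⟩ hqp
    by_contra hcon
    have h1 := height_lt_of_lt hq1 hp (lt_of_le_not_ge hqp hcon)
    have h2 := hq q hq1 hq2 hqp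
    have h3 : (i : ℕ∞) + 1 ≤ i := by
      calc (i : ℕ∞) + 1 ≤ q.height + 1 := by gcongr
        _ ≤ _ := h1
        _ ≤ i := by simpa using hph
    exact absurd h3 (by exact_mod_cast Nat.not_succ_le_self i)
  | succ n ih =>
    intro K p s i hp hK hD hq hph
    have hdim0 : (0 : WithBot ℕ∞) ≤ ringKrullDim (R ⧸ p) := ringKrullDim_nonneg_of_nontrivial
    by_cases hpa : ∃ q ∈ associatedPrimes R (R ⧸ K), p ≤ q
    · obtain ⟨q, hqa, hpq⟩ := hpa
      have h1 := isch2 s (R ⧸ K) hD q hqa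
      have h2 : ringKrullDim (R ⧸ q) ≤ ringKrullDim (R ⧸ p) :=
        ringKrullDim_le_of_surjective (Ideal.Quotient.factor hpq)
          (Ideal.Quotient.factor_surjective hpq)
      refine (h1.trans h2).trans ?_
      exact le_add_of_nonneg_left (by positivity)
    · rcases s with _ | s
      · simpa using add_nonneg (by positivity) hdim0
      push Not at hpa
      obtain ⟨x, hxp, hx⟩ : ∃ x ∈ p, IsSMulRegular (R ⧸ K) x := by
        by_contra hcon
        push Not at hcon
        have hfin := associatedPrimes.finite R (R ⧸ K)
        have hsub : (p : Set R) ⊆ ⋃ q ∈ (hfin.toFinset : Set (Ideal R)), (q : Set R) := by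
          intro x hx
          have h1 := hcon x hx
          have h2 := biUnion_associatedPrimes_eq_compl_regular R (R ⧸ K)
          have h3 : x ∈ (⋃ q ∈ associatedPrimes R (R ⧸ K), (q : Set R)) := by
            rw [h2]; exact h1
          simpa using h3
        rw [Ideal.subset_union_prime (f := fun q => q) ⊥ ⊥ (fun q hq _ _ => by
          have : q ∈ associatedPrimes R (R ⧸ K) := by simpa using hq
          exact this.1)] at hsub
        obtain ⟨q, hq1, hq2⟩ := hsub
        exact hpa q (by simpa using hq1) hq2
      have hD' : Dep R s (R ⧸ (K ⊔ Ideal.span {x})) := (hD.quot hx).equiv (quotQuotEquiv K x)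
      have := ih (K ⊔ Ideal.span {x}) p s (i + 1) hp
        (sup_le hK ((Ideal.span_singleton_le_iff_mem _).2 hxp)) hD' ?_
        (by convert hph using 2; ring)
      · push_cast
        calc (s : WithBot ℕ∞) + 1 ≤ (n + ringKrullDim (R ⧸ p)) + 1 := by gcongr
          _ = _ := by ring
      · intro q hq1 hq2 hqp
        have := hq1
        obtain ⟨q', hq'm, hq'⟩ := Ideal.exists_minimalPrimes_le (le_sup_left.trans hq2)
        have hxq' : x ∉ q' := regular_not_mem_assoc hx (min_assoc hq'm)
        have hlt : q' < q := lt_of_le_of_ne hq' (by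
          rintro rfl
          exact hxq' (hq2 (Ideal.mem_sup_right (Ideal.mem_span_singleton_self x))))
        have h1 := height_lt_of_lt hq'm.1.1 hq1 hlt
        have h2 := hq q' hq'm.1.1 hq'm.1.2 (hq'.trans hqp)
        push_cast
        exact le_trans (by gcongr) h1

lemma dep_of_mDepth {M : Type u} [AddCommGroup M] [Module R M] {s : ℕ}
    (h : (s : ℕ∞) ≤ mDepth R M) : Dep R s M := by
  rcases s with _ | s
  · exact Dep.zero
  have : (s : ℕ∞) < mDepth R M := lt_of_lt_of_le (by exact_mod_cast Nat.lt_succ_self s) h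
  obtain ⟨t, ⟨rs, h1, h2, h3⟩, h4⟩ := lt_sSup_iff.1 this
  refine (dep_of_regular rs h1 M h2.toIsWeaklyRegular).mono ?_
  rw [← h3] at h4
  exact_mod_cast h4

lemma ty_of_regular {c : ℕ} (rs : List R) (hrs : ∀ x ∈ rs, x ∈ maximalIdeal R) :
    ∀ (M : Type u) [AddCommGroup M] [Module R M], RingTheory.Sequence.IsWeaklyRegular M rs →
      Ty R 0 (M ⧸ (Ideal.ofList rs • (⊤ : Submodule R M))) c → Ty R rs.length M c := by
  induction rs with
  | nil =>
    intro M _ _ _ h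
    refine h.equiv ?_
    exact Submodule.quotEquivOfEqBot _ (by simp)
  | cons r rs ih =>
    intro M _ _ hr h
    rw [RingTheory.Sequence.isWeaklyRegular_cons_iff] at hr
    refine Ty.lift (hrs r (by simp)) hr.1 ?_
    exact ih (fun x hx => hrs x (by simp [hx])) _ hr.2
      (h.equiv (Submodule.quotOfListConsSMulTopEquivQuotSMulTopInner M r rs))

lemma ty_zero_of_socle {K : Ideal R} (u : R ⧸ K) (hu : socle R K = Ideal.span {u}) :
    Ty R 0 (R ⧸ K) 1 := by
  refine ⟨Dep.zero, ?_⟩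
  rw [(EEzero (R := R) (M := R ⧸ K)).length_eq]
  have hsoc : ∀ v : R ⧸ K, v ∈ socle R K ↔ ∀ r ∈ maximalIdeal R, r • v = 0 := by
    intro v
    rw [socle, Submodule.mem_colon]
    constructor
    · intro h r hr
      have := h (Ideal.Quotient.mk K r) (Ideal.mem_map_of_mem _ hr)
      rw [smul_eq_mul, Ideal.mem_bot] at this
      rw [Algebra.smul_def, mul_comm]; exact this
    · intro h y hy
      rw [SetLike.mem_coe, Ideal.mem_map_iff_of_surjective _ Ideal.Quotient.mk_surjective] at hy
      obtain ⟨r, hr, rfl⟩ := hy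
      have := h r hr
      rw [smul_eq_mul, Ideal.mem_bot, mul_comm]
      rwa [Algebra.smul_def] at this
  have humem : u ∈ socle R K := by rw [hu]; exact Ideal.mem_span_singleton_self u
  let T : ResidueField R →ₗ[R] R ⧸ K :=
    Submodule.liftQ (maximalIdeal R) (LinearMap.toSpanSingleton R _ u) (fun r hr => by
      rw [LinearMap.mem_ker, LinearMap.toSpanSingleton_apply]
      exact (hsoc u).1 humem r hr)
  have hT : ∀ v ∈ socle R K, v ∈ LinearMap.range T := by
    intro v hv
    rw [hu, Ideal.mem_span_singleton] at hv
    obtain ⟨w, rfl⟩ := hv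
    obtain ⟨w, rfl⟩ := Ideal.Quotient.mk_surjective w
    refine ⟨residue R w, ?_⟩
    change w • u = _
    rw [Algebra.smul_def, mul_comm]; rfl
  let E : (ResidueField R →ₗ[R] R ⧸ K) →ₗ[R] LinearMap.range T :=
    { toFun := fun f => ⟨f 1, hT _ ((hsoc _).2 fun r hr => by
        rw [← map_smul, Algebra.smul_def, mul_one]
        have : algebraMap R (ResidueField R) r = 0 := (residue_eq_zero_iff r).2 hr
        rw [this, map_zero])⟩
      map_add' := fun f g => rfl
      map_smul' := fun r f => rfl }
  have hE : Function.Injective E := by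
    intro f g hfg
    have h1 : f 1 = g 1 := congrArg Subtype.val hfg
    ext x
    obtain ⟨x, rfl⟩ := residue_surjective x
    have : residue R x = x • (1 : ResidueField R) := by
      rw [Algebra.smul_def, mul_one]; rfl
    rw [this, map_smul, map_smul, h1]
  have hk : Module.length R (ResidueField R) = 1 := by
    rw [Module.length_eq_one_iff]
    exact isSimpleModule_iff_isCoatom.2 (IsLocalRing.maximalIdeal.isMaximal R).out
  refine (Module.length_le_of_injective E hE).trans ?_
  refine (Module.length_le_of_surjective T.rangeRestrict T.surjective_rangeRestrict).trans ?_
  rw [hk]; simp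

lemma muE_attained {A : Type v} [CommRing A] {M : Type*} [AddCommGroup M] [Module A M]
    {N : Submodule A M} {n : ℕ}
    (h : muE N = (n : ℕ∞)) : ∃ S : Finset M, S.card = n ∧ Submodule.span A (S : Set M) = N := by
  have hne : {n : ℕ∞ | ∃ s : Finset M, (s.card : ℕ∞) = n ∧
      Submodule.span A (s : Set M) = N}.Nonempty := by
    by_contra hcon
    rw [Set.not_nonempty_iff_eq_empty] at hcon
    rw [muE, hcon, sInf_empty] at h
    exact ENat.natCast_ne_top n h.symm
  obtain ⟨s, h1, h2⟩ := csInf_mem hne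
  refine ⟨s, ?_, h2⟩
  have h3 : ((s.card : ℕ) : ℕ∞) = n := h1.trans h
  exact_mod_cast h3

lemma muE_le {A : Type v} [CommRing A] {M : Type*} [AddCommGroup M] [Module A M]
    {N : Submodule A M} (S : Finset M) (h : Submodule.span A (S : Set M) = N) :
    muE N ≤ S.card := sInf_le ⟨S, rfl, h⟩

lemma gor_ty (hGor : IsGorensteinLocalRing R) {d : ℕ}
    (hd : ringKrullDim R = (d : WithBot ℕ∞)) : Ty R d R 1 := by
  obtain ⟨hCM, hty⟩ := hGor
  have hq : qDepth R (⊥ : Ideal R) = (d : ℕ∞) := by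
    have : ((qDepth R (⊥ : Ideal R) : ℕ∞) : WithBot ℕ∞) = ((d : ℕ∞) : WithBot ℕ∞) := by
      rw [← hCM]; exact hd
    exact_mod_cast this
  have hne : {n : ℕ∞ | ∃ rs : List R, (∀ x ∈ rs, x ∈ maximalIdeal R) ∧
    RingTheory.Sequence.IsRegular (R ⧸ (⊥ : Ideal R)) rs ∧ (rs.length : ℕ∞) = qDepth R ⊥ ∧
    muE (socle R (⊥ ⊔ Ideal.ofList rs)) = n}.Nonempty := by
    by_contra hcon
    rw [Set.not_nonempty_iff_eq_empty] at hcon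
    rw [qType, hcon, sInf_empty] at hty
    exact absurd hty (by decide)
  obtain ⟨rs, h1, h2, h3, h4⟩ := csInf_mem hne
  have h5 : muE (socle R (⊥ ⊔ Ideal.ofList rs)) = ((1 : ℕ) : ℕ∞) := by
    rw [h4]; exact_mod_cast hty
  obtain ⟨S, hS1, hS2⟩ := muE_attained h5
  obtain ⟨u, rfl⟩ := Finset.card_eq_one.1 hS1
  have h6 := ty_zero_of_socle u (by rw [← hS2]; simp [Ideal.span])
  have h7 : rs.length = d := by
    rw [hq] at h3; exact_mod_cast h3
  rw [← h7]
  have e : (R ⧸ (⊥ : Ideal R)) ≃ₗ[R] R := Submodule.quotEquivOfEqBot _ rfl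
  refine ty_of_regular rs h1 R ((LinearEquiv.isWeaklyRegular_congr e rs).1 h2.toIsWeaklyRegular) ?_
  refine h6.equiv (Submodule.quotEquivOfEq _ _ ?_)
  rw [bot_sup_eq]
  simp

end Conv

section Conv2
variable {R : Type u} [CommRing R] [IsLocalRing R] [IsNoetherianRing R]
variable {I : Ideal R} {g l : ℕ}

lemma rDim_loc (p : Ideal R) [p.IsPrime] : rDim (Localization.AtPrime p) = (p.height : WithBot ℕ∞) :=
  IsLocalization.AtPrime.ringKrullDim_eq_height p _

lemma ht_le (hg : ht I = (g : WithBot ℕ∞)) : HtGE I g := by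
  intro p hp hI
  have h1 : ht I ≤ rDim (Localization.AtPrime p) := iInf₂_le (⟨p, hp⟩ : PrimeSpectrum R) hI
  rw [hg, rDim_loc] at h1
  exact_mod_cast h1

lemma ht_att (hg : ht I = (g : WithBot ℕ∞)) : ∃ p : Ideal R, p.IsPrime ∧ I ≤ p ∧ p.height ≤ (g : ℕ∞) := by
  by_contra hcon
  push Not at hcon
  have : ((g + 1 : ℕ) : WithBot ℕ∞) ≤ ht I := by
    refine le_iInf₂ fun p hp => ?_
    have h1 := hcon p.asIdeal p.isPrime hp
    rw [rDim_loc]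
    have h2 : ((g + 1 : ℕ) : ℕ∞) ≤ p.asIdeal.height := by
      push_cast
      exact Order.add_one_le_of_lt h1
    exact_mod_cast h2
  rw [hg] at this
  have h3 : ((g + 1 : ℕ) : ℕ∞) ≤ (g : ℕ∞) := by exact_mod_cast this
  exact absurd h3 (by exact_mod_cast Nat.not_succ_le_self g)

lemma gen_of_loc {p : Ideal R} (hp : p.IsPrime) {h : ℕ}
    (hmu : muE (Ideal.map (algebraMap R (Localization.AtPrime p)) I) ≤ (h : ℕ∞)) :
    gen I p ⊥ h := by
  classical
  obtain ⟨k, hk⟩ := ENat.ne_top_iff_exists.1 (ne_top_of_le_ne_top (ENat.natCast_ne_top h) hmu)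
  obtain ⟨S, hS1, hS2⟩ := muE_attained hk.symm
  have hkh : k ≤ h := by rw [← hk] at hmu; exact_mod_cast hmu
  have h1 : ∀ s : Localization.AtPrime p, ∃ a ∈ I, s ∈ S →
      ∃ σ : p.primeCompl, s * algebraMap R _ σ = algebraMap R (Localization.AtPrime p) a := by
    intro s
    by_cases hs : s ∈ S
    · have : s ∈ Ideal.map (algebraMap R (Localization.AtPrime p)) I := by
        rw [← hS2]; exact Submodule.subset_span hs
      rw [IsLocalization.mem_map_algebraMap_iff p.primeCompl] at this
      obtain ⟨⟨a, σ⟩, h2⟩ := this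
      exact ⟨a, a.2, fun _ => ⟨σ, h2⟩⟩
    · exact ⟨0, I.zero_mem, fun h => absurd h hs⟩
  choose a haI ha using h1
  let T := S.image a
  have hT : Ideal.map (algebraMap R (Localization.AtPrime p)) I ≤
      Ideal.map (algebraMap R (Localization.AtPrime p)) (Ideal.span (T : Set R)) := by
    rw [← hS2]
    refine Submodule.span_le.2 fun s hs => ?_
    obtain ⟨σ, hσ⟩ := ha s hs
    have hu := IsLocalization.map_units (Localization.AtPrime p) σ
    refine (Ideal.mul_unit_mem_iff_mem _ hu).1 ?_
    rw [hσ]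
    exact Ideal.mem_map_of_mem _ (Ideal.subset_span (by
      simp only [T, Finset.coe_image]; exact ⟨s, hs, rfl⟩))
  have h3 : ∀ x : R, ∃ σ : R, σ ∉ p ∧ (x ∈ I → σ * x ∈ Ideal.span (T : Set R)) := by
    intro x
    by_cases hx : x ∈ I
    · have h4 := hT (Ideal.mem_map_of_mem _ hx)
      rw [IsLocalization.algebraMap_mem_map_algebraMap_iff p.primeCompl] at h4
      obtain ⟨σ, hσ, h5⟩ := h4
      exact ⟨σ, hσ, fun _ => h5⟩
    · exact ⟨1, (Ideal.ne_top_iff_one _).1 hp.ne_top, fun h => absurd h hx⟩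
  choose σ hσ1 hσ2 using h3
  obtain ⟨G, hG⟩ := IsNoetherian.noetherian I
  refine ⟨T, ?_, Finset.card_image_le.trans (hS1.trans_le hkh), ∏ x ∈ G, σ x, ?_, ?_⟩
  · intro s hs
    obtain ⟨t, -, rfl⟩ := Finset.mem_image.1 hs
    exact haI t
  · intro hmem
    obtain ⟨x, -, hx⟩ := (hp.prod_mem_iff).1 hmem
    exact hσ1 x hx
  · intro x hx
    rw [bot_sup_eq]
    rw [← hG] at hx
    refine Submodule.span_induction ?_ ?_ ?_ ?_ hx
    · intro y hy
      rw [← Finset.prod_erase_mul _ _ hy, mul_assoc]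
      exact Ideal.mul_mem_left _ _ (hσ2 y (hG ▸ Submodule.subset_span hy))
    · rw [mul_zero]; exact Ideal.zero_mem _
    · intro y z _ _ hy hz; rw [mul_add]; exact Ideal.add_mem _ hy hz
    · intro c y _ hy
      rw [smul_eq_mul, mul_left_comm (∏ x ∈ G, σ x) c y]
      exact Ideal.mul_mem_left _ _ hy

lemma hG_of (hG : Gcond I l) (p : Ideal R) (hp : p.IsPrime) (hI : I ≤ p) (h : ℕ)
    (hh : p.height = h) (hl : h < l) : gen I p ⊥ h := by
  have h1 := hG ⟨p, hp⟩ hI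
  simp only [rDim_loc, hh] at h1
  have h2 := h1 (by exact_mod_cast hl)
  exact gen_of_loc hp (by exact_mod_cast h2)

lemma ctx_of (hGor : IsGorensteinLocalRing R) (hg : ht I = (g : WithBot ℕ∞)) (D : RCtx I l)
    (hl1 : 1 ≤ l) (hG : Gcond I l)
    (hdepth : ∀ j : ℕ, 1 ≤ j → j ≤ l - g + 1 →
      rDim (R ⧸ I) + 1 ≤ (qDepth R (I ^ j) : WithBot ℕ∞) + (j : WithBot ℕ∞)) :
    ∃ d, Ctx I g l d := by
  classical
  have hIm : I ≤ maximalIdeal R := by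
    refine le_maximalIdeal ?_
    rintro rfl
    have := D.mu2 {1} (by simp)
    simp at this
    omega
  obtain ⟨d, hdm⟩ := ENat.ne_top_iff_exists.1 (Ideal.height_ne_top (I := maximalIdeal R)
    (maximalIdeal.isMaximal R).ne_top)
  have hdR : ringKrullDim R = (d : WithBot ℕ∞) := by
    rw [← IsLocalRing.maximalIdeal_height_eq_ringKrullDim, ← hdm]; rfl
  have hTy := gor_ty hGor hdR
  have hld : l ≤ d := by
    by_contra hcon
    obtain ⟨S, h1, h2, h3⟩ := gen_m (hG_of hG _ inferInstance hIm d hdm.symm (by omega))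
    have := D.mu2 S (le_antisymm (Ideal.span_le.2 h1) (by simpa using h3))
    omega
  have hIg := ht_le hg
  have hgl : g ≤ l := by
    obtain ⟨J, hJ⟩ := D.exists_min
    obtain ⟨e, he, heI⟩ := D.min_e hJ
    obtain ⟨S, hS1, hS2⟩ := JJ_finset e l
    have hJm : J ≤ maximalIdeal R := hJ.1.1.trans hIm
    obtain ⟨p, hpm, -⟩ := Ideal.exists_minimalPrimes_le hJm
    obtain ⟨r, hr⟩ := hJ.1.2
    have hp := hpm.1.1
    have hIp : I ≤ p := by
      refine hp.le_of_pow_le (n := r + 1) ?_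
      rw [hr]
      exact Ideal.mul_le_left.trans hpm.1.2
    have h1 := hIg p hp hIp
    have h2 : p.height ≤ S.card := by
      refine Ideal.height_le_card_of_mem_minimalPrimes_span_finset ?_
      rw [hS2, ← he]; exact hpm
    have h3 : (g : ℕ∞) ≤ (S.card : ℕ∞) := h1.trans h2
    exact (by exact_mod_cast h3 : g ≤ S.card).trans hS1
  refine ⟨d, ?_, hIg, hTy, ?_, hgl, hld, hl1, hIm, fun p hp hI h hh hl => hG_of hG p hp hI h hh hl⟩
  · intro p hp
    rw [hdm]
    exact Ideal.height_mono (le_maximalIdeal hp.ne_top)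
  · intro j s hj1 hj2 hs
    obtain ⟨p, hp, hIp, hpg⟩ := ht_att hg
    have h1 := dim_ge g ⊥ p d 0 hp bot_le (hTy.1.equiv
      (Submodule.quotEquivOfEqBot _ rfl).symm) (fun q _ _ _ => by simp) (by simpa using hpg)
    have h2 : ringKrullDim (R ⧸ p) ≤ ringKrullDim (R ⧸ I) :=
      ringKrullDim_le_of_surjective (Ideal.Quotient.factor hIp)
        (Ideal.Quotient.factor_surjective hIp)
    have h3 := hdepth j hj1 hj2
    refine dep_of_mDepth ?_
    change (s : ℕ∞) ≤ qDepth R (I ^ j)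
    have h4 : (d : WithBot ℕ∞) + 1 ≤ g + ((qDepth R (I ^ j) : WithBot ℕ∞) + (j : WithBot ℕ∞)) := by
      calc (d : WithBot ℕ∞) + 1 ≤ (g + ringKrullDim (R ⧸ p)) + 1 := by gcongr
        _ ≤ (g + ringKrullDim (R ⧸ I)) + 1 := by gcongr
        _ = g + (rDim (R ⧸ I) + 1) := by rw [add_assoc]; rfl
        _ ≤ _ := by gcongr
    generalize qDepth R (I ^ j) = q at *
    rcases eq_or_ne q ⊤ with rfl | hq
    · exact le_top
    obtain ⟨q, rfl⟩ := ENat.ne_top_iff_exists.1 hq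
    have h5 : d + 1 ≤ g + (q + j) := by exact_mod_cast h4
    have : s ≤ q := by omega
    exact_mod_cast this

end Conv2


lemma dim_le_of_integral {B A : Type*} [CommRing B] [CommRing A] [Algebra B A]
    [Algebra.IsIntegral B A] : ringKrullDim A ≤ ringKrullDim B := by
  refine Order.krullDim_le_of_strictMono (PrimeSpectrum.comap (algebraMap B A)) ?_
  intro p q hpq
  exact Ideal.IsIntegral.comap_lt_comap (R := B) hpq

section Fib
variable {R : Type u} [CommRing R] [IsLocalRing R] [IsNoetherianRing R]
variable {I : Ideal R} {l : ℕ}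
variable {A : Type v} [CommRing A] [Algebra R A] {σ : Type*}

noncomputable def kF (R : Type u) [CommRing R] [IsLocalRing R] (A : Type v) [CommRing A] [Algebra R A] :
    ResidueField R →+* A ⧸ (Ideal.map (algebraMap R A) (maximalIdeal R)) :=
  Ideal.Quotient.lift (maximalIdeal R)
    ((Ideal.Quotient.mk (Ideal.map (algebraMap R A) (maximalIdeal R))).comp (algebraMap R A))
    (fun a ha => Ideal.Quotient.eq_zero_iff_mem.2 (Ideal.mem_map_of_mem _ ha))

lemma kF_residue (r : R) : kF R A (residue R r) = Ideal.Quotient.mk _ (algebraMap R A r) :=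
  Ideal.Quotient.lift_mk _ _ _

noncomputable def fib (b : σ → A) :
    MvPolynomial σ (ResidueField R) →+* A ⧸ (Ideal.map (algebraMap R A) (maximalIdeal R)) :=
  MvPolynomial.eval₂Hom (kF R A) (fun i => Ideal.Quotient.mk _ (b i))

lemma fib_map (b : σ → A) (P : MvPolynomial σ R) :
    fib b (MvPolynomial.map (residue R) P) =
      Ideal.Quotient.mk (Ideal.map (algebraMap R A) (maximalIdeal R)) (MvPolynomial.aeval b P) := by
  have h : (fib b).comp (MvPolynomial.map (residue R)) =
      (Ideal.Quotient.mk (Ideal.map (algebraMap R A) (maximalIdeal R))).comp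
        ((MvPolynomial.aeval b : MvPolynomial σ R →ₐ[R] A) : MvPolynomial σ R →+* A) := by
    refine MvPolynomial.ringHom_ext ?_ ?_
    · intro r
      simp only [RingHom.comp_apply, MvPolynomial.map_C, fib, MvPolynomial.coe_eval₂Hom,
        MvPolynomial.eval₂_C, RingHom.coe_coe, MvPolynomial.aeval_C]
      exact kF_residue r
    · intro i
      simp [fib]
  exact congrArg (fun f => f P) h

lemma fib_surj (b : σ → A) (hb : Function.Surjective
    (MvPolynomial.aeval b : MvPolynomial σ R →ₐ[R] A)) : Function.Surjective (fib (R := R) b) := by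
  intro y
  obtain ⟨y, rfl⟩ := Ideal.Quotient.mk_surjective y
  obtain ⟨P, rfl⟩ := hb y
  exact ⟨_, fib_map b P⟩

lemma dim_mv (σ : Type*) [Finite σ] :
    ringKrullDim (MvPolynomial σ (ResidueField R)) = (Nat.card σ : WithBot ℕ∞) := by
  rw [MvPolynomial.ringKrullDim_of_isNoetherianRing, ringKrullDim_eq_zero_of_field, zero_add]

/-- The degree `i` piece of the Rees algebra. -/
noncomputable def mon (i : ℕ) (c : R) (hc : c ∈ I ^ i) : reesAlgebra I :=
  ⟨Polynomial.monomial i c, reesAlgebra.monomial_mem.2 hc⟩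

lemma mon_add {i : ℕ} {c c' : R} (hc : c ∈ I ^ i) (hc' : c' ∈ I ^ i) :
    mon i (c + c') (add_mem hc hc') = mon i c hc + mon i c' hc' :=
  Subtype.ext (map_add _ _ _)

lemma mon_smul {i : ℕ} {c : R} (a : R) (hc : c ∈ I ^ i) :
    mon i (a * c) (Ideal.mul_mem_left _ _ hc) = algebraMap R (reesAlgebra I) a * mon i c hc :=
  Subtype.ext (by
    change Polynomial.monomial i (a * c) = Polynomial.C a * Polynomial.monomial i c
    rw [Polynomial.C_mul_monomial])

lemma mon_sum (a : reesAlgebra I) :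
    a = ∑ i ∈ Finset.range ((a : Polynomial R).natDegree + 1), mon i _ (a.2 i) := by
  apply Subtype.ext
  rw [AddSubmonoidClass.coe_finsetSum]
  exact Polynomial.as_sum_range _

lemma mon_mul {i j : ℕ} {c c' : R} (hc : c ∈ I ^ i) (hc' : c' ∈ I ^ j) (h : c * c' ∈ I ^ (i + j)) :
    mon (i + j) (c * c') h = mon i c hc * mon j c' hc' :=
  Subtype.ext (Polynomial.monomial_mul_monomial _ _ _ _).symm

set_option maxHeartbeats 2000000 in
lemma f1_of (hl : fiberDim I = (l : WithBot ℕ∞)) (S : Finset R)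
    (hS : IsReduction (Ideal.span (S : Set R)) I) : l ≤ S.card := by
  classical
  obtain ⟨hle, r, hr⟩ := hS
  have hb : ∀ s : S, (s : R) ∈ I ^ 1 := fun s => by
    rw [pow_one]; exact hle (Ideal.subset_span s.2)
  let b : S → reesAlgebra I := fun s => mon 1 s (hb s)
  let _ : Algebra (MvPolynomial S (ResidueField R)) (↥(reesAlgebra I) ⧸
    (Ideal.map (algebraMap R ↥(reesAlgebra I)) (maximalIdeal R))) := (fib (R := R) b).toAlgebra
  have hsm : ∀ (P : MvPolynomial S (ResidueField R)) (y : ↥(reesAlgebra I) ⧸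
    (Ideal.map (algebraMap R ↥(reesAlgebra I)) (maximalIdeal R))), P • y = fib (R := R) b P * y :=
    fun P y => Algebra.smul_def P y
  let q := Ideal.Quotient.mk (Ideal.map (algebraMap R ↥(reesAlgebra I)) (maximalIdeal R))
  have hG : ∀ i : ℕ, ∃ G : Finset R, Ideal.span (G : Set R) = I ^ i :=
    fun i => IsNoetherian.noetherian (I ^ i)
  choose G hG using hG
  have hGm : ∀ i, ∀ c : G i, (c : R) ∈ I ^ i := fun i c => hG i ▸ Ideal.subset_span c.2
  let gens : (Σ i : Fin (r + 1), G i) → ↥(reesAlgebra I) ⧸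
    (Ideal.map (algebraMap R ↥(reesAlgebra I)) (maximalIdeal R)) :=
    fun x => q (mon x.1 x.2 (hGm x.1 x.2))
  let N : Submodule (MvPolynomial S (ResidueField R)) _ := Submodule.span _ (Set.range gens)
  have hRN : ∀ (a : R) y, y ∈ N → q (algebraMap R _ a) * y ∈ N := by
    intro a y hy
    have h1 : q (algebraMap R _ a) * y = (MvPolynomial.C (residue R a) : MvPolynomial S (ResidueField R)) • y := by
      rw [hsm, ← MvPolynomial.map_C, fib_map]
      simp [q]
    rw [h1]
    exact N.smul_mem _ hy
  let K : ℕ → Ideal R := fun i =>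
    { carrier := {c | ∃ hc : c ∈ I ^ i, q (mon i c hc) ∈ N}
      add_mem' := by
        rintro x y ⟨hx, hx'⟩ ⟨hy, hy'⟩
        exact ⟨add_mem hx hy, by rw [mon_add hx hy, map_add]; exact N.add_mem hx' hy'⟩
      zero_mem' := ⟨zero_mem _, by
        have : mon i (0 : R) (zero_mem (I ^ i)) = 0 := Subtype.ext (map_zero _)
        rw [this, map_zero]; exact N.zero_mem⟩
      smul_mem' := by
        rintro a x ⟨hx, hx'⟩
        refine ⟨Ideal.mul_mem_left _ _ hx, ?_⟩
        change q (mon i (a * x) (Ideal.mul_mem_left _ _ hx)) ∈ N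
        rw [mon_smul a hx, map_mul]
        exact hRN _ _ hx' }
  have hK : ∀ i, I ^ i ≤ K i := by
    intro i
    induction i with
    | zero =>
      rw [← hG 0]
      refine Ideal.span_le.2 fun c hc => ⟨hGm 0 ⟨c, hc⟩, Submodule.subset_span ⟨⟨0, ⟨c, hc⟩⟩, rfl⟩⟩
    | succ i ih =>
      by_cases hi : i + 1 ≤ r
      · rw [← hG (i + 1)]
        exact Ideal.span_le.2 fun c hc => ⟨hGm (i + 1) ⟨c, hc⟩,
          Submodule.subset_span ⟨⟨⟨i + 1, by omega⟩, ⟨c, hc⟩⟩, rfl⟩⟩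
      · refine (red_mono (J := Ideal.span (S : Set R)) (r := r) (r' := i) (by omega) hr.le).trans ?_
        refine Ideal.mul_le.2 fun x hx y hy => ?_
        refine Submodule.span_induction (p := fun x _ => x * y ∈ K (i + 1)) ?_ ?_ ?_ ?_ hx
        · intro s hs
          obtain ⟨hy1, hy2⟩ := ih hy
          have hsy : s * y ∈ I ^ (1 + i) := by
            rw [pow_add]; exact Ideal.mul_mem_mul (hb ⟨s, hs⟩) hy
          have h1 : q (mon (1 + i) (s * y) hsy) ∈ N := by
            rw [mon_mul (hb ⟨s, hs⟩) hy hsy, map_mul]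
            have : q (mon 1 s (hb ⟨s, hs⟩)) * q (mon i y hy) =
                (MvPolynomial.X ⟨s, hs⟩ : MvPolynomial S (ResidueField R)) • q (mon i y hy) := by
              rw [hsm]
              congr 1
              simp [fib, q, b]
            rw [this]
            exact N.smul_mem _ hy2
          have h2 : ∀ j, j = 1 + i → s * y ∈ K j := by rintro j rfl; exact ⟨hsy, h1⟩
          exact h2 _ (add_comm _ _)
        · rw [zero_mul]; exact Ideal.zero_mem _
        · intro x z _ _ hx hz; rw [add_mul]; exact Ideal.add_mem _ hx hz
        · intro a x _ hx
          rw [smul_eq_mul, mul_assoc a x y]; exact Ideal.mul_mem_left _ _ hx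
  have hN : N = ⊤ := by
    rw [eq_top_iff]
    intro y _
    obtain ⟨a, rfl⟩ := Ideal.Quotient.mk_surjective y
    rw [mon_sum a, map_sum]
    refine Submodule.sum_mem _ fun i _ => ?_
    obtain ⟨h1, h2⟩ := hK i (a.2 i)
    exact h2
  have hfin : Module.Finite (MvPolynomial S (ResidueField R)) (↥(reesAlgebra I) ⧸
    (Ideal.map (algebraMap R ↥(reesAlgebra I)) (maximalIdeal R))) := by
    refine ⟨?_⟩
    rw [← hN]
    exact Submodule.fg_span (Set.finite_range gens)
  have h1 := dim_le_of_integral (B := MvPolynomial S (ResidueField R)) (A := ↥(reesAlgebra I) ⧸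
    (Ideal.map (algebraMap R ↥(reesAlgebra I)) (maximalIdeal R)))
  have h2 : ringKrullDim (↥(reesAlgebra I) ⧸
    (Ideal.map (algebraMap R ↥(reesAlgebra I)) (maximalIdeal R))) = (l : WithBot ℕ∞) := hl
  rw [h2, dim_mv] at h1
  have h3 : l ≤ Nat.card S := by exact_mod_cast h1
  simpa using h3

end Fib


lemma aeval_scale {R : Type*} [CommRing R] {A : Type*} [CommRing A] [Algebra R A] {σ : Type*}
    {G : MvPolynomial σ R} {f : ℕ} (hG : G.IsHomogeneous f) (t : A) (c : σ → A) :
    MvPolynomial.aeval (fun i => t * c i) G = t ^ f * MvPolynomial.aeval c G := by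
  rw [MvPolynomial.aeval_def, MvPolynomial.aeval_def, MvPolynomial.eval₂_eq, MvPolynomial.eval₂_eq,
    Finset.mul_sum]
  refine Finset.sum_congr rfl fun m hm => ?_
  have h1 : ∑ i ∈ m.support, m i = f := by
    rw [← hG (MvPolynomial.mem_support_iff.1 hm), Finsupp.weight_apply, Finsupp.sum]
    simp
  simp only [mul_pow]
  rw [Finset.prod_mul_distrib, Finset.prod_pow_eq_pow_sum, h1]
  ring

lemma aeval_rel {R : Type*} [CommRing R] {A : Type*} [CommRing A] [Algebra R A] {σ : Type*}
    {G : MvPolynomial σ R} {f : ℕ} (hG : G.IsHomogeneous f) (t : R) (x : A) (c : σ → A) (lam : σ → R)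
    (h : ∀ i, algebraMap R A t * c i = x * algebraMap R A (lam i)) :
    algebraMap R A t ^ f * MvPolynomial.aeval c G = x ^ f * algebraMap R A (MvPolynomial.eval lam G) := by
  rw [← aeval_scale hG, funext h, aeval_scale hG]
  congr 1
  exact MvPolynomial.aeval_algebraMap_apply _ lam G

lemma aeval_rel_hom {R : Type*} [CommRing R] {A : Type*} [CommRing A] [Algebra R A] {σ : Type*}
    {B : Type*} [CommRing B] (φ : A →+* B)
    {G : MvPolynomial σ R} {f : ℕ} (hG : G.IsHomogeneous f) (t : R) (x : A) (c : σ → A) (lam : σ → R)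
    (h : ∀ i, φ (algebraMap R A t * c i - x * algebraMap R A (lam i)) = 0)
    (h0 : φ (MvPolynomial.aeval c G) = 0) :
    φ (x ^ f * algebraMap R A (MvPolynomial.eval lam G)) = 0 := by
  let _ : Algebra R B := (φ.comp (algebraMap R A)).toAlgebra
  let ψ : A →ₐ[R] B := { φ with commutes' := fun r => rfl }
  have h1 := aeval_rel hG t (φ x) (fun i => φ (c i)) lam (fun i => by
    have := h i
    rw [map_sub, map_mul, map_mul, sub_eq_zero] at this
    exact this)
  have h2 : MvPolynomial.aeval (fun i => φ (c i)) G = φ (MvPolynomial.aeval c G) :=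
    (MvPolynomial.comp_aeval_apply (f := c) ψ G).symm
  rw [h2, h0, mul_zero] at h1
  rw [map_mul, map_pow]
  exact h1.symm

lemma aeval_rel_mem {R : Type*} [CommRing R] {A : Type*} [CommRing A] [Algebra R A] {σ : Type*}
    (Q : Ideal A)
    {G : MvPolynomial σ R} {f : ℕ} (hG : G.IsHomogeneous f) (t : R) (x : A) (c : σ → A) (lam : σ → R)
    (h : ∀ i, algebraMap R A t * c i - x * algebraMap R A (lam i) ∈ Q)
    (h0 : MvPolynomial.aeval c G ∈ Q) :
    x ^ f * algebraMap R A (MvPolynomial.eval lam G) ∈ Q :=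
  Ideal.Quotient.eq_zero_iff_mem.1 (aeval_rel_hom (Ideal.Quotient.mk Q) hG t x c lam
    (fun i => Ideal.Quotient.eq_zero_iff_mem.2 (h i)) (Ideal.Quotient.eq_zero_iff_mem.2 h0))

section Fib
variable {R : Type u} [CommRing R] [IsLocalRing R] [IsNoetherianRing R]
variable {I : Ideal R} {l : ℕ}

lemma rees_surj {e : ℕ → R} {n : ℕ} (hI : I = JJ e n) (he : ∀ i : Fin n, e i ∈ I ^ 1) :
    Function.Surjective (MvPolynomial.aeval (fun i : Fin n => mon (I := I) 1 (e i) (he i)) :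
      MvPolynomial (Fin n) R →ₐ[R] reesAlgebra I) := by
  let b : Fin n → reesAlgebra I := fun i => mon 1 (e i) (he i)
  let N : Subalgebra R (reesAlgebra I) := (MvPolynomial.aeval b : MvPolynomial (Fin n) R →ₐ[R] _).range
  let K : ℕ → Ideal R := fun i =>
    { carrier := {c | ∃ hc : c ∈ I ^ i, mon i c hc ∈ N}
      add_mem' := by
        rintro x y ⟨hx, hx'⟩ ⟨hy, hy'⟩
        exact ⟨add_mem hx hy, by rw [mon_add hx hy]; exact N.add_mem hx' hy'⟩
      zero_mem' := ⟨zero_mem _, by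
        have : mon i (0 : R) (zero_mem (I ^ i)) = 0 := Subtype.ext (map_zero _)
        rw [this]; exact N.zero_mem⟩
      smul_mem' := by
        rintro a x ⟨hx, hx'⟩
        refine ⟨Ideal.mul_mem_left _ _ hx, ?_⟩
        change mon i (a * x) (Ideal.mul_mem_left _ _ hx) ∈ N
        rw [mon_smul a hx]
        exact N.mul_mem (N.algebraMap_mem a) hx' }
  have hK : ∀ i, I ^ i ≤ K i := by
    intro i
    induction i with
    | zero =>
      intro c hc
      refine ⟨hc, ?_⟩
      have : mon 0 c hc = algebraMap R _ c := Subtype.ext rfl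
      rw [this]; exact N.algebraMap_mem c
    | succ i ih =>
      rw [pow_succ']
      refine Ideal.mul_le.2 fun x hx y hy => ?_
      rw [hI] at hx
      refine Submodule.span_induction (p := fun x _ => x * y ∈ K (i + 1)) ?_ ?_ ?_ ?_ hx
      · rintro _ ⟨j, hj, rfl⟩
        obtain ⟨hy1, hy2⟩ := ih hy
        have hsy : e j * y ∈ I ^ (1 + i) := by
          rw [pow_add]; exact Ideal.mul_mem_mul (he ⟨j, hj⟩) hy
        have h1 : mon (1 + i) (e j * y) hsy ∈ N := by
          rw [mon_mul (he ⟨j, hj⟩) hy hsy]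
          refine N.mul_mem ⟨MvPolynomial.X ⟨j, hj⟩, ?_⟩ hy2
          exact MvPolynomial.aeval_X _ _
        have h2 : ∀ k, k = 1 + i → e j * y ∈ K k := by rintro k rfl; exact ⟨hsy, h1⟩
        exact h2 _ (add_comm _ _)
      · rw [zero_mul]; exact Ideal.zero_mem _
      · intro x z _ _ hx hz; rw [add_mul]; exact Ideal.add_mem _ hx hz
      · intro a x _ hx
        rw [smul_eq_mul, mul_assoc a x y]; exact Ideal.mul_mem_left _ _ hx
  intro a
  have : a ∈ N := by
    rw [mon_sum a]
    refine Subalgebra.sum_mem _ fun i _ => ?_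
    obtain ⟨h1, h2⟩ := hK i (a.2 i)
    exact h2
  exact this

/-- Degree pieces of the ideal generated by the maximal ideal and by `L` in degree one. -/
def QP (I L : Ideal R) : ℕ → Ideal R
  | 0 => maximalIdeal R
  | i + 1 => maximalIdeal R * I ^ (i + 1) ⊔ L * I ^ i

lemma QP_mul {L : Ideal R} (hL : L ≤ I) (i j : ℕ) : I ^ i * QP I L j ≤ QP I L (i + j) := by
  rcases j with _ | j
  · rcases i with _ | i
    · simp [QP]
    · rw [add_zero, QP, QP, mul_comm]; exact le_sup_left
  · rw [← add_assoc, QP, QP, Ideal.mul_sup, mul_left_comm, ← pow_add, mul_left_comm, ← pow_add,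
      ← add_assoc]

def QI (I L : Ideal R) (hL : L ≤ I) : Ideal (reesAlgebra I) where
  carrier := {a | ∀ i, (a : Polynomial R).coeff i ∈ QP I L i}
  add_mem' := by
    intro a b ha hb i
    rw [Subalgebra.coe_add, Polynomial.coeff_add]; exact Ideal.add_mem _ (ha i) (hb i)
  zero_mem' := by intro i; simp
  smul_mem' := by
    intro a b hb i
    rw [smul_eq_mul, Subalgebra.coe_mul, Polynomial.coeff_mul]
    refine Ideal.sum_mem _ ?_
    rintro ⟨j, k⟩ h
    rw [← Finset.HasAntidiagonal.mem_antidiagonal.mp h]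
    exact QP_mul hL j k (Ideal.mul_mem_mul (a.2 j) (hb k))

lemma map_le_QI {L : Ideal R} (hL : L ≤ I) :
    Ideal.map (algebraMap R (reesAlgebra I)) (maximalIdeal R) ≤ QI I L hL := by
  refine Ideal.map_le_iff_le_comap.2 fun r hr i => ?_
  change (Polynomial.C r).coeff i ∈ _
  rw [Polynomial.coeff_C]
  split_ifs with h
  · subst h; exact hr
  · exact Ideal.zero_mem _

lemma QP_bot_le (L : Ideal R) (i : ℕ) : QP I ⊥ i ≤ QP I L i := by
  rcases i with _ | i
  · exact le_rfl
  · rw [QP, QP]; exact sup_le_sup_left (Ideal.mul_mono_left bot_le) _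

lemma coe_hom {n : ℕ} {e : ℕ → R} (he : ∀ i : Fin n, e i ∈ I ^ 1) {G : MvPolynomial (Fin n) R} {f : ℕ}
    (hG : G.IsHomogeneous f) :
    ((MvPolynomial.aeval (fun i : Fin n => mon (I := I) 1 (e i) (he i)) G : reesAlgebra I) :
      Polynomial R) = Polynomial.monomial f (MvPolynomial.eval (fun i : Fin n => e i) G) := by
  have h1 : ((MvPolynomial.aeval (fun i : Fin n => mon (I := I) 1 (e i) (he i)) G : reesAlgebra I) :
      Polynomial R) = MvPolynomial.aeval (fun i : Fin n => (Polynomial.X : Polynomial R) *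
        algebraMap R (Polynomial R) (e i)) G := by
    have := MvPolynomial.comp_aeval_apply (f := (fun i : Fin n => mon (I := I) 1 (e i) (he i)))
      (reesAlgebra I).val G
    refine Eq.trans this ?_
    congr 2
    ext1 i
    change Polynomial.monomial 1 (e i) = _
    rw [← Polynomial.C_mul_X_eq_monomial, mul_comm]; rfl
  rw [h1, aeval_scale hG]
  have h2 := MvPolynomial.aeval_algebraMap_apply (Polynomial R) (fun i : Fin n => e i) G
  have h3 : MvPolynomial.aeval (fun i : Fin n => algebraMap R (Polynomial R) (e i)) G =
    algebraMap R (Polynomial R) (MvPolynomial.aeval (fun i : Fin n => e i) G) := h2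
  rw [h3, mul_comm]
  change Polynomial.C _ * _ = _
  rw [Polynomial.C_mul_X_pow_eq_monomial]; rfl

lemma hom_mem {n : ℕ} {e : ℕ → R} (he : ∀ i : Fin n, e i ∈ I ^ 1) {P : MvPolynomial (Fin n) R}
    (hP : MvPolynomial.aeval (fun i : Fin n => mon (I := I) 1 (e i) (he i)) P ∈ QI I ⊥ bot_le)
    (f : ℕ) : MvPolynomial.eval (fun i : Fin n => e i) (MvPolynomial.homogeneousComponent f P)
      ∈ QP I ⊥ f := by
  classical
  have h1 := hP f
  by_cases hf : f ∈ Finset.range (P.totalDegree + 1)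
  · rw [← MvPolynomial.sum_homogeneousComponent P, map_sum, AddSubmonoidClass.coe_finsetSum,
      Polynomial.finsetSum_coeff] at h1
    rw [Finset.sum_eq_single_of_mem f hf] at h1
    · rwa [coe_hom he (MvPolynomial.homogeneousComponent_isHomogeneous f P),
        Polynomial.coeff_monomial_same] at h1
    · intro k _ hk
      rw [coe_hom he (MvPolynomial.homogeneousComponent_isHomogeneous k P),
        Polynomial.coeff_monomial_of_ne _ hk.symm]
  · rw [MvPolynomial.homogeneousComponent_eq_zero _ _ (by simpa using hf), map_zero]
    exact Ideal.zero_mem _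

lemma exists_form (hl : fiberDim I = (l : WithBot ℕ∞)) {e : ℕ → R} (hI : I = JJ e (l + 1)) :
    ∃ (f : ℕ) (G : MvPolynomial (Fin (l + 1)) R), G.IsHomogeneous f ∧
      MvPolynomial.map (residue R) G ≠ 0 ∧
      MvPolynomial.eval (fun i : Fin (l + 1) => e i) G ∈ QP I ⊥ f := by
  have he : ∀ i : Fin (l + 1), e i ∈ I ^ 1 := fun i => by
    rw [pow_one, hI]; exact mem_JJ e i.2
  let b : Fin (l + 1) → reesAlgebra I := fun i => mon 1 (e i) (he i)
  have hsurj := fib_surj (R := R) b (rees_surj hI he)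
  obtain ⟨Pb, hP1, hP2⟩ : ∃ P, fib (R := R) b P = 0 ∧ P ≠ 0 := by
    by_contra hcon
    push Not at hcon
    have hinj : Function.Injective (fib (R := R) b) := (injective_iff_map_eq_zero _).2 hcon
    have h1 := ringKrullDim_eq_of_ringEquiv (RingEquiv.ofBijective (fib (R := R) b) ⟨hinj, hsurj⟩)
    have h2 : ringKrullDim (↥(reesAlgebra I) ⧸
      (Ideal.map (algebraMap R ↥(reesAlgebra I)) (maximalIdeal R))) = (l : WithBot ℕ∞) := hl
    rw [h2, dim_mv, Nat.card_fin] at h1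
    have h3 : l + 1 = l := by exact_mod_cast h1
    omega
  obtain ⟨P, rfl⟩ := MvPolynomial.map_surjective _ residue_surjective Pb
  rw [fib_map, Ideal.Quotient.eq_zero_iff_mem] at hP1
  have h4 := hom_mem he (map_le_QI bot_le hP1)
  obtain ⟨f, hf⟩ : ∃ f, MvPolynomial.map (residue R) (MvPolynomial.homogeneousComponent f P) ≠ 0 := by
    by_contra hcon
    push Not at hcon
    apply hP2
    rw [← MvPolynomial.sum_homogeneousComponent P, map_sum]
    exact Finset.sum_eq_zero fun i _ => hcon i
  exact ⟨f, _, MvPolynomial.homogeneousComponent_isHomogeneous f P, hf, h4 f⟩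

set_option maxHeartbeats 2000000 in
lemma f2_of [Infinite (ResidueField R)] (hl : fiberDim I = (l : WithBot ℕ∞)) {e : ℕ → R}
    (hI : I = JJ e (l + 1)) (mu2 : ∀ S : Finset R, Ideal.span (S : Set R) = I → l + 1 ≤ S.card) :
    ∃ L : Ideal R, IsReduction L I ∧ L ≠ I := by
  classical
  obtain ⟨f, G, hG, hG0, hGe⟩ := exists_form hl hI
  have heI : ∀ i : Fin (l + 1), e i ∈ I := fun i => by rw [hI]; exact mem_JJ e i.2
  have he : ∀ i : Fin (l + 1), e i ∈ I ^ 1 := fun i => by rw [pow_one]; exact heI i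
  obtain ⟨lb, hlb⟩ : ∃ x, MvPolynomial.eval x (MvPolynomial.map (residue R) G *
      MvPolynomial.X (0 : Fin (l + 1))) ≠ 0 := by
    by_contra hcon
    push Not at hcon
    have : MvPolynomial.map (residue R) G * MvPolynomial.X (0 : Fin (l + 1)) = 0 :=
      MvPolynomial.funext (fun x => by rw [hcon x, map_zero])
    exact (mul_ne_zero hG0 (MvPolynomial.X_ne_zero _)) this
  have hlam : ∀ i, ∃ r : R, residue R r = lb i := fun i => residue_surjective _
  choose lam hlam using hlam
  rw [map_mul, MvPolynomial.eval_X, mul_ne_zero_iff] at hlb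
  obtain ⟨h1, h2⟩ := hlb
  have hlam' : lb = fun i => residue R (lam i) := by ext i; rw [hlam]
  have hu0 : IsUnit (lam 0) := by
    rw [← hlam 0] at h2
    exact (residue_ne_zero_iff_isUnit _).1 h2
  have hu1 : IsUnit (MvPolynomial.eval lam G) := by
    refine (residue_ne_zero_iff_isUnit _).1 ?_
    rw [MvPolynomial.eval_map, hlam'] at h1
    have := MvPolynomial.eval₂_comp (residue R) lam G
    rwa [this]
  let y : Fin l → R := fun i => lam 0 * e i.succ - lam i.succ * e 0
  let L : Ideal R := Ideal.span (Set.range y)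
  have hyL : ∀ i, y i ∈ L := fun i => Ideal.subset_span ⟨i, rfl⟩
  have h00 : e 0 ∈ I := heI 0
  have hLI : L ≤ I := by
    refine Ideal.span_le.2 ?_
    rintro _ ⟨i, rfl⟩
    exact Ideal.sub_mem _ (Ideal.mul_mem_left _ _ (heI i.succ)) (Ideal.mul_mem_left _ _ h00)
  refine ⟨L, ?_, ?_⟩
  swap
  · intro h
    have h3 := mu2 (Finset.univ.image y) (by rw [← h]; simp [L])
    have h4 : (Finset.univ.image y).card ≤ l := Finset.card_image_le.trans (by simp)
    omega
  have hyL' : ∀ i : Fin (l + 1), lam 0 * e i - lam i * e 0 ∈ L := by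
    intro i
    refine Fin.cases ?_ (fun i => ?_) i
    · simp
    · exact hyL i
  -- relation in the quotient
  let b : Fin (l + 1) → reesAlgebra I := fun i => mon 1 (e i) (he i)
  have hrel : ∀ i, algebraMap R _ (lam 0) * b i - b 0 * algebraMap R _ (lam i) ∈ QI I L hLI := by
    intro i k
    have : ((algebraMap R (reesAlgebra I) (lam 0) * b i - b 0 * algebraMap R _ (lam i) :
        reesAlgebra I) : Polynomial R) = Polynomial.monomial 1 (lam 0 * e i - lam i * e 0) := by
      change Polynomial.C (lam 0) * Polynomial.monomial 1 (e i) -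
        Polynomial.monomial 1 (e 0) * Polynomial.C (lam i) = _
      rw [Polynomial.C_mul_monomial, Polynomial.monomial_mul_C, map_sub, mul_comm (e 0)]
    rw [this, Polynomial.coeff_monomial]
    split_ifs with hk
    · subst hk
      rw [QP, pow_zero, mul_one]
      exact Ideal.mem_sup_right (hyL' i)
    · exact Ideal.zero_mem _
  have h7 : MvPolynomial.aeval b G ∈ QI I L hLI := by
    intro k
    rw [coe_hom he hG, Polynomial.coeff_monomial]
    split_ifs with hk
    · subst hk; exact QP_bot_le L _ hGe
    · exact Ideal.zero_mem _
  have h8 : b 0 ^ f * algebraMap R _ (MvPolynomial.eval lam G) ∈ QI I L hLI :=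
    aeval_rel_mem _ hG _ _ _ _ hrel h7
  have h9 := h8 f
  have h10 : ((b 0 ^ f * algebraMap R _ (MvPolynomial.eval lam G) : reesAlgebra I) : Polynomial R)
      = Polynomial.monomial f (e 0 ^ f * MvPolynomial.eval lam G) := by
    change Polynomial.monomial 1 (e 0) ^ f * Polynomial.C _ = _
    rw [Polynomial.monomial_pow, one_mul, Polynomial.monomial_mul_C]
  rw [h10, Polynomial.coeff_monomial_same, Ideal.mul_unit_mem_iff_mem _ hu1] at h9
  rcases f with _ | r
  · rw [pow_zero, QP] at h9
    exact absurd h9 ((Ideal.ne_top_iff_one _).1 (maximalIdeal.isMaximal R).ne_top)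
  rw [QP] at h9
  refine red_of (r := r) hLI (naka_m ?_)
  have h11 : I ≤ L ⊔ Ideal.span {e 0} := by
    conv_lhs => rw [hI]
    refine Ideal.span_le.2 ?_
    rintro _ ⟨j, hj, rfl⟩
    refine (Ideal.unit_mul_mem_iff_mem _ hu0).1 ?_
    have := hyL' ⟨j, hj⟩
    have h12 : lam 0 * e j = (lam 0 * e j - lam ⟨j, hj⟩ * e 0) + lam ⟨j, hj⟩ * e 0 := by ring
    rw [h12]
    exact Submodule.add_mem_sup this (Ideal.mul_mem_left _ _ (Ideal.mem_span_singleton_self _))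
  have h13 : L ⊔ Ideal.span {e 0} = I :=
    le_antisymm (sup_le hLI ((Ideal.span_singleton_le_iff_mem _).2 h00)) h11
  have h14 := sup_pow_le L (Ideal.span {e 0}) r
  rw [h13, Ideal.span_singleton_pow] at h14
  refine h14.trans (sup_le le_sup_left ((Ideal.span_singleton_le_iff_mem _).2 ?_))
  rw [sup_comm]; exact h9

lemma rctx_of [Infinite (ResidueField R)] (hl : fiberDim I = (l : WithBot ℕ∞)) {e : ℕ → R}
    (hI : I = JJ e (l + 1)) (hn : muE I = ((l + 1 : ℕ) : ℕ∞)) : RCtx I l := by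
  have mu2 : ∀ S : Finset R, Ideal.span (S : Set R) = I → l + 1 ≤ S.card := by
    intro S hS
    have := muE_le S hS
    rw [hn] at this
    exact_mod_cast this
  refine ⟨fun S hS => f1_of hl S hS, f2_of hl hI mu2, ?_, mu2⟩
  obtain ⟨S, h1, h2⟩ := muE_attained hn
  rw [← h1]
  exact gen_of_m (fun s hs => h2 ▸ Submodule.subset_span hs) (by
    rw [bot_sup_eq]; exact h2.ge)

end Fib


lemma present_data {R : Type u} [CommRing R] [IsLocalRing R] [IsNoetherianRing R] {I : Ideal R} {n m : ℕ}
    (φ : Matrix (Fin n) (Fin m) R) (hφ : Presents φ I) :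
    ∃ e : ℕ → R, I = JJ e n ∧ minorsIdeal 1 φ = Rel e n := by
  obtain ⟨_, π, hrange, hker⟩ := hφ
  set e : ℕ → R := fun j => if h : j < n then π (Pi.single ⟨j, h⟩ 1) else 0 with he
  have hπ : ∀ c : ℕ → R, π (fun i : Fin n => c i) = ∑ i ∈ Finset.range n, c i * e i := by
    intro c
    rw [Finset.sum_range, LinearMap.pi_apply_eq_sum_univ π]
    refine Finset.sum_congr rfl fun i _ => ?_
    have h1 : e i = π (Pi.single i 1) := by simp [he]
    rw [h1, smul_eq_mul]
    congr 2
    ext j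
    simp [Pi.single_apply, eq_comm]
  have hext : ∀ v : Fin n → R, ∃ c : ℕ → R, v = fun i : Fin n => c i := by
    intro v
    refine ⟨fun j => if h : j < n then v ⟨j, h⟩ else 0, ?_⟩
    ext i
    simp
  have hmin : ∀ i j, φ i j ∈ minorsIdeal 1 φ := by
    intro i j
    refine Ideal.subset_span ⟨fun _ => i, fun _ => j, ?_⟩
    simp
  refine ⟨e, ?_, ?_⟩
  · ext z
    rw [mem_JJ_iff, ← hrange]
    constructor
    · rintro ⟨v, rfl⟩
      obtain ⟨c, rfl⟩ := hext v
      exact ⟨c, hπ c⟩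
    · rintro ⟨c, rfl⟩
      exact ⟨_, hπ c⟩
  · apply le_antisymm
    · refine Ideal.span_le.2 ?_
      rintro d ⟨r, s, rfl⟩
      have h1 : Matrix.toLin' φ (Pi.single (s 0) 1) ∈ LinearMap.ker π := by
        rw [← hker]; exact ⟨_, rfl⟩
      obtain ⟨c, hc⟩ := hext (Matrix.toLin' φ (Pi.single (s 0) 1))
      rw [hc, LinearMap.mem_ker, hπ] at h1
      have h2 : (φ.submatrix r s).det = c (r 0) := by
        have := congrFun hc (r 0)
        simp at this
        simp [this]
      rw [h2]
      exact Ideal.subset_span ⟨c, r 0, (r 0).2, h1, rfl⟩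
    · refine Ideal.span_le.2 ?_
      rintro d ⟨c, j, hj, h0, rfl⟩
      have h1 : (fun i : Fin n => c i) ∈ LinearMap.ker π := by
        rw [LinearMap.mem_ker, hπ, h0]
      rw [← hker] at h1
      obtain ⟨w, hw⟩ := h1
      have h2 := congrFun hw ⟨j, hj⟩
      simp only [Matrix.toLin'_apply, Matrix.mulVec, dotProduct] at h2
      change c j ∈ _
      rw [← h2]
      exact Ideal.sum_mem _ fun k _ => Ideal.mul_mem_right _ _ (hmin _ _)


/-- Corollary 3.7: for an ideal with `n = ℓ + 1 ≥ 2` generators, `G_ℓ` and the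
sliding depth conditions in a local Gorenstein ring with infinite residue field,
the reduction number is `ℓ - g + 1` iff `core I = I₁(φ)·I`; and under normality
the relevant ideals are integrally closed. -/
theorem statement13 {R : Type u} [CommRing R] [IsNoetherianRing R] [IsLocalRing R]
    (hGor : IsGorensteinLocalRing R) (hres : Infinite (ResidueField R))
    (I : Ideal R) (g l n : ℕ) (hg : ht I = (g : WithBot ℕ∞))
    (hl : fiberDim I = (l : WithBot ℕ∞)) (hn : muE I = (n : ℕ∞))
    (hnl : n = l + 1) (hn2 : 2 ≤ n) (hG : Gcond I l)
    (hdepth : ∀ j : ℕ, 1 ≤ j → j ≤ l - g + 1 →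
      rDim (R ⧸ I) + 1 ≤ (qDepth R (I ^ j) : WithBot ℕ∞) + (j : WithBot ℕ∞))
    {m : ℕ} (φ : Matrix (Fin n) (Fin m) R) (hφ : Presents φ I) :
    (reductionNumber I = ((l - g + 1 : ℕ) : ℕ∞) ↔ core I = minorsIdeal 1 φ * I) ∧
    (core I = minorsIdeal 1 φ * I →
      IsDomain R → IsIntegrallyClosed R → IsNormalIdeal I →
      IsIntClosedIdeal (minorsIdeal 1 φ) ∧ IsIntClosedIdeal (core I)) := by
  subst hnl
  obtain ⟨e, hI, hmin⟩ := present_data φ hφ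
  have D : RCtx I l := rctx_of hl hI hn
  obtain ⟨d, C⟩ := ctx_of hGor hg D (by omega) hG hdepth
  rw [hmin]
  refine ⟨redNumber_iff C D hI, ?_⟩
  intro hcore hdom hR hN
  exact normal_final C D hI hcore hR hN

end CPU
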